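/- With E_s = −∫_{1/√3}^∞ g_{4,6}((1+iy)/2) y^{s−1} dy the quasi-period Eichler integrals, the 4-loop Bessel moments satisfy M(1,5,1)/π⁴ = 4M(1,5,3)/π⁴ + 5E₂/18 and M(2,4,1)/π³ = 4M(2,4,3)/π³ + E₁/3; moreover M(1,5,1)/π⁴ = D₂/2 and M(2,4,1)/π³ = 3D₁/5, where D_s = −∫_{1/√3}^∞ f_{4,6}((1+iy)/2) y^{s−1} dy. -/

import Mathlib

open scoped BigOperators Real

/-- The modified Bessel function `I₀(x) = (1/π)∫₀^π e^{x cos θ} dθ`. -/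
noncomputable def besselI0 (x : ℝ) : ℝ :=
  (1 / π) * ∫ θ in (0 : ℝ)..π, Real.exp (x * Real.cos θ)

/-- The modified Bessel function `K₀(x) = ∫₀^∞ e^{-x cosh t} dt`. -/
noncomputable def besselK0 (x : ℝ) : ℝ :=
  ∫ t in Set.Ioi (0 : ℝ), Real.exp (-(x * Real.cosh t))

/-- The Bessel moment `M(a,b,c) = ∫₀^∞ I₀(x)^a K₀(x)^b x^c dx`. -/
noncomputable def besselMoment (a b c : ℕ) : ℝ :=
  ∫ x in Set.Ioi (0 : ℝ), besselI0 x ^ a * besselK0 x ^ b * x ^ c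

/-- The Dedekind eta function `η(z) = e^{πiz/12} ∏_{n≥1} (1 - e^{2πinz})`. -/
noncomputable def dedekindEta (z : ℂ) : ℂ :=
  Complex.exp (Real.pi * Complex.I * z / 12) *
    ∏' n : ℕ, (1 - Complex.exp (2 * Real.pi * Complex.I * ((n : ℂ) + 1) * z))

/-- The weight-4 level-6 cusp form `f_{4,6}(z) = (η(z)η(2z)η(3z)η(6z))²`. -/
noncomputable def f46 (z : ℂ) : ℂ :=
  (dedekindEta z * dedekindEta (2 * z) * dedekindEta (3 * z) * dedekindEta (6 * z)) ^ 2

/-- The Hauptmodul-type quotient `w(z) = 3η(2z)²η(3z)⁴/(η(z)⁴η(6z)²)`. -/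
noncomputable def w46 (z : ℂ) : ℂ :=
  3 * dedekindEta (2 * z) ^ 2 * dedekindEta (3 * z) ^ 4 /
    (dedekindEta z ^ 4 * dedekindEta (6 * z) ^ 2)

/-- The weakly holomorphic weight-4 modular form
`g_{4,6}(z) = ((w² - 3)²(w⁴ + 9)/(8w⁴))·f_{4,6}(z)`. -/
noncomputable def g46 (z : ℂ) : ℂ :=
  ((w46 z ^ 2 - 3) ^ 2 * (w46 z ^ 4 + 9) / (8 * w46 z ^ 4)) * f46 z

/-- The period Eichler integrals `D_s = -∫_{1/√3}^∞ f_{4,6}((1+iy)/2) y^{s-1} dy`. -/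
noncomputable def D (s : ℕ) : ℂ :=
  -∫ y in Set.Ioi (1 / Real.sqrt 3), f46 ((1 + Complex.I * (y : ℂ)) / 2) * (y : ℂ) ^ (s - 1)

/-- The quasi-period Eichler integrals `E_s = -∫_{1/√3}^∞ g_{4,6}((1+iy)/2) y^{s-1} dy`. -/
noncomputable def E (s : ℕ) : ℂ :=
  -∫ y in Set.Ioi (1 / Real.sqrt 3), g46 ((1 + Complex.I * (y : ℂ)) / 2) * (y : ℂ) ^ (s - 1)

namespace BesselPeriods

open MeasureTheory Set Filter Topology Real
open Complex (I)
open ENNReal (ofReal ofReal_mul)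

/-- Weighted Stieltjes transform `∫ h(t) / (t + z)^k dm(t)`. -/
noncomputable def stieltjes {𝕜 : Type*} [RCLike 𝕜] (m : Measure ℝ) (h : ℝ → ℝ) (k : ℕ) (z : 𝕜) : 𝕜 :=
  ∫ t, (h t : 𝕜) / ((t : 𝕜) + z) ^ k ∂m

section Stieltjes
variable {𝕜 : Type*} [RCLike 𝕜] {m : Measure ℝ} {h : ℝ → ℝ}

lemma le_norm_add {t δ : ℝ} (ht : 1 ≤ t) (hδ1 : δ ≤ 1) {z : 𝕜}
    (hz : -1 + δ ≤ RCLike.re z) : δ * t ≤ ‖(t : 𝕜) + z‖ := by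
  refine le_trans ?_ (RCLike.re_le_norm _)
  simp only [map_add, RCLike.ofReal_re]
  nlinarith

lemma norm_div_pow_le {t δ : ℝ} (ht : 1 ≤ t) (hδ : 0 < δ) (hδ1 : δ ≤ 1) {z : 𝕜}
    (hz : -1 + δ ≤ RCLike.re z) (a : ℝ) (k : ℕ) :
    ‖(a : 𝕜) / ((t : 𝕜) + z) ^ (k + 1)‖ ≤ (1 / δ) ^ (k + 1) * (|a| / t) := by
  have h1 := le_norm_add (𝕜 := 𝕜) ht hδ1 hz
  have h2 : δ ≤ ‖(t : 𝕜) + z‖ := le_trans (by nlinarith) h1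
  rw [norm_div, norm_pow, RCLike.norm_ofReal]
  have h3 : δ ^ (k + 1) * t ≤ ‖(t : 𝕜) + z‖ ^ (k + 1) := by
    rw [pow_succ, pow_succ, mul_assoc]
    gcongr
  have ht0 : 0 < t := by linarith
  have : 0 < δ ^ (k + 1) * t := by positivity
  calc |a| / ‖(t : 𝕜) + z‖ ^ (k + 1) ≤ |a| / (δ ^ (k + 1) * t) := by gcongr
    _ = _ := by rw [one_div, inv_pow]; field_simp

lemma aesm_stieltjes (hh : AEStronglyMeasurable h m) (k : ℕ) (z : 𝕜) :
    AEStronglyMeasurable (fun t : ℝ => (h t : 𝕜) / ((t : 𝕜) + z) ^ k) m := by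
  have h1 : AEStronglyMeasurable (fun t : ℝ => (h t : 𝕜)) m :=
    RCLike.continuous_ofReal.comp_aestronglyMeasurable hh
  have h2 : Measurable (fun t : ℝ => (((t : 𝕜) + z) ^ k)) := by
    have : Measurable (fun t : ℝ => (t : 𝕜)) := RCLike.measurable_ofReal
    fun_prop
  exact (h1.aemeasurable.div h2.aemeasurable).aestronglyMeasurable

lemma integrable_stieltjes (hm : ∀ᵐ t ∂m, 1 ≤ t) (hh : AEStronglyMeasurable h m)
    (hi : Integrable (fun t => h t / t) m) {z : 𝕜} (hz : -1 < RCLike.re z) (k : ℕ) :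
    Integrable (fun t : ℝ => (h t : 𝕜) / ((t : 𝕜) + z) ^ (k + 1)) m := by
  obtain ⟨δ, hδ, hδ1, hz'⟩ : ∃ δ : ℝ, 0 < δ ∧ δ ≤ 1 ∧ -1 + δ ≤ RCLike.re z :=
    ⟨min 1 (RCLike.re z + 1), lt_min one_pos (by linarith), min_le_left _ _, by
      linarith [min_le_right 1 (RCLike.re z + 1)]⟩
  refine Integrable.mono' (hi.norm.const_mul ((1 / δ) ^ (k + 1))) (aesm_stieltjes hh _ z) ?_
  filter_upwards [hm] with t ht
  have := norm_div_pow_le (𝕜 := 𝕜) ht hδ hδ1 hz' (h t) k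
  rwa [norm_eq_abs, abs_div, abs_of_pos (by linarith : 0 < t)]

lemma hasDerivAt_stieltjes (hm : ∀ᵐ t ∂m, 1 ≤ t) (hh : AEStronglyMeasurable h m)
    (hi : Integrable (fun t => h t / t) m) {z : 𝕜} (hz : -1 < RCLike.re z) (k : ℕ) :
    HasDerivAt (stieltjes m h (k + 1)) (-((k + 1 : ℕ) : 𝕜) * stieltjes m h (k + 2) z) z := by
  obtain ⟨δ, hδ, hδ1, hz'⟩ : ∃ δ : ℝ, 0 < δ ∧ δ ≤ 1 ∧ -1 + 2 * δ ≤ RCLike.re z :=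
    ⟨min 1 ((RCLike.re z + 1) / 2), lt_min one_pos (by linarith), min_le_left _ _, by
      linarith [min_le_right 1 ((RCLike.re z + 1) / 2)]⟩
  have hball : ∀ w ∈ Metric.ball z δ, -1 + δ ≤ RCLike.re w := by
    intro w hw
    have h1 : |RCLike.re (w - z)| ≤ ‖w - z‖ := RCLike.abs_re_le_norm _
    rw [Metric.mem_ball, dist_eq_norm] at hw
    have := (abs_le.1 h1).1
    rw [map_sub] at this
    linarith
  have key := (hasDerivAt_integral_of_dominated_loc_of_deriv_le (μ := m) (x₀ := z)
    (F := fun (w : 𝕜) (t : ℝ) => (h t : 𝕜) / ((t : 𝕜) + w) ^ (k + 1))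
    (F' := fun (w : 𝕜) (t : ℝ) => -((k + 1 : ℕ) : 𝕜) * ((h t : 𝕜) / ((t : 𝕜) + w) ^ (k + 2)))
    (bound := fun t => ((k + 1 : ℕ) : ℝ) * ((1 / δ) ^ (k + 2) * ‖h t / t‖))
    (Metric.ball_mem_nhds z hδ) (Eventually.of_forall fun w => aesm_stieltjes hh _ w)
    (integrable_stieltjes hm hh hi hz k) ((aesm_stieltjes hh _ z).const_mul _) ?_
    ((hi.norm.const_mul _).const_mul _) ?_).2
  · rw [integral_const_mul] at key
    exact key
  · filter_upwards [hm] with t ht w hw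
    rw [norm_mul, norm_neg, RCLike.norm_natCast, norm_eq_abs, abs_div,
      abs_of_pos (by linarith : 0 < t)]
    gcongr
    exact norm_div_pow_le (𝕜 := 𝕜) ht hδ hδ1 (hball w hw) (h t) (k + 1)
  · filter_upwards [hm] with t ht w hw
    have hne : (t : 𝕜) + w ≠ 0 := by
      have := le_norm_add (𝕜 := 𝕜) ht hδ1 (hball w hw)
      exact norm_pos_iff.1 (lt_of_lt_of_le (by nlinarith) this)
    have h1 : HasDerivAt (fun w : 𝕜 => ((t : 𝕜) + w) ^ (k + 1))
        (((k + 1 : ℕ) : 𝕜) * ((t : 𝕜) + w) ^ k * 1) w := by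
      exact ((hasDerivAt_id w).const_add (t : 𝕜)).fun_pow (k + 1)
    have h2 := (hasDerivAt_const w (h t : 𝕜)).div h1 (pow_ne_zero _ hne)
    refine h2.congr_deriv ?_
    field_simp
    ring

lemma stieltjes_ofReal (k : ℕ) (x : ℝ) :
    stieltjes m h k (x : ℂ) = ((stieltjes m h k x : ℝ) : ℂ) := by
  unfold stieltjes
  rw [← integral_complex_ofReal]
  congr 1
  ext t
  simp

end Stieltjes

lemma integral_poisson {r : ℝ} (hr : |r| < 1) :
    ∫ φ in (0 : ℝ)..π, (1 - r ^ 2) / (1 - 2 * r * cos φ + r ^ 2) = π := by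
  have hr' := abs_lt.1 hr
  have h1 : ∀ φ : ℝ, 0 < 1 - r * cos φ := by
    intro φ
    have := abs_lt.1 (lt_of_le_of_lt (by
      rw [abs_mul]; exact mul_le_of_le_one_right (abs_nonneg r) (abs_cos_le_one φ)) hr :
        |r * cos φ| < 1)
    linarith
  have h2 : ∀ φ : ℝ, 1 - 2 * r * cos φ + r ^ 2
      = (1 - r * cos φ) ^ 2 + (r * sin φ) ^ 2 := by
    intro φ
    have := sin_sq_add_cos_sq φ
    linear_combination (-r ^ 2) * this
  have hpos : ∀ φ : ℝ, 0 < 1 - 2 * r * cos φ + r ^ 2 := fun φ => by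
    rw [h2]; have := h1 φ; positivity
  have hder : ∀ φ : ℝ, HasDerivAt
      (fun φ => φ + 2 * arctan (r * sin φ / (1 - r * cos φ)))
      ((1 - r ^ 2) / (1 - 2 * r * cos φ + r ^ 2)) φ := by
    intro φ
    have hq : HasDerivAt (fun φ => r * sin φ / (1 - r * cos φ))
        ((r * cos φ * (1 - r * cos φ) - r * sin φ * (r * sin φ))
          / (1 - r * cos φ) ^ 2) φ := by
      refine (((hasDerivAt_sin φ).const_mul r).div
        (((hasDerivAt_cos φ).const_mul r).const_sub 1) (h1 φ).ne').congr_deriv ?_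
      ring
    refine ((hasDerivAt_id φ).add ((hq.arctan).const_mul 2)).congr_deriv ?_
    have e1 := (h1 φ).ne'
    have e2 := (hpos φ).ne'
    have e3 : 1 + (r * sin φ / (1 - r * cos φ)) ^ 2
        = (1 - 2 * r * cos φ + r ^ 2) / (1 - r * cos φ) ^ 2 := by
      rw [h2]; field_simp
    rw [e3]
    have hs : sin φ ^ 2 = 1 - cos φ ^ 2 := sin_sq φ
    field_simp
    rw [hs]
    ring
  rw [intervalIntegral.integral_eq_sub_of_hasDerivAt (fun φ _ => hder φ)]
  · simp
  · apply Continuous.intervalIntegrable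
    exact continuous_const.div (by fun_prop) (fun φ => (hpos φ).ne')

lemma integral_inv_sub_cos {a b : ℝ} (hb : 0 < b) (hab : b < a) :
    ∫ φ in (0 : ℝ)..π, 1 / (a - b * cos φ) = π / sqrt (a ^ 2 - b ^ 2) := by
  set q := sqrt (a ^ 2 - b ^ 2) with hq
  have hpos : 0 < a ^ 2 - b ^ 2 := by nlinarith
  have hq0 : 0 < q := sqrt_pos.2 hpos
  have hq2 : q ^ 2 = a ^ 2 - b ^ 2 := sq_sqrt hpos.le
  have hqa : q < a := by nlinarith
  set r := (a - q) / b with hr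
  have hr0 : 0 < r := div_pos (by linarith) hb
  have hr1 : r < 1 := by
    rw [hr, div_lt_one hb]; nlinarith
  have hP := integral_poisson (r := r) (by rw [abs_of_pos hr0]; exact hr1)
  have : ∀ φ : ℝ, 1 / (a - b * cos φ)
      = (1 / q) * ((1 - r ^ 2) / (1 - 2 * r * cos φ + r ^ 2)) := by
    intro φ
    have hc := cos_le_one φ
    have h1 : 0 < a - b * cos φ := by nlinarith
    have h2 : 1 - 2 * r * cos φ + r ^ 2 = (2 * r / b) * (a - b * cos φ) := by
      rw [hr]; field_simp; nlinarith
    have h3 : 1 - r ^ 2 = (2 * r / b) * q := by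
      rw [hr]; field_simp; nlinarith
    rw [h2, h3]
    field_simp
  simp_rw [this]
  rw [intervalIntegral.integral_const_mul, hP]
  ring

/-- `∫₀^∞ dr / (a + b cosh r)`, together with integrability. -/
lemma integral_inv_add_cosh {a b : ℝ} (hb : 0 < b) (hab : b < a) :
    IntegrableOn (fun r => 1 / (a + b * cosh r)) (Ioi 0) ∧
    ∫ r in Ioi (0 : ℝ), 1 / (a + b * cosh r)
      = log ((a + sqrt (a ^ 2 - b ^ 2)) / b) / sqrt (a ^ 2 - b ^ 2) := by
  set q := sqrt (a ^ 2 - b ^ 2) with hq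
  have hpos : 0 < a ^ 2 - b ^ 2 := by nlinarith
  have hq0 : 0 < q := sqrt_pos.2 hpos
  have hq2 : q ^ 2 = a ^ 2 - b ^ 2 := sq_sqrt hpos.le
  have hqa : q < a := by nlinarith
  let Φ : ℝ → ℝ := fun r => (1 / q) * log ((b * exp r + a - q) / (b * exp r + a + q))
  have hn : ∀ r, 0 < b * exp r + a - q := fun r => by
    have := exp_pos r; nlinarith [mul_pos hb this]
  have hd : ∀ r, 0 < b * exp r + a + q := fun r => by
    have := exp_pos r; nlinarith [mul_pos hb this]
  have hder : ∀ r, HasDerivAt Φ (1 / (a + b * cosh r)) r := by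
    intro r
    have h1 : HasDerivAt (fun r => b * exp r + a - q) (b * exp r) r :=
      (((Real.hasDerivAt_exp r).const_mul b).add_const a).sub_const q
    have h2 : HasDerivAt (fun r => b * exp r + a + q) (b * exp r) r :=
      (((Real.hasDerivAt_exp r).const_mul b).add_const a).add_const q
    refine (((h1.div h2 (hd r).ne').log (div_pos (hn r) (hd r)).ne').const_mul (1 / q)).congr_deriv ?_
    have e1 := (hn r).ne'
    have e2 := (hd r).ne'
    have e3 := exp_pos r
    have e4 : 0 < a + b * cosh r := by have := cosh_pos r; nlinarith [mul_pos hb this]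
    have e5 : a + b * cosh r
        = (b * exp r + a - q) * (b * exp r + a + q) / (2 * b * exp r) := by
      rw [cosh_eq, exp_neg]
      field_simp
      linear_combination hq2
    rw [e5]
    simp only [Pi.div_apply]
    field_simp
    ring
  have hlim : Tendsto Φ atTop (𝓝 0) := by
    have h0 : Tendsto (fun r : ℝ => 1 - (2 * q) / (b * exp r + a + q)) atTop (𝓝 (1 - 0)) := by
      refine tendsto_const_nhds.sub (tendsto_const_nhds.div_atTop ?_)
      refine tendsto_atTop_add_const_right _ _ (tendsto_atTop_add_const_right _ _ ?_)
      exact tendsto_exp_atTop.const_mul_atTop hb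
    have h1 := ((continuousAt_log (by norm_num : (1 - 0 : ℝ) ≠ 0)).tendsto.comp h0).const_mul (1 / q)
    simp only [sub_zero, log_one, mul_zero] at h1
    refine h1.congr fun r => ?_
    have := (hd r).ne'
    simp only [Φ, Function.comp]
    congr 2
    field_simp
    ring
  have hnn : ∀ r ∈ Ioi (0 : ℝ), 0 ≤ 1 / (a + b * cosh r) := fun r _ => by
    have := cosh_pos r
    have ha : 0 < a := hb.trans hab
    positivity
  refine ⟨integrableOn_Ioi_deriv_of_nonneg' (fun r _ => hder r) hnn hlim, ?_⟩
  rw [integral_Ioi_of_hasDerivAt_of_nonneg' (fun r _ => hder r) hnn hlim]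
  have h0 : (b * exp 0 + a - q) / (b * exp 0 + a + q) = ((a + q) / b)⁻¹ := by
    have h1 := (hd 0).ne'
    have h2 : a + q ≠ 0 := (by linarith : 0 < a + q).ne'
    rw [exp_zero, mul_one] at *
    rw [inv_div, div_eq_div_iff h1 h2]
    linear_combination -hq2
  simp only [Φ]
  rw [h0, log_inv]
  ring

/-- `d(s) = 2 cosh (s/2)`. -/
noncomputable def dd (s : ℝ) : ℝ := 2 * cosh (s / 2)

noncomputable def kF (x : ℝ × ℝ) : ℝ := 1 + dd x.1 ^ 2 - 2 * dd x.1 * cos x.2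

noncomputable def kG (x : ℝ × ℝ) : ℝ := 1 + dd x.1 ^ 2 + 2 * dd x.1 * cosh x.2

noncomputable def muF : Measure (ℝ × ℝ) :=
  (volume.restrict (Ioi 0)).prod (ofReal (1 / π) • volume.restrict (Ioc 0 π))

noncomputable def muG : Measure (ℝ × ℝ) :=
  (volume.restrict (Ioi 0)).prod (volume.restrict (Ioi 0))

/-- The spectral measure of `I₀K₀²`. -/
noncomputable def mF : Measure ℝ := muF.map kF

/-- The spectral measure of `K₀³`. -/
noncomputable def mG : Measure ℝ := muG.map kG

lemma dd_sq (s : ℝ) : dd s ^ 2 = 2 + 2 * cosh s := by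
  have h := cosh_two_mul (s / 2)
  rw [show 2 * (s / 2) = s by ring] at h
  have h2 := cosh_sq (s / 2)
  unfold dd
  nlinarith

lemma two_le_dd (s : ℝ) : 2 ≤ dd s := by
  have := one_le_cosh (s / 2); unfold dd; linarith

lemma exp_half_le_dd (s : ℝ) : exp (s / 2) ≤ dd s := by
  unfold dd; rw [cosh_eq]; have := exp_pos (-(s / 2)); linarith

lemma dd_le {s : ℝ} (hs : 0 ≤ s) : dd s ≤ 2 * exp (s / 2) := by
  unfold dd; rw [cosh_eq]
  have : exp (-(s / 2)) ≤ exp (s / 2) := exp_le_exp.2 (by linarith)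
  linarith

@[fun_prop] lemma continuous_dd : Continuous dd := by unfold dd; fun_prop
@[fun_prop] lemma continuous_kF : Continuous kF := by unfold kF; fun_prop
@[fun_prop] lemma continuous_kG : Continuous kG := by unfold kG; fun_prop

lemma dd_sub_sq_le_kF (x : ℝ × ℝ) : (dd x.1 - 1) ^ 2 ≤ kF x := by
  have := cos_le_one x.2; have := two_le_dd x.1; unfold kF; nlinarith

lemma one_le_kF (x : ℝ × ℝ) : 1 ≤ kF x := by
  have := dd_sub_sq_le_kF x; have := two_le_dd x.1; nlinarith

lemma exp_le_kF (x : ℝ × ℝ) : exp x.1 / 4 ≤ kF x := by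
  have h1 := dd_sub_sq_le_kF x
  have h2 := two_le_dd x.1
  have h3 := exp_half_le_dd x.1
  have h4 : exp x.1 = exp (x.1 / 2) ^ 2 := by rw [← exp_nat_mul]; congr 1; push_cast; ring
  have h5 := exp_pos (x.1 / 2)
  rw [h4]; nlinarith

lemma nine_le_kG (x : ℝ × ℝ) : 9 ≤ kG x := by
  have := one_le_cosh x.2; have := two_le_dd x.1; unfold kG; nlinarith

lemma exp_le_kG (x : ℝ × ℝ) : exp (x.1 / 2) * exp x.2 ≤ kG x := by
  have h1 := exp_half_le_dd x.1
  have h3 := two_le_dd x.1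
  have h2 : exp x.2 ≤ 2 * cosh x.2 := by
    rw [cosh_eq]; have := exp_pos (-x.2); linarith
  have h4 := exp_pos x.2
  have : exp (x.1 / 2) * exp x.2 ≤ dd x.1 * (2 * cosh x.2) := by gcongr
  unfold kG; nlinarith

lemma abs_kF_sub_exp_le (x : ℝ × ℝ) (hs : 0 ≤ x.1) :
    |kF x - exp x.1| ≤ 8 * exp (x.1 / 2) := by
  have h1 := dd_sq x.1
  rw [cosh_eq] at h1
  have h2 := dd_le hs
  have h3 := two_le_dd x.1
  have h4 : exp (-x.1) ≤ 1 := exp_le_one_iff.2 (by linarith)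
  have h5 : 1 ≤ exp (x.1 / 2) := one_le_exp (by linarith)
  have h6 := exp_pos (-x.1)
  have h7 := abs_le.1 (abs_cos_le_one x.2)
  unfold kF
  rw [abs_le]
  constructor <;> nlinarith

instance : IsFiniteMeasure (ofReal (1 / π) • volume.restrict (Ioc 0 π)) := by
  refine Measure.smul_finite _ ENNReal.ofReal_ne_top

lemma integrable_exp_neg_mul {δ : ℝ} (hδ : 0 < δ) :
    Integrable (fun s : ℝ => exp (-(δ * s))) (volume.restrict (Ioi 0)) := by
  have h := integrableOn_exp_mul_Ioi (neg_lt_zero.2 hδ) 0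
  simp only [neg_mul] at h
  exact h

lemma integrable_muF {g : ℝ × ℝ → ℝ} (hg : AEStronglyMeasurable g muF) {C δ : ℝ} (hδ : 0 < δ)
    (hb : ∀ x : ℝ × ℝ, 0 < x.1 → |g x| ≤ C * exp (-(δ * x.1))) : Integrable g muF := by
  have h1 := integrable_exp_neg_mul hδ
  have h2 : Integrable (fun x : ℝ × ℝ => C * (exp (-(δ * x.1)) * 1)) muF :=
    (h1.mul_prod (integrable_const (1 : ℝ))).const_mul C
  refine h2.mono' hg ?_
  have : ∀ᵐ x ∂muF, x.1 ∈ Ioi (0 : ℝ) := by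
    have := (Measure.quasiMeasurePreserving_fst (μ := volume.restrict (Ioi (0 : ℝ)))
      (ν := ofReal (1 / π) • volume.restrict (Ioc 0 π))).ae
      (ae_restrict_mem measurableSet_Ioi)
    exact this
  filter_upwards [this] with x hx
  simpa using hb x hx

lemma ae_muF : ∀ᵐ x ∂muF, 0 < x.1 :=
  (Measure.quasiMeasurePreserving_fst (μ := volume.restrict (Ioi (0 : ℝ)))
      (ν := ofReal (1 / π) • volume.restrict (Ioc 0 π))).ae
      (ae_restrict_mem measurableSet_Ioi)

lemma one_le_mF : ∀ᵐ t ∂mF, 1 ≤ t := by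
  refine (ae_map_iff continuous_kF.measurable.aemeasurable measurableSet_Ici).2 ?_
  exact Eventually.of_forall one_le_kF

lemma nine_le_mG : ∀ᵐ t ∂mG, 9 ≤ t := by
  refine (ae_map_iff continuous_kG.measurable.aemeasurable measurableSet_Ici).2 ?_
  exact Eventually.of_forall nine_le_kG

lemma one_le_mG : ∀ᵐ t ∂mG, 1 ≤ t := by
  filter_upwards [nine_le_mG] with t ht; linarith

lemma measurable_inv_sqrt : Measurable (fun t : ℝ => 1 / sqrt t) := by
  simp only [one_div]
  exact continuous_sqrt.measurable.inv

lemma integrable_inv_sqrt_mF : Integrable (fun t => 1 / sqrt t) mF := by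
  refine (integrable_map_measure measurable_inv_sqrt.aestronglyMeasurable continuous_kF.measurable.aemeasurable).2 ?_
  refine integrable_muF (C := 2) (δ := 1 / 2) ?_ (by norm_num) ?_
  · exact (measurable_inv_sqrt.comp continuous_kF.measurable).aestronglyMeasurable
  · intro x hx
    have h1 := exp_le_kF x
    have h2 : exp (x.1 / 2) / 2 ≤ sqrt (kF x) := by
      apply le_sqrt_of_sq_le
      have h4 : exp x.1 = exp (x.1 / 2) ^ 2 := by
        rw [← exp_nat_mul]; congr 1; push_cast; ring
      nlinarith
    have h3 := exp_pos (x.1 / 2)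
    simp only [Function.comp]
    rw [abs_of_nonneg (by positivity), show -(1 / 2 * x.1) = -(x.1 / 2) by ring, exp_neg]
    calc 1 / sqrt (kF x) ≤ 1 / (exp (x.1 / 2) / 2) := by gcongr
      _ = _ := by field_simp

lemma integrable_inv_sqrt_mG : Integrable (fun t => 1 / sqrt t) mG := by
  refine (integrable_map_measure measurable_inv_sqrt.aestronglyMeasurable continuous_kG.measurable.aemeasurable).2 ?_
  refine ((integrable_exp_neg_mul (δ := 1 / 4) (by norm_num)).mul_prod
    (integrable_exp_neg_mul (δ := 1 / 2) (by norm_num))).mono' ?_ ?_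
  · exact (measurable_inv_sqrt.comp continuous_kG.measurable).aestronglyMeasurable
  · refine Eventually.of_forall fun x => ?_
    have h1 := exp_le_kG x
    have h2 : exp (x.1 / 4) * exp (x.2 / 2) ≤ sqrt (kG x) := by
      apply le_sqrt_of_sq_le
      refine le_trans (le_of_eq ?_) h1
      rw [← exp_add, ← exp_add, ← exp_nat_mul]; congr 1; push_cast; ring
    have h3 := exp_pos (x.1 / 4)
    have h4 := exp_pos (x.2 / 2)
    simp only [Function.comp]
    rw [norm_eq_abs, abs_of_nonneg (by positivity), show -(1 / 4 * x.1) = -(x.1 / 4) by ring,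
      show -(1 / 2 * x.2) = -(x.2 / 2) by ring, exp_neg, exp_neg, ← mul_inv, ← one_div]
    gcongr

lemma integral_mF {h : ℝ → ℝ} (hi : Integrable h mF) :
    ∫ t, h t ∂mF = ∫ s in Ioi (0 : ℝ), (1 / π) * ∫ φ in (0 : ℝ)..π, h (kF (s, φ)) := by
  have hi' := (integrable_map_measure hi.aestronglyMeasurable
    continuous_kF.measurable.aemeasurable).1 hi
  unfold mF
  rw [integral_map continuous_kF.measurable.aemeasurable hi.aestronglyMeasurable]
  unfold muF at *
  rw [integral_prod (fun x => h (kF x)) hi']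
  refine integral_congr_ae (Eventually.of_forall fun s => ?_)
  simp only
  rw [integral_smul_measure, ENNReal.toReal_ofReal (by positivity), smul_eq_mul,
    intervalIntegral.integral_of_le pi_pos.le]

lemma integral_mG {h : ℝ → ℝ} (hi : Integrable h mG) :
    ∫ t, h t ∂mG = ∫ s in Ioi (0 : ℝ), ∫ r in Ioi (0 : ℝ), h (kG (s, r)) := by
  have hi' := (integrable_map_measure hi.aestronglyMeasurable
    continuous_kG.measurable.aemeasurable).1 hi
  unfold mG
  rw [integral_map continuous_kG.measurable.aemeasurable hi.aestronglyMeasurable]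
  unfold muG at *
  rw [integral_prod (fun x => h (kG x)) hi']

instance : SFinite muF := by unfold muF; infer_instance
instance : SFinite muG := by unfold muG; infer_instance
instance : SFinite mF := by unfold mF; infer_instance
instance : SFinite mG := by unfold mG; infer_instance

/-- The Stieltjes transform `F` of the spectral measure of `I₀K₀²`. -/
noncomputable def FF (X : ℝ) : ℝ := stieltjes mF (fun _ => 1) 1 X

/-- The Stieltjes transform `G` of the spectral measure of `K₀³`. -/
noncomputable def GG (X : ℝ) : ℝ := stieltjes mG (fun _ => 1) 1 X

noncomputable def FF1 (X : ℝ) : ℝ := -stieltjes mF (fun _ => 1) 2 X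
noncomputable def FF2 (X : ℝ) : ℝ := 2 * stieltjes mF (fun _ => 1) 3 X
noncomputable def GG1 (X : ℝ) : ℝ := -stieltjes mG (fun _ => 1) 2 X
noncomputable def GG2 (X : ℝ) : ℝ := 2 * stieltjes mG (fun _ => 1) 3 X

lemma integrable_inv_of_inv_sqrt {m : Measure ℝ} (hm : ∀ᵐ t ∂m, 1 ≤ t)
    (h : Integrable (fun t => 1 / sqrt t) m) : Integrable (fun t : ℝ => (1 : ℝ) / t) m := by
  refine h.mono' ?_ ?_
  · simp only [one_div]; exact (measurable_id.inv).aestronglyMeasurable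
  · filter_upwards [hm] with t ht
    rw [norm_eq_abs, abs_of_nonneg (by positivity)]
    have h1 : sqrt t ≤ t := by
      rw [sqrt_le_left (by linarith)]; nlinarith
    have h2 : 0 < sqrt t := sqrt_pos.2 (by linarith)
    gcongr

lemma integrable_inv_mF : Integrable (fun t : ℝ => (1 : ℝ) / t) mF :=
  integrable_inv_of_inv_sqrt one_le_mF integrable_inv_sqrt_mF
lemma integrable_inv_mG : Integrable (fun t : ℝ => (1 : ℝ) / t) mG :=
  integrable_inv_of_inv_sqrt one_le_mG integrable_inv_sqrt_mG

lemma hasDerivAt_FF {X : ℝ} (hX : -1 < X) : HasDerivAt FF (FF1 X) X :=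
  (hasDerivAt_stieltjes one_le_mF aestronglyMeasurable_const integrable_inv_mF (z := X) hX 0).congr_deriv
    (by simp [FF1])
lemma hasDerivAt_FF1 {X : ℝ} (hX : -1 < X) : HasDerivAt FF1 (FF2 X) X :=
  (hasDerivAt_stieltjes one_le_mF aestronglyMeasurable_const integrable_inv_mF (z := X) hX 1).neg.congr_deriv
    (by simp [FF2])
lemma hasDerivAt_GG {X : ℝ} (hX : -1 < X) : HasDerivAt GG (GG1 X) X :=
  (hasDerivAt_stieltjes one_le_mG aestronglyMeasurable_const integrable_inv_mG (z := X) hX 0).congr_deriv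
    (by simp [GG1])
lemma hasDerivAt_GG1 {X : ℝ} (hX : -1 < X) : HasDerivAt GG1 (GG2 X) X :=
  (hasDerivAt_stieltjes one_le_mG aestronglyMeasurable_const integrable_inv_mG (z := X) hX 1).neg.congr_deriv
    (by simp [GG2])

/-- The quadratic `P` with `F(X) = ∫₀^∞ P(X,s)^{-1/2} ds`. -/
noncomputable def PP (X s : ℝ) : ℝ :=
  4 * cosh s ^ 2 + 4 * (X + 1) * cosh s + X ^ 2 + 6 * X + 1

noncomputable def QQ (X s : ℝ) : ℝ := sqrt (PP X s)

/-- `a(X,s) = X + 3 + 2 cosh s`. -/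
noncomputable def aa (X s : ℝ) : ℝ := X + 3 + 2 * cosh s

noncomputable def AA (X s : ℝ) : ℝ := log ((aa X s + QQ X s) / (2 * dd s))

lemma PP_eq (X s : ℝ) : PP X s = aa X s ^ 2 - (2 * dd s) ^ 2 := by
  have := dd_sq s
  unfold PP aa
  rw [mul_pow, this]; ring

lemma sq_le_PP {X : ℝ} (hX : 0 ≤ X) (s : ℝ) : (aa X s - 2) ^ 2 ≤ PP X s := by
  unfold PP aa; nlinarith [one_le_cosh s]

lemma aa_ge {X : ℝ} (hX : 0 ≤ X) (s : ℝ) : 2 * cosh s + 1 ≤ aa X s - 2 := by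
  unfold aa; linarith

lemma QQ_ge {X : ℝ} (hX : 0 ≤ X) (s : ℝ) : aa X s - 2 ≤ QQ X s :=
  le_sqrt_of_sq_le (sq_le_PP hX s)

lemma QQ_le {X : ℝ} (hX : 0 ≤ X) (s : ℝ) : QQ X s ≤ aa X s := by
  apply sqrt_le_iff.2
  have := one_le_cosh s
  refine ⟨by unfold aa; linarith, ?_⟩
  rw [PP_eq]; nlinarith [sq_nonneg (2 * dd s)]

lemma QQ_pos {X : ℝ} (hX : 0 ≤ X) (s : ℝ) : 0 < QQ X s := by
  have := QQ_ge hX s; have := aa_ge hX s; have := one_le_cosh s; linarith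

lemma QQ_sq {X : ℝ} (hX : 0 ≤ X) (s : ℝ) : QQ X s ^ 2 = PP X s :=
  sq_sqrt (le_trans (sq_nonneg _) (sq_le_PP hX s))

lemma FF_eq {X : ℝ} (hX : 0 ≤ X) : FF X = ∫ s in Ioi (0 : ℝ), 1 / QQ X s := by
  unfold FF stieltjes
  have hi := integrable_stieltjes (𝕜 := ℝ) (z := X) one_le_mF
    aestronglyMeasurable_const integrable_inv_mF (by simp; linarith) 0
  have hh := integral_mF hi
  simp only [zero_add] at hh
  rw [hh]
  refine integral_congr_ae (Eventually.of_forall fun s => ?_)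
  simp only
  have hd := two_le_dd s
  have := integral_inv_sub_cos (a := X + 1 + dd s ^ 2) (b := 2 * dd s) (by linarith) (by nlinarith)
  have e : (X + 1 + dd s ^ 2) ^ 2 - (2 * dd s) ^ 2 = PP X s := by
    rw [PP_eq, dd_sq]; unfold aa; ring
  rw [e] at this
  have e2 : ∀ φ : ℝ, ((1 : ℝ) : ℝ) / ((kF (s, φ) : ℝ) + X) ^ 1
      = 1 / (X + 1 + dd s ^ 2 - 2 * dd s * cos φ) := fun φ => by
    rw [pow_one]; unfold kF; congr 1; ring
  simp only [RCLike.ofReal_real_eq_id, id_eq] at *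
  simp_rw [e2, this]
  have := pi_pos.ne'
  unfold QQ
  field_simp

lemma GG_eq {X : ℝ} (hX : 0 ≤ X) : GG X = ∫ s in Ioi (0 : ℝ), AA X s / QQ X s := by
  unfold GG stieltjes
  have hi := integrable_stieltjes (𝕜 := ℝ) (z := X) one_le_mG
    aestronglyMeasurable_const integrable_inv_mG (by simp; linarith) 0
  have hh := integral_mG hi
  simp only [zero_add] at hh
  rw [hh]
  refine integral_congr_ae (Eventually.of_forall fun s => ?_)
  simp only
  have hd := two_le_dd s
  have hP : 0 < PP X s := by
    have := QQ_pos hX s; have h2 := QQ_sq hX s; rw [← h2]; positivity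
  have := (integral_inv_add_cosh (a := aa X s) (b := 2 * dd s) (by linarith) (by
    have h1 := PP_eq X s
    have := QQ_le hX s
    have := QQ_pos hX s
    nlinarith)).2
  rw [← PP_eq] at this
  have e2 : ∀ r : ℝ, ((1 : ℝ) : ℝ) / ((kG (s, r) : ℝ) + X) ^ 1
      = 1 / (aa X s + 2 * dd s * cosh r) := fun r => by
    rw [pow_one]; unfold kG aa; congr 1; simp only; rw [dd_sq]; ring
  simp only [RCLike.ofReal_real_eq_id, id_eq] at *
  simp_rw [e2, this]
  rfl

lemma hasDerivAt_integral_Ioi {v v1 : ℝ → ℝ → ℝ} {b : ℝ → ℝ} {X : ℝ} (hX : 0 < X)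
    (hc : ∀ Y, 0 < Y → Continuous (v Y)) (hc1 : ∀ Y, 0 < Y → Continuous (v1 Y))
    (hder : ∀ Y, 0 < Y → ∀ s, HasDerivAt (fun Z => v Z s) (v1 Y s) Y)
    (hInt : IntegrableOn (v X) (Ioi 0))
    (hb : ∀ Y ∈ Ioo 0 (X + 1), ∀ s, 0 < s → |v1 Y s| ≤ b s) (hbi : IntegrableOn b (Ioi 0)) :
    IntegrableOn (v1 X) (Ioi 0) ∧
      HasDerivAt (fun Y => ∫ s in Ioi (0 : ℝ), v Y s) (∫ s in Ioi (0 : ℝ), v1 X s) X := by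
  have hmem : Ioo 0 (X + 1) ∈ 𝓝 X := Ioo_mem_nhds hX (by linarith)
  refine hasDerivAt_integral_of_dominated_loc_of_deriv_le hmem ?_ hInt
    (hc1 X hX).aestronglyMeasurable ?_ hbi ?_
  · filter_upwards [hmem] with Y hY using (hc Y hY.1).aestronglyMeasurable
  · filter_upwards [ae_restrict_mem measurableSet_Ioi] with s hs Y hY using hb Y hY s hs
  · exact Eventually.of_forall fun s Y hY => hder Y hY.1 s

/-- `p(X) = X (X + 1) (X + 9)`. -/
noncomputable def pp (X : ℝ) : ℝ := X * (X + 1) * (X + 9)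
noncomputable def pp1 (X : ℝ) : ℝ := 3 * X ^ 2 + 20 * X + 9

lemma exp_le_QQ {X : ℝ} (hX : 0 ≤ X) (s : ℝ) : exp s ≤ QQ X s := by
  have h1 := QQ_ge hX s
  have h2 := aa_ge hX s
  have h3 : exp s ≤ 2 * cosh s := by
    rw [cosh_eq]; have := exp_pos (-s); linarith
  linarith

lemma inv_QQ_le {X : ℝ} (hX : 0 ≤ X) (s : ℝ) : 1 / QQ X s ≤ exp (-s) := by
  rw [exp_neg, ← one_div]
  exact one_div_le_one_div_of_le (exp_pos s) (exp_le_QQ hX s)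

lemma inv_QQ_le_one {X : ℝ} (hX : 0 ≤ X) (s : ℝ) : 1 / QQ X s ≤ 1 := by
  rw [div_le_one (QQ_pos hX s)]
  have h1 := QQ_ge hX s; have h2 := aa_ge hX s; have := one_le_cosh s; linarith

lemma aa_le_two_QQ {X : ℝ} (hX : 0 ≤ X) (s : ℝ) : aa X s ≤ 2 * QQ X s := by
  have h1 := QQ_ge hX s; have h2 := aa_ge hX s; have := one_le_cosh s; linarith

lemma aa_pos {X : ℝ} (hX : 0 ≤ X) (s : ℝ) : 0 < aa X s := by
  have h2 := aa_ge hX s; have := one_le_cosh s; linarith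

noncomputable def v1 (X s : ℝ) : ℝ := -aa X s / QQ X s ^ 3
noncomputable def v2 (X s : ℝ) : ℝ := -1 / QQ X s ^ 3 + 3 * aa X s ^ 2 / QQ X s ^ 5

lemma abs_v1_le {X : ℝ} (hX : 0 ≤ X) (s : ℝ) : |v1 X s| ≤ 2 * (1 / QQ X s) := by
  have h := QQ_pos hX s
  have h1 := aa_le_two_QQ hX s
  have h2 := inv_QQ_le_one hX s
  have h3 := aa_pos hX s
  unfold v1
  rw [abs_div, abs_neg, abs_of_pos h3, abs_of_pos (by positivity)]
  calc aa X s / QQ X s ^ 3 ≤ 2 * QQ X s / QQ X s ^ 3 := by gcongr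
    _ = 2 * ((1 / QQ X s) * (1 / QQ X s)) := by field_simp
    _ ≤ 2 * ((1 / QQ X s) * 1) := by gcongr
    _ = _ := by ring

lemma abs_v2_le {X : ℝ} (hX : 0 ≤ X) (s : ℝ) : |v2 X s| ≤ 13 * (1 / QQ X s) := by
  have h := QQ_pos hX s
  have h1 := aa_le_two_QQ hX s
  have h2 := inv_QQ_le_one hX s
  have h3 := aa_pos hX s
  have h4 : 1 / QQ X s ^ 3 ≤ 1 / QQ X s := by
    calc 1 / QQ X s ^ 3 = (1 / QQ X s) * ((1 / QQ X s) * (1 / QQ X s)) := by field_simp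
      _ ≤ (1 / QQ X s) * (1 * 1) := by gcongr
      _ = _ := by ring
  have h5 : 3 * aa X s ^ 2 / QQ X s ^ 5 ≤ 12 * (1 / QQ X s ^ 3) := by
    calc 3 * aa X s ^ 2 / QQ X s ^ 5 ≤ 3 * (2 * QQ X s) ^ 2 / QQ X s ^ 5 := by gcongr
      _ = _ := by field_simp; norm_num
  unfold v2
  have h6 : 0 ≤ 3 * aa X s ^ 2 / QQ X s ^ 5 := by positivity
  have h7 : 0 < 1 / QQ X s ^ 3 := by positivity
  rw [abs_le]
  constructor
  · rw [neg_div]; linarith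
  · rw [neg_div]; linarith

@[fun_prop] lemma continuous_aa (X : ℝ) : Continuous (aa X) := by unfold aa; fun_prop
@[fun_prop] lemma continuous_QQ (X : ℝ) : Continuous (QQ X) := by unfold QQ PP; fun_prop
lemma continuous_inv_QQ {X : ℝ} (hX : 0 < X) : Continuous (fun s => 1 / QQ X s) :=
  continuous_const.div (by fun_prop) fun s => (QQ_pos hX.le s).ne'
lemma continuous_v1 {X : ℝ} (hX : 0 < X) : Continuous (v1 X) :=
  (by fun_prop : Continuous fun s => -aa X s).div (by fun_prop)
    fun s => (pow_pos (QQ_pos hX.le s) _).ne'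
lemma continuous_v2 {X : ℝ} (hX : 0 < X) : Continuous (v2 X) :=
  (continuous_const.div (by fun_prop) fun s => (pow_pos (QQ_pos hX.le s) _).ne').add
    ((by fun_prop : Continuous fun s => 3 * aa X s ^ 2).div (by fun_prop)
    fun s => (pow_pos (QQ_pos hX.le s) _).ne')

lemma hasDerivAt_QQ {X : ℝ} (hX : 0 < X) (s : ℝ) :
    HasDerivAt (fun Y => QQ Y s) (aa X s / QQ X s) X := by
  have hP : PP X s ≠ 0 := by rw [← QQ_sq hX.le]; exact (pow_pos (QQ_pos hX.le s) _).ne'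
  have h1 : HasDerivAt (fun Y => PP Y s) (2 * aa X s) X := by
    unfold PP
    have h := (((((hasDerivAt_id X).add_const 1).const_mul 4).mul_const (cosh s)).const_add
      (4 * cosh s ^ 2)).add (((hasDerivAt_id X).pow 2).add ((hasDerivAt_id X).const_mul 6))
    refine (h.add_const 1).congr_of_eventuallyEq (Eventually.of_forall fun Y => ?_) |>.congr_deriv ?_
    · simp; ring
    · simp [aa]; ring
  refine (h1.sqrt hP).congr_deriv ?_
  have := QQ_pos hX.le s
  unfold QQ at *
  field_simp

lemma hasDerivAt_inv_QQ {X : ℝ} (hX : 0 < X) (s : ℝ) :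
    HasDerivAt (fun Y => 1 / QQ Y s) (v1 X s) X := by
  have h := QQ_pos hX.le s
  refine ((hasDerivAt_const X (1 : ℝ)).div (hasDerivAt_QQ hX s) h.ne').congr_deriv ?_
  unfold v1; field_simp; ring

lemma hasDerivAt_aa (X s : ℝ) : HasDerivAt (fun Y => aa Y s) 1 X := by
  unfold aa
  exact ((hasDerivAt_id X).add_const 3).add_const _

lemma hasDerivAt_v1 {X : ℝ} (hX : 0 < X) (s : ℝ) : HasDerivAt (fun Y => v1 Y s) (v2 X s) X := by
  have h := QQ_pos hX.le s
  refine ((hasDerivAt_aa X s).neg.div ((hasDerivAt_QQ hX s).pow 3) (pow_ne_zero 3 h.ne')).congr_deriv ?_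
  unfold v2; simp only [Pi.neg_apply, Pi.pow_apply]; field_simp; push_cast; ring

/-- the derivatives of `QQ` in `s` -/
lemma hasDerivAt_QQ_snd {X : ℝ} (hX : 0 < X) (s : ℝ) :
    HasDerivAt (fun s => QQ X s) (2 * sinh s * (aa X s - 2) / QQ X s) s := by
  have hP : PP X s ≠ 0 := by rw [← QQ_sq hX.le]; exact (pow_pos (QQ_pos hX.le s) _).ne'
  have h1 : HasDerivAt (fun s => PP X s) (4 * sinh s * (aa X s - 2)) s := by
    unfold PP
    have h := ((((hasDerivAt_cosh s).pow 2).const_mul 4).add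
      ((hasDerivAt_cosh s).const_mul (4 * (X + 1))))
    refine (h.add_const (X ^ 2 + 6 * X + 1)).congr_of_eventuallyEq
      (Eventually.of_forall fun Y => ?_) |>.congr_deriv ?_
    · simp; ring
    · simp [aa]; ring
  refine (h1.sqrt hP).congr_deriv ?_
  have := QQ_pos hX.le s
  unfold QQ at *
  field_simp
  ring

noncomputable def RR (X s : ℝ) : ℝ := -(2 * X ^ 2 + 6) - 4 * (X + 3) * cosh s
noncomputable def SS (X s : ℝ) : ℝ := sinh s * RR X s / QQ X s ^ 3

lemma hasDerivAt_SS {X : ℝ} (hX : 0 < X) (s : ℝ) :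
    HasDerivAt (SS X) (pp X * v2 X s + pp1 X * v1 X s + (X + 3) * (1 / QQ X s)) s := by
  have h := QQ_pos hX.le s
  have hR : HasDerivAt (RR X) (-(4 * (X + 3) * sinh s)) s :=
    ((hasDerivAt_cosh s).const_mul (4 * (X + 3))).const_sub _
  refine (((hasDerivAt_sinh s).mul hR).div ((hasDerivAt_QQ_snd hX s).pow 3)
    (pow_ne_zero 3 h.ne')).congr_deriv ?_
  have hs : sinh s ^ 2 = cosh s ^ 2 - 1 := sinh_sq s
  have hq := QQ_sq hX.le s
  simp only [Pi.mul_apply, Pi.pow_apply, v2, v1]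
  field_simp
  have e6 : QQ X s ^ 4 = PP X s ^ 2 := by rw [← hq]; ring
  simp only [hq, e6, RR, aa, PP, pp, pp1]
  push_cast
  ring_nf
  simp only [hs]
  ring

lemma integrableOn_exp_neg_half : IntegrableOn (fun s : ℝ => exp (-(s / 2))) (Ioi 0) := by
  have := integrableOn_exp_mul_Ioi (a := -(1 / 2)) (by norm_num) 0
  refine this.congr_fun (fun s _ => ?_) measurableSet_Ioi
  simp only; congr 1; ring

lemma tendsto_exp_neg_half : Tendsto (fun s : ℝ => exp (-(s / 2))) atTop (𝓝 0) :=
  tendsto_exp_neg_atTop_nhds_zero.comp (tendsto_id.atTop_div_const (by norm_num))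

lemma inv_QQ_le_half {X s : ℝ} (hX : 0 ≤ X) (hs : 0 ≤ s) : 1 / QQ X s ≤ exp (-(s / 2)) :=
  (inv_QQ_le hX s).trans (exp_le_exp.2 (by linarith))

lemma integrableOn_of_bound {f : ℝ → ℝ} {C : ℝ} (hf : Continuous f)
    (h : ∀ s, 0 < s → |f s| ≤ C * exp (-(s / 2))) : IntegrableOn f (Ioi 0) := by
  refine (integrableOn_exp_neg_half.const_mul C).mono' hf.aestronglyMeasurable ?_
  filter_upwards [ae_restrict_mem measurableSet_Ioi] with s hs using h s hs

lemma integrableOn_inv_QQ {X : ℝ} (hX : 0 < X) : IntegrableOn (fun s => 1 / QQ X s) (Ioi 0) :=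
  integrableOn_of_bound (C := 1) (continuous_inv_QQ hX) fun s hs => by
    rw [abs_of_pos (one_div_pos.2 (QQ_pos hX.le s)), one_mul]
    exact inv_QQ_le_half hX.le (le_of_lt hs)

lemma FF1_eq {X : ℝ} (hX : 0 < X) :
    IntegrableOn (v1 X) (Ioi 0) ∧ FF1 X = ∫ s in Ioi (0 : ℝ), v1 X s := by
  have h := hasDerivAt_integral_Ioi (v := fun Y s => 1 / QQ Y s) (v1 := v1)
    (b := fun s => 2 * exp (-(s / 2))) hX
    (fun Y hY => continuous_inv_QQ hY) (fun Y hY => continuous_v1 hY)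
    (fun Y hY s => hasDerivAt_inv_QQ hY s) (integrableOn_inv_QQ hX)
    (fun Y hY s hs => (abs_v1_le hY.1.le s).trans
      (by have := inv_QQ_le_half hY.1.le hs.le; linarith))
    (integrableOn_exp_neg_half.const_mul 2)
  refine ⟨h.1, (hasDerivAt_FF (by linarith)).unique (h.2.congr_of_eventuallyEq ?_)⟩
  filter_upwards [Ioi_mem_nhds hX] with Y hY using FF_eq (le_of_lt hY)

lemma FF2_eq {X : ℝ} (hX : 0 < X) :
    IntegrableOn (v2 X) (Ioi 0) ∧ FF2 X = ∫ s in Ioi (0 : ℝ), v2 X s := by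
  have h := hasDerivAt_integral_Ioi (v := v1) (v1 := v2)
    (b := fun s => 13 * exp (-(s / 2))) hX
    (fun Y hY => continuous_v1 hY) (fun Y hY => continuous_v2 hY)
    (fun Y hY s => hasDerivAt_v1 hY s) (FF1_eq hX).1
    (fun Y hY s hs => (abs_v2_le hY.1.le s).trans
      (by have := inv_QQ_le_half hY.1.le hs.le; linarith))
    (integrableOn_exp_neg_half.const_mul 13)
  refine ⟨h.1, (hasDerivAt_FF1 (by linarith)).unique (h.2.congr_of_eventuallyEq ?_)⟩
  filter_upwards [Ioi_mem_nhds hX] with Y hY using (FF1_eq hY).2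

lemma abs_SS_le {X : ℝ} (hX : 0 < X) {s : ℝ} (hs : 0 ≤ s) :
    |SS X s| ≤ (2 * X ^ 2 + 4 * X + 18) * (1 / QQ X s) := by
  have h := QQ_pos hX.le s
  have h1 : |sinh s| ≤ QQ X s := by
    rw [abs_of_nonneg (sinh_nonneg_iff.2 hs)]
    have := QQ_ge hX.le s; have := aa_ge hX.le s; have := sinh_lt_cosh s
    have := one_le_cosh s
    linarith
  have h2 : |RR X s| ≤ (2 * X ^ 2 + 4 * X + 18) * QQ X s := by
    have := QQ_ge hX.le s; have := aa_ge hX.le s; have h1 := one_le_cosh s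
    have hc : cosh s ≤ QQ X s := by linarith
    have : |RR X s| = 2 * X ^ 2 + 6 + 4 * (X + 3) * cosh s := by
      unfold RR; rw [abs_of_nonpos (by nlinarith)]; ring
    rw [this]
    nlinarith [mul_nonneg hX.le (sub_nonneg.2 h1), sq_nonneg X, mul_nonneg (sq_nonneg X) (sub_nonneg.2 h1),
      mul_le_mul_of_nonneg_left hc (by positivity : 0 ≤ 2 * X ^ 2 + 4 * X + 18)]
  unfold SS
  rw [abs_div, abs_mul, abs_of_pos (pow_pos h 3)]
  calc |sinh s| * |RR X s| / QQ X s ^ 3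
      ≤ QQ X s * ((2 * X ^ 2 + 4 * X + 18) * QQ X s) / QQ X s ^ 3 := by gcongr
    _ = _ := by field_simp

lemma ode_FF_of_pos {X : ℝ} (hX : 0 < X) :
    pp X * FF2 X + pp1 X * FF1 X + (X + 3) * FF X = 0 := by
  have h1 := FF1_eq hX
  have h2 := FF2_eq hX
  have h0 := integrableOn_inv_QQ hX
  have hi := ((h2.1.const_mul (pp X)).add (h1.1.const_mul (pp1 X))).add (h0.const_mul (X + 3))
  have ht : Tendsto (SS X) atTop (𝓝 0) := by
    refine squeeze_zero_norm' ?_ (by simpa using tendsto_exp_neg_half.const_mul (2 * X ^ 2 + 4 * X + 18))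
    filter_upwards [eventually_ge_atTop 0] with s hs
    refine (abs_SS_le hX hs).trans ?_
    gcongr
    exact inv_QQ_le_half hX.le hs
  have := integral_Ioi_of_hasDerivAt_of_tendsto' (a := (0 : ℝ)) (fun s _ => hasDerivAt_SS hX s) hi ht
  rw [integral_add, integral_add, integral_const_mul, integral_const_mul, integral_const_mul] at this
  · rw [h1.2, h2.2, FF_eq hX.le, this]; simp [SS]
  · exact h2.1.const_mul _
  · exact h1.1.const_mul _
  · exact (h2.1.const_mul _).add (h1.1.const_mul _)
  · exact h0.const_mul _

lemma two_dd_lt_aa {X : ℝ} (hX : 0 ≤ X) (s : ℝ) : 2 * dd s < aa X s := by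
  have h1 := PP_eq X s
  have h2 := QQ_sq hX s
  have h3 := QQ_pos hX s
  have h4 := aa_pos hX s
  have h5 := two_le_dd s
  nlinarith [pow_pos h3 2]

lemma AA_nonneg {X : ℝ} (hX : 0 ≤ X) (s : ℝ) : 0 ≤ AA X s := by
  have h := two_dd_lt_aa hX s
  have h5 := two_le_dd s
  have := QQ_pos hX s
  refine log_nonneg ?_
  rw [le_div_iff₀ (by linarith)]; linarith

lemma AA_div_QQ_le {X : ℝ} (hX : 0 ≤ X) (s : ℝ) :
    AA X s * (1 / QQ X s) ≤ 2 * exp (-(s / 2)) := by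
  have h := two_dd_lt_aa hX s
  have h5 := two_le_dd s
  have hq := QQ_pos hX s
  have hql := QQ_le hX s
  have h6 := exp_half_le_dd s
  have h7 := aa_le_two_QQ hX s
  have ha := aa_pos hX s
  have : AA X s ≤ 2 * QQ X s * exp (-(s / 2)) := by
    calc AA X s ≤ (aa X s + QQ X s) / (2 * dd s) :=
          (log_le_sub_one_of_pos (by positivity)).trans (by linarith)
      _ ≤ (aa X s + aa X s) / (2 * exp (s / 2)) := by gcongr
      _ = aa X s * exp (-(s / 2)) := by rw [exp_neg]; field_simp; ring
      _ ≤ _ := by gcongr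
  calc AA X s * (1 / QQ X s) ≤ 2 * QQ X s * exp (-(s / 2)) * (1 / QQ X s) := by gcongr
    _ = _ := by field_simp

lemma continuous_AA {X : ℝ} (hX : 0 < X) : Continuous (AA X) := by
  have h : ∀ s, 2 * dd s ≠ 0 := fun s => by have := two_le_dd s; positivity
  unfold AA
  refine Continuous.log (by fun_prop (disch := exact h _)) fun s => ?_
  have := two_le_dd s; have := aa_pos hX.le s; have := QQ_pos hX.le s
  positivity

noncomputable def g1 (X s : ℝ) : ℝ := (1 / QQ X s) ^ 2 + AA X s * v1 X s
noncomputable def g2 (X s : ℝ) : ℝ := 3 * (1 / QQ X s) * v1 X s + AA X s * v2 X s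

lemma hasDerivAt_AA {X : ℝ} (hX : 0 < X) (s : ℝ) :
    HasDerivAt (fun Y => AA Y s) (1 / QQ X s) X := by
  have h5 := two_le_dd s
  have ha := aa_pos hX.le s
  have hq := QQ_pos hX.le s
  refine ((((hasDerivAt_aa X s).add (hasDerivAt_QQ hX s)).div_const (2 * dd s)).log
    (by simp only [Pi.add_apply]; positivity)).congr_deriv ?_
  simp only [Pi.add_apply]
  field_simp
  ring

lemma hasDerivAt_AA_div_QQ {X : ℝ} (hX : 0 < X) (s : ℝ) :
    HasDerivAt (fun Y => AA Y s * (1 / QQ Y s)) (g1 X s) X := by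
  refine ((hasDerivAt_AA hX s).mul (hasDerivAt_inv_QQ hX s)).congr_deriv ?_
  unfold g1; ring

lemma hasDerivAt_g1 {X : ℝ} (hX : 0 < X) (s : ℝ) : HasDerivAt (fun Y => g1 Y s) (g2 X s) X := by
  refine (((hasDerivAt_inv_QQ hX s).pow 2).add
    ((hasDerivAt_AA hX s).mul (hasDerivAt_v1 hX s))).congr_deriv ?_
  unfold g2; simp; ring

lemma abs_g1_le {X s : ℝ} (hX : 0 ≤ X) (hs : 0 < s) : |g1 X s| ≤ 5 * exp (-(s / 2)) := by
  have h1 := AA_div_QQ_le hX s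
  have h2 := inv_QQ_le_half hX hs.le
  have h3 := abs_v1_le hX s
  have h4 := AA_nonneg hX s
  have h5 := inv_QQ_le_one hX s
  have h6 : 0 < 1 / QQ X s := one_div_pos.2 (QQ_pos hX s)
  unfold g1
  refine (abs_add_le _ _).trans ?_
  rw [abs_of_pos (pow_pos h6 2), abs_mul, abs_of_nonneg h4]
  nlinarith [mul_le_mul_of_nonneg_left h3 h4]

lemma abs_g2_le {X s : ℝ} (hX : 0 ≤ X) (hs : 0 < s) : |g2 X s| ≤ 32 * exp (-(s / 2)) := by
  have h1 := AA_div_QQ_le hX s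
  have h2 := inv_QQ_le_half hX hs.le
  have h3 := abs_v1_le hX s
  have h3' := abs_v2_le hX s
  have h4 := AA_nonneg hX s
  have h5 := inv_QQ_le_one hX s
  have h6 : 0 < 1 / QQ X s := one_div_pos.2 (QQ_pos hX s)
  unfold g2
  refine (abs_add_le _ _).trans ?_
  rw [abs_mul, abs_mul (AA X s), abs_of_nonneg h4,
    abs_of_pos (by positivity : (0 : ℝ) < 3 * (1 / QQ X s))]
  nlinarith [mul_le_mul_of_nonneg_left h3' h4, mul_le_mul_of_nonneg_left h3 h6.le]

lemma continuous_g1 {X : ℝ} (hX : 0 < X) : Continuous (g1 X) :=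
  ((continuous_inv_QQ hX).pow 2).add ((continuous_AA hX).mul (continuous_v1 hX))
lemma continuous_g2 {X : ℝ} (hX : 0 < X) : Continuous (g2 X) :=
  ((continuous_const.mul (continuous_inv_QQ hX)).mul (continuous_v1 hX)).add
    ((continuous_AA hX).mul (continuous_v2 hX))

lemma integrableOn_AA_div_QQ {X : ℝ} (hX : 0 < X) :
    IntegrableOn (fun s => AA X s * (1 / QQ X s)) (Ioi 0) :=
  integrableOn_of_bound (C := 2) ((continuous_AA hX).mul (continuous_inv_QQ hX)) fun s _ => by
    rw [abs_of_nonneg (mul_nonneg (AA_nonneg hX.le s) (one_div_pos.2 (QQ_pos hX.le s)).le)]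
    exact AA_div_QQ_le hX.le s

lemma GG_eq' {X : ℝ} (hX : 0 ≤ X) : GG X = ∫ s in Ioi (0 : ℝ), AA X s * (1 / QQ X s) := by
  rw [GG_eq hX]; simp only [div_eq_mul_inv, one_mul]

lemma GG1_eq {X : ℝ} (hX : 0 < X) :
    IntegrableOn (g1 X) (Ioi 0) ∧ GG1 X = ∫ s in Ioi (0 : ℝ), g1 X s := by
  have h := hasDerivAt_integral_Ioi (v := fun Y s => AA Y s * (1 / QQ Y s)) (v1 := g1)
    (b := fun s => 5 * exp (-(s / 2))) hX
    (fun Y hY => (continuous_AA hY).mul (continuous_inv_QQ hY)) (fun Y hY => continuous_g1 hY)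
    (fun Y hY s => hasDerivAt_AA_div_QQ hY s) (integrableOn_AA_div_QQ hX)
    (fun Y hY s hs => abs_g1_le hY.1.le hs) (integrableOn_exp_neg_half.const_mul 5)
  refine ⟨h.1, (hasDerivAt_GG (by linarith)).unique (h.2.congr_of_eventuallyEq ?_)⟩
  filter_upwards [Ioi_mem_nhds hX] with Y hY using GG_eq' (le_of_lt hY)

lemma GG2_eq {X : ℝ} (hX : 0 < X) :
    IntegrableOn (g2 X) (Ioi 0) ∧ GG2 X = ∫ s in Ioi (0 : ℝ), g2 X s := by
  have h := hasDerivAt_integral_Ioi (v := g1) (v1 := g2)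
    (b := fun s => 32 * exp (-(s / 2))) hX
    (fun Y hY => continuous_g1 hY) (fun Y hY => continuous_g2 hY)
    (fun Y hY s => hasDerivAt_g1 hY s) (GG1_eq hX).1
    (fun Y hY s hs => abs_g2_le hY.1.le hs) (integrableOn_exp_neg_half.const_mul 32)
  refine ⟨h.1, (hasDerivAt_GG1 (by linarith)).unique (h.2.congr_of_eventuallyEq ?_)⟩
  filter_upwards [Ioi_mem_nhds hX] with Y hY using (GG1_eq hY).2

noncomputable def TT (X s : ℝ) : ℝ :=
  AA X s * SS X s + sinh s * (5 * X + 3 + 6 * cosh s) / PP X s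

lemma hasDerivAt_AA_snd {X : ℝ} (hX : 0 < X) (s : ℝ) :
    HasDerivAt (AA X)
      (sinh s * (2 * cosh s + 1 - X) / ((2 + 2 * cosh s) * QQ X s)) s := by
  have h5 := two_le_dd s
  have ha := aa_pos hX.le s
  have hq := QQ_pos hX.le s
  have hd : HasDerivAt (fun s => dd s ^ 2) (2 * sinh s) s := by
    have : (fun s => dd s ^ 2) = fun s => 2 + 2 * cosh s := funext dd_sq
    rw [this]
    exact ((hasDerivAt_cosh s).const_mul 2).const_add 2
  have hae : HasDerivAt (aa X) (2 * sinh s) s :=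
    ((hasDerivAt_cosh s).const_mul 2).const_add _
  have hAA : AA X = fun s => log (aa X s + QQ X s) - (log (4 * dd s ^ 2)) / 2 := by
    funext s
    have h5 := two_le_dd s
    have ha := aa_pos hX.le s
    have hq := QQ_pos hX.le s
    unfold AA
    rw [log_div (by positivity) (by positivity),
      show (4 : ℝ) * dd s ^ 2 = (2 * dd s) ^ 2 by ring, log_pow]
    push_cast; ring
  rw [hAA]
  refine (((hae.add (hasDerivAt_QQ_snd hX s)).log (by simp only [Pi.add_apply]; positivity)).sub
    (((hd.const_mul 4).log (by positivity)).div_const 2)).congr_deriv ?_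
  simp only [Pi.add_apply]
  rw [dd_sq]
  have hc := one_le_cosh s
  have hq2 := QQ_sq hX.le s
  have hne : aa X s + QQ X s ≠ 0 := by positivity
  have hne2 : 2 + 2 * cosh s ≠ 0 := by positivity
  have hne3 : 1 + cosh s ≠ 0 := by positivity
  field_simp
  unfold PP at hq2
  unfold aa at *
  generalize QQ X s = q at *
  generalize cosh s = c at *
  linear_combination (-sinh s) * hq2

lemma hasDerivAt_TT {X : ℝ} (hX : 0 < X) (s : ℝ) :
    HasDerivAt (TT X) (pp X * g2 X s + pp1 X * g1 X s + (X + 3) * (AA X s * (1 / QQ X s))) s := by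
  have h := QQ_pos hX.le s
  have hP : HasDerivAt (PP X) (4 * sinh s * (aa X s - 2)) s := by
    unfold PP
    have h := ((((hasDerivAt_cosh s).pow 2).const_mul 4).add
      ((hasDerivAt_cosh s).const_mul (4 * (X + 1))))
    refine (h.add_const (X ^ 2 + 6 * X + 1)).congr_of_eventuallyEq
      (Eventually.of_forall fun Y => ?_) |>.congr_deriv ?_
    · simp; ring
    · simp [aa]; ring
  have hP0 : PP X s ≠ 0 := by rw [← QQ_sq hX.le]; exact (pow_pos h 2).ne'
  have hl : HasDerivAt (fun s => 5 * X + 3 + 6 * cosh s) (6 * sinh s) s :=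
    ((hasDerivAt_cosh s).const_mul 6).const_add _
  refine (((hasDerivAt_AA_snd hX s).mul (hasDerivAt_SS hX s)).add
    (((hasDerivAt_sinh s).mul hl).div hP hP0)).congr_deriv ?_
  have hs : sinh s ^ 2 = cosh s ^ 2 - 1 := sinh_sq s
  have hq := QQ_sq hX.le s
  have hc := one_le_cosh s
  have hne2 : 2 + 2 * cosh s ≠ 0 := by positivity
  have hne3 : 1 + cosh s ≠ 0 := by positivity
  simp only [Pi.mul_apply, g1, g2]
  have e1 : sinh s * (2 * cosh s + 1 - X) / ((2 + 2 * cosh s) * QQ X s) * SS X s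
      = (cosh s - 1) * (2 * cosh s + 1 - X) * RR X s / (2 * PP X s ^ 2) := by
    have e4 : QQ X s ^ 4 = PP X s ^ 2 := by rw [← hq]; ring
    unfold SS
    rw [show sinh s * (2 * cosh s + 1 - X) / ((2 + 2 * cosh s) * QQ X s) *
      (sinh s * RR X s / QQ X s ^ 3) = sinh s ^ 2 * (2 * cosh s + 1 - X) * RR X s /
        ((2 + 2 * cosh s) * QQ X s ^ 4) by field_simp, hs, e4]
    field_simp
    ring
  have e2 : 3 * (1 / QQ X s) * v1 X s = -3 * aa X s / PP X s ^ 2 := by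
    rw [← hq]; unfold v1; field_simp
  have e3 : (1 / QQ X s) ^ 2 = 1 / PP X s := by rw [← hq]; field_simp
  have e5 : (cosh s - 1) * (2 * cosh s + 1 - X) * RR X s / (2 * PP X s ^ 2) +
      ((cosh s * (5 * X + 3 + 6 * cosh s) + sinh s * (6 * sinh s)) * PP X s -
          sinh s * (5 * X + 3 + 6 * cosh s) * (4 * sinh s * (aa X s - 2))) /
        PP X s ^ 2 = pp X * (-3 * aa X s / PP X s ^ 2) + pp1 X * (1 / PP X s) := by
    field_simp
    unfold RR pp pp1 aa PP
    ring_nf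
    simp only [hs]
    ring
  rw [e1, e2, e3]
  linear_combination e5

lemma tendsto_TT {X : ℝ} (hX : 0 < X) : Tendsto (TT X) atTop (𝓝 (3 / 2)) := by
  have h1 : Tendsto (fun s => AA X s * SS X s) atTop (𝓝 0) := by
    refine squeeze_zero_norm' ?_
      (by simpa using tendsto_exp_neg_half.const_mul ((2 * X ^ 2 + 4 * X + 18) * 2))
    filter_upwards [eventually_ge_atTop 0] with s hs
    rw [norm_eq_abs, abs_mul, abs_of_nonneg (AA_nonneg hX.le s)]
    calc AA X s * |SS X s| ≤ AA X s * ((2 * X ^ 2 + 4 * X + 18) * (1 / QQ X s)) :=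
          mul_le_mul_of_nonneg_left (abs_SS_le hX hs) (AA_nonneg hX.le s)
      _ = (2 * X ^ 2 + 4 * X + 18) * (AA X s * (1 / QQ X s)) := by ring
      _ ≤ (2 * X ^ 2 + 4 * X + 18) * (2 * exp (-(s / 2))) := by
          exact mul_le_mul_of_nonneg_left (AA_div_QQ_le hX.le s) (by positivity)
      _ = _ := by ring
  have hc : Tendsto (fun s => 1 / cosh s) atTop (𝓝 0) := by
    refine squeeze_zero' (Eventually.of_forall fun s => (one_div_pos.2 (cosh_pos s)).le) ?_
      (by simpa using tendsto_exp_neg_atTop_nhds_zero.const_mul 2)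
    filter_upwards with s
    rw [exp_neg, div_le_iff₀ (cosh_pos s), cosh_eq]
    have := exp_pos s; have := exp_pos (-s)
    field_simp
    linarith
  have hs : Tendsto (fun s => sinh s / cosh s) atTop (𝓝 1) := by
    have : (fun s => sinh s / cosh s) =
        fun s => 1 - exp (-s) * (1 / cosh s) := by
      funext s
      have := cosh_pos s
      rw [eq_sub_iff_add_eq, exp_neg, ← exp_neg, ← cosh_sub_sinh]
      field_simp
      ring
    rw [this]
    simpa using (tendsto_exp_neg_atTop_nhds_zero.mul hc).const_sub 1
  have h2 : Tendsto (fun s => sinh s * (5 * X + 3 + 6 * cosh s) / PP X s) atTop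
      (𝓝 (3 / 2)) := by
    have hn := hs.mul ((hc.const_mul (5 * X + 3)).add_const 6)
    have hd := (((hc.const_mul (4 * (X + 1))).const_add 4).add
      ((hc.pow 2).const_mul (X ^ 2 + 6 * X + 1)))
    have := hn.div hd (by norm_num)
    refine (this.congr' (Eventually.of_forall fun s => ?_)).trans (by norm_num)
    have hcp := cosh_pos s
    have hP : 0 < PP X s := by rw [← QQ_sq hX.le]; exact pow_pos (QQ_pos hX.le s) 2
    simp only [Pi.div_apply]
    rw [div_eq_div_iff _ hP.ne']
    · unfold PP; field_simp; ring
    · have : 0 < (X ^ 2 + 6 * X + 1) := by positivity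
      positivity
  have := h1.add h2
  rw [zero_add] at this
  exact this

lemma ode_GG {X : ℝ} (hX : 0 < X) :
    pp X * GG2 X + pp1 X * GG1 X + (X + 3) * GG X = 3 / 2 := by
  have h1 := GG1_eq hX
  have h2 := GG2_eq hX
  have h0 := integrableOn_AA_div_QQ hX
  have hi := ((h2.1.const_mul (pp X)).add (h1.1.const_mul (pp1 X))).add (h0.const_mul (X + 3))
  have := integral_Ioi_of_hasDerivAt_of_tendsto' (a := (0 : ℝ)) (fun s _ => hasDerivAt_TT hX s) hi
    (tendsto_TT hX)
  rw [integral_add, integral_add, integral_const_mul, integral_const_mul, integral_const_mul] at this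
  · rw [h1.2, h2.2, GG_eq' hX.le, this]; simp [TT, SS]
  · exact h2.1.const_mul _
  · exact h1.1.const_mul _
  · exact (h2.1.const_mul _).add (h1.1.const_mul _)
  · exact h0.const_mul _

lemma abs_comp_kF_sub_le {h h' : ℝ → ℝ} {K : ℝ} (hd : ∀ t, 0 < t → HasDerivAt h (h' t) t)
    (hb : ∀ t, 0 < t → |h' t| ≤ K / t) (x : ℝ × ℝ) (hx : 0 < x.1) :
    |h (kF x) - h (exp x.1)| ≤ 32 * K * exp (-(1 / 2 * x.1)) := by
  have hK : 0 ≤ K := by have := (abs_nonneg _).trans (hb 1 one_pos); simpa using this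
  have he := exp_pos x.1
  have hs : Convex ℝ (Ici (exp x.1 / 4)) := convex_Ici _
  have h1 := hs.norm_image_sub_le_of_norm_hasDerivWithin_le (f := h) (f' := h')
    (C := K / (exp x.1 / 4)) (x := exp x.1) (y := kF x)
    (fun t ht => (hd t (lt_of_lt_of_le (by positivity) ht)).hasDerivWithinAt)
    (fun t ht => (hb t (lt_of_lt_of_le (by positivity) ht)).trans
      (div_le_div_of_nonneg_left hK (by positivity) ht))
    (show exp x.1 / 4 ≤ exp x.1 by linarith) (exp_le_kF x)
  refine h1.trans ?_
  rw [norm_eq_abs]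
  have h2 := abs_kF_sub_exp_le x hx.le
  calc K / (exp x.1 / 4) * |kF x - exp x.1|
      ≤ K / (exp x.1 / 4) * (8 * exp (x.1 / 2)) := by gcongr
    _ = 32 * K * (exp (x.1 / 2) / exp x.1) := by field_simp; ring
    _ = _ := by rw [← exp_sub]; congr 2; ring

lemma real_univ_angle : (ofReal (1 / π) • volume.restrict (Ioc (0 : ℝ) π)).real univ = 1 := by
  have := pi_pos
  rw [measureReal_ennreal_smul_apply, ENNReal.toReal_ofReal (by positivity)]
  simp [Measure.real, this.le]

/-- Comparison of an integral against `mF` with the integral of `h (exp s)`. -/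
lemma integral_mF_sub {h h' : ℝ → ℝ} {K : ℝ} (hd : ∀ t, 0 < t → HasDerivAt h (h' t) t)
    (hb : ∀ t, 0 < t → |h' t| ≤ K / t) (hm : Measurable h) (hi : Integrable h mF) :
    IntegrableOn (fun s => h (exp s)) (Ioi 0) ∧
    ∫ t, h t ∂mF - ∫ s in Ioi (0 : ℝ), h (exp s) =
      ∫ x, (h (kF x) - h (exp x.1)) ∂muF := by
  have hmd : Measurable (fun x : ℝ × ℝ => h (kF x) - h (exp x.1)) :=
    (hm.comp continuous_kF.measurable).sub (hm.comp (by fun_prop))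
  have h1 : Integrable (fun x : ℝ × ℝ => h (kF x) - h (exp x.1)) muF :=
    integrable_muF hmd.aestronglyMeasurable (δ := 1 / 2) (by norm_num)
      (abs_comp_kF_sub_le hd hb)
  have h2 : Integrable (fun x => h (kF x)) muF :=
    (integrable_map_measure hi.aestronglyMeasurable continuous_kF.measurable.aemeasurable).1 hi
  have h3 : Integrable (fun x : ℝ × ℝ => h (exp x.1)) muF := by
    refine (h2.sub h1).congr (Eventually.of_forall fun x => ?_)
    simp
  constructor
  · unfold muF at h3
    refine (Integrable.comp_fst_iff (f := fun s => h (exp s)) ?_).1 h3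
    intro h0
    have := real_univ_angle
    rw [h0] at this
    simp at this
  · rw [integral_sub h2 h3]
    congr 1
    · exact integral_map continuous_kF.measurable.aemeasurable hi.aestronglyMeasurable
    · unfold muF
      rw [integral_fun_fst (fun s => h (exp s)), real_univ_angle, one_smul]

lemma abs_integral_mF_sub_le {h h' : ℝ → ℝ} {K : ℝ} (hd : ∀ t, 0 < t → HasDerivAt h (h' t) t)
    (hb : ∀ t, 0 < t → |h' t| ≤ K / t) (hm : Measurable h) (hi : Integrable h mF) :
    |∫ t, h t ∂mF - ∫ s in Ioi (0 : ℝ), h (exp s)| ≤ 64 * K := by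
  rw [(integral_mF_sub hd hb hm hi).2, ← norm_eq_abs]
  have hI : Integrable (fun x : ℝ × ℝ => 32 * K * exp (-(1 / 2 * x.1))) muF := by
    unfold muF
    exact ((integrable_exp_neg_mul (δ := 1 / 2) (by norm_num)).comp_fst _).const_mul _
  refine (norm_integral_le_of_norm_le hI ?_).trans (le_of_eq ?_)
  · filter_upwards [ae_muF] with x hx using abs_comp_kF_sub_le hd hb x hx
  · unfold muF
    rw [integral_fun_fst (fun s => 32 * K * exp (-(1 / 2 * s))), real_univ_angle, one_smul,
      integral_const_mul]
    have : ∫ s in Ioi (0 : ℝ), exp (-(1 / 2 * s)) = 2 := by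
      have := integral_exp_mul_Ioi (a := -(1 / 2)) (by norm_num) 0
      simp only [neg_mul] at this
      rw [this]; norm_num
    rw [this]; ring

lemma integrable_rpow_mF {δ : ℝ} (hδ : 0 < δ) : Integrable (fun t : ℝ => t ^ (-δ)) mF := by
  have hm : Measurable (fun t : ℝ => t ^ (-δ)) := measurable_id.pow_const _
  refine (integrable_map_measure hm.aestronglyMeasurable
    continuous_kF.measurable.aemeasurable).2 ?_
  refine integrable_muF (C := 4 ^ δ) (δ := δ) (hm.comp continuous_kF.measurable).aestronglyMeasurable
    hδ fun x _ => ?_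
  have h1 := exp_le_kF x
  have h0 := one_le_kF x
  have he := exp_pos x.1
  simp only [Function.comp_apply]
  rw [abs_of_nonneg (by positivity)]
  calc kF x ^ (-δ) ≤ (exp x.1 / 4) ^ (-δ) :=
        rpow_le_rpow_of_nonpos (by positivity) h1 (by linarith)
    _ = _ := by
        rw [div_rpow he.le (by norm_num), rpow_neg (by norm_num : (0 : ℝ) ≤ 4),
          ← exp_mul]
        rw [div_inv_eq_mul, mul_comm]; congr 2; ring

lemma FF_def (X : ℝ) : FF X = ∫ t, 1 / (t + X) ∂mF := by
  simp [FF, stieltjes]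
lemma FF1_def (X : ℝ) : FF1 X = -∫ t, 1 / (t + X) ^ 2 ∂mF := by
  simp [FF1, stieltjes]

lemma integrable_inv_pow_mF {X : ℝ} (hX : -1 < X) (k : ℕ) :
    Integrable (fun t : ℝ => 1 / (t + X) ^ (k + 1)) mF := by
  have := integrable_stieltjes (𝕜 := ℝ) (z := X) one_le_mF
    aestronglyMeasurable_const integrable_inv_mF (by simpa using hX) k
  simpa using this

lemma integrable_inv_add_mF {X : ℝ} (hX : -1 < X) : Integrable (fun t : ℝ => 1 / (t + X)) mF := by
  simpa using integrable_inv_pow_mF hX 0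

lemma mul_FF_add_eq {Y : ℝ} (hY : 0 < Y) :
    Integrable (fun t => Y * t / (t + Y) ^ 2) mF ∧
    Y * (FF Y + Y * FF1 Y) = ∫ t, Y * t / (t + Y) ^ 2 ∂mF := by
  have h1 := (integrable_inv_add_mF (X := Y) (by linarith)).const_mul Y
  have h2 := (integrable_inv_pow_mF (X := Y) (by linarith) 1).const_mul (Y ^ 2)
  have e : ∀ᵐ t ∂mF, Y * (1 / (t + Y)) - Y ^ 2 * (1 / (t + Y) ^ (1 + 1)) = Y * t / (t + Y) ^ 2 := by
    filter_upwards [one_le_mF] with t ht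
    have : t + Y ≠ 0 := by positivity
    field_simp; ring
  refine ⟨(h1.sub h2).congr e, ?_⟩
  rw [← integral_congr_ae e, integral_sub h1 h2, integral_const_mul, integral_const_mul, FF_def,
    FF1_def]
  ring

lemma tendsto_mul_FF_add : Tendsto (fun Y => Y * (FF Y + Y * FF1 Y)) atTop (𝓝 1) := by
  set h : ℝ → ℝ → ℝ := fun Y t => Y * t / (t + Y) ^ 2 with hh
  set h' : ℝ → ℝ → ℝ := fun Y t => Y * (Y - t) / (t + Y) ^ 3
  have hd : ∀ Y, 0 < Y → ∀ t, 0 < t → HasDerivAt (h Y) (h' Y t) t := by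
    intro Y hY t ht
    have h1 : HasDerivAt (fun t => (t + Y) ^ 2) (2 * (t + Y)) t := by
      simpa using ((hasDerivAt_id t).add_const Y).fun_pow 2
    refine (((hasDerivAt_id t).const_mul Y).div h1 (by positivity)).congr_deriv ?_
    simp only [id, h']
    field_simp; ring
  have hb : ∀ Y, 0 < Y → ∀ t, 0 < t → |h' Y t| ≤ 1 / t := by
    intro Y hY t ht
    simp only [h']
    rw [abs_div, abs_mul, abs_of_pos hY, abs_of_pos (by positivity : (0 : ℝ) < (t + Y) ^ 3),
      div_le_div_iff₀ (by positivity) ht]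
    have : |Y - t| ≤ t + Y := by rw [abs_le]; constructor <;> linarith
    calc Y * |Y - t| * t ≤ Y * (t + Y) * t := by gcongr
      _ ≤ 1 * (t + Y) ^ 3 := by
        have := mul_pos hY ht
        nlinarith [sq_nonneg (t - Y), mul_pos (mul_pos hY ht) ht, mul_pos (mul_pos hY ht) hY, pow_pos ht 3, pow_pos hY 3]
  have hm : ∀ Y, Measurable (h Y) := fun Y => by simp only [hh]; fun_prop
  have key : ∀ Y, 0 < Y → Y * (FF Y + Y * FF1 Y) =
      Y / (Y + 1) + ∫ x, (h Y (kF x) - h Y (exp x.1)) ∂muF := by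
    intro Y hY
    obtain ⟨hi, he⟩ := mul_FF_add_eq hY
    obtain ⟨hi2, he2⟩ := integral_mF_sub (hd Y hY) (hb Y hY) (hm Y) hi
    rw [he, ← he2]
    have hder : ∀ s ∈ Ici (0 : ℝ), HasDerivAt (fun s => -(Y / (exp s + Y)))
        (h Y (exp s)) s := by
      intro s _
      have hp : exp s + Y ≠ 0 := by positivity
      refine ((hasDerivAt_const s Y).div ((Real.hasDerivAt_exp s).add_const Y) hp).neg.congr_deriv ?_
      simp only [h]; field_simp; ring
    have hlim : Tendsto (fun s => -(Y / (exp s + Y))) atTop (𝓝 0) := by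
      have : Tendsto (fun s => exp s + Y) atTop atTop :=
        tendsto_atTop_add_const_right _ _ tendsto_exp_atTop
      simpa using (this.const_div_atTop Y).neg
    have := integral_Ioi_of_hasDerivAt_of_tendsto' hder hi2 hlim
    rw [this]
    simp only [exp_zero]
    ring
  have hlim0 : Tendsto (fun Y => ∫ x, (h Y (kF x) - h Y (exp x.1)) ∂muF) atTop (𝓝 0) := by
    have hpt : ∀ t, 0 < t → Tendsto (fun Y => h Y t) atTop (𝓝 0) := by
      intro t ht
      refine squeeze_zero' ?_ ?_ (tendsto_const_nhds.div_atTop tendsto_id : Tendsto (fun Y => t / Y) atTop (𝓝 0))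
      · filter_upwards [eventually_gt_atTop 0] with Y hY
        positivity
      · filter_upwards [eventually_gt_atTop 0] with Y hY
        simp only [h]
        rw [div_le_div_iff₀ (by positivity) hY]
        nlinarith [mul_pos ht ht, mul_pos (mul_pos ht ht) hY, pow_pos ht 3]
    have := tendsto_integral_filter_of_dominated_convergence (μ := muF) (l := (atTop : Filter ℝ))
      (F := fun Y x => h Y (kF x) - h Y (exp x.1)) (f := fun _ => 0)
      (fun x => 32 * 1 * exp (-(1 / 2 * x.1))) ?_ ?_ ?_ ?_
    · simpa using this
    · exact Eventually.of_forall fun Y => (((hm Y).comp continuous_kF.measurable).sub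
        ((hm Y).comp (by fun_prop))).aestronglyMeasurable
    · filter_upwards [eventually_gt_atTop 0] with Y hY
      filter_upwards [ae_muF] with x hx using abs_comp_kF_sub_le (hd Y hY) (hb Y hY) x hx
    · unfold muF
      exact ((integrable_exp_neg_mul (δ := 1 / 2) (by norm_num)).comp_fst _).const_mul _
    · filter_upwards with x
      simpa using (hpt _ (by have := one_le_kF x; linarith)).sub (hpt _ (exp_pos x.1))
  have h1 : Tendsto (fun Y : ℝ => Y / (Y + 1)) atTop (𝓝 1) := by
    have h2 : Tendsto (fun Y : ℝ => 1 - 1 / (Y + 1)) atTop (𝓝 (1 - 0)) :=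
      ((tendsto_atTop_add_const_right _ 1 tendsto_id).const_div_atTop 1).const_sub 1
    rw [sub_zero] at h2
    refine h2.congr' ?_
    filter_upwards [eventually_gt_atTop 0] with Y hY
    have : Y + 1 ≠ 0 := by positivity
    field_simp; ring
  have := h1.add hlim0
  rw [add_zero] at this
  refine this.congr' ?_
  filter_upwards [eventually_gt_atTop 0] with Y hY using (key Y hY).symm

lemma inv_add_le_rpow {t Y : ℝ} (ht : 1 ≤ t) (hY : 0 ≤ Y) :
    1 / (t + Y) ≤ t ^ (-(1 / 4) : ℝ) * (1 + Y) ^ (-(3 / 4) : ℝ) := by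
  have h0 : 0 < t + Y := by linarith
  rw [rpow_neg (by linarith), rpow_neg (by linarith), ← mul_inv, one_div]
  refine inv_anti₀ (by positivity) ?_
  calc t ^ (1 / 4 : ℝ) * (1 + Y) ^ (3 / 4 : ℝ) ≤ (t + Y) ^ (1 / 4 : ℝ) * (t + Y) ^ (3 / 4 : ℝ) := by
        gcongr <;> linarith
    _ = t + Y := by rw [← rpow_add h0]; norm_num

lemma exists_FF_le : ∃ C, 0 < C ∧ ∀ Y, 0 ≤ Y → FF Y ≤ C * (1 + Y) ^ (-(3 / 4) : ℝ) := by
  refine ⟨∫ t, t ^ (-(1 / 4) : ℝ) ∂mF + 1, ?_, fun Y hY => ?_⟩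
  · have : 0 ≤ ∫ t, t ^ (-(1 / 4) : ℝ) ∂mF := integral_nonneg_of_ae (by
      filter_upwards [one_le_mF] with t ht
      positivity)
    linarith
  · rw [FF_def]
    calc ∫ t, 1 / (t + Y) ∂mF ≤ ∫ t, t ^ (-(1 / 4) : ℝ) * (1 + Y) ^ (-(3 / 4) : ℝ) ∂mF := by
          refine integral_mono_ae (integrable_inv_add_mF (by linarith))
            ((integrable_rpow_mF (by norm_num)).mul_const _) ?_
          filter_upwards [one_le_mF] with t ht using inv_add_le_rpow ht hY
      _ = (∫ t, t ^ (-(1 / 4) : ℝ) ∂mF) * (1 + Y) ^ (-(3 / 4) : ℝ) := integral_mul_const _ _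
      _ ≤ _ := by gcongr; linarith

lemma integral_mF_pos {h : ℝ → ℝ} (hi : Integrable h mF) (hp : ∀ t, 1 ≤ t → 0 < h t) :
    0 < ∫ t, h t ∂mF := by
  rw [integral_pos_iff_support_of_nonneg_ae]
  · have h1 : mF (Function.support h)ᶜ = 0 := by
      have : ∀ᵐ t ∂mF, t ∈ Function.support h := by
        filter_upwards [one_le_mF] with t ht using (hp t ht).ne'
      exact this
    have h2 : mF univ ≠ 0 := by
      unfold mF
      rw [Measure.map_apply continuous_kF.measurable MeasurableSet.univ, preimage_univ, muF,
        ← univ_prod_univ, Measure.prod_prod]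
      have := real_univ_angle
      rw [Measure.real] at this
      intro h0
      rcases mul_eq_zero.1 h0 with h | h
      · simp at h
      · rw [h] at this; simp at this
    rcases eq_or_ne (mF (Function.support h)) 0 with h3 | h3
    · exact absurd (by
        rw [← union_compl_self (Function.support h)]
        exact measure_union_null h3 h1) h2
    · exact pos_iff_ne_zero.2 h3
  · filter_upwards [one_le_mF] with t ht using (hp t ht).le
  · exact hi

lemma FF_pos {X : ℝ} (hX : -1 < X) : 0 < FF X := by
  rw [FF_def]
  exact integral_mF_pos (integrable_inv_add_mF hX) fun t ht => one_div_pos.2 (by linarith)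

lemma FF1_neg {X : ℝ} (hX : -1 < X) : FF1 X < 0 := by
  rw [FF1_def, neg_lt_zero]
  exact integral_mF_pos (integrable_inv_pow_mF hX 1) fun t ht => one_div_pos.2 (by
    have : 0 < t + X := by linarith
    positivity)

/-- `-X F'(X) ≤ F(X)`. -/
lemma neg_mul_FF1_le {X : ℝ} (hX : 0 ≤ X) : -(X * FF1 X) ≤ FF X := by
  rw [FF1_def, FF_def, mul_neg, neg_neg, ← integral_const_mul]
  refine integral_mono_ae ((integrable_inv_pow_mF (by linarith) 1).const_mul X)
    (integrable_inv_add_mF (by linarith)) ?_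
  filter_upwards [one_le_mF] with t ht
  have : 0 < t + X := by linarith
  rw [show (1 : ℝ) / (t + X) = (t + X) * (1 / (t + X) ^ 2) by field_simp]
  gcongr; linarith

lemma tendsto_one_add_rpow_neg {a : ℝ} (ha : 0 < a) :
    Tendsto (fun Y : ℝ => (1 + Y) ^ (-a)) atTop (𝓝 0) :=
  (tendsto_rpow_neg_atTop ha).comp (tendsto_atTop_add_const_left _ 1 tendsto_id)

lemma tendsto_FF : Tendsto FF atTop (𝓝 0) := by
  obtain ⟨C, hC, h⟩ := exists_FF_le
  refine squeeze_zero' ?_ ?_ (by simpa using (tendsto_one_add_rpow_neg (by norm_num : (0 : ℝ) < 3 / 4)).const_mul C)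
  · filter_upwards [eventually_ge_atTop 0] with Y hY using (FF_pos (by linarith)).le
  · filter_upwards [eventually_ge_atTop 0] with Y hY using h Y hY

lemma tendsto_mul_FF1 : Tendsto (fun X => X * FF1 X) atTop (𝓝 0) := by
  have := tendsto_FF.neg
  rw [neg_zero] at this
  refine tendsto_of_tendsto_of_tendsto_of_le_of_le' this tendsto_const_nhds ?_ ?_
  · filter_upwards [eventually_ge_atTop 0] with Y hY
    have := neg_mul_FF1_le hY; linarith
  · filter_upwards [eventually_ge_atTop 0] with Y hY
    have := FF1_neg (X := Y) (by linarith); nlinarith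

/-! ### Analytic continuation -/

lemma eq_zero_of_analytic {Φ : ℂ → ℂ} (hΦ : DifferentiableOn ℂ Φ {z | -1 < z.re}) {a b : ℝ}
    (ha : -1 ≤ a) (hab : a < b) (h0 : ∀ x : ℝ, a < x → x < b → Φ x = 0) {x : ℝ} (hx : -1 < x) :
    Φ x = 0 := by
  have ho : IsOpen {z : ℂ | -1 < z.re} := isOpen_lt continuous_const Complex.continuous_re
  have hc : IsPreconnected {z : ℂ | -1 < z.re} := (convex_halfSpace_re_gt (-1)).isPreconnected
  set c : ℝ := (a + b) / 2
  refine (hΦ.analyticOnNhd ho).eqOn_zero_of_preconnected_of_frequently_eq_zero hc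
    (z₀ := (c : ℂ)) (by simp [c]; linarith) ?_ (by simpa using hx)
  have h1 : ∃ᶠ t : ℝ in 𝓝[>] c, Φ t = 0 := by
    refine Eventually.frequently ?_
    have h2 : Ioo c b ∈ 𝓝[>] c := Ioo_mem_nhdsGT (by simp only [c]; linarith)
    filter_upwards [h2] with t ht
    exact h0 t (by have := ht.1; simp only [c] at this; linarith) ht.2
  have h3 : Tendsto (fun t : ℝ => (t : ℂ)) (𝓝[>] c) (𝓝[≠] (c : ℂ)) := by
    refine tendsto_nhdsWithin_iff.2 ⟨(Complex.continuous_ofReal.tendsto c).mono_left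
      nhdsWithin_le_nhds, ?_⟩
    filter_upwards [self_mem_nhdsWithin] with t ht
    simp only [mem_compl_iff, mem_singleton_iff, Complex.ofReal_inj]
    exact ne_of_gt ht
  exact h3.frequently h1

lemma differentiableOn_stieltjes {m : Measure ℝ} {h : ℝ → ℝ} (hm : ∀ᵐ t ∂m, 1 ≤ t)
    (hh : AEStronglyMeasurable h m) (hi : Integrable (fun t => h t / t) m) (k : ℕ) :
    DifferentiableOn ℂ (stieltjes m h (k + 1) : ℂ → ℂ) {z | -1 < z.re} := fun z hz =>
  (hasDerivAt_stieltjes (𝕜 := ℂ) hm hh hi hz k).differentiableAt.differentiableWithinAt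

lemma ode_FF {X : ℝ} (hX : -1 < X) : pp X * FF2 X + pp1 X * FF1 X + (X + 3) * FF X = 0 := by
  have hd := fun k => differentiableOn_stieltjes one_le_mF aestronglyMeasurable_const
    integrable_inv_mF k
  have := eq_zero_of_analytic
    (Φ := fun z => (z * (z + 1) * (z + 9)) * (2 * stieltjes mF (fun _ => 1) 3 z) +
      (3 * z ^ 2 + 20 * z + 9) * (-stieltjes mF (fun _ => 1) 2 z) +
      (z + 3) * stieltjes mF (fun _ => 1) 1 z)
    (by
      have h0 := hd 0; have h1 := hd 1; have h2 := hd 2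
      simp only [zero_add, Nat.reduceAdd] at h0 h1 h2
      fun_prop) (a := 0) (b := 1) (by norm_num) (by norm_num) (fun x hx _ => by
        have := ode_FF_of_pos hx
        simp only [stieltjes_ofReal]
        simp only [pp, pp1, FF2, FF1, FF] at this
        exact_mod_cast this) hX
  simp only [stieltjes_ofReal] at this
  simp only [pp, pp1, FF2, FF1, FF]
  exact_mod_cast this

noncomputable def MM (X : ℝ) : ℝ := stieltjes mF log 1 X
noncomputable def MM1 (X : ℝ) : ℝ := -stieltjes mF log 2 X
noncomputable def MM2 (X : ℝ) : ℝ := 2 * stieltjes mF log 3 X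

lemma aesm_log : AEStronglyMeasurable log mF := measurable_log.aestronglyMeasurable

lemma integrable_log_div_mF : Integrable (fun t => log t / t) mF := by
  refine ((integrable_rpow_mF (δ := 1 / 2) (by norm_num)).const_mul 2).mono'
    (measurable_log.div measurable_id).aestronglyMeasurable ?_
  filter_upwards [one_le_mF] with t ht
  have h1 := log_le_rpow_div (x := t) (ε := 1 / 2) (by linarith) (by norm_num)
  have h2 := log_nonneg ht
  rw [norm_eq_abs, abs_of_nonneg (by positivity)]
  calc log t / t ≤ (t ^ (1 / 2 : ℝ) / (1 / 2)) / t := by gcongr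
    _ = 2 * (t ^ (1 / 2 : ℝ) / t ^ (1 : ℝ)) := by rw [rpow_one]; ring
    _ = _ := by rw [← rpow_sub (by linarith)]; norm_num

lemma hasDerivAt_MM {X : ℝ} (hX : -1 < X) : HasDerivAt MM (MM1 X) X :=
  (hasDerivAt_stieltjes one_le_mF aesm_log integrable_log_div_mF (z := X) hX 0).congr_deriv
    (by simp [MM1])
lemma hasDerivAt_MM1 {X : ℝ} (hX : -1 < X) : HasDerivAt MM1 (MM2 X) X :=
  (hasDerivAt_stieltjes one_le_mF aesm_log integrable_log_div_mF (z := X) hX 1).neg.congr_deriv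
    (by simp [MM2])

/-- The iterated Stieltjes transform `∫₀^∞ F(Y) (Y + T)^{-k} dY`. -/
noncomputable def NN (k : ℕ) (T : ℝ) : ℝ := ∫ Y in Ioi (0 : ℝ), FF Y / (Y + T) ^ k

lemma continuousOn_FF : ContinuousOn FF (Ioi (-1)) := fun _ hX =>
  (hasDerivAt_FF hX).continuousAt.continuousWithinAt

lemma measurable_FF_restrict : AEStronglyMeasurable FF (volume.restrict (Ioi 0)) :=
  (continuousOn_FF.mono (Ioi_subset_Ioi (by norm_num))).aestronglyMeasurable measurableSet_Ioi

lemma integrableOn_one_add_rpow {a : ℝ} (ha : 1 < a) :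
    IntegrableOn (fun Y : ℝ => (1 + Y) ^ (-a)) (Ioi 0) := by
  simpa [add_comm] using integrableOn_add_rpow_Ioi_of_lt (a := -a) (c := 0) (m := 1)
    (by linarith) (by norm_num)

/-- Lebesgue measure on `(1, ∞)`, as the image of Lebesgue measure on `(0, ∞)`. -/
noncomputable def nu : Measure ℝ := (volume.restrict (Ioi (0 : ℝ))).map (fun Y => Y + 1)

lemma one_le_nu : ∀ᵐ t ∂nu, 1 ≤ t := by
  refine (ae_map_iff (by fun_prop) measurableSet_Ici).2 ?_
  filter_upwards [ae_restrict_mem measurableSet_Ioi] with Y hY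
  have : (0 : ℝ) < Y := hY
  linarith

lemma measurableEmbedding_add_one : MeasurableEmbedding (fun Y : ℝ => Y + 1) :=
  (Homeomorph.addRight (1 : ℝ)).measurableEmbedding

lemma aesm_FF_nu : AEStronglyMeasurable (fun t => FF (t - 1)) nu := by
  unfold nu
  rw [measurableEmbedding_add_one.aestronglyMeasurable_map_iff]
  refine measurable_FF_restrict.congr (Eventually.of_forall fun Y => ?_)
  simp

lemma integrableOn_FF_div : IntegrableOn (fun Y => FF Y / (1 + Y)) (Ioi 0) := by
  obtain ⟨C, hC, h⟩ := exists_FF_le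
  refine ((integrableOn_one_add_rpow (a := 7 / 4) (by norm_num)).const_mul C).mono'
    (by
      simp only [div_eq_mul_inv]
      exact measurable_FF_restrict.mul (Measurable.aestronglyMeasurable (by fun_prop))) ?_
  filter_upwards [ae_restrict_mem measurableSet_Ioi] with Y hY
  have hY : (0 : ℝ) < Y := hY
  rw [norm_eq_abs, abs_of_pos (div_pos (FF_pos (by linarith)) (by linarith))]
  calc FF Y / (1 + Y) ≤ C * (1 + Y) ^ (-(3 / 4) : ℝ) / (1 + Y) ^ (1 : ℝ) := by
        rw [rpow_one]; gcongr; exact h Y hY.le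
    _ = C * ((1 + Y) ^ (-(3 / 4) : ℝ) / (1 + Y) ^ (1 : ℝ)) := by ring
    _ = _ := by rw [← rpow_sub (by linarith)]; norm_num

lemma integrable_FF_div_nu : Integrable (fun t => FF (t - 1) / t) nu := by
  unfold nu
  rw [measurableEmbedding_add_one.integrable_map_iff]
  refine integrableOn_FF_div.congr (Eventually.of_forall fun Y => ?_)
  simp [add_comm]

lemma stieltjes_nu (k : ℕ) (T : ℝ) :
    stieltjes nu (fun t => FF (t - 1)) k (T - 1) = NN k T := by
  unfold stieltjes nu NN
  rw [measurableEmbedding_add_one.integral_map]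
  refine integral_congr_ae (Eventually.of_forall fun Y => ?_)
  simp

lemma integrableOn_NN {T : ℝ} (hT : 0 < T) (k : ℕ) :
    IntegrableOn (fun Y => FF Y / (Y + T) ^ (k + 1)) (Ioi 0) := by
  have := integrable_stieltjes (𝕜 := ℝ) (z := T - 1) one_le_nu aesm_FF_nu integrable_FF_div_nu
    (by simp; linarith) k
  unfold nu at this
  rw [measurableEmbedding_add_one.integrable_map_iff] at this
  refine Integrable.congr this (Eventually.of_forall fun Y => ?_)
  simp

lemma hasDerivAt_NN {T : ℝ} (hT : 0 < T) (k : ℕ) :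
    HasDerivAt (NN (k + 1)) (-((k + 1 : ℕ) : ℝ) * NN (k + 2) T) T := by
  have := hasDerivAt_stieltjes (𝕜 := ℝ) (z := T - 1) one_le_nu aesm_FF_nu integrable_FF_div_nu
    (by simp; linarith) k
  have h2 := this.comp T ((hasDerivAt_id T).sub_const 1)
  rw [mul_one, stieltjes_nu] at h2
  refine h2.congr_of_eventuallyEq (Eventually.of_forall fun S => ?_)
  simp [stieltjes_nu]

/-- The inhomogeneous equation for the iterated Stieltjes transform, at `X = -T`. -/
lemma ode_NN {T : ℝ} (hT : 0 < T) :
    pp (-T) * (2 * NN 3 T) + pp1 (-T) * NN 2 T + (-T + 3) * NN 1 T = -1 := by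
  have i1 := (integrableOn_NN hT 0).const_mul (-T + 3)
  have i2 := (integrableOn_NN hT 1).const_mul (pp1 (-T))
  have i3 := (integrableOn_NN hT 2).const_mul (pp (-T) * 2)
  have hi := (i3.add i2).add i1
  have hder : ∀ Y ∈ Ici (0 : ℝ), HasDerivAt
      (fun Y => -(pp Y * (FF Y / (Y + T) ^ 2 + FF1 Y / (Y + T))))
      (pp (-T) * 2 * (FF Y / (Y + T) ^ (2 + 1)) + pp1 (-T) * (FF Y / (Y + T) ^ (1 + 1)) +
        (-T + 3) * (FF Y / (Y + T) ^ (0 + 1))) Y := by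
    intro Y hY
    have hY : (0 : ℝ) ≤ Y := hY
    have hne : Y + T ≠ 0 := by positivity
    have hl : HasDerivAt (fun Y => Y + T) 1 Y := (hasDerivAt_id Y).add_const T
    have hp : HasDerivAt pp (pp1 Y) Y := by
      unfold pp pp1
      refine (((hasDerivAt_id Y).mul ((hasDerivAt_id Y).add_const 1)).mul
        ((hasDerivAt_id Y).add_const 9)).congr_deriv ?_
      simp; ring
    refine (hp.mul (((hasDerivAt_FF (by linarith)).div (hl.fun_pow 2) (pow_ne_zero 2 hne)).add
      ((hasDerivAt_FF1 (by linarith)).div hl hne))).neg.congr_deriv ?_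
    have hode := ode_FF (X := Y) (by linarith)
    simp only [Pi.add_apply, Pi.div_apply]
    have e : pp Y * (FF2 Y / (Y + T)) = (-(pp1 Y * FF1 Y) - (Y + 3) * FF Y) / (Y + T) := by
      rw [← mul_div_assoc]; congr 1; linarith
    have e' : (FF2 Y * (Y + T) - FF1 Y * 1) / (Y + T) ^ 2 =
        FF2 Y / (Y + T) - FF1 Y / (Y + T) ^ 2 := by field_simp
    rw [e', mul_add (pp Y), mul_sub (pp Y) (FF2 Y / (Y + T)), e]
    unfold pp pp1
    field_simp
    ring
  have hlim : Tendsto (fun Y => -(pp Y * (FF Y / (Y + T) ^ 2 + FF1 Y / (Y + T)))) atTop (𝓝 (-1)) := by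
    have hinv : Tendsto (fun Y : ℝ => 1 / (Y + T)) atTop (𝓝 0) :=
      (tendsto_atTop_add_const_right _ T tendsto_id).const_div_atTop 1
    have hr : Tendsto (fun Y : ℝ => (1 + (1 - T) * (1 / (Y + T))) * (1 + (9 - T) * (1 / (Y + T))))
        atTop (𝓝 1) := by
      simpa using ((hinv.const_mul (1 - T)).const_add 1).mul ((hinv.const_mul (9 - T)).const_add 1)
    have := (hr.mul (tendsto_mul_FF_add.add (tendsto_mul_FF1.const_mul T))).neg
    rw [mul_zero, add_zero, mul_one] at this
    refine this.congr' ?_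
    filter_upwards [eventually_gt_atTop 0] with Y hY
    have hne : Y + T ≠ 0 := by positivity
    unfold pp
    field_simp
    ring
  have := integral_Ioi_of_hasDerivAt_of_tendsto' hder hi hlim
  rw [integral_add, integral_add, integral_const_mul, integral_const_mul, integral_const_mul] at this
  · simp only [NN]
    norm_num [pp] at this ⊢
    linarith
  · exact i3
  · exact i2
  · exact i3.add i2
  · exact i1

lemma integral_inv_mul_inv {a b : ℝ} (ha : 0 < a) (hab : a < b) :
    ∫ Y in Ioi (0 : ℝ), 1 / ((b + Y) * (Y + a)) = log (b / a) / (b - a) := by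
  have hba : b - a ≠ 0 := by linarith
  have hb : 0 < b := by linarith
  have hder : ∀ Y ∈ Ici (0 : ℝ), HasDerivAt
      (fun Y => (log ((Y + a) / (b + Y))) / (b - a)) (1 / ((b + Y) * (Y + a))) Y := by
    intro Y hY
    have hY : (0 : ℝ) ≤ Y := hY
    have h1 : Y + a ≠ 0 := by positivity
    have h2 : b + Y ≠ 0 := by positivity
    refine (((((hasDerivAt_id Y).add_const a).div ((hasDerivAt_id Y).const_add b) h2).log
      (by simp only [Pi.div_apply, id]; positivity)).div_const (b - a)).congr_deriv ?_
    simp only [Pi.div_apply, id]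
    field_simp
    ring
  have hlim : Tendsto (fun Y => (log ((Y + a) / (b + Y))) / (b - a)) atTop (𝓝 0) := by
    have h1 : Tendsto (fun Y : ℝ => (Y + a) / (b + Y)) atTop (𝓝 1) := by
      have h2 : Tendsto (fun Y : ℝ => 1 - (b - a) / (b + Y)) atTop (𝓝 (1 - 0)) :=
        ((tendsto_atTop_add_const_left _ b tendsto_id).const_div_atTop (b - a)).const_sub 1
      rw [sub_zero] at h2
      refine h2.congr' ?_
      filter_upwards [eventually_gt_atTop 0] with Y hY
      have : b + Y ≠ 0 := by positivity
      field_simp; ring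
    have := ((continuousAt_log one_ne_zero).tendsto.comp h1).div_const (b - a)
    simpa using this
  have := integral_Ioi_of_hasDerivAt_of_nonneg' hder (fun Y hY => by
    have hY : (0 : ℝ) < Y := hY
    positivity) hlim
  rw [this, zero_sub, zero_add, add_zero, ← neg_div, ← log_inv, inv_div]

lemma NN_one_eq {T : ℝ} (hT : 0 < T) (hT1 : T < 1) : NN 1 T = MM (-T) - log T * FF (-T) := by
  have hInt : Integrable (Function.uncurry fun Y t : ℝ => 1 / ((t + Y) * (Y + T)))
      ((volume.restrict (Ioi (0 : ℝ))).prod mF) := by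
    refine (((integrableOn_one_add_rpow (a := 7 / 4) (by norm_num)).const_mul (1 / T)).mul_prod
      (integrable_rpow_mF (δ := 1 / 4) (by norm_num))).mono' ?_ ?_
    · refine Measurable.aestronglyMeasurable ?_
      unfold Function.uncurry
      simp only [one_div]
      exact Measurable.inv (by fun_prop)
    · have h1 := (Measure.quasiMeasurePreserving_fst (μ := volume.restrict (Ioi (0 : ℝ)))
        (ν := mF)).ae (ae_restrict_mem measurableSet_Ioi)
      have h2 := (Measure.quasiMeasurePreserving_snd (μ := volume.restrict (Ioi (0 : ℝ)))
        (ν := mF)).ae one_le_mF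
      filter_upwards [h1, h2] with x hY ht
      obtain ⟨Y, t⟩ := x
      simp only [mem_Ioi] at hY ht
      simp only [Function.uncurry]
      have h3 := inv_add_le_rpow ht hY.le
      have h4 : 1 / (Y + T) ≤ 1 / T * (1 + Y) ^ (-1 : ℝ) := by
        rw [rpow_neg_one, ← one_div, one_div_mul_one_div]
        exact one_div_le_one_div_of_le (by positivity) (by nlinarith)
      rw [norm_eq_abs, abs_of_pos (by positivity), ← one_div_mul_one_div]
      calc 1 / (t + Y) * (1 / (Y + T)) ≤ (t ^ (-(1 / 4) : ℝ) * (1 + Y) ^ (-(3 / 4) : ℝ)) *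
            (1 / T * (1 + Y) ^ (-1 : ℝ)) := by gcongr
        _ = 1 / T * ((1 + Y) ^ (-(3 / 4) : ℝ) * (1 + Y) ^ (-1 : ℝ)) * t ^ (-(1 / 4) : ℝ) := by ring
        _ = _ := by rw [← rpow_add (by linarith)]; norm_num
  have h1 : NN 1 T = ∫ Y in Ioi (0 : ℝ), ∫ t, 1 / ((t + Y) * (Y + T)) ∂mF := by
    unfold NN
    refine integral_congr_ae (Eventually.of_forall fun Y => ?_)
    simp only [pow_one]
    rw [FF_def, ← integral_div]
    refine integral_congr_ae (Eventually.of_forall fun t => ?_)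
    simp only
    rw [div_div]
  rw [h1, integral_integral_swap hInt]
  have j1 : Integrable (fun t => log t / (t + -T)) mF := by
    simpa using integrable_stieltjes (𝕜 := ℝ) (z := -T) one_le_mF aesm_log integrable_log_div_mF
      (by simp; linarith) 0
  have j2 := (integrable_inv_add_mF (X := -T) (by linarith)).const_mul (log T)
  have e : ∀ᵐ t ∂mF, (∫ Y in Ioi (0 : ℝ), 1 / ((t + Y) * (Y + T))) =
      log t / (t + -T) - log T * (1 / (t + -T)) := by
    filter_upwards [one_le_mF] with t ht
    rw [integral_inv_mul_inv hT (by linarith), log_div (by linarith) (by linarith)]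
    rw [← sub_eq_add_neg]; ring
  rw [integral_congr_ae e, integral_sub j1 j2, integral_const_mul, FF_def]
  simp [MM, stieltjes]

lemma ode_MM {X : ℝ} (hX : -1 < X) : pp X * MM2 X + pp1 X * MM1 X + (X + 3) * MM X =
    -1 + 2 * (X + 1) * (X + 9) * FF1 X + (2 * X + 10) * FF X := by
  have key : ∀ x : ℝ, -1 < x → x < 0 → pp x * MM2 x + pp1 x * MM1 x + (x + 3) * MM x =
    -1 + 2 * (x + 1) * (x + 9) * FF1 x + (2 * x + 10) * FF x := by
    intro x hx hx0
    have hnhd : Ioo (-1 : ℝ) 0 ∈ 𝓝 x := Ioo_mem_nhds hx hx0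
    have hM : ∀ y ∈ Ioo (-1 : ℝ) 0, MM y = NN 1 (-y) + log (-y) * FF y := by
      intro y hy
      have := NN_one_eq (T := -y) (by linarith [hy.2]) (by linarith [hy.1])
      rw [this]; simp
    have hlog : ∀ y ∈ Ioo (-1 : ℝ) 0, HasDerivAt (fun y => log (-y)) (1 / y) y := by
      intro y hy
      refine ((hasDerivAt_id y).neg.log (by simp; exact hy.2.ne)).congr_deriv ?_
      simp [neg_div_neg_eq]
    have hN : ∀ k, ∀ y ∈ Ioo (-1 : ℝ) 0,
        HasDerivAt (fun y => NN (k + 1) (-y)) (((k + 1 : ℕ) : ℝ) * NN (k + 2) (-y)) y := by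
      intro k y hy
      refine ((hasDerivAt_NN (T := -y) (by linarith [hy.2]) k).comp y
        (hasDerivAt_id y).neg).congr_deriv ?_
      ring
    have hM1 : ∀ y ∈ Ioo (-1 : ℝ) 0,
        MM1 y = NN 2 (-y) + (1 / y * FF y + log (-y) * FF1 y) := by
      intro y hy
      refine (hasDerivAt_MM hy.1).unique (HasDerivAt.congr_of_eventuallyEq
        (((hN 0 y hy).add ((hlog y hy).mul (hasDerivAt_FF hy.1))).congr_deriv ?_) ?_)
      · simp
      · filter_upwards [Ioo_mem_nhds hy.1 hy.2] with u hu using hM u hu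
    have hM2 : MM2 x = 2 * NN 3 (-x) + ((-1 / x ^ 2 * FF x + 1 / x * FF1 x) +
        (1 / x * FF1 x + log (-x) * FF2 x)) := by
      have hxm : x ∈ Ioo (-1 : ℝ) 0 := ⟨hx, hx0⟩
      have hinv : HasDerivAt (fun y : ℝ => 1 / y) (-1 / x ^ 2) x := by
        simpa [neg_div] using hasDerivAt_inv hx0.ne
      refine (hasDerivAt_MM1 hx).unique (HasDerivAt.congr_of_eventuallyEq
        (((hN 1 x hxm).add ((hinv.mul (hasDerivAt_FF hx)).add ((hlog x hxm).mul
          (hasDerivAt_FF1 hx)))).congr_deriv ?_) ?_)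
      · simp
      · filter_upwards [hnhd] with u hu using hM1 u hu
    have h1 := ode_NN (T := -x) (by linarith)
    have h2 := ode_FF hx
    rw [hM2, hM1 x ⟨hx, hx0⟩, hM x ⟨hx, hx0⟩]
    simp only [neg_neg] at h1
    have e1 : pp x * (-1 / x ^ 2 * FF x + 1 / x * FF1 x + 1 / x * FF1 x) + pp1 x * (1 / x * FF x) =
        2 * (x + 1) * (x + 9) * FF1 x + (2 * x + 10) * FF x := by
      have := hx0.ne
      unfold pp pp1
      field_simp
      ring
    linear_combination h1 + log (-x) * h2 + e1
  have hd := fun k => differentiableOn_stieltjes one_le_mF aestronglyMeasurable_const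
    integrable_inv_mF k
  have hd' := fun k => differentiableOn_stieltjes one_le_mF aesm_log integrable_log_div_mF k
  have := eq_zero_of_analytic
    (Φ := fun z => (z * (z + 1) * (z + 9)) * (2 * stieltjes mF log 3 z) +
      (3 * z ^ 2 + 20 * z + 9) * (-stieltjes mF log 2 z) +
      (z + 3) * stieltjes mF log 1 z - (-1 +
      2 * (z + 1) * (z + 9) * (-stieltjes mF (fun _ => 1) 2 z) +
      (2 * z + 10) * stieltjes mF (fun _ => 1) 1 z))
    (by
      have h0 := hd 0; have h1 := hd 1
      have h0' := hd' 0; have h1' := hd' 1; have h2' := hd' 2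
      simp only [zero_add, Nat.reduceAdd] at h0 h1 h0' h1' h2'
      fun_prop) (a := -1) (b := 0) (by norm_num) (by norm_num) (fun x hx hx0 => by
        have := key x hx hx0
        simp only [stieltjes_ofReal]
        simp only [pp, pp1, MM2, MM1, MM, FF1, FF] at this
        rw [sub_eq_zero]
        exact_mod_cast this) hX
  simp only [stieltjes_ofReal] at this
  simp only [pp, pp1, MM2, MM1, MM, FF1, FF]
  rw [sub_eq_zero] at this
  exact_mod_cast this

lemma pp_pos {X : ℝ} (hX : 0 < X) : 0 < pp X := by unfold pp; positivity

lemma hasDerivAt_pp (X : ℝ) : HasDerivAt pp (pp1 X) X := by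
  unfold pp pp1
  refine (((hasDerivAt_id X).mul ((hasDerivAt_id X).add_const 1)).mul
    ((hasDerivAt_id X).add_const 9)).congr_deriv ?_
  simp; ring

/-- `U` solves `(p U')' + (X + 3) U = 0` on `(0, ∞)`, with derivative `U₁`. -/
def IsSol (U U₁ : ℝ → ℝ) : Prop := ∀ X, 0 < X → HasDerivAt U (U₁ X) X ∧
  HasDerivAt (fun X => pp X * U₁ X) (-((X + 3) * U X)) X

lemma isSol_of_deriv {U U₁ U₂ : ℝ → ℝ} (h0 : ∀ X, 0 < X → HasDerivAt U (U₁ X) X)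
    (h1 : ∀ X, 0 < X → HasDerivAt U₁ (U₂ X) X)
    (h : ∀ X, 0 < X → pp X * U₂ X + pp1 X * U₁ X + (X + 3) * U X = 0) : IsSol U U₁ := by
  intro X hX
  refine ⟨h0 X hX, ((hasDerivAt_pp X).mul (h1 X hX)).congr_deriv ?_⟩
  linarith [h X hX]

lemma IsSol.wronskian {U U₁ V V₁ : ℝ → ℝ} (hU : IsSol U U₁) (hV : IsSol V V₁) :
    ∃ c, ∀ X, 0 < X → pp X * (U X * V₁ X - U₁ X * V X) = c := by
  have hd : ∀ X, 0 < X → HasDerivAt (fun X => U X * (pp X * V₁ X) - pp X * U₁ X * V X) 0 X := by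
    intro X hX
    refine (((hU X hX).1.mul (hV X hX).2).sub ((hU X hX).2.mul (hV X hX).1)).congr_deriv ?_
    ring
  refine ⟨U 1 * (pp 1 * V₁ 1) - pp 1 * U₁ 1 * V 1, fun X hX => ?_⟩
  have := (convex_Ioi (0 : ℝ)).is_const_of_fderivWithin_eq_zero (𝕜 := ℝ)
    (f := fun X => U X * (pp X * V₁ X) - pp X * U₁ X * V X)
    (fun x hx => (hd x hx).differentiableAt.differentiableWithinAt)
    (fun x hx => by
      have := (hd x hx).hasFDerivAt.hasFDerivWithinAt (s := Ioi 0)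
      rw [this.fderivWithin (isOpen_Ioi.uniqueDiffWithinAt hx)]
      ext; simp) (show X ∈ Ioi 0 from hX) (show (1 : ℝ) ∈ Ioi 0 from mem_Ioi.2 one_pos)
  linarith

lemma IsSol.wronskian_eq {U U₁ V V₁ : ℝ → ℝ} (hU : IsSol U U₁) (hV : IsSol V V₁) {c : ℝ}
    (hc : Tendsto (fun X => pp X * (U X * V₁ X - U₁ X * V X)) (𝓝[>] 0) (𝓝 c)) {X : ℝ}
    (hX : 0 < X) : pp X * (U X * V₁ X - U₁ X * V X) = c := by
  obtain ⟨d, hd⟩ := hU.wronskian hV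
  rw [hd X hX]
  refine tendsto_nhds_unique (Tendsto.congr' ?_ tendsto_const_nhds) hc
  filter_upwards [self_mem_nhdsWithin] with X hX using (hd X hX).symm

lemma isSol_FF : IsSol FF FF1 :=
  isSol_of_deriv (fun _ hX => hasDerivAt_FF (by linarith)) (fun _ hX => hasDerivAt_FF1 (by linarith))
    fun _ hX => ode_FF (by linarith)

/-- The Fricke-type reflection `s(X) = (3/X) F(9/X)` of `F`. -/
noncomputable def ss (X : ℝ) : ℝ := 3 / X * FF (9 / X)
noncomputable def ss1 (X : ℝ) : ℝ := -3 / X ^ 2 * FF (9 / X) - 27 / X ^ 3 * FF1 (9 / X)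
noncomputable def ss2 (X : ℝ) : ℝ := 6 / X ^ 3 * FF (9 / X) + 108 / X ^ 4 * FF1 (9 / X) +
  243 / X ^ 5 * FF2 (9 / X)

lemma hasDerivAt_const_div_pow (c : ℝ) {X : ℝ} (hX : 0 < X) (k : ℕ) :
    HasDerivAt (fun X : ℝ => c / X ^ k) (-(k * c) / X ^ (k + 1)) X := by
  have := (hasDerivAt_const X c).div (hasDerivAt_pow k X) (pow_ne_zero k hX.ne')
  refine this.congr_deriv ?_
  rcases k with _ | k
  · simp
  · field_simp; simp; ring

lemma hasDerivAt_nine_div {X : ℝ} (hX : 0 < X) : HasDerivAt (fun X : ℝ => 9 / X) (-9 / X ^ 2) X := by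
  simpa using hasDerivAt_const_div_pow 9 hX 1

lemma hasDerivAt_ss {X : ℝ} (hX : 0 < X) : HasDerivAt ss (ss1 X) X := by
  have h9 : -1 < 9 / X := by have : 0 < 9 / X := by positivity
                             linarith
  have h := (hasDerivAt_const_div_pow 3 hX 1).mul ((hasDerivAt_FF h9).comp X (hasDerivAt_nine_div hX))
  simp only [pow_one] at h
  refine h.congr_deriv ?_
  simp only [ss1, Function.comp]
  field_simp; push_cast; ring

lemma hasDerivAt_ss1 {X : ℝ} (hX : 0 < X) : HasDerivAt ss1 (ss2 X) X := by
  have h9 : -1 < 9 / X := by have : 0 < 9 / X := by positivity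
                             linarith
  have h := ((hasDerivAt_const_div_pow (-3) hX 2).mul
    ((hasDerivAt_FF h9).comp X (hasDerivAt_nine_div hX))).sub
    ((hasDerivAt_const_div_pow 27 hX 3).mul
    ((hasDerivAt_FF1 h9).comp X (hasDerivAt_nine_div hX)))
  refine h.congr_deriv ?_
  simp only [ss2, Function.comp]
  field_simp; push_cast; ring

lemma isSol_ss : IsSol ss ss1 :=
  isSol_of_deriv (fun _ hX => hasDerivAt_ss hX) (fun _ hX => hasDerivAt_ss1 hX) fun X hX => by
    have h9 : -1 < 9 / X := by have : 0 < 9 / X := by positivity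
                               linarith
    have := ode_FF h9
    have e : pp X * ss2 X + pp1 X * ss1 X + (X + 3) * ss X =
      3 / X * (pp (9 / X) * FF2 (9 / X) + pp1 (9 / X) * FF1 (9 / X) +
        (9 / X + 3) * FF (9 / X)) := by
      unfold pp pp1 ss ss1 ss2
      field_simp; ring
    rw [e, this, mul_zero]

/-- `n(X) = ½ ∫ log(t/X) / (t + X) dm_F(t)`. -/
noncomputable def nn (X : ℝ) : ℝ := (MM X - log X * FF X) / 2
noncomputable def nn1 (X : ℝ) : ℝ := (MM1 X - (1 / X * FF X + log X * FF1 X)) / 2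
noncomputable def nn2 (X : ℝ) : ℝ :=
  (MM2 X - (-1 / X ^ 2 * FF X + 1 / X * FF1 X + (1 / X * FF1 X + log X * FF2 X))) / 2

lemma hasDerivAt_nn {X : ℝ} (hX : 0 < X) : HasDerivAt nn (nn1 X) X := by
  have h1 : -1 < X := by linarith
  refine (((hasDerivAt_MM h1).sub ((hasDerivAt_log hX.ne').mul
    (hasDerivAt_FF h1))).div_const 2).congr_deriv ?_
  simp [nn1]

lemma hasDerivAt_nn1 {X : ℝ} (hX : 0 < X) : HasDerivAt nn1 (nn2 X) X := by
  have h1 : -1 < X := by linarith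
  have hinv : HasDerivAt (fun y : ℝ => 1 / y) (-1 / X ^ 2) X := by
    simpa [neg_div] using hasDerivAt_inv hX.ne'
  refine (((hasDerivAt_MM1 h1).sub ((hinv.mul (hasDerivAt_FF h1)).add
    ((hasDerivAt_log hX.ne').mul (hasDerivAt_FF1 h1)))).div_const 2).congr_deriv ?_
  simp [nn2]

lemma ode_nn {X : ℝ} (hX : 0 < X) : pp X * nn2 X + pp1 X * nn1 X + (X + 3) * nn X = -1 / 2 := by
  have h1 : -1 < X := by linarith
  have hM := ode_MM h1
  have hF := ode_FF h1
  have e1 : pp X * (-1 / X ^ 2 * FF X + 1 / X * FF1 X + 1 / X * FF1 X) + pp1 X * (1 / X * FF X) =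
      2 * (X + 1) * (X + 9) * FF1 X + (2 * X + 10) * FF X := by
    unfold pp pp1; field_simp; ring
  unfold nn nn1 nn2
  linear_combination hM / 2 - log X / 2 * hF - e1 / 2

noncomputable def hh (X : ℝ) : ℝ := GG X + 3 * nn X
noncomputable def hh1 (X : ℝ) : ℝ := GG1 X + 3 * nn1 X

lemma isSol_hh : IsSol hh hh1 :=
  isSol_of_deriv (U₂ := fun X => GG2 X + 3 * nn2 X)
    (fun _ hX => (hasDerivAt_GG (by linarith)).add ((hasDerivAt_nn hX).const_mul 3))
    (fun _ hX => (hasDerivAt_GG1 (by linarith)).add ((hasDerivAt_nn1 hX).const_mul 3))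
    fun X hX => by
      have h1 := ode_GG hX
      have h2 := ode_nn hX
      unfold hh hh1
      linarith

lemma tendsto_id_zero : Tendsto (fun X : ℝ => X) (𝓝[>] 0) (𝓝 0) :=
  tendsto_id.mono_left nhdsWithin_le_nhds

lemma tendsto_mul_log : Tendsto (fun X : ℝ => X * log X) (𝓝[>] 0) (𝓝 0) := by
  have := (continuous_mul_log.tendsto 0).mono_left (nhdsWithin_le_nhds (s := Ioi 0))
  simpa using this

lemma tendsto_zero_of_hasDerivAt {f : ℝ → ℝ} {f' : ℝ} (h : HasDerivAt f f' 0) :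
    Tendsto f (𝓝[>] 0) (𝓝 (f 0)) :=
  h.continuousAt.tendsto.mono_left nhdsWithin_le_nhds

lemma tendsto_FF_zero : Tendsto FF (𝓝[>] 0) (𝓝 (FF 0)) :=
  tendsto_zero_of_hasDerivAt (hasDerivAt_FF (by norm_num))
lemma tendsto_FF1_zero : Tendsto FF1 (𝓝[>] 0) (𝓝 (FF1 0)) :=
  tendsto_zero_of_hasDerivAt (hasDerivAt_FF1 (by norm_num))

lemma tendsto_mul_nn : Tendsto (fun X => X * nn X) (𝓝[>] 0) (𝓝 0) := by
  have h := ((tendsto_id_zero.mul (tendsto_zero_of_hasDerivAt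
    (hasDerivAt_MM (by norm_num : (-1 : ℝ) < 0)))).sub (tendsto_mul_log.mul tendsto_FF_zero)).div_const 2
  simp only [zero_mul, sub_zero, zero_div] at h
  refine h.congr fun X => ?_
  unfold nn; ring

lemma tendsto_mul_nn1 : Tendsto (fun X => X * nn1 X) (𝓝[>] 0) (𝓝 (-FF 0 / 2)) := by
  have h := ((tendsto_id_zero.mul (tendsto_zero_of_hasDerivAt
    (hasDerivAt_MM1 (by norm_num : (-1 : ℝ) < 0)))).sub (tendsto_FF_zero.add
      (tendsto_mul_log.mul tendsto_FF1_zero))).div_const 2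
  simp only [zero_mul, add_zero, zero_sub] at h
  refine h.congr' ?_
  filter_upwards [self_mem_nhdsWithin] with X hX
  have : X ≠ 0 := (show (0:ℝ) < X from hX).ne'
  unfold nn1; field_simp

lemma tendsto_pp_div : Tendsto (fun X => (X + 1) * (X + 9)) (𝓝[>] (0 : ℝ)) (𝓝 9) := by
  have := ((tendsto_id_zero.add_const 1).mul (tendsto_id_zero.add_const 9))
  simpa using this

lemma wronskian_hh_FF {X : ℝ} (hX : 0 < X) :
    pp X * (hh X * FF1 X - hh1 X * FF X) = 27 / 2 * FF 0 ^ 2 := by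
  refine isSol_hh.wronskian_eq isSol_FF ?_ hX
  have hG := tendsto_id_zero.mul (tendsto_zero_of_hasDerivAt (hasDerivAt_GG (by norm_num : (-1 : ℝ) < 0)))
  have hG1 := tendsto_id_zero.mul (tendsto_zero_of_hasDerivAt (hasDerivAt_GG1 (by norm_num : (-1 : ℝ) < 0)))
  have h := tendsto_pp_div.mul (((hG.add (tendsto_mul_nn.const_mul 3)).mul tendsto_FF1_zero).sub
    ((hG1.add (tendsto_mul_nn1.const_mul 3)).mul tendsto_FF_zero))
  convert h.congr fun X => ?_ using 2
  · ring
  · unfold pp hh hh1; ring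

lemma tendsto_nine_div : Tendsto (fun X : ℝ => 9 / X) (𝓝[>] 0) atTop :=
  (tendsto_inv_nhdsGT_zero.const_mul_atTop (by norm_num : (0 : ℝ) < 9)).congr fun X => by
    rw [div_eq_mul_inv]

lemma tendsto_mul_ss : Tendsto (fun X => X * ss X) (𝓝[>] 0) (𝓝 0) := by
  have h := (tendsto_FF.comp tendsto_nine_div).const_mul 3
  rw [mul_zero] at h
  refine h.congr' ?_
  filter_upwards [self_mem_nhdsWithin] with X hX
  have : X ≠ 0 := (show (0:ℝ) < X from hX).ne'
  simp only [ss, Function.comp]; field_simp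

lemma tendsto_mul_ss1 : Tendsto (fun X => X * ss1 X) (𝓝[>] 0) (𝓝 (-(1 / 3))) := by
  have h := (tendsto_mul_FF_add.comp tendsto_nine_div).const_mul (-(1 / 3))
  rw [mul_one] at h
  refine h.congr' ?_
  filter_upwards [self_mem_nhdsWithin] with X hX
  have : X ≠ 0 := (show (0:ℝ) < X from hX).ne'
  simp only [ss1, Function.comp]; field_simp; ring

lemma wronskian_ss_FF {X : ℝ} (hX : 0 < X) :
    pp X * (ss X * FF1 X - ss1 X * FF X) = 3 * FF 0 := by
  refine isSol_ss.wronskian_eq isSol_FF ?_ hX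
  have h := tendsto_pp_div.mul ((tendsto_mul_ss.mul tendsto_FF1_zero).sub
    (tendsto_mul_ss1.mul tendsto_FF_zero))
  convert h.congr fun X => ?_ using 2
  · ring
  · unfold pp; ring

lemma FF_zero_pos : 0 < FF 0 := FF_pos (by norm_num)

/-- The three Wronskians force a linear relation between the solutions. -/
lemma exists_hh_eq : ∃ c, ∀ X, 0 < X → hh X = 9 / 2 * FF 0 * ss X + c * FF X ∧
    hh1 X = 9 / 2 * FF 0 * ss1 X + c * FF1 X := by
  obtain ⟨k, hk⟩ := isSol_hh.wronskian isSol_ss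
  have h0 := FF_zero_pos
  refine ⟨-k / (3 * FF 0), fun X hX => ?_⟩
  have h1 := wronskian_hh_FF hX
  have h2 := wronskian_ss_FF hX
  have h3 := hk X hX
  constructor
  · field_simp
    linear_combination (-2 * hh X) * h2 - 2 * FF X * h3 + 2 * ss X * h1
  · field_simp
    linear_combination (-2 * hh1 X) * h2 - 2 * FF1 X * h3 + 2 * ss1 X * h1

/-- `log(1 + X e^{-s})`. -/
noncomputable def rr (X s : ℝ) : ℝ := log (X + exp s) - s

lemma rr_nonneg {X : ℝ} (hX : 0 < X) (s : ℝ) : 0 ≤ rr X s := by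
  unfold rr
  have : s ≤ log (X + exp s) := by
    rw [le_log_iff_exp_le (by positivity)]; linarith
  linarith

lemma rr_le {X : ℝ} (hX : 0 < X) (s : ℝ) : rr X s ≤ X * exp (-s) := by
  unfold rr
  have h : X + exp s = exp s * (1 + X * exp (-s)) := by
    rw [mul_add, mul_left_comm, ← exp_add]; simp; ring
  rw [h, log_mul (by positivity) (by positivity), log_exp]
  have := log_le_sub_one_of_pos (x := 1 + X * exp (-s)) (by positivity)
  linarith

lemma continuous_rr {X : ℝ} (hX : 0 < X) : Continuous (rr X) := by
  unfold rr
  exact (Continuous.log (by fun_prop) fun s => by positivity).sub continuous_id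

lemma hasDerivAt_rr {X : ℝ} (hX : 0 < X) (s : ℝ) :
    HasDerivAt (rr X) (-(X / (X + exp s))) s := by
  have hne : X + exp s ≠ 0 := by positivity
  refine ((((Real.hasDerivAt_exp s).const_add X).log hne).sub (hasDerivAt_id s)).congr_deriv ?_
  field_simp; ring

lemma integrableOn_rr {X : ℝ} (hX : 0 < X) : IntegrableOn (rr X) (Ioi 0) :=
  integrableOn_of_bound (C := X) (continuous_rr hX) fun s hs => by
    rw [abs_of_nonneg (rr_nonneg hX s)]
    refine (rr_le hX s).trans ?_
    gcongr; linarith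

lemma abs_integral_rr_sub_le {X : ℝ} (hX : 1 ≤ X) :
    |(∫ s in Ioi (0 : ℝ), rr X s) - log X ^ 2 / 2| ≤ 2 := by
  have hX0 : 0 < X := by linarith
  set L := log X with hL
  have hL0 : 0 ≤ L := log_nonneg hX
  have hLX : exp L = X := exp_log hX0
  rw [← intervalIntegral.integral_interval_add_Ioi (integrableOn_rr hX0)
    ((integrableOn_rr hX0).mono_set (Ioi_subset_Ioi hL0))]
  have e1 : (∫ s in (0 : ℝ)..L, (L - s)) = L ^ 2 / 2 := by
    rw [intervalIntegral.integral_sub (by simp) (by simp)]; simp; ring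
  have e2 : (∫ s in (0 : ℝ)..L, exp (s - L)) ≤ 1 := by
    rw [intervalIntegral.integral_comp_sub_right (fun s => exp s)]
    simp; positivity
  have e3 : (∫ s in Ioi L, X * exp (-s)) = 1 := by
    rw [integral_const_mul, integral_exp_neg_Ioi, exp_neg, hLX, mul_inv_cancel₀ hX0.ne']
  have c1 : IntervalIntegrable (rr X) volume 0 L := (continuous_rr hX0).intervalIntegrable _ _
  have c2 : IntervalIntegrable (fun s => L - s) volume 0 L :=
    Continuous.intervalIntegrable (by fun_prop) _ _
  have c3 : IntervalIntegrable (fun s => exp (s - L)) volume 0 L :=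
    Continuous.intervalIntegrable (by fun_prop) _ _
  have hr : ∀ s, L - s ≤ rr X s ∧ rr X s ≤ (L - s) + exp (s - L) := by
    intro s
    unfold rr
    have h : X + exp s = X * (1 + exp (s - L)) := by
      rw [exp_sub, hLX]; field_simp
    rw [h, log_mul (by positivity) (by positivity), ← hL]
    have h1 := log_le_sub_one_of_pos (x := 1 + exp (s - L)) (by positivity)
    have h2 := log_nonneg (x := 1 + exp (s - L)) (by linarith [exp_pos (s - L)])
    constructor <;> linarith
  have b1 : (∫ s in (0 : ℝ)..L, (L - s)) ≤ ∫ s in (0 : ℝ)..L, rr X s :=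
    intervalIntegral.integral_mono hL0 c2 c1 fun s => (hr s).1
  have b2 : (∫ s in (0 : ℝ)..L, rr X s) ≤ ∫ s in (0 : ℝ)..L, ((L - s) + exp (s - L)) :=
    intervalIntegral.integral_mono hL0 c1 (c2.add c3) fun s => (hr s).2
  rw [intervalIntegral.integral_add c2 c3] at b2
  have b3 : 0 ≤ ∫ s in Ioi L, rr X s := integral_nonneg fun s => rr_nonneg hX0 s
  have b4 : (∫ s in Ioi L, rr X s) ≤ ∫ s in Ioi L, X * exp (-s) :=
    integral_mono ((integrableOn_rr hX0).mono_set (Ioi_subset_Ioi hL0))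
      ((integrableOn_exp_neg_Ioi L).const_mul X) fun s => rr_le hX0 s
  rw [abs_le]
  constructor <;> linarith

lemma tendsto_mul_rr {X : ℝ} (hX : 0 < X) : Tendsto (fun s => s * rr X s) atTop (𝓝 0) := by
  have h := (tendsto_pow_mul_exp_neg_atTop_nhds_zero 1).const_mul X
  rw [mul_zero] at h
  refine squeeze_zero' ?_ ?_ h
  · filter_upwards [eventually_ge_atTop 0] with s hs using mul_nonneg hs (rr_nonneg hX s)
  · filter_upwards [eventually_ge_atTop 0] with s hs
    have := mul_le_mul_of_nonneg_left (rr_le hX s) hs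
    linarith

lemma tendsto_rr {X : ℝ} (hX : 0 < X) : Tendsto (rr X) atTop (𝓝 0) := by
  have h := tendsto_exp_neg_atTop_nhds_zero.const_mul X
  rw [mul_zero] at h
  exact squeeze_zero (fun s => rr_nonneg hX s) (fun s => rr_le hX s) h

/-- The leading part of the integrand of `X (G + 3 n)`. -/
noncomputable def lead (X s : ℝ) : ℝ := X * (rr X s + 2 * s - 3 / 2 * log X) / (X + exp s)

lemma abs_integral_lead_le {X : ℝ} (hX : 1 ≤ X) (hi : IntegrableOn (lead X) (Ioi 0)) :
    |∫ s in Ioi (0 : ℝ), lead X s| ≤ 8 := by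
  have hX0 : 0 < X := by linarith
  have hd : ∀ s ∈ Ici (0 : ℝ), HasDerivAt (fun s => -(rr X s ^ 2 / 2) + 3 / 2 * log X * rr X s -
      2 * (s * rr X s)) (lead X s - 2 * rr X s) s := by
    intro s _
    have h := hasDerivAt_rr hX0 s
    refine ((((h.fun_pow 2).div_const 2).neg.add (h.const_mul (3 / 2 * log X))).sub
      (((hasDerivAt_id s).mul h).const_mul 2)).congr_deriv ?_
    unfold lead
    simp only [id]
    have hne : X + exp s ≠ 0 := by positivity
    field_simp
    simp; ring
  have hlim := ((((tendsto_rr hX0).pow 2).div_const 2).neg.add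
    ((tendsto_rr hX0).const_mul (3 / 2 * log X))).sub ((tendsto_mul_rr hX0).const_mul 2)
  have h := integral_Ioi_of_hasDerivAt_of_tendsto' hd
    (hi.sub ((integrableOn_rr hX0).const_mul 2)) hlim
  rw [integral_sub hi ((integrableOn_rr hX0).const_mul 2), integral_const_mul] at h
  have hr := abs_integral_rr_sub_le hX
  set L := log X with hL
  have hL0 : 0 ≤ L := log_nonneg hX
  have h1 : L ≤ rr X 0 := by
    unfold rr; simp only [sub_zero]; exact log_le_log hX0 (by simp)
  have h2 : rr X 0 ≤ L + 1 / X := by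
    unfold rr
    rw [exp_zero, sub_zero, show X + 1 = X * (1 + 1 / X) by field_simp,
      log_mul (by positivity) (by positivity), ← hL]
    have := log_le_sub_one_of_pos (x := 1 + 1 / X) (by positivity)
    linarith
  have h3 : L ≤ X := (log_le_sub_one_of_pos hX0).trans (by linarith)
  have h4 : L * (1 / X) ≤ 1 := by rw [mul_one_div, div_le_one hX0]; exact h3
  have h5 : 1 / X ≤ 1 := by rw [div_le_one hX0]; exact hX
  obtain ⟨e, he⟩ : ∃ e, e = rr X 0 - L := ⟨_, rfl⟩
  have he0 : 0 ≤ e := by linarith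
  have he1 : e ≤ 1 / X := by linarith
  have he2 : L * e ≤ 1 := (mul_le_mul_of_nonneg_left he1 hL0).trans h4
  have he3 : 0 ≤ L * e := by positivity
  have he4 : e ^ 2 ≤ 1 := by nlinarith
  rw [show rr X 0 = L + e by linarith] at h
  rw [abs_le] at hr ⊢
  constructor <;> nlinarith

noncomputable def hn (X t : ℝ) : ℝ := X * (log t - log X) / (t + X)

lemma integrable_hn {X : ℝ} (hX : 0 < X) : Integrable (hn X) mF ∧ ∫ t, hn X t ∂mF = 2 * X * nn X := by
  have j1 : Integrable (fun t => log t / (t + X)) mF := by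
    simpa using integrable_stieltjes (𝕜 := ℝ) (z := X) one_le_mF aesm_log integrable_log_div_mF
      (by simp; linarith) 0
  have j2 := integrable_inv_add_mF (X := X) (by linarith)
  have e : hn X = fun t => X * (log t / (t + X)) - X * log X * (1 / (t + X)) := by
    ext t; unfold hn; ring
  refine ⟨by rw [e]; exact (j1.const_mul X).sub (j2.const_mul _), ?_⟩
  rw [e, integral_sub (j1.const_mul X) (j2.const_mul _), integral_const_mul, integral_const_mul,
    ← FF_def]
  have : MM X = ∫ t, log t / (t + X) ∂mF := by simp [MM, stieltjes]
  rw [← this, nn]; ring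

lemma abs_mul_nn_sub_le {X : ℝ} (hX : 0 < X) :
    IntegrableOn (fun s => hn X (exp s)) (Ioi 0) ∧
    |2 * X * nn X - ∫ s in Ioi (0 : ℝ), hn X (exp s)| ≤ 128 := by
  have hd : ∀ t, 0 < t → HasDerivAt (hn X)
      ((X * t⁻¹ * (t + X) - X * (log t - log X)) / (t + X) ^ 2) t := by
    intro t ht
    refine ((((hasDerivAt_log ht.ne').sub_const (log X)).const_mul X).div
      ((hasDerivAt_id t).add_const X) (by simp; positivity)).congr_deriv ?_
    simp
  have hb : ∀ t, 0 < t →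
      |(X * t⁻¹ * (t + X) - X * (log t - log X)) / (t + X) ^ 2| ≤ 2 / t := by
    intro t ht
    rw [abs_div, abs_of_pos (a := (t + X) ^ 2) (by positivity), div_le_div_iff₀ (by positivity) ht]
    have h1 : log t - log X ≤ t / X := by
      rw [← log_div ht.ne' hX.ne']
      exact (log_le_sub_one_of_pos (by positivity)).trans (by linarith)
    have h2 : log X - log t ≤ X / t := by
      rw [← log_div hX.ne' ht.ne']
      exact (log_le_sub_one_of_pos (by positivity)).trans (by linarith)
    have h3 : X * t * (log t - log X) ≤ t ^ 2 := by
      calc _ ≤ X * t * (t / X) := by gcongr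
        _ = _ := by field_simp
    have h4 : X * t * (log X - log t) ≤ X ^ 2 := by
      calc _ ≤ X * t * (X / t) := by gcongr
        _ = _ := by field_simp
    rw [← abs_of_pos ht, ← abs_mul, abs_of_pos ht]
    have e : (X * t⁻¹ * (t + X) - X * (log t - log X)) * t =
      X * (t + X) - X * t * (log t - log X) := by field_simp
    have hXt : 0 < X * t := by positivity
    rw [e, abs_le]
    constructor <;> nlinarith
  have hm : Measurable (hn X) := by
    unfold hn
    exact (measurable_const.mul (measurable_log.sub_const _)).div (measurable_id.add_const X)
  have h := integrable_hn hX
  refine ⟨(integral_mF_sub hd hb hm h.1).1, ?_⟩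
  have := abs_integral_mF_sub_le hd hb hm h.1
  rw [h.2] at this
  linarith

noncomputable def hg (X s : ℝ) : ℝ := X * (rr X s + s / 2) / (X + exp s)

lemma abs_AA_sub_le {X : ℝ} (hX : 1 ≤ X) {s : ℝ} (hs : 0 < s) :
    |AA X s - (rr X s + s / 2)| ≤ 5 * exp (-s) := by
  have hX0 : 0 < X := by linarith
  have hd : dd s = exp (s / 2) * (1 + exp (-s)) := by
    have h1 := dd_sq s
    have h2 : 0 < dd s := by linarith [two_le_dd s]
    rw [← sq_eq_sq₀ h2.le (by positivity), h1, mul_pow, ← exp_nat_mul, cosh_eq]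
    push_cast
    rw [show (2 : ℝ) * (s / 2) = s by ring, add_sq, ← exp_nat_mul]
    push_cast
    rw [mul_add, mul_add, mul_one, ← exp_add, mul_left_comm, ← exp_add]
    ring_nf
    simp; ring
  have hc : 2 * cosh s = exp s + exp (-s) := by rw [cosh_eq]; ring
  have he : exp (-s) ≤ 1 := exp_le_one_iff.2 (by linarith)
  have hQ1 := QQ_ge hX0.le s
  have hQ2 := QQ_le hX0.le s
  have ha : aa X s = X + 3 + exp s + exp (-s) := by unfold aa; rw [hc]; ring
  have hpos := exp_pos (-s)
  have hes := exp_pos s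
  obtain ⟨δ, hδ⟩ : ∃ δ, δ = ((aa X s + QQ X s) / 2 - (X + exp s)) / (X + exp s) := ⟨_, rfl⟩
  have hδ0 : 0 ≤ δ := by rw [hδ]; apply div_nonneg <;> linarith
  have hδ1 : δ ≤ 4 * exp (-s) := by
    rw [hδ, div_le_iff₀ (by positivity)]
    have : exp (-s) * exp s = 1 := by rw [← exp_add]; simp
    nlinarith
  have hA : AA X s = log (X + exp s) + log (1 + δ) - s / 2 -
      log (1 + exp (-s)) := by
    have e : (aa X s + QQ X s) / (2 * dd s) = ((X + exp s) * (1 + δ)) /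
        (exp (s / 2) * (1 + exp (-s))) := by
      rw [hδ, hd]; field_simp; ring
    unfold AA
    rw [e, log_div (by positivity) (by positivity), log_mul (by positivity) (by positivity),
      log_mul (by positivity) (by positivity), log_exp]
    ring
  have l1 := log_le_sub_one_of_pos (x := 1 + δ) (by positivity)
  have l2 := log_nonneg (x := 1 + δ) (by linarith)
  have l3 := log_le_sub_one_of_pos (x := 1 + exp (-s)) (by positivity)
  have l4 := log_nonneg (x := 1 + exp (-s)) (by linarith)
  rw [hA, rr, abs_le]
  constructor <;> linarith

lemma abs_AA_div_QQ_sub_le {X : ℝ} (hX : 1 ≤ X) {s : ℝ} (hs : 0 < s) :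
    |X * (AA X s * (1 / QQ X s)) - hg X s| ≤ 13 * exp (-(s / 2)) := by
  have hX0 : 0 < X := by linarith
  have hA := abs_AA_sub_le hX hs
  have hQ1 := QQ_ge hX0.le s
  have hQ2 := QQ_le hX0.le s
  have hQ := QQ_pos hX0.le s
  have hc : 2 * cosh s = exp s + exp (-s) := by rw [cosh_eq]; ring
  have he : exp (-s) ≤ 1 := exp_le_one_iff.2 (by linarith)
  have hes := exp_pos s
  have hems := exp_pos (-s)
  have ha : aa X s = X + 3 + exp s + exp (-s) := by unfold aa; rw [hc]; ring
  have hr0 : 0 ≤ rr X s + s / 2 := by have := rr_nonneg hX0 s; linarith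
  obtain ⟨E, hE⟩ : ∃ E, E = X + exp s := ⟨_, rfl⟩
  have hE0 : 0 < E := by rw [hE]; positivity
  have hr1 : rr X s + s / 2 ≤ 2 * sqrt E := by
    have h1 : log E = 2 * log (sqrt E) := by
      rw [log_sqrt hE0.le]; ring
    have h2 := log_le_sub_one_of_pos (x := sqrt E) (by positivity)
    unfold rr; rw [← hE]; linarith
  have hsq : exp (s / 2) ≤ sqrt E := by
    apply le_sqrt_of_sq_le
    rw [← exp_nat_mul, hE]; push_cast
    rw [show (2 : ℝ) * (s / 2) = s by ring]; linarith
  have t1 : |X * ((AA X s - (rr X s + s / 2)) * (1 / QQ X s))| ≤ 5 * exp (-(s / 2)) := by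
    rw [show X * ((AA X s - (rr X s + s / 2)) * (1 / QQ X s)) =
      (X / QQ X s) * (AA X s - (rr X s + s / 2)) by ring, abs_mul, abs_of_pos (by positivity)]
    have h1 : X / QQ X s ≤ 1 := by rw [div_le_one hQ]; linarith
    have h2 : exp (-s) ≤ exp (-(s / 2)) := exp_le_exp.2 (by linarith)
    calc _ ≤ 1 * (5 * exp (-s)) := by gcongr
      _ ≤ _ := by linarith
  have t2 : |X * ((rr X s + s / 2) * (1 / QQ X s - 1 / E))| ≤ 8 * exp (-(s / 2)) := by
    rw [show X * ((rr X s + s / 2) * (1 / QQ X s - 1 / E)) =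
      (X / QQ X s) * (rr X s + s / 2) * (E - QQ X s) * (1 / E) by field_simp, abs_mul, abs_mul, abs_mul,
      abs_of_pos (a := X / QQ X s) (by positivity), abs_of_pos (a := 1 / E) (by positivity),
      abs_of_nonneg hr0]
    have h1 : X / QQ X s ≤ 1 := by rw [div_le_one hQ]; linarith
    have h2 : |E - QQ X s| ≤ 4 := by rw [abs_le]; constructor <;> linarith
    calc _ ≤ 1 * (2 * sqrt E) * 4 * (1 / E) := by gcongr
      _ = 8 * (1 / sqrt E) := by
        have := sq_sqrt hE0.le
        have h3 : 0 < sqrt E := by positivity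
        field_simp; nlinarith
      _ ≤ 8 * (1 / exp (s / 2)) := by gcongr
      _ = _ := by rw [exp_neg, one_div]
  have e : X * (AA X s * (1 / QQ X s)) - hg X s = X * ((AA X s - (rr X s + s / 2)) * (1 / QQ X s)) +
      X * ((rr X s + s / 2) * (1 / QQ X s - 1 / E)) := by
    unfold hg; rw [← hE]; ring
  rw [e]
  refine (abs_add_le _ _).trans ?_
  linarith

lemma exists_abs_mul_hh_le : ∃ C, ∀ X, 1 ≤ X → |X * hh X| ≤ C := by
  refine ⟨13 * (∫ s in Ioi (0 : ℝ), exp (-(s / 2))) + 192 + 8, fun X hX => ?_⟩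
  have hX0 : 0 < X := by linarith
  obtain ⟨i1, b1⟩ := abs_mul_nn_sub_le hX0
  have i2 := (integrableOn_AA_div_QQ hX0).const_mul X
  have i3 : IntegrableOn (fun s => X * (AA X s * (1 / QQ X s)) - hg X s) (Ioi 0) := by
    refine integrableOn_of_bound (C := 13) ?_ fun s hs => abs_AA_div_QQ_sub_le hX hs
    refine (continuous_const.mul ((continuous_AA hX0).mul (continuous_inv_QQ hX0))).sub ?_
    unfold hg
    exact (continuous_const.mul ((continuous_rr hX0).add (by fun_prop))).div (by fun_prop)
      fun s => by positivity
  have i4 : IntegrableOn (hg X) (Ioi 0) :=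
    (i2.sub i3).congr (Eventually.of_forall fun s => by simp)
  have hl : ∀ s, lead X s = hg X s + 3 / 2 * hn X (exp s) := by
    intro s; unfold lead hg hn; rw [log_exp, add_comm (exp s) X]; ring
  have i5 : IntegrableOn (lead X) (Ioi 0) :=
    (i4.add (i1.const_mul (3 / 2))).congr (Eventually.of_forall fun s => (hl s).symm)
  have b5 := abs_integral_lead_le hX i5
  have e5 : (∫ s in Ioi (0 : ℝ), lead X s) = (∫ s in Ioi (0 : ℝ), hg X s) +
      3 / 2 * ∫ s in Ioi (0 : ℝ), hn X (exp s) := by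
    rw [← integral_const_mul, ← integral_add i4 (i1.const_mul (3 / 2))]
    exact integral_congr_ae (Eventually.of_forall hl)
  have b3 : |X * GG X - ∫ s in Ioi (0 : ℝ), hg X s| ≤
      13 * ∫ s in Ioi (0 : ℝ), exp (-(s / 2)) := by
    rw [GG_eq' hX0.le, ← integral_const_mul, ← integral_sub i2 i4, ← norm_eq_abs,
      ← integral_const_mul]
    refine norm_integral_le_of_norm_le (integrableOn_exp_neg_half.const_mul 13) ?_
    filter_upwards [ae_restrict_mem measurableSet_Ioi] with s hs using abs_AA_div_QQ_sub_le hX hs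
  rw [e5] at b5
  rw [abs_le] at *
  unfold hh
  constructor <;> linarith

lemma tendsto_mul_FF : Tendsto (fun X => X * FF X) atTop atTop := by
  have h : ∀ X, 1 ≤ X → log X / 7 ≤ X * FF X := by
    intro X hX
    have hX0 : 0 < X := by linarith
    have hL := log_nonneg hX
    rw [FF_eq hX0.le, ← integral_const_mul]
    have hi : IntegrableOn (fun s => X * (1 / QQ X s)) (Ioi 0) :=
      (integrableOn_inv_QQ hX0).const_mul X
    have hsub : Ioc 0 (log X) ⊆ Ioi (0 : ℝ) := Ioc_subset_Ioi_self
    calc log X / 7 = ∫ s in Ioc 0 (log X), (1 / 7 : ℝ) := by simp [hL]; ring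
      _ ≤ ∫ s in Ioc 0 (log X), X * (1 / QQ X s) := by
        refine setIntegral_mono_on (by simp) (hi.mono_set hsub) measurableSet_Ioc fun s hs => ?_
        have h1 := QQ_le hX0.le s
        have h2 : exp s ≤ X := (le_log_iff_exp_le hX0).1 hs.2
        have h3 : exp (-s) ≤ 1 := exp_le_one_iff.2 (by linarith [hs.1])
        have hQ := QQ_pos hX0.le s
        have hc : 2 * cosh s = exp s + exp (-s) := by rw [cosh_eq]; ring
        rw [mul_one_div, le_div_iff₀ hQ]
        unfold aa at h1
        linarith
      _ ≤ _ := setIntegral_mono_set hi (by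
          filter_upwards with s using by have := QQ_pos hX0.le s; positivity) hsub.eventuallyLE
  refine tendsto_atTop_mono' _ ?_ (tendsto_log_atTop.atTop_div_const (by norm_num : (0 : ℝ) < 7))
  filter_upwards [eventually_ge_atTop 1] with X hX using h X hX

lemma tendsto_mul_ss_atTop : Tendsto (fun X => X * ss X) atTop (𝓝 (3 * FF 0)) := by
  have h0 : Tendsto (fun X : ℝ => 9 / X) atTop (𝓝 0) := tendsto_id.const_div_atTop 9
  have h := ((hasDerivAt_FF (by norm_num : (-1 : ℝ) < 0)).continuousAt.tendsto.comp h0).const_mul 3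
  refine h.congr' ?_
  filter_upwards [eventually_gt_atTop 0] with X hX
  simp only [ss, Function.comp]; field_simp

/-- `G + 3 n` is a multiple of `s`. -/
lemma hh_eq {X : ℝ} (hX : 0 < X) : GG X + 3 * nn X = 9 / 2 * FF 0 * ss X ∧
    GG1 X + 3 * nn1 X = 9 / 2 * FF 0 * ss1 X := by
  obtain ⟨c, hc⟩ := exists_hh_eq
  have hc0 : c = 0 := by
    obtain ⟨C, hC⟩ := exists_abs_mul_hh_le
    by_contra hne
    have h1 : Tendsto (fun X => |c| * (X * FF X)) atTop atTop :=
      tendsto_mul_FF.const_mul_atTop (abs_pos.2 hne)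
    have h2 : Tendsto (fun X => C + |9 / 2 * FF 0 * (X * ss X)|) atTop
        (𝓝 (C + |9 / 2 * FF 0 * (3 * FF 0)|)) :=
      ((tendsto_mul_ss_atTop.const_mul _).abs).const_add C
    have h3 : Tendsto (fun X => C + |9 / 2 * FF 0 * (X * ss X)|) atTop atTop := by
      refine tendsto_atTop_mono' _ ?_ h1
      filter_upwards [eventually_ge_atTop 1] with X hX
      have hF : 0 < FF X := FF_pos (by linarith)
      have e := (hc X (by linarith)).1
      have : c * (X * FF X) = X * hh X - 9 / 2 * FF 0 * (X * ss X) := by rw [e]; ring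
      calc |c| * (X * FF X) = |c * (X * FF X)| := by
            rw [abs_mul, abs_of_pos (a := X * FF X) (by positivity)]
        _ ≤ |X * hh X| + |9 / 2 * FF 0 * (X * ss X)| := by rw [this]; exact abs_sub _ _
        _ ≤ _ := by gcongr; exact hC X hX
    exact not_tendsto_nhds_of_tendsto_atTop h3 _ h2
  have := hc X hX
  rw [hc0] at this
  simpa [hh, hh1] using this

/-- A convenient integrable majorant on `(0, ∞)`. -/
noncomputable def ww (X : ℝ) : ℝ := X ^ (-(1 / 4) : ℝ) * (1 + X)⁻¹

lemma integrableOn_ww : IntegrableOn ww (Ioi 0) := by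
  rw [← Ioc_union_Ioi_eq_Ioi (zero_le_one' ℝ)]
  have hm : Measurable ww := by
    unfold ww
    exact (measurable_id.pow_const _).mul (measurable_id.const_add 1).inv
  refine IntegrableOn.union ?_ ?_
  · have h1 : IntegrableOn (fun X : ℝ => X ^ (-(1 / 4) : ℝ)) (Ioc 0 1) :=
      (intervalIntegrable_iff_integrableOn_Ioc_of_le zero_le_one).1
        (intervalIntegral.intervalIntegrable_rpow' (by norm_num))
    refine h1.mono' hm.aestronglyMeasurable ?_
    filter_upwards [ae_restrict_mem measurableSet_Ioc] with X hX
    have h0 : 0 < X := hX.1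
    unfold ww
    rw [norm_eq_abs, abs_of_nonneg (by positivity)]
    exact mul_le_of_le_one_right (by positivity) (inv_le_one_of_one_le₀ (by linarith))
  · have h1 : IntegrableOn (fun X : ℝ => X ^ (-(5 / 4) : ℝ)) (Ioi 1) :=
      integrableOn_Ioi_rpow_of_lt (by norm_num) one_pos
    refine h1.mono' hm.aestronglyMeasurable ?_
    filter_upwards [ae_restrict_mem measurableSet_Ioi] with X hX
    have h0 : 0 < X := lt_trans one_pos hX
    unfold ww
    rw [norm_eq_abs, abs_of_nonneg (by positivity)]
    calc X ^ (-(1 / 4) : ℝ) * (1 + X)⁻¹ ≤ X ^ (-(1 / 4) : ℝ) * X ^ (-1 : ℝ) := by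
          rw [rpow_neg_one]; gcongr; linarith
      _ = _ := by rw [← rpow_add h0]; norm_num

lemma rpow_le_ww {X : ℝ} (hX : 0 < X) : (1 + X) ^ (-(3 / 2) : ℝ) ≤ ww X := by
  unfold ww
  have h1 : (1 + X) ^ (-(1 / 4) : ℝ) ≤ X ^ (-(1 / 4) : ℝ) :=
    rpow_le_rpow_of_nonpos hX (by linarith) (by norm_num)
  calc (1 + X) ^ (-(3 / 2) : ℝ) ≤ (1 + X) ^ (-(1 / 4) + -1 : ℝ) :=
        rpow_le_rpow_of_exponent_le (by linarith) (by norm_num)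
    _ = (1 + X) ^ (-(1 / 4) : ℝ) * (1 + X)⁻¹ := by
        rw [rpow_add (by linarith), rpow_neg_one]
    _ ≤ _ := by gcongr

lemma abs_log_mul_le_ww {X : ℝ} (hX : 0 < X) :
    |log X| * (1 + X) ^ (-(3 / 2) : ℝ) ≤ 4 * ww X := by
  have h : |log X| ≤ 4 * (X ^ (-(1 / 4) : ℝ) * (1 + X) ^ (1 / 2 : ℝ)) := by
    rcases le_total 1 X with h1 | h1
    · rw [abs_of_nonneg (log_nonneg h1)]
      calc log X ≤ X ^ (1 / 4 : ℝ) / (1 / 4) := log_le_rpow_div hX.le (by norm_num)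
        _ = 4 * X ^ (-(1 / 4) + 1 / 2 : ℝ) := by norm_num; ring
        _ = 4 * (X ^ (-(1 / 4) : ℝ) * X ^ (1 / 2 : ℝ)) := by rw [rpow_add hX]
        _ ≤ _ := by gcongr; linarith
    · rw [abs_of_nonpos (log_nonpos hX.le h1), ← log_inv]
      calc log X⁻¹ ≤ X⁻¹ ^ (1 / 4 : ℝ) / (1 / 4) :=
            log_le_rpow_div (by positivity) (by norm_num)
        _ = 4 * (X ^ (-(1 / 4) : ℝ) * 1) := by
          rw [inv_rpow hX.le, rpow_neg hX.le]; ring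
        _ ≤ _ := by
          gcongr; exact one_le_rpow (by linarith) (by norm_num)
  calc _ ≤ 4 * (X ^ (-(1 / 4) : ℝ) * (1 + X) ^ (1 / 2 : ℝ)) * (1 + X) ^ (-(3 / 2) : ℝ) := by gcongr
    _ = 4 * (X ^ (-(1 / 4) : ℝ) * ((1 + X) ^ (1 / 2 : ℝ) * (1 + X) ^ (-(3 / 2) : ℝ))) := by ring
    _ = _ := by
      rw [← rpow_add (by linarith), ww, ← rpow_neg_one]; norm_num

lemma image_const_div {c : ℝ} (hc : 0 < c) : (fun Y : ℝ => c / Y) '' Ioi 0 = Ioi 0 := by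
  ext X
  simp only [mem_image, mem_Ioi]
  constructor
  · rintro ⟨Y, hY, rfl⟩; positivity
  · intro hX; exact ⟨c / X, by positivity, by field_simp⟩

lemma injOn_const_div {c : ℝ} (hc : 0 < c) (s : Set ℝ) : InjOn (fun Y : ℝ => c / Y) s := by
  intro a _ b _ h
  simp only [div_eq_mul_inv] at h
  exact inv_injective (mul_left_cancel₀ hc.ne' h)

lemma integral_comp_const_div {c : ℝ} (hc : 0 < c) (g : ℝ → ℝ) :
    ∫ X in Ioi (0 : ℝ), g X = ∫ Y in Ioi (0 : ℝ), c / Y ^ 2 * g (c / Y) := by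
  have := integral_image_eq_integral_abs_deriv_smul (s := Ioi (0 : ℝ)) (f := fun Y => c / Y)
    (f' := fun Y => -c / Y ^ 2) measurableSet_Ioi (fun Y hY => by
      have h := hasDerivAt_const_div_pow c hY 1
      simp only [pow_one, Nat.cast_one, one_mul] at h
      exact h.hasDerivWithinAt) (injOn_const_div hc _) g
  rw [image_const_div hc] at this
  rw [this]
  refine setIntegral_congr_fun measurableSet_Ioi fun Y hY => ?_
  have hY : (0 : ℝ) < Y := hY
  simp only [smul_eq_mul]
  rw [neg_div, abs_neg, abs_of_pos (by positivity)]

/-- The integrand of the triple integrals for `∫ F n` and `∫ X F' n'`. -/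
noncomputable def kk (j : ℕ) (X : ℝ) (x : ℝ × ℝ) : ℝ :=
  X ^ j * (log x.1 - log X) / ((x.1 + X) ^ (j + 1) * (x.2 + X) ^ (j + 1))

lemma measurable_kk (j : ℕ) : Measurable (Function.uncurry (kk j)) := by
  unfold kk Function.uncurry
  have h1 : Measurable fun x : ℝ × ℝ × ℝ => log x.2.1 :=
    measurable_log.comp (by fun_prop)
  have h2 : Measurable fun x : ℝ × ℝ × ℝ => log x.1 :=
    measurable_log.comp (by fun_prop)
  exact ((measurable_fst.pow_const j).mul (h1.sub h2)).div (by fun_prop)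

lemma abs_kk_le (j : ℕ) {X t u : ℝ} (hX : 0 < X) (ht : 1 ≤ t) (hu : 1 ≤ u) :
    |kk j X (t, u)| ≤ 12 * ww X * (t ^ (-(1 / 8) : ℝ) * u ^ (-(1 / 4) : ℝ)) := by
  have h1 := inv_add_le_rpow ht hX.le
  have h2 := inv_add_le_rpow hu hX.le
  have htX : 0 < t + X := by linarith
  have huX : 0 < u + X := by linarith
  have hj : X ^ j / ((t + X) * (u + X)) ^ j ≤ 1 := by
    rw [← div_pow]
    apply pow_le_one₀ (by positivity)
    rw [div_le_one (by positivity)]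
    nlinarith
  have hl : |log t - log X| ≤ log t + |log X| := by
    have h3 := log_nonneg ht
    have := abs_sub (log t) (log X)
    rwa [abs_of_nonneg h3] at this
  have hlt : log t * t ^ (-(1 / 4) : ℝ) ≤ 8 * t ^ (-(1 / 8) : ℝ) := by
    have := log_le_rpow_div (x := t) (ε := 1 / 8) (by linarith) (by norm_num)
    calc _ ≤ (t ^ (1 / 8 : ℝ) / (1 / 8)) * t ^ (-(1 / 4) : ℝ) := by gcongr
      _ = 8 * (t ^ (1 / 8 : ℝ) * t ^ (-(1 / 4) : ℝ)) := by ring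
      _ = _ := by rw [← rpow_add (by linarith)]; norm_num
  have hlt' : t ^ (-(1 / 4) : ℝ) ≤ t ^ (-(1 / 8) : ℝ) :=
    rpow_le_rpow_of_exponent_le ht (by norm_num)
  have e : kk j X (t, u) = X ^ j / ((t + X) * (u + X)) ^ j * (log t - log X) *
      (1 / (t + X) * (1 / (u + X))) := by
    simp only [kk]; rw [mul_pow]; field_simp; ring
  have hlt0 := log_nonneg ht
  have hw0 : 0 ≤ ww X := by unfold ww; positivity
  have hw := rpow_le_ww hX
  have hlw := abs_log_mul_le_ww hX
  rw [e, abs_mul, abs_mul, abs_of_nonneg (a := X ^ j / ((t + X) * (u + X)) ^ j) (by positivity),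
    abs_of_nonneg (a := 1 / (t + X) * (1 / (u + X))) (by positivity)]
  calc _ ≤ 1 * (log t + |log X|) * ((t ^ (-(1 / 4) : ℝ) * (1 + X) ^ (-(3 / 4) : ℝ)) *
        (u ^ (-(1 / 4) : ℝ) * (1 + X) ^ (-(3 / 4) : ℝ))) := by gcongr
    _ = (log t + |log X|) * ((1 + X) ^ (-(3 / 4) : ℝ) * (1 + X) ^ (-(3 / 4) : ℝ)) *
        t ^ (-(1 / 4) : ℝ) * u ^ (-(1 / 4) : ℝ) := by ring
    _ = (log t + |log X|) * (1 + X) ^ (-(3 / 2) : ℝ) *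
        t ^ (-(1 / 4) : ℝ) * u ^ (-(1 / 4) : ℝ) := by
      rw [← rpow_add (by linarith)]; norm_num
    _ = ((log t * t ^ (-(1 / 4) : ℝ)) * (1 + X) ^ (-(3 / 2) : ℝ) +
        (|log X| * (1 + X) ^ (-(3 / 2) : ℝ)) * t ^ (-(1 / 4) : ℝ)) * u ^ (-(1 / 4) : ℝ) := by ring
    _ ≤ ((8 * t ^ (-(1 / 8) : ℝ)) * ww X + (4 * ww X) * t ^ (-(1 / 8) : ℝ)) *
        u ^ (-(1 / 4) : ℝ) := by gcongr
    _ = _ := by ring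

instance : SFinite mF := by unfold mF; infer_instance

lemma integrable_kk (j : ℕ) :
    Integrable (Function.uncurry (kk j)) ((volume.restrict (Ioi (0 : ℝ))).prod (mF.prod mF)) := by
  have h1 : Integrable (fun x : ℝ × ℝ => x.1 ^ (-(1 / 8) : ℝ) * x.2 ^ (-(1 / 4) : ℝ)) (mF.prod mF) :=
    (integrable_rpow_mF (by norm_num)).mul_prod (integrable_rpow_mF (by norm_num))
  refine ((integrableOn_ww.const_mul 12).mul_prod h1).mono' (measurable_kk j).aestronglyMeasurable ?_
  have a1 := (Measure.quasiMeasurePreserving_fst (μ := volume.restrict (Ioi (0 : ℝ)))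
    (ν := mF.prod mF)).ae (ae_restrict_mem measurableSet_Ioi)
  have a2 := (Measure.quasiMeasurePreserving_snd (μ := volume.restrict (Ioi (0 : ℝ)))
    (ν := mF.prod mF)).ae ((Measure.quasiMeasurePreserving_fst (μ := mF) (ν := mF)).ae one_le_mF)
  have a3 := (Measure.quasiMeasurePreserving_snd (μ := volume.restrict (Ioi (0 : ℝ)))
    (ν := mF.prod mF)).ae ((Measure.quasiMeasurePreserving_snd (μ := mF) (ν := mF)).ae one_le_mF)
  filter_upwards [a1, a2, a3] with x hX ht hu
  exact abs_kk_le j hX ht hu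

lemma integral_kk_swap (j : ℕ) {t u : ℝ} (ht : 1 ≤ t) (hu : 1 ≤ u) :
    ∫ X in Ioi (0 : ℝ), kk j X (t, u) = -∫ X in Ioi (0 : ℝ), kk j X (u, t) := by
  rw [integral_comp_const_div (c := t * u) (by positivity), ← integral_neg]
  refine setIntegral_congr_fun measurableSet_Ioi fun Y hY => ?_
  have hY : (0 : ℝ) < Y := hY
  have h1 : 0 < t := by linarith
  have h2 : 0 < u := by linarith
  simp only [kk]
  rw [log_div (by positivity) hY.ne', log_mul h1.ne' h2.ne']
  have e1 : t + t * u / Y = t * (u + Y) / Y := by field_simp; ring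
  have e2 : u + t * u / Y = u * (t + Y) / Y := by field_simp; ring
  rw [e1, e2]
  simp only [div_pow, mul_pow]
  field_simp
  ring

lemma integral_kk (j : ℕ) : ∫ X in Ioi (0 : ℝ), ∫ x, kk j X x ∂(mF.prod mF) = 0 := by
  rw [integral_integral_swap (integrable_kk j)]
  have h : ∫ x, (∫ X in Ioi (0 : ℝ), kk j X x) ∂(mF.prod mF) =
      -∫ x, (∫ X in Ioi (0 : ℝ), kk j X x) ∂(mF.prod mF) := by
    conv_lhs => rw [← integral_prod_swap]
    rw [← integral_neg]
    refine integral_congr_ae ?_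
    filter_upwards [(Measure.quasiMeasurePreserving_fst (μ := mF) (ν := mF)).ae one_le_mF,
      (Measure.quasiMeasurePreserving_snd (μ := mF) (ν := mF)).ae one_le_mF] with x h1 h2
    exact integral_kk_swap j h2 h1
  linarith

lemma integral_kk_prod (j : ℕ) (X : ℝ) : ∫ x, kk j X x ∂(mF.prod mF) = X ^ j *
    ((∫ t, (log t - log X) / (t + X) ^ (j + 1) ∂mF) * ∫ u, 1 / (u + X) ^ (j + 1) ∂mF) := by
  rw [← integral_prod_mul, ← integral_const_mul]
  refine integral_congr_ae (Eventually.of_forall fun x => ?_)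
  simp only [kk]
  rw [div_mul_div_comm, mul_one, ← mul_div_assoc]

lemma integral_log_sub (j : ℕ) {X : ℝ} (hX : 0 < X) :
    ∫ t, (log t - log X) / (t + X) ^ (j + 1) ∂mF =
      stieltjes mF log (j + 1) X - log X * ∫ t, 1 / (t + X) ^ (j + 1) ∂mF := by
  have j1 : Integrable (fun t => log t / (t + X) ^ (j + 1)) mF := by
    simpa using integrable_stieltjes (𝕜 := ℝ) (z := X) one_le_mF aesm_log integrable_log_div_mF
      (by simp; linarith) j
  have j2 := (integrable_inv_pow_mF (X := X) (by linarith) j).const_mul (log X)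
  have : stieltjes mF log (j + 1) X = ∫ t, log t / (t + X) ^ (j + 1) ∂mF := by
    simp [stieltjes]
  rw [this, ← integral_const_mul, ← integral_sub j1 j2]
  refine integral_congr_ae (Eventually.of_forall fun t => ?_)
  simp only; ring

lemma integral_FF_mul_nn : IntegrableOn (fun X => FF X * nn X) (Ioi 0) ∧
    ∫ X in Ioi (0 : ℝ), FF X * nn X = 0 := by
  have e : ∀ X ∈ Ioi (0 : ℝ), (1 / 2) * ∫ x, kk 0 X x ∂(mF.prod mF) = FF X * nn X := by
    intro X hX
    rw [integral_kk_prod, integral_log_sub 0 hX]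
    simp only [zero_add, pow_one, pow_zero]
    rw [← FF_def, nn, MM]; ring
  refine ⟨((integrable_kk 0).integral_prod_left.const_mul (1 / 2)).congr ?_, ?_⟩
  · filter_upwards [ae_restrict_mem measurableSet_Ioi] with X hX using e X hX
  · rw [← setIntegral_congr_fun measurableSet_Ioi e, integral_const_mul, integral_kk, mul_zero]

lemma continuousOn_FF1 : ContinuousOn FF1 (Ioi (-1)) := fun _ hX =>
  (hasDerivAt_FF1 hX).continuousAt.continuousWithinAt

lemma integral_FF_mul_FF1 : IntegrableOn (fun X => FF X * FF1 X) (Ioi 0) ∧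
    ∫ X in Ioi (0 : ℝ), FF X * FF1 X = -FF 0 ^ 2 / 2 := by
  have hd : ∀ X ∈ Ici (0 : ℝ), HasDerivAt (fun X => FF X ^ 2 / 2) (FF X * FF1 X) X := by
    intro X hX
    have hX : (0 : ℝ) ≤ X := hX
    refine (((hasDerivAt_FF (by linarith)).fun_pow 2).div_const 2).congr_deriv ?_
    simp; ring
  have hneg : ∀ X ∈ Ioi (0 : ℝ), FF X * FF1 X ≤ 0 := fun X hX =>
    mul_nonpos_of_nonneg_of_nonpos (FF_pos (lt_trans (by norm_num) (mem_Ioi.1 hX))).le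
      (FF1_neg (lt_trans (by norm_num) (mem_Ioi.1 hX))).le
  have hlim : Tendsto (fun X => FF X ^ 2 / 2) atTop (𝓝 0) := by
    simpa using (tendsto_FF.pow 2).div_const 2
  refine ⟨integrableOn_Ioi_deriv_of_nonpos' hd hneg hlim, ?_⟩
  rw [integral_Ioi_of_hasDerivAt_of_nonpos' hd hneg hlim]; ring

lemma integral_FF1_mul_nn1 : IntegrableOn (fun X => X * FF1 X * nn1 X) (Ioi 0) ∧
    ∫ X in Ioi (0 : ℝ), X * FF1 X * nn1 X = FF 0 ^ 2 / 4 := by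
  have e : ∀ X ∈ Ioi (0 : ℝ), (1 / 2) * (∫ x, kk 1 X x ∂(mF.prod mF)) -
      (1 / 2) * (FF X * FF1 X) = X * FF1 X * nn1 X := by
    intro X hX
    have hX0 : X ≠ 0 := (mem_Ioi.1 hX).ne'
    rw [integral_kk_prod, integral_log_sub 1 hX]
    simp only [Nat.reduceAdd, pow_one]
    have h1 : (∫ t, 1 / (t + X) ^ 2 ∂mF) = -FF1 X := by rw [FF1_def, neg_neg]
    have h2 : stieltjes mF log 2 X = -MM1 X := by rw [MM1, neg_neg]
    rw [h1, h2, nn1]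
    field_simp; ring
  have i1 : IntegrableOn (fun X => (1 / 2) * ∫ x, kk 1 X x ∂(mF.prod mF)) (Ioi 0) :=
    (integrable_kk 1).integral_prod_left.const_mul (1 / 2)
  have i2 := integral_FF_mul_FF1.1.const_mul (1 / 2)
  refine ⟨(i1.sub i2).congr ?_, ?_⟩
  · filter_upwards [ae_restrict_mem measurableSet_Ioi] with X hX using e X hX
  · rw [← setIntegral_congr_fun measurableSet_Ioi e, integral_sub i1 i2, integral_const_mul,
      integral_const_mul, integral_kk, integral_FF_mul_FF1.2]
    ring

/-- The ratio `g_{4,6} / f_{4,6}` (up to normalisation) in the coordinate `X`. -/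
noncomputable def gX (X : ℝ) : ℝ :=
  (5 * X ^ 2 + 18 * X + 45) * (X - 3) ^ 2 / ((X + 1) ^ 2 * (X + 9) ^ 2)

lemma gX_nonneg (X : ℝ) : 0 ≤ gX X := by
  unfold gX
  have : 0 ≤ 5 * X ^ 2 + 18 * X + 45 := by nlinarith [sq_nonneg (5 * X + 9)]
  positivity

lemma gX_le {X : ℝ} (hX : 0 < X) : gX X ≤ 5 := by
  unfold gX
  rw [div_le_iff₀ (by positivity)]
  have := pow_pos hX 2
  have := pow_pos hX 3
  nlinarith

/-- The boundary form whose derivative relates the period and quasi-period integrands. -/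
noncomputable def bform (U U₁ V V₁ : ℝ → ℝ) (X : ℝ) : ℝ :=
  (-(4 / 9) * X * (X ^ 3 + 8 * X ^ 2 + 39 * X + 72) * (U X * V X) +
    (-4 - 4 / 9 * X * (X + 5)) * (U X * (pp X * V₁ X) + pp X * U₁ X * V X) -
    4 / 9 * (pp X * U₁ X * (pp X * V₁ X))) / ((X + 1) * (X + 9))

lemma hasDerivAt_bform {U U₁ V V₁ : ℝ → ℝ} (hU : IsSol U U₁) (hV : IsSol V V₁) {X : ℝ} (hX : 0 < X) :
    HasDerivAt (bform U U₁ V V₁)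
      (1 / 2 * (U X * V X) - 8 * (X * U₁ X * V₁ X) - 5 / 18 * (gX X * (U X * V X))) X := by
  obtain ⟨u1, u2⟩ := hU X hX
  obtain ⟨v1, v2⟩ := hV X hX
  have hx := hasDerivAt_id X
  have hA : HasDerivAt (fun X : ℝ => -(4 / 9) * X * (X ^ 3 + 8 * X ^ 2 + 39 * X + 72))
      (-(4 / 9) * (4 * X ^ 3 + 24 * X ^ 2 + 78 * X + 72)) X := by
    have h := ((hasDerivAt_pow 4 X).add (((hasDerivAt_pow 3 X).const_mul 8).add
      (((hasDerivAt_pow 2 X).const_mul 39).add (hx.const_mul 72)))).const_mul (-(4 / 9))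
    refine (h.congr_of_eventuallyEq (Eventually.of_forall fun y => ?_)).congr_deriv ?_
    · simp; ring
    · simp; ring
  have hB : HasDerivAt (fun X : ℝ => -4 - 4 / 9 * X * (X + 5)) (-(4 / 9 * (2 * X + 5))) X := by
    refine ((hx.const_mul (4 / 9)).mul (hx.add_const 5) |>.const_sub (-4)).congr_deriv ?_
    simp; ring
  have hq : HasDerivAt (fun X : ℝ => (X + 1) * (X + 9)) (2 * X + 10) X := by
    refine ((hx.add_const 1).mul (hx.add_const 9)).congr_deriv ?_
    simp; ring
  have hne : (X + 1) * (X + 9) ≠ 0 := by positivity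
  have h := (((hA.mul (u1.mul v1)).add (hB.mul ((u1.mul v2).add (u2.mul v1)))).sub
    ((u2.mul v2).const_mul (4 / 9))).div hq hne
  refine h.congr_deriv ?_
  simp only [Pi.add_apply, Pi.mul_apply, Pi.sub_apply]
  unfold gX pp
  field_simp
  ring

/-- Expansion of the boundary form in `X (U + X U')`, suited to `X → ∞`. -/
lemma bform_eq (U U₁ V V₁ : ℝ → ℝ) {X : ℝ} (hX : 0 < X) : bform U U₁ V V₁ X =
    (8 * X ^ 3 - 84 * X ^ 2 + 72 * X + 324) / (9 * ((X + 1) * (X + 9))) * (U X * V X) +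
    20 / 9 * (U X * (X * (V X + X * V₁ X)) + X * (U X + X * U₁ X) * V X) -
    4 / 9 * ((1 + 1 / X) * (1 + 9 / X)) * (X * (U X + X * U₁ X) * (X * (V X + X * V₁ X))) := by
  unfold bform pp
  field_simp
  ring

lemma abs_coeff_le {X : ℝ} (hX : 0 < X) :
    |(8 * X ^ 3 - 84 * X ^ 2 + 72 * X + 324) / (9 * ((X + 1) * (X + 9)))| ≤ 12 * (1 + X) := by
  have := pow_pos hX 2
  have := pow_pos hX 3
  rw [abs_div, abs_of_pos (a := 9 * ((X + 1) * (X + 9))) (by positivity), div_le_iff₀ (by positivity),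
    abs_le]
  constructor <;> nlinarith

lemma tendsto_coeff : Tendsto (fun X : ℝ => 4 / 9 * ((1 + 1 / X) * (1 + 9 / X))) atTop (𝓝 (4 / 9)) := by
  have h1 : Tendsto (fun X : ℝ => 1 / X) atTop (𝓝 0) := tendsto_id.const_div_atTop 1
  have h9 : Tendsto (fun X : ℝ => 9 / X) atTop (𝓝 0) := tendsto_id.const_div_atTop 9
  simpa using ((h1.const_add 1).mul (h9.const_add 1)).const_mul (4 / 9)

lemma tendsto_coeff_mul {f : ℝ → ℝ} (hf : Tendsto (fun X => (1 + X) * f X) atTop (𝓝 0)) :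
    Tendsto (fun X : ℝ => (8 * X ^ 3 - 84 * X ^ 2 + 72 * X + 324) / (9 * ((X + 1) * (X + 9))) * f X)
      atTop (𝓝 0) := by
  have h := (hf.abs.const_mul 12)
  rw [abs_zero, mul_zero] at h
  refine squeeze_zero_norm' ?_ h
  filter_upwards [eventually_gt_atTop 0] with X hX
  rw [norm_mul, norm_eq_abs, norm_eq_abs, abs_mul (1 + X),
    abs_of_pos (a := 1 + X) (by positivity)]
  have := mul_le_mul_of_nonneg_right (abs_coeff_le hX) (abs_nonneg (f X))
  linarith

lemma tendsto_mul_FF_sq : Tendsto (fun X => (1 + X) * (FF X * FF X)) atTop (𝓝 0) := by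
  obtain ⟨C, hC, h⟩ := exists_FF_le
  refine squeeze_zero' ?_ ?_ (by
    simpa using (tendsto_one_add_rpow_neg (by norm_num : (0 : ℝ) < 1 / 2)).const_mul (C * C))
  · filter_upwards [eventually_ge_atTop 0] with X hX
    have := FF_pos (X := X) (by linarith)
    positivity
  · filter_upwards [eventually_ge_atTop 0] with X hX
    have h0 := FF_pos (X := X) (by linarith)
    calc (1 + X) * (FF X * FF X) ≤ (1 + X) ^ (1 : ℝ) * ((C * (1 + X) ^ (-(3 / 4) : ℝ)) *
          (C * (1 + X) ^ (-(3 / 4) : ℝ))) := by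
          rw [rpow_one]; gcongr <;> exact h X hX
      _ = C * C * ((1 + X) ^ (1 : ℝ) * (1 + X) ^ (-(3 / 4) : ℝ) * (1 + X) ^ (-(3 / 4) : ℝ)) := by ring
      _ = _ := by
        rw [← rpow_add (by linarith), ← rpow_add (by linarith)]; norm_num

lemma tendsto_bform_FF_FF : Tendsto (bform FF FF1 FF FF1) atTop (𝓝 (-(4 / 9))) := by
  have hT := tendsto_mul_FF_add
  have h := ((tendsto_coeff_mul tendsto_mul_FF_sq).add (((tendsto_FF.mul hT).add
    (hT.mul tendsto_FF)).const_mul (20 / 9))).sub (tendsto_coeff.mul (hT.mul hT))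
  simp only [zero_mul, mul_one, add_zero, mul_zero, zero_sub] at h
  refine h.congr' ?_
  filter_upwards [eventually_gt_atTop 0] with X hX using (bform_eq _ _ _ _ hX).symm

lemma tendsto_ss : Tendsto ss atTop (𝓝 0) := by
  have h := tendsto_mul_ss_atTop.mul (tendsto_inv_atTop_zero (𝕜 := ℝ))
  rw [mul_zero] at h
  refine h.congr' ?_
  filter_upwards [eventually_gt_atTop 0] with X hX
  field_simp

lemma tendsto_mul_ss_add : Tendsto (fun X => X * (ss X + X * ss1 X)) atTop (𝓝 0) := by
  have h0 : Tendsto (fun X : ℝ => 9 / X) atTop (𝓝 0) := tendsto_id.const_div_atTop 9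
  have h := (h0.mul ((hasDerivAt_FF1 (by norm_num : (-1 : ℝ) < 0)).continuousAt.tendsto.comp
    h0)).const_mul (-3)
  simp only [zero_mul, mul_zero] at h
  refine h.congr' ?_
  filter_upwards [eventually_gt_atTop 0] with X hX
  simp only [ss, ss1, Function.comp]; field_simp; ring

lemma tendsto_bform_FF_ss : Tendsto (bform FF FF1 ss ss1) atTop (𝓝 0) := by
  have hT := tendsto_mul_FF_add
  have hS := tendsto_mul_ss_add
  have hFs : Tendsto (fun X => (1 + X) * (FF X * ss X)) atTop (𝓝 0) := by
    have := (tendsto_FF.mul tendsto_ss).add (tendsto_FF.mul tendsto_mul_ss_atTop)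
    simp only [zero_mul, add_zero] at this
    refine this.congr fun X => ?_
    ring
  have h := ((tendsto_coeff_mul hFs).add (((tendsto_FF.mul hS).add
    (hT.mul tendsto_ss)).const_mul (20 / 9))).sub (tendsto_coeff.mul (hT.mul hS))
  simp only [mul_zero, add_zero, sub_zero] at h
  refine h.congr' ?_
  filter_upwards [eventually_gt_atTop 0] with X hX using (bform_eq _ _ _ _ hX).symm

lemma tendsto_bform_FF_FF_zero : Tendsto (bform FF FF1 FF FF1) (𝓝[>] 0) (𝓝 0) := by
  have hF := tendsto_FF_zero
  have hF1 := tendsto_FF1_zero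
  have hx := tendsto_id_zero
  have hp : Tendsto pp (𝓝[>] 0) (𝓝 0) := by
    have := tendsto_zero_of_hasDerivAt (hasDerivAt_pp 0)
    simpa [pp] using this
  have hA : Tendsto (fun X : ℝ => -(4 / 9) * X * (X ^ 3 + 8 * X ^ 2 + 39 * X + 72)) (𝓝[>] 0) (𝓝 0) :=
    Tendsto.mono_left (by
      have : Continuous (fun X : ℝ => -(4 / 9) * X * (X ^ 3 + 8 * X ^ 2 + 39 * X + 72)) := by fun_prop
      simpa using this.tendsto 0) nhdsWithin_le_nhds
  have hB : Tendsto (fun X : ℝ => -4 - 4 / 9 * X * (X + 5)) (𝓝[>] 0) (𝓝 (-4)) :=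
    Tendsto.mono_left (by
      have : Continuous (fun X : ℝ => -4 - 4 / 9 * X * (X + 5)) := by fun_prop
      simpa using this.tendsto 0) nhdsWithin_le_nhds
  have h := (((hA.mul (hF.mul hF)).add (hB.mul ((hF.mul (hp.mul hF1)).add
    ((hp.mul hF1).mul hF)))).sub (((hp.mul hF1).mul (hp.mul hF1)).const_mul (4 / 9))).div tendsto_pp_div
      (by norm_num)
  convert h.congr fun X => ?_ using 2
  · simp
  · simp only [bform, Pi.div_apply]

lemma tendsto_bform_FF_ss_zero : Tendsto (bform FF FF1 ss ss1) (𝓝[>] 0) (𝓝 (4 / 3 * FF 0)) := by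
  have hF := tendsto_FF_zero
  have hF1 := tendsto_FF1_zero
  have hp : Tendsto pp (𝓝[>] 0) (𝓝 0) := by
    have := tendsto_zero_of_hasDerivAt (hasDerivAt_pp 0)
    simpa [pp] using this
  have hA : Tendsto (fun X : ℝ => -(4 / 9) * (X ^ 3 + 8 * X ^ 2 + 39 * X + 72)) (𝓝[>] 0) (𝓝 (-32)) :=
    Tendsto.mono_left (by
      have : Continuous (fun X : ℝ => -(4 / 9) * (X ^ 3 + 8 * X ^ 2 + 39 * X + 72)) := by fun_prop
      convert this.tendsto 0 using 2; norm_num) nhdsWithin_le_nhds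
  have hB : Tendsto (fun X : ℝ => -4 - 4 / 9 * X * (X + 5)) (𝓝[>] 0) (𝓝 (-4)) :=
    Tendsto.mono_left (by
      have : Continuous (fun X : ℝ => -4 - 4 / 9 * X * (X + 5)) := by fun_prop
      simpa using this.tendsto 0) nhdsWithin_le_nhds
  have hq := tendsto_pp_div
  have hs := tendsto_mul_ss
  have hs1 := tendsto_mul_ss1
  have h := (((hA.mul (hF.mul hs)).add (hB.mul ((hF.mul (hq.mul hs1)).add
    ((hq.mul hF1).mul hs)))).sub (((hp.mul hF1).mul (hq.mul hs1)).const_mul (4 / 9))).div hq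
      (by norm_num)
  convert h.congr fun X => ?_ using 2
  · ring
  · simp only [bform, pp, Pi.div_apply]; ring

lemma integral_Ioi_of_tendsto {f f' : ℝ → ℝ} {l m : ℝ} (hd : ∀ X, 0 < X → HasDerivAt f (f' X) X)
    (hi : IntegrableOn f' (Ioi 0)) (hl : Tendsto f (𝓝[>] 0) (𝓝 l)) (hm : Tendsto f atTop (𝓝 m)) :
    ∫ X in Ioi (0 : ℝ), f' X = m - l := by
  have := integral_Ioi_of_hasDerivAt_of_tendsto (a := (0 : ℝ)) (f := Function.update f 0 l) (f' := f')
    (m := m) ?_ ?_ hi ?_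
  · simpa using this
  · have := continuousWithinAt_update_same (f := f) (s := Ici (0 : ℝ)) (x := 0) (y := l)
    rw [this]
    simpa using hl
  · intro X hX
    have hX : (0 : ℝ) < X := hX
    refine (hd X hX).congr_of_eventuallyEq ?_
    filter_upwards [eventually_ne_nhds hX.ne'] with y hy
    rw [Function.update_of_ne hy]
  · refine hm.congr' ?_
    filter_upwards [eventually_ne_atTop 0] with y hy
    rw [Function.update_of_ne hy]

lemma ss_pos {X : ℝ} (hX : 0 < X) : 0 < ss X := by
  unfold ss
  have : 0 < 9 / X := by positivity
  have := FF_pos (X := 9 / X) (by linarith)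
  positivity

lemma abs_mul_ss1_le {X : ℝ} (hX : 0 < X) : |X * ss1 X| ≤ ss X := by
  have h9 : 0 < 9 / X := by positivity
  have h1 := neg_mul_FF1_le h9.le
  have h2 := FF1_neg (X := 9 / X) (by linarith)
  have e : X * ss1 X = -ss X + 3 / X * (-(9 / X * FF1 (9 / X))) := by
    unfold ss ss1; field_simp; ring
  have h3 : 3 / X * (-(9 / X * FF1 (9 / X))) ≤ ss X := by
    unfold ss; gcongr
  have h4 : 0 ≤ 3 / X * (-(9 / X * FF1 (9 / X))) := by
    have : 0 ≤ -(9 / X * FF1 (9 / X)) := by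
      rw [← mul_neg]; exact mul_nonneg h9.le (by linarith)
    positivity
  rw [e, abs_le]
  constructor <;> linarith [ss_pos hX]

lemma abs_mul_FF1_le {X : ℝ} (hX : 0 < X) : |X * FF1 X| ≤ FF X := by
  have h2 := FF1_neg (X := X) (by linarith)
  rw [abs_of_nonpos (mul_nonpos_of_nonneg_of_nonpos hX.le h2.le)]
  exact neg_mul_FF1_le hX.le

lemma abs_FF1_le {X : ℝ} (hX : 0 < X) : |FF1 X| ≤ FF X := by
  rw [abs_of_neg (FF1_neg (by linarith)), FF1_def, neg_neg, FF_def]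
  refine integral_mono_ae (integrable_inv_pow_mF (by linarith) 1)
    (integrable_inv_add_mF (by linarith)) ?_
  filter_upwards [one_le_mF] with t ht
  apply one_div_le_one_div_of_le (by linarith)
  nlinarith

lemma continuousOn_of_hasDerivAt {f f' : ℝ → ℝ} (h : ∀ X, 0 < X → HasDerivAt f (f' X) X) :
    ContinuousOn f (Ioi 0) := fun X hX => (h X hX).continuousAt.continuousWithinAt

lemma aesm_of_continuousOn {f : ℝ → ℝ} (h : ContinuousOn f (Ioi 0)) :
    AEStronglyMeasurable f (volume.restrict (Ioi 0)) := h.aestronglyMeasurable measurableSet_Ioi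

lemma contFF : ContinuousOn FF (Ioi 0) := continuousOn_FF.mono (Ioi_subset_Ioi (by norm_num))
lemma contFF1 : ContinuousOn FF1 (Ioi 0) := continuousOn_FF1.mono (Ioi_subset_Ioi (by norm_num))
lemma contss : ContinuousOn ss (Ioi 0) := continuousOn_of_hasDerivAt fun _ hX => hasDerivAt_ss hX
lemma contss1 : ContinuousOn ss1 (Ioi 0) := continuousOn_of_hasDerivAt fun _ hX => hasDerivAt_ss1 hX
lemma contgX : ContinuousOn gX (Ioi 0) := by
  unfold gX
  refine ContinuousOn.div (by fun_prop) (by fun_prop) fun X hX => ?_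
  have hX : (0 : ℝ) < X := hX
  positivity

lemma integrableOn_FF_FF : IntegrableOn (fun X => FF X * FF X) (Ioi 0) := by
  obtain ⟨C, hC, h⟩ := exists_FF_le
  refine (integrableOn_ww.const_mul (C * C)).mono' (aesm_of_continuousOn (contFF.mul contFF)) ?_
  filter_upwards [ae_restrict_mem measurableSet_Ioi] with X hX
  have hX : (0 : ℝ) < X := hX
  have h0 := FF_pos (X := X) (by linarith)
  rw [norm_eq_abs, abs_of_pos (by positivity)]
  calc FF X * FF X ≤ (C * (1 + X) ^ (-(3 / 4) : ℝ)) * (C * (1 + X) ^ (-(3 / 4) : ℝ)) := by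
        gcongr <;> exact h X hX.le
    _ = C * C * ((1 + X) ^ (-(3 / 4) : ℝ) * (1 + X) ^ (-(3 / 4) : ℝ)) := by ring
    _ = C * C * (1 + X) ^ (-(3 / 2) : ℝ) := by rw [← rpow_add (by linarith)]; norm_num
    _ ≤ _ := by gcongr; exact rpow_le_ww hX

lemma integrableOn_FF_ss : IntegrableOn (fun X => FF X * ss X) (Ioi 0) := by
  obtain ⟨C, hC, h⟩ := exists_FF_le
  refine (integrableOn_ww.const_mul (3 * (C * C))).mono'
    (aesm_of_continuousOn (contFF.mul contss)) ?_
  filter_upwards [ae_restrict_mem measurableSet_Ioi] with X hX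
  have hX : (0 : ℝ) < X := hX
  have h0 := FF_pos (X := X) (by linarith)
  have hs := ss_pos hX
  have h9 : 0 < 9 / X := by positivity
  rw [norm_eq_abs, abs_of_pos (by positivity)]
  have hs1 : ss X ≤ 3 * C * (X ^ (-(1 / 4) : ℝ) * (1 + X) ^ (-(3 / 4) : ℝ)) := by
    unfold ss
    calc 3 / X * FF (9 / X) ≤ 3 / X * (C * ((1 + X) / X) ^ (-(3 / 4) : ℝ)) := by
          have h1 : (1 + 9 / X) ^ (-(3 / 4) : ℝ) ≤ ((1 + X) / X) ^ (-(3 / 4) : ℝ) := by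
            refine rpow_le_rpow_of_nonpos (by positivity) ?_ (by norm_num)
            rw [div_le_iff₀ hX]; field_simp; linarith
          have h2 := h (9 / X) h9.le
          gcongr
          exact h2.trans (by gcongr)
      _ = 3 * C * (X ^ (-1 : ℝ) * X ^ (3 / 4 : ℝ) * (1 + X) ^ (-(3 / 4) : ℝ)) := by
          rw [div_rpow (by positivity) hX.le, rpow_neg hX.le, rpow_neg_one]
          field_simp
      _ = _ := by rw [← rpow_add hX]; norm_num
  calc FF X * ss X ≤ (C * (1 + X) ^ (-(3 / 4) : ℝ)) *
        (3 * C * (X ^ (-(1 / 4) : ℝ) * (1 + X) ^ (-(3 / 4) : ℝ))) := by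
        gcongr; exact h X hX.le
    _ = 3 * (C * C) * (X ^ (-(1 / 4) : ℝ) * ((1 + X) ^ (-(3 / 4) : ℝ) * (1 + X) ^ (-(3 / 4) : ℝ))) := by
        ring
    _ = 3 * (C * C) * (X ^ (-(1 / 4) : ℝ) * (1 + X) ^ (-(3 / 2) : ℝ)) := by
        rw [← rpow_add (by linarith)]; norm_num
    _ ≤ _ := by
      unfold ww
      have : (1 + X) ^ (-(3 / 2) : ℝ) ≤ (1 + X)⁻¹ := by
        rw [← rpow_neg_one]
        exact rpow_le_rpow_of_exponent_le (by linarith) (by norm_num)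
      gcongr

lemma integrableOn_FF1_FF1 : IntegrableOn (fun X => X * FF1 X * FF1 X) (Ioi 0) := by
  refine integrableOn_FF_FF.mono' (aesm_of_continuousOn ((continuousOn_id.mul contFF1).mul contFF1)) ?_
  filter_upwards [ae_restrict_mem measurableSet_Ioi] with X hX
  rw [norm_mul]
  exact mul_le_mul (abs_mul_FF1_le hX) (abs_FF1_le hX) (abs_nonneg _)
    (FF_pos (lt_trans (by norm_num) (mem_Ioi.1 hX))).le

lemma integrableOn_FF1_ss1 : IntegrableOn (fun X => X * FF1 X * ss1 X) (Ioi 0) := by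
  refine integrableOn_FF_ss.mono' (aesm_of_continuousOn ((continuousOn_id.mul contFF1).mul contss1)) ?_
  filter_upwards [ae_restrict_mem measurableSet_Ioi] with X hX
  rw [show X * FF1 X * ss1 X = FF1 X * (X * ss1 X) by ring, norm_mul]
  exact mul_le_mul (abs_FF1_le hX) (abs_mul_ss1_le hX) (abs_nonneg _)
    (FF_pos (lt_trans (by norm_num) (mem_Ioi.1 hX))).le

lemma integrableOn_gX_mul {f : ℝ → ℝ} (hf : IntegrableOn f (Ioi 0)) :
    IntegrableOn (fun X => gX X * f X) (Ioi 0) := by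
  refine Integrable.bdd_mul (c := 5) hf (aesm_of_continuousOn contgX) ?_
  filter_upwards [ae_restrict_mem measurableSet_Ioi] with X hX
  rw [norm_eq_abs, abs_of_nonneg (gX_nonneg X)]
  exact gX_le hX

lemma integral_bform {V V₁ : ℝ → ℝ} (hV : IsSol V V₁) {l m : ℝ}
    (i1 : IntegrableOn (fun X => FF X * V X) (Ioi 0))
    (i2 : IntegrableOn (fun X => X * FF1 X * V₁ X) (Ioi 0))
    (hl : Tendsto (bform FF FF1 V V₁) (𝓝[>] 0) (𝓝 l))
    (hm : Tendsto (bform FF FF1 V V₁) atTop (𝓝 m)) :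
    1 / 2 * (∫ X in Ioi (0 : ℝ), FF X * V X) - 8 * ∫ X in Ioi (0 : ℝ), X * FF1 X * V₁ X =
      5 / 18 * (∫ X in Ioi (0 : ℝ), gX X * (FF X * V X)) + (m - l) := by
  have i3 := integrableOn_gX_mul i1
  have h := integral_Ioi_of_tendsto (fun X hX => hasDerivAt_bform isSol_FF hV hX)
    (((i1.const_mul (1 / 2)).sub (i2.const_mul 8)).sub (i3.const_mul (5 / 18))) hl hm
  have i12 : IntegrableOn (fun X => 1 / 2 * (FF X * V X) - 8 * (X * FF1 X * V₁ X)) (Ioi 0) :=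
    (i1.const_mul (1 / 2)).sub (i2.const_mul 8)
  rw [integral_sub i12 (i3.const_mul (5 / 18)),
    integral_sub (i1.const_mul (1 / 2)) (i2.const_mul 8), integral_const_mul, integral_const_mul,
    integral_const_mul] at h
  linarith

lemma integral_bform_FF_FF :
    1 / 2 * (∫ X in Ioi (0 : ℝ), FF X * FF X) - 8 * ∫ X in Ioi (0 : ℝ), X * FF1 X * FF1 X =
      5 / 18 * (∫ X in Ioi (0 : ℝ), gX X * (FF X * FF X)) - 4 / 9 := by
  rw [integral_bform isSol_FF integrableOn_FF_FF integrableOn_FF1_FF1 tendsto_bform_FF_FF_zero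
    tendsto_bform_FF_FF]
  ring

lemma integral_bform_FF_ss :
    1 / 2 * (∫ X in Ioi (0 : ℝ), FF X * ss X) - 8 * ∫ X in Ioi (0 : ℝ), X * FF1 X * ss1 X =
      5 / 18 * (∫ X in Ioi (0 : ℝ), gX X * (FF X * ss X)) - 4 / 3 * FF 0 := by
  rw [integral_bform isSol_ss integrableOn_FF_ss integrableOn_FF1_ss1 tendsto_bform_FF_ss_zero
    tendsto_bform_FF_ss]
  ring

lemma integral_FF_GG : IntegrableOn (fun X => FF X * GG X) (Ioi 0) ∧
    ∫ X in Ioi (0 : ℝ), FF X * GG X = 9 / 2 * FF 0 * ∫ X in Ioi (0 : ℝ), FF X * ss X := by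
  have e : ∀ X ∈ Ioi (0 : ℝ), 9 / 2 * FF 0 * (FF X * ss X) - 3 * (FF X * nn X) = FF X * GG X := by
    intro X hX
    have := (hh_eq hX).1
    linear_combination (-FF X) * this
  have i1 := integrableOn_FF_ss.const_mul (9 / 2 * FF 0)
  have i2 := integral_FF_mul_nn.1.const_mul 3
  refine ⟨(i1.sub i2).congr ?_, ?_⟩
  · filter_upwards [ae_restrict_mem measurableSet_Ioi] with X hX using e X hX
  · rw [← setIntegral_congr_fun measurableSet_Ioi e, integral_sub i1 i2, integral_const_mul,
      integral_const_mul, integral_FF_mul_nn.2]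
    ring

lemma integral_FF1_GG1 : IntegrableOn (fun X => X * FF1 X * GG1 X) (Ioi 0) ∧
    ∫ X in Ioi (0 : ℝ), X * FF1 X * GG1 X =
      9 / 2 * FF 0 * (∫ X in Ioi (0 : ℝ), X * FF1 X * ss1 X) - 3 / 4 * FF 0 ^ 2 := by
  have e : ∀ X ∈ Ioi (0 : ℝ), 9 / 2 * FF 0 * (X * FF1 X * ss1 X) - 3 * (X * FF1 X * nn1 X) =
      X * FF1 X * GG1 X := by
    intro X hX
    have := (hh_eq hX).2
    linear_combination (-(X * FF1 X)) * this
  have i1 := integrableOn_FF1_ss1.const_mul (9 / 2 * FF 0)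
  have i2 := integral_FF1_mul_nn1.1.const_mul 3
  refine ⟨(i1.sub i2).congr ?_, ?_⟩
  · filter_upwards [ae_restrict_mem measurableSet_Ioi] with X hX using e X hX
  · rw [← setIntegral_congr_fun measurableSet_Ioi e, integral_sub i1 i2, integral_const_mul,
      integral_const_mul, integral_FF1_mul_nn1.2]
    ring

/-! ### Product formulas for `K₀` -/

lemma one_add_sq_le_cosh (t : ℝ) : 1 + t ^ 2 / 2 ≤ cosh t := by
  have h1 := cosh_two_mul (t / 2)
  rw [show 2 * (t / 2) = t by ring, cosh_sq] at h1
  have h2 : (t / 2) ^ 2 ≤ sinh (t / 2) ^ 2 := by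
    rw [← sq_abs (t / 2), ← sq_abs (sinh (t / 2)), abs_sinh]
    have : |t / 2| ≤ sinh |t / 2| := self_le_sinh_iff.2 (abs_nonneg _)
    gcongr
  nlinarith

lemma integrable_exp_neg_mul_cosh {x : ℝ} (hx : 0 < x) :
    Integrable (fun t : ℝ => exp (-(x * cosh t))) := by
  refine (integrable_exp_neg_mul_sq (half_pos hx)).mono'
    (by fun_prop) (Eventually.of_forall fun t => ?_)
  rw [norm_eq_abs, abs_exp]
  refine exp_le_exp.2 ?_
  have := one_add_sq_le_cosh t
  nlinarith

/-- Twice `K₀`, as a lower integral over the line. -/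
noncomputable def kL (x : ℝ) : ENNReal := ∫⁻ t : ℝ, ofReal (exp (-(x * cosh t)))

lemma two_mul_besselK0 (x : ℝ) : 2 * besselK0 x = ∫ t : ℝ, exp (-(x * cosh t)) := by
  rw [besselK0, ← integral_comp_abs (f := fun t => exp (-(x * cosh t)))]
  simp only [cosh_abs]

lemma besselK0_nonneg (x : ℝ) : 0 ≤ besselK0 x :=
  integral_nonneg fun _ => (exp_pos _).le

lemma kL_eq {x : ℝ} (hx : 0 < x) : kL x = ofReal (2 * besselK0 x) := by
  rw [two_mul_besselK0, ofReal_integral_eq_lintegral_ofReal (integrable_exp_neg_mul_cosh hx)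
    (Eventually.of_forall fun _ => (exp_pos _).le), kL]

lemma lintegral_exp_add_exp {P Q : ℝ} (hP : 0 < P) (hQ : 0 < Q) :
    ∫⁻ t : ℝ, ofReal (exp (-((P * exp t + Q * exp (-t)) / 2)))
      = kL (sqrt (P * Q)) := by
  set c := log (sqrt Q / sqrt P) with hc
  have hp := sqrt_pos.2 hP
  have hq := sqrt_pos.2 hQ
  have hec : exp c = sqrt Q / sqrt P := exp_log (by positivity)
  rw [← lintegral_add_right_eq_self _ c, kL]
  refine lintegral_congr fun t => ?_
  congr 3
  rw [neg_add, exp_add, exp_add, exp_neg c, hec, cosh_eq,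
    sqrt_mul hP.le]
  have e1 : P = sqrt P ^ 2 := (sq_sqrt hP.le).symm
  have e2 : Q = sqrt Q ^ 2 := (sq_sqrt hQ.le).symm
  generalize sqrt P = p at *
  generalize sqrt Q = q at *
  subst e1 e2
  field_simp

lemma kL_mul_kL {a b : ℝ} (ha : 0 < a) (hb : 0 < b) :
    kL a * kL b = ∫⁻ r : ℝ, kL (sqrt (a ^ 2 + b ^ 2 + 2 * a * b * cosh r)) := by
  have h1 : kL a * kL b = ∫⁻ t : ℝ, ∫⁻ r : ℝ,
      ofReal (exp (-(a * cosh (r + t)))) *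
        ofReal (exp (-(b * cosh t))) := by
    conv_lhs => rw [kL, kL]
    rw [← lintegral_const_mul _ (by fun_prop)]
    refine lintegral_congr fun t => ?_
    rw [lintegral_mul_const _ (by fun_prop)]
    congr 1
    rw [lintegral_add_right_eq_self (fun r => ofReal (exp (-(a * cosh r)))) t]
  rw [h1, lintegral_lintegral_swap (by fun_prop)]
  refine lintegral_congr fun r => ?_
  have e := lintegral_exp_add_exp (P := a * exp r + b) (Q := a * exp (-r) + b)
    (by positivity) (by positivity)
  have e2 : (a * exp r + b) * (a * exp (-r) + b) =
      a ^ 2 + b ^ 2 + 2 * a * b * cosh r := by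
    rw [cosh_eq]
    have := exp_add r (-r)
    rw [add_neg_cancel, exp_zero] at this
    linear_combination -(a ^ 2) * this
  rw [← e2, ← e]
  refine lintegral_congr fun t => ?_
  rw [← ofReal_mul (exp_pos _).le, ← exp_add]
  congr 2
  rw [cosh_eq, cosh_eq, neg_add, exp_add, exp_add]
  ring

lemma lintegral_comp_abs (f : ℝ → ENNReal) :
    ∫⁻ x : ℝ, f |x| = 2 * ∫⁻ x in Ioi (0 : ℝ), f x := by
  have h1 : ∫⁻ x in Ioi (0 : ℝ), f |x| = ∫⁻ x in Ioi (0 : ℝ), f x :=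
    setLIntegral_congr_fun measurableSet_Ioi fun x hx => by simp only [abs_of_pos (mem_Ioi.1 hx)]
  have h2 : ∫⁻ x in Iio (0 : ℝ), f |x| = ∫⁻ x in Ioi (0 : ℝ), f |x| := by
    have h := (Measure.measurePreserving_neg (volume : Measure ℝ)).setLIntegral_comp_preimage_emb
      (MeasurableEquiv.neg ℝ).measurableEmbedding (fun x => f |x|) (Ioi 0)
    rw [← h]
    simp
  rw [← lintegral_add_compl _ (measurableSet_Ioi (a := (0 : ℝ))), compl_Ioi,
    setLIntegral_congr Iio_ae_eq_Iic.symm, h2, h1, two_mul]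

lemma kL_heat {μ τ : ℝ} (hμ : 0 < μ) (hτ : 0 < τ) :
    ∫⁻ x in Ioi (0 : ℝ), ofReal (exp (-(μ * x) - τ ^ 2 / (4 * x)) / x)
      = kL (sqrt μ * τ) := by
  have h := lintegral_image_eq_lintegral_abs_deriv_mul (s := univ) (f := exp) (f' := exp)
    MeasurableSet.univ (fun x _ => (Real.hasDerivAt_exp x).hasDerivWithinAt)
    exp_injective.injOn
    (fun x => ofReal (exp (-(μ * x) - τ ^ 2 / (4 * x)) / x))
  rw [image_univ, range_exp] at h
  rw [h, setLIntegral_univ]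
  have e := lintegral_exp_add_exp (P := 2 * μ) (Q := τ ^ 2 / 2) (by positivity) (by positivity)
  rw [show 2 * μ * (τ ^ 2 / 2) = μ * τ ^ 2 by ring, sqrt_mul hμ.le, sqrt_sq hτ.le] at e
  rw [← e]
  refine lintegral_congr fun t => ?_
  rw [← ofReal_mul (abs_nonneg _), abs_of_pos (exp_pos _), exp_neg t]
  have := exp_pos t
  congr 1
  rw [mul_div_cancel₀ _ this.ne']
  congr 1
  field_simp
  ring

lemma re_cosh_add_mul_I (t χ : ℝ) :
    (Complex.cosh (t + χ * I)).re = cosh t * cos χ := by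
  rw [Complex.cosh_add, Complex.cosh_mul_I, Complex.sinh_mul_I]
  simp [← Complex.ofReal_cosh, ← Complex.ofReal_sinh, ← Complex.ofReal_cos, ← Complex.ofReal_sin]

lemma norm_sinh_add_mul_I_le (t χ : ℝ) :
    ‖Complex.sinh (t + χ * I)‖ ≤ cosh t := by
  have h : ‖Complex.sinh (t + χ * I)‖ ≤ (exp t + exp (-t)) / 2 := by
    rw [Complex.sinh, norm_div, show ‖(2 : ℂ)‖ = 2 by simp]
    gcongr
    refine (norm_sub_le _ _).trans (le_of_eq ?_)
    simp [Complex.norm_exp]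
  rwa [← cosh_eq] at h

lemma norm_cexp_neg_cosh (R t χ : ℝ) : ‖Complex.exp (-(R * Complex.cosh (t + χ * I)))‖ =
    exp (-(R * cos χ * cosh t)) := by
  rw [Complex.norm_exp, Complex.neg_re, Complex.re_ofReal_mul, re_cosh_add_mul_I]
  congr 1; ring

lemma tendsto_exp_neg_mul_cosh {x : ℝ} (hx : 0 < x) :
    Tendsto (fun t : ℝ => exp (-(x * cosh t))) atTop (𝓝 0) ∧
    Tendsto (fun t : ℝ => exp (-(x * cosh t))) atBot (𝓝 0) := by
  have h : Tendsto (fun t : ℝ => exp (-(x * cosh t))) atTop (𝓝 0) := by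
    refine tendsto_exp_neg_atTop_nhds_zero.comp (Tendsto.const_mul_atTop hx ?_)
    refine tendsto_atTop_mono' _ ?_ tendsto_id
    filter_upwards with t
    have := one_add_sq_le_cosh t
    simp only [id]; nlinarith [sq_nonneg (t - 1)]
  refine ⟨h, ?_⟩
  have := h.comp tendsto_neg_atBot_atTop
  simpa [Function.comp_def, cosh_neg] using this

lemma mul_cosh_mul_exp_le {R c C : ℝ} (hR : 0 < R) (hc : 0 < c) (hC : 1 ≤ C) :
    R * C * exp (-(R * c * C)) ≤ 2 / c * exp (-(R * c / 2 * C)) := by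
  have h1 : R * c * C / 2 ≤ exp (R * c * C / 2) := by
    have := add_one_le_exp (R * c * C / 2); linarith
  have h2 : exp (-(R * c / 2 * C)) = exp (-(R * c * C)) * exp (R * c * C / 2) := by
    rw [← exp_add]; congr 1; ring
  rw [h2]
  have h3 := exp_pos (-(R * c * C))
  have h4 : R * C = 2 / c * (R * c * C / 2) := by field_simp
  rw [h4, mul_assoc (2 / c), mul_comm (exp (-(R * c * C)))]
  gcongr

lemma integral_cexp_neg_cosh_shift {R χ : ℝ} (hR : 0 < R) (hχ : |χ| < π / 2) :
    ∫ t : ℝ, Complex.exp (-(R * Complex.cosh (t + χ * I))) =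
      ((2 * besselK0 R : ℝ) : ℂ) := by
  have hderiv : ∀ t x : ℝ, HasDerivAt
      (fun x : ℝ => Complex.exp (-(R * Complex.cosh (t + x * I))))
      (-(R * Complex.sinh (t + x * I)) * I *
        Complex.exp (-(R * Complex.cosh (t + x * I)))) x := by
    intro t x
    have h1 : HasDerivAt (fun x : ℝ => (t : ℂ) + x * I) I x := by
      simpa using ((Complex.ofRealCLM.hasDerivAt (x := x)).mul_const I).const_add (t : ℂ)
    refine ((((Complex.hasDerivAt_cosh _).comp x h1).const_mul (R : ℂ)).neg.cexp).congr_deriv ?_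
    simp only [Function.comp, Pi.neg_apply]; ring
  have hderiv2 : ∀ t x : ℝ, HasDerivAt
      (fun t : ℝ => Complex.exp (-(R * Complex.cosh (t + x * I))))
      (-(R * Complex.sinh (t + x * I)) *
        Complex.exp (-(R * Complex.cosh (t + x * I)))) t := by
    intro t x
    have h1 : HasDerivAt (fun t : ℝ => (t : ℂ) + x * I) 1 t := by
      simpa using (Complex.ofRealCLM.hasDerivAt (x := t)).add_const ((x : ℂ) * I)
    refine ((((Complex.hasDerivAt_cosh _).comp t h1).const_mul (R : ℂ)).neg.cexp).congr_deriv ?_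
    simp only [Function.comp, Pi.neg_apply]; ring
  have hmain : ∀ x ∈ Ioo (-(π / 2)) (π / 2), HasDerivAt
      (fun x : ℝ => ∫ t : ℝ, Complex.exp (-(R * Complex.cosh (t + x * I)))) 0 x := by
    intro x hx
    have hcx : 0 < cos x := cos_pos_of_mem_Ioo hx
    set c := cos x / 2 with hc
    have hc0 : 0 < c := half_pos hcx
    have hs : {y : ℝ | c < cos y} ∈ 𝓝 x :=
      (isOpen_lt continuous_const continuous_cos).mem_nhds (by simp only [mem_ofPred_eq]; linarith)
    have hcont : ∀ y : ℝ, Continuous (fun t : ℝ =>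
        Complex.exp (-(R * Complex.cosh (t + y * I)))) := fun y => by fun_prop
    have hb : ∀ t : ℝ, ∀ y ∈ {y : ℝ | c < cos y},
        ‖-(R * Complex.sinh (t + y * I)) * I *
        Complex.exp (-(R * Complex.cosh (t + y * I)))‖ ≤
          2 / c * exp (-(R * c / 2 * cosh t)) := by
      intro t y hy
      have hy' : c < cos y := hy
      have h1 := one_le_cosh t
      rw [norm_mul, norm_mul, norm_neg, norm_mul, norm_cexp_neg_cosh, Complex.norm_I, mul_one,
        Complex.norm_real, norm_eq_abs, abs_of_pos hR]
      refine le_trans ?_ (mul_cosh_mul_exp_le hR hc0 h1)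
      have := norm_sinh_add_mul_I_le t y
      gcongr
    obtain ⟨hInt, hd⟩ := hasDerivAt_integral_of_dominated_loc_of_deriv_le (μ := volume)
      (F := fun (x : ℝ) (t : ℝ) => Complex.exp (-(R * Complex.cosh (t + x * I))))
      (F' := fun (x : ℝ) (t : ℝ) => -(R * Complex.sinh (t + x * I)) * I *
        Complex.exp (-(R * Complex.cosh (t + x * I)))) (x₀ := x) hs
      (Eventually.of_forall fun y => (hcont y).aestronglyMeasurable)
      ((integrable_exp_neg_mul_cosh (mul_pos hR hcx)).mono' (hcont x).aestronglyMeasurable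
        (Eventually.of_forall fun t => (norm_cexp_neg_cosh R t x).le))
      (by fun_prop) (Eventually.of_forall hb)
      ((integrable_exp_neg_mul_cosh (by positivity)).const_mul _)
      (Eventually.of_forall fun t y _ => hderiv t y)
    refine hd.congr_deriv ?_
    have hint2 : Integrable (fun t : ℝ => -(R * Complex.sinh (t + x * I)) *
        Complex.exp (-(R * Complex.cosh (t + x * I)))) := by
      refine (hInt.mul_const (-I)).congr (Eventually.of_forall fun t => ?_)
      linear_combination (R * Complex.sinh (t + x * I)) *
        Complex.exp (-(R * Complex.cosh (t + x * I))) * Complex.I_sq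
    have ht := tendsto_exp_neg_mul_cosh (mul_pos hR hcx)
    have hz := integral_of_hasDerivAt_of_tendsto (fun t => hderiv2 t x) hint2 (m := 0) (n := 0)
      (tendsto_zero_iff_norm_tendsto_zero.2 (by simpa only [norm_cexp_neg_cosh] using ht.2))
      (tendsto_zero_iff_norm_tendsto_zero.2 (by simpa only [norm_cexp_neg_cosh] using ht.1))
    have : ∀ t : ℝ, -(R * Complex.sinh (t + x * I)) * I *
        Complex.exp (-(R * Complex.cosh (t + x * I))) =
        I * (-(R * Complex.sinh (t + x * I)) *
        Complex.exp (-(R * Complex.cosh (t + x * I)))) := fun t => by ring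
    simp only [this]
    rw [integral_const_mul, hz]
    simp
  have hx : χ ∈ Ioo (-(π / 2)) (π / 2) := abs_lt.1 hχ
  have h0 : (0 : ℝ) ∈ Ioo (-(π / 2)) (π / 2) := by
    constructor <;> have := pi_pos <;> linarith
  have hconst := isOpen_Ioo.is_const_of_deriv_eq_zero isPreconnected_Ioo
    (fun y hy => (hmain y hy).differentiableAt.differentiableWithinAt)
    (fun y hy => (hmain y hy).deriv) hx h0
  rw [hconst, two_mul_besselK0, ← integral_complex_ofReal]
  refine integral_congr_ae (Eventually.of_forall fun t => ?_)
  simp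

lemma integral_cexp_conj {P : ℂ} (hP : 0 < P.re) :
    ∫ t : ℝ, Complex.exp (-((P * Complex.exp t + (starRingEnd ℂ) P * Complex.exp (-t)) / 2)) =
      ((2 * besselK0 ‖P‖ : ℝ) : ℂ) := by
  have hP0 : P ≠ 0 := by rintro rfl; simp at hP
  rw [← integral_cexp_neg_cosh_shift (norm_pos_iff.2 hP0)
    (Complex.abs_arg_lt_pi_div_two_iff.2 (Or.inl hP))]
  refine integral_congr_ae (Eventually.of_forall fun t => ?_)
  simp only
  have h1 : P = ‖P‖ * Complex.exp (P.arg * I) := (Complex.norm_mul_exp_arg_mul_I P).symm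
  have h2 : (starRingEnd ℂ) P = ‖P‖ * Complex.exp (-(P.arg * I)) := by
    conv_lhs => rw [h1]
    rw [map_mul, Complex.conj_ofReal, ← Complex.exp_conj, map_mul, Complex.conj_ofReal,
      Complex.conj_I, mul_neg]
  rw [h2, Complex.cosh, neg_add, Complex.exp_add, Complex.exp_add]
  congr 1
  linear_combination -(1 / 2 * Complex.exp t) * h1

lemma integral_cexp_cos_shift (a t : ℝ) :
    ∫ φ in (0 : ℝ)..2 * π, Complex.exp (a * Complex.cos (φ + t * I)) =
      ∫ φ in (0 : ℝ)..2 * π, Complex.exp (a * Complex.cos φ) := by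
  have key : ∀ r R : ℝ, 0 < r → r ≤ R →
      (∫ φ in (0 : ℝ)..2 * π, Complex.exp (a * ((circleMap 0 R φ) + (circleMap 0 R φ)⁻¹) / 2)) =
      ∫ φ in (0 : ℝ)..2 * π, Complex.exp (a * ((circleMap 0 r φ) + (circleMap 0 r φ)⁻¹) / 2) := by
    intro r R hr hrR
    have hd : ∀ z : ℂ, z ≠ 0 → DifferentiableAt ℂ (fun z : ℂ => Complex.exp (a * (z + z⁻¹) / 2)) z := by
      intro z hz
      have := differentiableAt_inv (𝕜 := ℂ) hz
      fun_prop
    have hne : ∀ z : ℂ, z ∉ Metric.ball (0 : ℂ) r → z ≠ 0 := by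
      rintro z hz rfl; exact hz (Metric.mem_ball_self hr)
    have h := Complex.circleIntegral_sub_center_inv_smul_eq_of_differentiable_on_annulus_off_countable
      (c := 0) hr hrR (f := fun z : ℂ => Complex.exp (a * (z + z⁻¹) / 2)) countable_empty
      (fun z hz => (hd z (hne z hz.2)).continuousAt.continuousWithinAt)
      (fun z hz => hd z (hne z fun h => hz.1.2 (Metric.ball_subset_closedBall h)))
    simp only [circleIntegral, sub_zero, deriv_circleMap, smul_eq_mul] at h
    have e : ∀ ρ : ℝ, 0 < ρ → ∀ φ : ℝ, circleMap 0 ρ φ * I * ((circleMap 0 ρ φ)⁻¹ *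
        Complex.exp (a * ((circleMap 0 ρ φ) + (circleMap 0 ρ φ)⁻¹) / 2)) =
        I * Complex.exp (a * ((circleMap 0 ρ φ) + (circleMap 0 ρ φ)⁻¹) / 2) := by
      intro ρ hρ φ
      have : circleMap 0 ρ φ ≠ 0 := circleMap_ne_center hρ.ne'
      field_simp
    simp only [e R (hr.trans_le hrR), e r hr, intervalIntegral.integral_const_mul] at h
    exact mul_left_cancel₀ Complex.I_ne_zero h
  have e1 : ∀ t φ : ℝ, Complex.exp (a * ((circleMap 0 (exp (-t)) φ) +
      (circleMap 0 (exp (-t)) φ)⁻¹) / 2) = Complex.exp (a * Complex.cos (φ + t * I)) := by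
    intro t φ
    have : circleMap 0 (exp (-t)) φ = Complex.exp ((φ + t * I) * I) := by
      rw [circleMap, zero_add, Complex.ofReal_exp, ← Complex.exp_add]
      congr 1
      push_cast
      linear_combination -t * Complex.I_sq
    rw [this, ← Complex.exp_neg, Complex.cos]
    congr 1
    ring_nf
  have e0 : ∀ φ : ℝ, Complex.exp (a * Complex.cos φ) = Complex.exp (a * ((circleMap 0 (exp (-0)) φ) +
      (circleMap 0 (exp (-0)) φ)⁻¹) / 2) := by
    intro φ; rw [e1 0 φ]; simp
  simp only [e0, ← e1 t]
  rcases le_total (exp (-t)) (exp (-0)) with h | h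
  · exact (key _ _ (exp_pos _) h).symm
  · exact key _ _ (exp_pos _) h

lemma intervalIntegral_comp_cos {g : ℝ → ℝ}
    (hg : IntervalIntegrable (fun φ => g (cos φ)) volume 0 (2 * π)) :
    ∫ φ in (0 : ℝ)..2 * π, g (cos φ) = 2 * ∫ φ in (0 : ℝ)..π, g (cos φ) := by
  have hpi := pi_pos
  have h1 := hg.mono_set (c := 0) (d := π) (by
    rw [uIcc_of_le hpi.le, uIcc_of_le (by linarith)]; exact Icc_subset_Icc le_rfl (by linarith))
  have h2 := hg.mono_set (c := π) (d := 2 * π) (by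
    rw [uIcc_of_le (by linarith), uIcc_of_le (by linarith)]; exact Icc_subset_Icc hpi.le le_rfl)
  rw [← intervalIntegral.integral_add_adjacent_intervals h1 h2]
  have h3 := intervalIntegral.integral_comp_sub_left (fun φ => g (cos φ)) (2 * π) (a := π) (b := 2 * π)
  simp only [cos_two_pi_sub] at h3
  rw [h3, sub_self, show 2 * π - π = π by ring, two_mul]

lemma norm_sub_mul_exp {a b φ : ℝ} : ‖(b : ℂ) - a * Complex.exp (-(φ * I))‖ =
    sqrt (a ^ 2 + b ^ 2 - 2 * a * b * cos φ) := by
  rw [Complex.norm_def, Complex.normSq_apply]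
  congr 1
  have h1 : ((b : ℂ) - a * Complex.exp (-(φ * I))).re = b - a * cos φ := by
    rw [← neg_mul, ← Complex.ofReal_neg, Complex.sub_re, Complex.re_ofReal_mul,
      Complex.exp_ofReal_mul_I_re, cos_neg, Complex.ofReal_re]
  have h2 : ((b : ℂ) - a * Complex.exp (-(φ * I))).im = a * sin φ := by
    rw [← neg_mul, ← Complex.ofReal_neg, Complex.sub_im, Complex.im_ofReal_mul,
      Complex.exp_ofReal_mul_I_im, sin_neg, Complex.ofReal_im]
    ring
  rw [h1, h2]
  linear_combination a ^ 2 * sin_sq_add_cos_sq φ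

lemma integral_cexp_cos_sub_cosh {a b : ℝ} (ha : 0 < a) (hab : a < b) (φ : ℝ) :
    ∫ t : ℝ, Complex.exp (a * Complex.cos (φ + t * I) - b * cosh t) =
      ((2 * besselK0 (sqrt (a ^ 2 + b ^ 2 - 2 * a * b * cos φ)) : ℝ) : ℂ) := by
  have hre : 0 < ((b : ℂ) - a * Complex.exp (-(φ * I))).re := by
    rw [← neg_mul, ← Complex.ofReal_neg, Complex.sub_re, Complex.re_ofReal_mul,
      Complex.exp_ofReal_mul_I_re, cos_neg, Complex.ofReal_re]
    have := cos_le_one φ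
    nlinarith
  rw [← norm_sub_mul_exp, ← integral_cexp_conj hre]
  refine integral_congr_ae (Eventually.of_forall fun t => ?_)
  simp only
  congr 1
  rw [map_sub, Complex.conj_ofReal, map_mul, Complex.conj_ofReal, ← Complex.exp_conj, map_neg, map_mul,
    Complex.conj_ofReal, Complex.conj_I, mul_neg, neg_neg, Complex.cos, Complex.ofReal_cosh, Complex.cosh,
    show ((φ : ℂ) + t * I) * I = φ * I - t by
      linear_combination (t : ℂ) * Complex.I_sq,
    show -((φ : ℂ) + t * I) * I = -(φ * I) + t by
      linear_combination -(t : ℂ) * Complex.I_sq, sub_eq_add_neg ((φ : ℂ) * I),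
    Complex.exp_add, Complex.exp_add]
  ring

lemma besselI0_mul_besselK0 {a b : ℝ} (ha : 0 < a) (hab : a < b) :
    IntegrableOn (fun φ => besselK0 (sqrt (a ^ 2 + b ^ 2 - 2 * a * b * cos φ))) (Ioc 0 π) ∧
    besselI0 a * besselK0 b = (1 / π) *
      ∫ φ in (0 : ℝ)..π, besselK0 (sqrt (a ^ 2 + b ^ 2 - 2 * a * b * cos φ)) := by
  have hpi := pi_pos
  have hInt : Integrable (fun x : ℝ × ℝ =>
      Complex.exp (a * Complex.cos (x.1 + x.2 * I) - b * cosh x.2))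
      ((volume.restrict (Ioc 0 (2 * π))).prod volume) := by
    have hdom : Integrable (fun x : ℝ × ℝ => 1 * exp (-((b - a) * cosh x.2)))
        ((volume.restrict (Ioc 0 (2 * π))).prod volume) :=
      (integrable_const (1 : ℝ)).mul_prod (integrable_exp_neg_mul_cosh (sub_pos.2 hab))
    refine hdom.mono' (by fun_prop) (Eventually.of_forall fun x => ?_)
    rw [Complex.norm_exp, one_mul]
    refine exp_le_exp.2 ?_
    have h1 : (Complex.cos (x.1 + x.2 * I)).re = cos x.1 * cosh x.2 := by
      rw [Complex.cos_add, Complex.cos_mul_I, Complex.sin_mul_I]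
      simp [← Complex.ofReal_cosh, ← Complex.ofReal_sinh, ← Complex.ofReal_cos, ← Complex.ofReal_sin]
    rw [Complex.sub_re, Complex.re_ofReal_mul, h1, Complex.re_ofReal_mul, Complex.ofReal_re]
    have := cos_le_one x.1
    have := one_le_cosh x.2
    nlinarith [mul_nonneg (mul_nonneg ha.le (sub_nonneg.2 (cos_le_one x.1)))
      (zero_le_one.trans (one_le_cosh x.2))]
  have hI : IntervalIntegrable
      (fun φ => besselK0 (sqrt (a ^ 2 + b ^ 2 - 2 * a * b * cos φ))) volume 0 (2 * π) := by
    rw [intervalIntegrable_iff_integrableOn_Ioc_of_le (by positivity)]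
    have h := hInt.integral_prod_left
    simp only [integral_cexp_cos_sub_cosh ha hab] at h
    have h' := h.re.const_mul (1 / 2)
    refine h'.congr (Eventually.of_forall fun φ => ?_)
    simp
  refine ⟨((intervalIntegrable_iff_integrableOn_Ioc_of_le (by positivity)).1 hI).mono_set
    (Ioc_subset_Ioc le_rfl (by linarith)), ?_⟩
  have hswap := integral_integral_swap (f := fun (φ t : ℝ) =>
    Complex.exp (a * Complex.cos (φ + t * I) - b * cosh t)) hInt
  simp only [integral_cexp_cos_sub_cosh ha hab] at hswap
  rw [integral_complex_ofReal] at hswap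
  have hr : ∀ t : ℝ, ∫ φ in Ioc 0 (2 * π),
      Complex.exp (a * Complex.cos (φ + t * I) - b * cosh t) =
      ((2 * π * besselI0 a * exp (-(b * cosh t)) : ℝ) : ℂ) := by
    intro t
    have h2 : ∀ φ : ℝ, Complex.exp (a * Complex.cos (φ + t * I) - b * cosh t) =
        Complex.exp (a * Complex.cos (φ + t * I)) * ((exp (-(b * cosh t)) : ℝ) : ℂ) := by
      intro φ
      rw [sub_eq_add_neg, Complex.exp_add]; push_cast; rfl
    simp only [h2]
    rw [integral_mul_const, ← intervalIntegral.integral_of_le (by positivity),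
      integral_cexp_cos_shift, Complex.ofReal_mul]
    congr 1
    have h3 : ∀ φ : ℝ, Complex.exp (a * Complex.cos φ) = ((exp (a * cos φ) : ℝ) : ℂ) := by
      intro φ; push_cast; rfl
    simp only [h3]
    rw [intervalIntegral.integral_ofReal,
      intervalIntegral_comp_cos (g := fun c => exp (a * c))
        (Continuous.intervalIntegrable (by fun_prop) _ _), besselI0]
    congr 1
    field_simp
  simp only [hr] at hswap
  rw [integral_complex_ofReal, Complex.ofReal_inj, integral_const_mul, integral_const_mul,
    ← two_mul_besselK0, ← intervalIntegral.integral_of_le (by positivity),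
    intervalIntegral_comp_cos (g := fun c => besselK0 (sqrt (a ^ 2 + b ^ 2 - 2 * a * b * c))) hI]
    at hswap
  rw [one_div, eq_inv_mul_iff_mul_eq₀ hpi.ne']
  linarith

lemma measurable_kL : Measurable kL := by
  unfold kL
  exact Measurable.lintegral_prod_right' (f := fun p : ℝ × ℝ =>
    ofReal (exp (-(p.1 * cosh p.2)))) (by fun_prop)

lemma measurable_kL_dd (τ : ℝ) : Measurable (fun s => kL (dd s * τ)) :=
  measurable_kL.comp (by fun_prop)

lemma besselI0_nonneg (x : ℝ) : 0 ≤ besselI0 x := by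
  unfold besselI0
  have := pi_pos
  refine mul_nonneg (by positivity) (intervalIntegral.integral_nonneg (by positivity)
    fun _ _ => (exp_pos _).le)

lemma lintegral_kL_dd {τ : ℝ} (hτ : 0 < τ) :
    2 * ∫⁻ s in Ioi (0 : ℝ), kL (dd s * τ) = kL τ * kL τ := by
  rw [kL_mul_kL hτ hτ, ← lintegral_comp_abs]
  refine lintegral_congr fun s => ?_
  congr 1
  have h : τ ^ 2 + τ ^ 2 + 2 * τ * τ * cosh s = (dd |s| * τ) ^ 2 := by
    rw [mul_pow, dd_sq, cosh_abs]; ring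
  have := two_le_dd |s|
  rw [h, sqrt_sq (by positivity)]

lemma lintegral_kL_mF {τ : ℝ} (hτ : 0 < τ) :
    ∫⁻ μ, kL (sqrt μ * τ) ∂mF = ofReal (2 * (besselI0 τ * besselK0 τ ^ 2)) := by
  have hpi := pi_pos
  have hm : Measurable (fun μ : ℝ => kL (sqrt μ * τ)) :=
    measurable_kL.comp (by fun_prop)
  have hmK : Measurable (fun x : ℝ × ℝ => kL (sqrt (kF x) * τ)) :=
    hm.comp continuous_kF.measurable
  rw [mF, lintegral_map hm continuous_kF.measurable, muF, lintegral_prod _ hmK.aemeasurable]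
  have h1 : ∀ s : ℝ, ∫⁻ φ, kL (sqrt (kF (s, φ)) * τ)
      ∂(ofReal (1 / π) • volume.restrict (Ioc 0 π)) =
      ofReal (besselI0 τ) * kL (dd s * τ) := by
    intro s
    have hd := two_le_dd s
    obtain ⟨hi, he⟩ := besselI0_mul_besselK0 hτ (b := dd s * τ) (by nlinarith)
    rw [lintegral_smul_measure, kL_eq (by positivity), ← ofReal_mul (besselI0_nonneg _),
      show besselI0 τ * (2 * besselK0 (dd s * τ)) = 2 * (besselI0 τ * besselK0 (dd s * τ)) by ring, he,
      intervalIntegral.integral_of_le hpi.le, mul_left_comm, ← integral_const_mul,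
      ofReal_mul (by positivity), smul_eq_mul,
      ofReal_integral_eq_lintegral_ofReal (hi.const_mul 2)
        (Eventually.of_forall fun φ => mul_nonneg zero_le_two (besselK0_nonneg _))]
    congr 1
    refine lintegral_congr fun φ => ?_
    have hk := one_le_kF (s, φ)
    rw [kL_eq (mul_pos (sqrt_pos.2 (by linarith)) hτ)]
    congr 3
    rw [← sqrt_sq hτ.le, ← sqrt_mul (by linarith), sqrt_sq hτ.le]
    congr 1
    simp only [kF]; ring
  simp only [h1]
  rw [lintegral_const_mul _ (measurable_kL_dd τ)]
  have h2 := lintegral_kL_dd hτ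
  have h3 : ∫⁻ s in Ioi (0 : ℝ), kL (dd s * τ) = ofReal (2 * besselK0 τ ^ 2) := by
    rw [kL_eq hτ, ← ofReal_mul (mul_nonneg zero_le_two (besselK0_nonneg _)),
      show 2 * besselK0 τ * (2 * besselK0 τ) = 2 * (2 * besselK0 τ ^ 2) by ring,
      ofReal_mul zero_le_two, ENNReal.ofReal_ofNat] at h2
    exact (ENNReal.mul_right_inj two_ne_zero ENNReal.ofNat_ne_top).1 h2
  rw [h3, ← ofReal_mul (besselI0_nonneg _)]
  congr 1; ring

lemma lintegral_kL_mG {τ : ℝ} (hτ : 0 < τ) :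
    ∫⁻ μ, kL (sqrt μ * τ) ∂mG = ofReal (2 * besselK0 τ ^ 3) := by
  have hm : Measurable (fun μ : ℝ => kL (sqrt μ * τ)) :=
    measurable_kL.comp (by fun_prop)
  have hmK : Measurable (fun x : ℝ × ℝ => kL (sqrt (kG x) * τ)) :=
    hm.comp continuous_kG.measurable
  rw [mG, lintegral_map hm continuous_kG.measurable, muG, lintegral_prod _ hmK.aemeasurable]
  have h1 : ∀ s : ℝ, 2 * ∫⁻ r in Ioi (0 : ℝ), kL (sqrt (kG (s, r)) * τ) =
      kL τ * kL (dd s * τ) := by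
    intro s
    have hd := two_le_dd s
    rw [kL_mul_kL hτ (by positivity), ← lintegral_comp_abs]
    refine lintegral_congr fun r => ?_
    have hk := nine_le_kG (s, |r|)
    congr 1
    rw [← sqrt_sq hτ.le, ← sqrt_mul (by linarith), sqrt_sq hτ.le]
    congr 1
    simp only [kG, cosh_abs]; ring
  have h2 : 2 * (2 * ∫⁻ s in Ioi (0 : ℝ), ∫⁻ r in Ioi (0 : ℝ), kL (sqrt (kG (s, r)) * τ)) =
      kL τ * (kL τ * kL τ) := by
    rw [← lintegral_const_mul _ hmK.lintegral_prod_right', ← lintegral_kL_dd hτ]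
    simp only [h1]
    rw [lintegral_const_mul _ (measurable_kL_dd τ)]
    ring
  have hK := besselK0_nonneg τ
  rw [kL_eq hτ, ← ofReal_mul (by positivity), ← ofReal_mul (by positivity),
      show 2 * besselK0 τ * (2 * besselK0 τ * (2 * besselK0 τ)) = 2 * (2 * (2 * besselK0 τ ^ 3)) by ring,
      ofReal_mul zero_le_two, ofReal_mul zero_le_two, ENNReal.ofReal_ofNat] at h2
  exact (ENNReal.mul_right_inj two_ne_zero ENNReal.ofNat_ne_top).1
    ((ENNReal.mul_right_inj two_ne_zero ENNReal.ofNat_ne_top).1 h2)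

lemma lintegral_exp_neg_mul {c : ℝ} (hc : 0 < c) :
    ∫⁻ X in Ioi (0 : ℝ), ofReal (exp (-(c * X))) = ofReal (1 / c) := by
  rw [← ofReal_integral_eq_lintegral_ofReal (integrable_exp_neg_mul hc)
    (Eventually.of_forall fun _ => (exp_pos _).le)]
  congr 1
  have := integral_exp_mul_Ioi (neg_lt_zero.2 hc) 0
  simp only [neg_mul, mul_zero, exp_zero] at this
  rw [this]; field_simp

lemma lintegral_mul_exp_neg_mul {c : ℝ} (hc : 0 < c) :
    ∫⁻ X in Ioi (0 : ℝ), ofReal (X * exp (-(c * X))) = ofReal (1 / c ^ 2) := by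
  have h := integral_rpow_mul_exp_neg_mul_Ioi (a := 2) (by norm_num) hc
  have hi : IntegrableOn (fun X : ℝ => X * exp (-(c * X))) (Ioi 0) := by
    by_contra hcon
    have h0 := integral_undef hcon
    have : ∫ t in Ioi (0 : ℝ), t ^ ((2 : ℝ) - 1) * exp (-(c * t)) =
        ∫ t in Ioi (0 : ℝ), t * exp (-(c * t)) := by
      norm_num
    rw [this, h0] at h
    have : 0 < (1 / c) ^ (2 : ℝ) * Real.Gamma 2 := by
      have := Real.Gamma_pos_of_pos (s := 2) (by norm_num)
      positivity
    linarith
  rw [← ofReal_integral_eq_lintegral_ofReal hi]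
  · congr 1
    norm_num at h
    rw [h]
    simp
  · filter_upwards [ae_restrict_mem measurableSet_Ioi] with X hX
    have := mem_Ioi.1 hX
    positivity

lemma lintegral_gauss {c : ℝ} (hc : 0 < c) (k : ℕ) :
    ∫⁻ τ in Ioi (0 : ℝ), ofReal (τ ^ (2 * k + 1) * exp (-(c * τ ^ 2))) =
      ∫⁻ X in Ioi (0 : ℝ), ofReal (X ^ k * exp (-(c * X)) / 2) := by
  have him : (fun τ : ℝ => τ ^ 2) '' Ioi 0 = Ioi 0 := by
    ext x
    simp only [mem_image, mem_Ioi]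
    constructor
    · rintro ⟨τ, hτ, rfl⟩; positivity
    · exact fun hx => ⟨sqrt x, sqrt_pos.2 hx, sq_sqrt hx.le⟩
  have h := lintegral_image_eq_lintegral_abs_deriv_mul (s := Ioi (0 : ℝ)) (f := fun τ => τ ^ 2)
    (f' := fun τ => 2 * τ) measurableSet_Ioi
    (fun x _ => by simpa using (hasDerivAt_pow 2 x).hasDerivWithinAt)
    (fun x hx y hy hxy => by
      have hx' := mem_Ioi.1 hx
      have hy' := mem_Ioi.1 hy
      exact (pow_left_inj₀ hx'.le hy'.le two_ne_zero).1 hxy)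
    (fun X => ofReal (X ^ k * exp (-(c * X)) / 2))
  rw [him] at h
  rw [h]
  refine setLIntegral_congr_fun measurableSet_Ioi fun τ hτ => ?_
  have := mem_Ioi.1 hτ
  rw [← ofReal_mul (abs_nonneg _), abs_of_pos (by positivity)]
  congr 1
  rw [← pow_mul]; ring

/-- The heat kernel representation of `K₀`. -/
noncomputable def heat (μ τ x : ℝ) : ENNReal :=
  ofReal (exp (-(μ * x) - τ ^ 2 / (4 * x)) / x)

lemma lintegral_pow_mul_kL_mul_kL {μ ν : ℝ} (hμ : 0 < μ) (hν : 0 < ν) (k : ℕ) (A : ℝ → ENNReal)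
    (g : ℝ → ℝ → ℝ → ENNReal) (hg : Measurable (fun p : ℝ × ℝ × ℝ => g p.1 p.2.1 p.2.2))
    (hA : ∀ x > 0, ∀ y > 0, ∫⁻ τ in Ioi (0 : ℝ), ofReal (τ ^ k) *
      (heat μ τ x * heat ν τ y) = ∫⁻ X in Ioi (0 : ℝ), g x y X)
    (hB : ∀ X > 0, ∫⁻ x in Ioi (0 : ℝ), ∫⁻ y in Ioi (0 : ℝ), g x y X = A X) :
    ∫⁻ τ in Ioi (0 : ℝ), ofReal (τ ^ k) * (kL (sqrt μ * τ) * kL (sqrt ν * τ)) =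
      ∫⁻ X in Ioi (0 : ℝ), A X := by
  have hm1 : ∀ μ, Measurable (fun p : ℝ × ℝ => heat μ p.1 p.2) := fun μ => by unfold heat; fun_prop
  have hm2 : ∀ μ τ, Measurable (fun x : ℝ => heat μ τ x) := fun μ τ => by unfold heat; fun_prop
  have h1 : ∀ τ > 0, ofReal (τ ^ k) * (kL (sqrt μ * τ) * kL (sqrt ν * τ)) =
      ∫⁻ x in Ioi (0 : ℝ), ∫⁻ y in Ioi (0 : ℝ), ofReal (τ ^ k) * (heat μ τ x * heat ν τ y) := by
    intro τ hτ
    rw [← kL_heat hμ hτ, ← kL_heat hν hτ]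
    change _ * ((∫⁻ x in Ioi (0 : ℝ), heat μ τ x) * (∫⁻ x in Ioi (0 : ℝ), heat ν τ x)) = _
    have : ∀ x, ∫⁻ y in Ioi (0 : ℝ), ofReal (τ ^ k) * (heat μ τ x * heat ν τ y) =
        ofReal (τ ^ k) * (heat μ τ x * ∫⁻ y in Ioi (0 : ℝ), heat ν τ y) := by
      intro x
      rw [lintegral_const_mul _ (by fun_prop), lintegral_const_mul _ (by fun_prop)]
    simp only [this]
    rw [lintegral_const_mul _ (by fun_prop), lintegral_mul_const _ (by fun_prop)]
  rw [setLIntegral_congr_fun measurableSet_Ioi (fun τ hτ => h1 τ hτ)]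
  have hM : Measurable (fun p : ℝ × ℝ × ℝ =>
      ofReal (p.1 ^ k) * (heat μ p.1 p.2.1 * heat ν p.1 p.2.2)) := by
    unfold heat; fun_prop
  have hM' : Measurable (fun p : (ℝ × ℝ) × ℝ =>
      ofReal (p.1.1 ^ k) * (heat μ p.1.1 p.1.2 * heat ν p.1.1 p.2)) := by
    unfold heat; fun_prop
  rw [lintegral_lintegral_swap (hM'.lintegral_prod_right').aemeasurable]
  have h2 : ∀ x > 0, ∫⁻ τ in Ioi (0 : ℝ), ∫⁻ y in Ioi (0 : ℝ),
      ofReal (τ ^ k) * (heat μ τ x * heat ν τ y) =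
      ∫⁻ X in Ioi (0 : ℝ), ∫⁻ y in Ioi (0 : ℝ), g x y X := by
    intro x hx
    rw [lintegral_lintegral_swap (by unfold heat; fun_prop),
      setLIntegral_congr_fun measurableSet_Ioi (fun y hy => hA x hx y hy)]
    exact lintegral_lintegral_swap
      (hg.comp (measurable_const.prodMk (measurable_fst.prodMk measurable_snd))).aemeasurable
  rw [setLIntegral_congr_fun measurableSet_Ioi (fun x hx => h2 x hx), lintegral_lintegral_swap]
  · exact setLIntegral_congr_fun measurableSet_Ioi (fun X hX => hB X hX)
  · have : Measurable (fun p : (ℝ × ℝ) × ℝ => g p.1.1 p.2 p.1.2) :=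
      hg.comp ((measurable_fst.comp measurable_fst).prodMk
        (measurable_snd.prodMk (measurable_snd.comp measurable_fst)))
    exact this.lintegral_prod_right'.aemeasurable

lemma heat_mul_heat {μ ν τ x y : ℝ} (hx : 0 < x) (hy : 0 < y) : heat μ τ x * heat ν τ y =
    ofReal (exp (-(μ * x)) * exp (-(ν * y)) / (x * y)) *
      ofReal (exp (-((x + y) / (4 * (x * y)) * τ ^ 2))) := by
  unfold heat
  rw [← ofReal_mul (by positivity), ← ofReal_mul (by positivity)]
  congr 1
  rw [div_mul_div_comm, ← exp_add, div_mul_eq_mul_div, ← exp_add, ← exp_add]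
  congr 2
  field_simp
  ring

lemma lintegral_mul_kL_mul_kL {μ ν : ℝ} (hμ : 0 < μ) (hν : 0 < ν) :
    ∫⁻ τ in Ioi (0 : ℝ), ofReal (τ ^ 1) * (kL (sqrt μ * τ) * kL (sqrt ν * τ)) =
      ∫⁻ X in Ioi (0 : ℝ), 2 * (ofReal (1 / (μ + X)) * ofReal (1 / (ν + X))) := by
  refine lintegral_pow_mul_kL_mul_kL hμ hν 1 _ (fun x y X => 2 * (ofReal
    (exp (-((μ + X) * x))) * ofReal (exp (-((ν + X) * y))))) (by fun_prop) ?_ ?_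
  · intro x hx y hy
    have hxy : 0 < x * y := mul_pos hx hy
    have h := lintegral_gauss (c := (x + y) / (4 * (x * y))) (by positivity) 0
    simp only [heat_mul_heat hx hy]
    have e : ∀ τ : ℝ, 0 < τ → ofReal (τ ^ 1) *
        (ofReal (exp (-(μ * x)) * exp (-(ν * y)) / (x * y)) *
      ofReal (exp (-((x + y) / (4 * (x * y)) * τ ^ 2)))) =
      ofReal (exp (-(μ * x)) * exp (-(ν * y)) / (x * y)) *
      ofReal (τ ^ (2 * 0 + 1) * exp (-((x + y) / (4 * (x * y)) * τ ^ 2))) := by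
      intro τ hτ
      rw [← ofReal_mul (by positivity), ← ofReal_mul (by positivity),
        ← ofReal_mul (by positivity)]
      congr 1; ring
    rw [setLIntegral_congr_fun measurableSet_Ioi (fun τ hτ => e τ hτ),
      lintegral_const_mul _ (by fun_prop), h]
    have e2 : ∀ X : ℝ, ofReal (X ^ 0 * exp (-((x + y) / (4 * (x * y)) * X)) / 2) =
        ofReal (1 / 2) * ofReal (exp (-((x + y) / (4 * (x * y)) * X))) := by
      intro X
      rw [← ofReal_mul (by positivity)]; congr 1; ring
    have e3 : ∀ X : ℝ, 2 * (ofReal (exp (-((μ + X) * x))) *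
        ofReal (exp (-((ν + X) * y)))) =
        ofReal (2 * (exp (-(μ * x)) * exp (-(ν * y)))) *
          ofReal (exp (-((x + y) * X))) := by
      intro X
      rw [← ENNReal.ofReal_ofNat, ← ofReal_mul (by positivity), ← ofReal_mul (by positivity),
        ← ofReal_mul (by positivity), ← exp_add, ← exp_add, mul_assoc, ← exp_add]
      congr 3; ring
    simp only [e2, e3]
    rw [lintegral_const_mul _ (by fun_prop), lintegral_const_mul _ (by fun_prop),
      lintegral_exp_neg_mul (by positivity), lintegral_exp_neg_mul (by positivity),
      ← ofReal_mul (by positivity), ← ofReal_mul (by positivity),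
      ← ofReal_mul (by positivity)]
    congr 1
    field_simp
    ring
  · intro X hX
    have : ∀ x, ∫⁻ y in Ioi (0 : ℝ), 2 * (ofReal (exp (-((μ + X) * x))) *
        ofReal (exp (-((ν + X) * y)))) =
        2 * (ofReal (exp (-((μ + X) * x))) * ofReal (1 / (ν + X))) := by
      intro x
      rw [lintegral_const_mul _ (by fun_prop), lintegral_const_mul _ (by fun_prop),
        lintegral_exp_neg_mul (add_pos hν hX)]
    simp only [this]
    rw [lintegral_const_mul _ (by fun_prop), lintegral_mul_const _ (by fun_prop),
        lintegral_exp_neg_mul (add_pos hμ hX)]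

lemma lintegral_pow_three_mul_kL_mul_kL {μ ν : ℝ} (hμ : 0 < μ) (hν : 0 < ν) :
    ∫⁻ τ in Ioi (0 : ℝ), ofReal (τ ^ 3) * (kL (sqrt μ * τ) * kL (sqrt ν * τ)) =
      ∫⁻ X in Ioi (0 : ℝ), ofReal (8 * X) *
        (ofReal (1 / (μ + X) ^ 2) * ofReal (1 / (ν + X) ^ 2)) := by
  refine lintegral_pow_mul_kL_mul_kL hμ hν 3 _ (fun x y X => ofReal (8 * X) * (ofReal
    (x * exp (-((μ + X) * x))) * ofReal (y * exp (-((ν + X) * y))))) (by fun_prop) ?_ ?_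
  · intro x hx y hy
    have hxy : 0 < x * y := mul_pos hx hy
    have h := lintegral_gauss (c := (x + y) / (4 * (x * y))) (by positivity) 1
    simp only [heat_mul_heat hx hy]
    have e : ∀ τ : ℝ, 0 < τ → ofReal (τ ^ 3) *
        (ofReal (exp (-(μ * x)) * exp (-(ν * y)) / (x * y)) *
      ofReal (exp (-((x + y) / (4 * (x * y)) * τ ^ 2)))) =
      ofReal (exp (-(μ * x)) * exp (-(ν * y)) / (x * y)) *
      ofReal (τ ^ (2 * 1 + 1) * exp (-((x + y) / (4 * (x * y)) * τ ^ 2))) := by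
      intro τ hτ
      rw [← ofReal_mul (by positivity), ← ofReal_mul (by positivity),
        ← ofReal_mul (by positivity)]
      congr 1; ring
    rw [setLIntegral_congr_fun measurableSet_Ioi (fun τ hτ => e τ hτ),
      lintegral_const_mul _ (by fun_prop), h]
    have e2 : ∀ X : ℝ, ofReal (X ^ 1 * exp (-((x + y) / (4 * (x * y)) * X)) / 2) =
        ofReal (1 / 2) * ofReal (X * exp (-((x + y) / (4 * (x * y)) * X))) := by
      intro X
      rw [← ofReal_mul (by positivity)]; congr 1; ring
    have e3 : ∀ X : ℝ, 0 < X → ofReal (8 * X) * (ofReal (x * exp (-((μ + X) * x))) *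
        ofReal (y * exp (-((ν + X) * y)))) =
        ofReal (8 * (x * y) * (exp (-(μ * x)) * exp (-(ν * y)))) *
          ofReal (X * exp (-((x + y) * X))) := by
      intro X hX
      have hx' : 0 < x := hx
      have hy' : 0 < y := hy
      rw [← ofReal_mul (by positivity), ← ofReal_mul (by positivity),
        ← ofReal_mul (by positivity),
        show -((μ + X) * x) = -(μ * x) + -(X * x) by ring, show -((ν + X) * y) = -(ν * y) + -(X * y) by ring,
        show -((x + y) * X) = -(X * x) + -(X * y) by ring, exp_add, exp_add, exp_add]
      congr 1; ring
    rw [setLIntegral_congr_fun measurableSet_Ioi (fun X hX => e3 X hX)]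
    simp only [e2]
    rw [lintegral_const_mul _ (by fun_prop), lintegral_const_mul _ (by fun_prop),
      lintegral_mul_exp_neg_mul (by positivity), lintegral_mul_exp_neg_mul (by positivity),
      ← ofReal_mul (by positivity), ← ofReal_mul (by positivity),
      ← ofReal_mul (by positivity)]
    congr 1
    field_simp
    ring
  · intro X hX
    have : ∀ x, ∫⁻ y in Ioi (0 : ℝ), ofReal (8 * X) * (ofReal (x * exp (-((μ + X) * x))) *
        ofReal (y * exp (-((ν + X) * y)))) =
        ofReal (8 * X) * (ofReal (x * exp (-((μ + X) * x))) *
          ofReal (1 / (ν + X) ^ 2)) := by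
      intro x
      rw [lintegral_const_mul _ (by fun_prop), lintegral_const_mul _ (by fun_prop),
        lintegral_mul_exp_neg_mul (add_pos hν hX)]
    simp only [this]
    rw [lintegral_const_mul _ (by fun_prop), lintegral_mul_const _ (by fun_prop),
        lintegral_mul_exp_neg_mul (add_pos hμ hX)]

lemma lintegral_mul_of_spectral {m₁ m₂ : Measure ℝ} [SFinite m₁] [SFinite m₂]
    (h₁ : ∀ᵐ t ∂m₁, 1 ≤ t) (h₂ : ∀ᵐ t ∂m₂, 1 ≤ t) {P₁ P₂ a₁ a₂ b : ℝ → ENNReal} {k l : ℕ}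
    (hP₁ : ∀ τ > 0, ∫⁻ μ, kL (sqrt μ * τ) ∂m₁ = P₁ τ)
    (hP₂ : ∀ τ > 0, ∫⁻ μ, kL (sqrt μ * τ) ∂m₂ = P₂ τ)
    (ha₁ : ∀ X > 0, ∫⁻ μ, ofReal (1 / (μ + X) ^ l) ∂m₁ = a₁ X)
    (ha₂ : ∀ X > 0, ∫⁻ μ, ofReal (1 / (μ + X) ^ l) ∂m₂ = a₂ X) (hb : Measurable b)
    (hk : ∀ μ ν : ℝ, 0 < μ → 0 < ν → ∫⁻ τ in Ioi (0 : ℝ), ofReal (τ ^ k) *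
      (kL (sqrt μ * τ) * kL (sqrt ν * τ)) = ∫⁻ X in Ioi (0 : ℝ), b X *
        (ofReal (1 / (μ + X) ^ l) * ofReal (1 / (ν + X) ^ l))) :
    ∫⁻ τ in Ioi (0 : ℝ), ofReal (τ ^ k) * (P₁ τ * P₂ τ) =
      ∫⁻ X in Ioi (0 : ℝ), b X * (a₁ X * a₂ X) := by
  have general : ∀ (c : ℝ → ENNReal) (f : ℝ → ℝ → ENNReal), Measurable c →
      Measurable (fun p : ℝ × ℝ => f p.1 p.2) →
      ∫⁻ τ in Ioi (0 : ℝ), c τ * ((∫⁻ μ, f μ τ ∂m₁) * ∫⁻ ν, f ν τ ∂m₂) =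
        ∫⁻ μ, ∫⁻ ν, (∫⁻ τ in Ioi (0 : ℝ), c τ * (f μ τ * f ν τ)) ∂m₂ ∂m₁ := by
    intro c f hc hf
    have hf1 : ∀ τ, Measurable (fun μ => f μ τ) := fun τ => hf.comp (measurable_id.prodMk measurable_const)
    have e : ∀ τ, c τ * ((∫⁻ μ, f μ τ ∂m₁) * ∫⁻ ν, f ν τ ∂m₂) =
        ∫⁻ μ, ∫⁻ ν, c τ * (f μ τ * f ν τ) ∂m₂ ∂m₁ := by
      intro τ
      have : ∀ μ, ∫⁻ ν, c τ * (f μ τ * f ν τ) ∂m₂ = c τ * (f μ τ * ∫⁻ ν, f ν τ ∂m₂) := by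
        intro μ
        rw [lintegral_const_mul _ ((hf1 τ).const_mul _), lintegral_const_mul _ (hf1 τ)]
      simp only [this]
      rw [lintegral_const_mul _ ((hf1 τ).mul_const _), lintegral_mul_const _ (hf1 τ)]
    simp only [e]
    have hM : Measurable (fun p : (ℝ × ℝ) × ℝ => c p.1.1 * (f p.1.2 p.1.1 * f p.2 p.1.1)) := by
      have a1 : Measurable (fun p : (ℝ × ℝ) × ℝ => c p.1.1) := hc.comp (measurable_fst.comp measurable_fst)
      have a2 : Measurable (fun p : (ℝ × ℝ) × ℝ => f p.1.2 p.1.1) :=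
        hf.comp ((measurable_snd.comp measurable_fst).prodMk (measurable_fst.comp measurable_fst))
      have a3 : Measurable (fun p : (ℝ × ℝ) × ℝ => f p.2 p.1.1) :=
        hf.comp (measurable_snd.prodMk (measurable_fst.comp measurable_fst))
      exact a1.mul (a2.mul a3)
    rw [lintegral_lintegral_swap hM.lintegral_prod_right'.aemeasurable]
    refine lintegral_congr fun μ => lintegral_lintegral_swap ?_
    exact (hM.comp ((measurable_fst.prodMk measurable_const).prodMk measurable_snd)).aemeasurable
  have hkm : Measurable (fun p : ℝ × ℝ => kL (sqrt p.1 * p.2)) := measurable_kL.comp (by fun_prop)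
  have e1 := general (fun τ => ofReal (τ ^ k)) (fun μ τ => kL (sqrt μ * τ)) (by fun_prop) hkm
  have e2 := general b (fun μ X => ofReal (1 / (μ + X) ^ l)) hb (by fun_prop)
  have e3 : ∫⁻ τ in Ioi (0 : ℝ), ofReal (τ ^ k) * (P₁ τ * P₂ τ) =
      ∫⁻ τ in Ioi (0 : ℝ), ofReal (τ ^ k) * ((∫⁻ μ, kL (sqrt μ * τ) ∂m₁) *
        ∫⁻ μ, kL (sqrt μ * τ) ∂m₂) :=
    setLIntegral_congr_fun measurableSet_Ioi fun τ hτ => by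
      simp only [hP₁ τ hτ, hP₂ τ hτ]
  have e4 : ∫⁻ X in Ioi (0 : ℝ), b X * (a₁ X * a₂ X) =
      ∫⁻ X in Ioi (0 : ℝ), b X * ((∫⁻ μ, ofReal (1 / (μ + X) ^ l) ∂m₁) *
        ∫⁻ μ, ofReal (1 / (μ + X) ^ l) ∂m₂) :=
    setLIntegral_congr_fun measurableSet_Ioi fun τ hτ => by
      simp only [ha₁ τ hτ, ha₂ τ hτ]
  rw [e3, e4, e1, e2]
  refine lintegral_congr_ae ?_
  filter_upwards [h₁] with μ hμ
  refine lintegral_congr_ae ?_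
  filter_upwards [h₂] with ν hν
  exact hk μ ν (by linarith) (by linarith)

lemma measurable_besselK0 : Measurable besselK0 := by
  unfold besselK0
  exact (StronglyMeasurable.integral_prod_right' (f := fun p : ℝ × ℝ => exp (-(p.1 * cosh p.2)))
    (by fun_prop)).measurable

lemma measurable_besselI0 : Measurable besselI0 := by
  unfold besselI0
  simp only [intervalIntegral.integral_of_le pi_pos.le]
  exact ((StronglyMeasurable.integral_prod_right' (f := fun p : ℝ × ℝ => exp (p.1 * cos p.2))
    (by fun_prop)).measurable).const_mul _

lemma setIntegral_eq_of_lintegral_eq {f g : ℝ → ℝ} (hf : ∀ x > 0, 0 ≤ f x) (hg : ∀ x > 0, 0 ≤ g x)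
    (hfm : AEStronglyMeasurable f (volume.restrict (Ioi 0)))
    (hgm : AEStronglyMeasurable g (volume.restrict (Ioi 0)))
    (h : ∫⁻ x in Ioi (0 : ℝ), ofReal (f x) = ∫⁻ x in Ioi (0 : ℝ), ofReal (g x)) :
    ∫ x in Ioi (0 : ℝ), f x = ∫ x in Ioi (0 : ℝ), g x := by
  rw [integral_eq_lintegral_of_nonneg_ae _ hfm, integral_eq_lintegral_of_nonneg_ae _ hgm, h]
  · filter_upwards [ae_restrict_mem measurableSet_Ioi] with x hx using hg x hx
  · filter_upwards [ae_restrict_mem measurableSet_Ioi] with x hx using hf x hx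

lemma lintegral_inv_pow {m : Measure ℝ} (hm : ∀ᵐ t ∂m, 1 ≤ t) (hi : Integrable (fun t : ℝ => 1 / t) m)
    (k : ℕ) {X : ℝ} (hX : 0 < X) : ∫⁻ μ, ofReal (1 / (μ + X) ^ (k + 1)) ∂m =
      ofReal (∫ t, 1 / (t + X) ^ (k + 1) ∂m) := by
  have h : Integrable (fun t : ℝ => 1 / (t + X) ^ (k + 1)) m := by
    have := integrable_stieltjes (𝕜 := ℝ) hm (h := fun _ => 1) aestronglyMeasurable_const hi (z := X)
      (by simp; linarith) k
    simpa using this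
  rw [ofReal_integral_eq_lintegral_ofReal h]
  filter_upwards [hm] with t ht
  have : 0 < t + X := by linarith
  positivity

lemma GG_def (X : ℝ) : GG X = ∫ t, 1 / (t + X) ∂mG := by
  simp [GG, stieltjes]
lemma GG1_def (X : ℝ) : GG1 X = -∫ t, 1 / (t + X) ^ 2 ∂mG := by
  simp [GG1, stieltjes]

lemma lint_FF {X : ℝ} (hX : 0 < X) : ∫⁻ μ, ofReal (1 / (μ + X) ^ 1) ∂mF = ofReal (FF X) := by
  rw [lintegral_inv_pow one_le_mF integrable_inv_mF 0 hX, FF_def]; simp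
lemma lint_GG {X : ℝ} (hX : 0 < X) : ∫⁻ μ, ofReal (1 / (μ + X) ^ 1) ∂mG = ofReal (GG X) := by
  rw [lintegral_inv_pow one_le_mG integrable_inv_mG 0 hX, GG_def]; simp
lemma lint_FF1 {X : ℝ} (hX : 0 < X) :
    ∫⁻ μ, ofReal (1 / (μ + X) ^ 2) ∂mF = ofReal (-FF1 X) := by
  rw [lintegral_inv_pow one_le_mF integrable_inv_mF 1 hX, FF1_def, neg_neg]
lemma lint_GG1 {X : ℝ} (hX : 0 < X) :
    ∫⁻ μ, ofReal (1 / (μ + X) ^ 2) ∂mG = ofReal (-GG1 X) := by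
  rw [lintegral_inv_pow one_le_mG integrable_inv_mG 1 hX, GG1_def, neg_neg]

lemma GG_nonneg {X : ℝ} (hX : 0 < X) : 0 ≤ GG X := by
  rw [GG_def]
  refine integral_nonneg_of_ae ?_
  filter_upwards [one_le_mG] with t ht
  have : 0 < t + X := by linarith
  simp only [Pi.zero_apply]; positivity

lemma GG1_nonpos {X : ℝ} : 0 ≤ -GG1 X := by
  rw [GG1_def, neg_neg]
  exact integral_nonneg fun t => by positivity

lemma lintegral_one {μ ν : ℝ} (hμ : 0 < μ) (hν : 0 < ν) :
    ∫⁻ τ in Ioi (0 : ℝ), ofReal (τ ^ 1) *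
      (kL (sqrt μ * τ) * kL (sqrt ν * τ)) = ∫⁻ X in Ioi (0 : ℝ), (fun _ => 2) X *
        (ofReal (1 / (μ + X) ^ 1) * ofReal (1 / (ν + X) ^ 1)) := by
  rw [lintegral_mul_kL_mul_kL hμ hν]; simp only [pow_one]

lemma besselMoment_eq_one {a b : ℕ} {U V A B : ℝ → ℝ} (hU : ∀ X > 0, 0 ≤ U X) (hV : ∀ X > 0, 0 ≤ V X)
    (hUc : ContinuousOn U (Ioi 0)) (hVc : ContinuousOn V (Ioi 0))
    (hA : ∀ τ > 0, 0 ≤ A τ) (hB : ∀ τ > 0, 0 ≤ B τ)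
    (hAB : ∀ τ, A τ * B τ = besselI0 τ ^ a * besselK0 τ ^ b)
    (h : ∫⁻ τ in Ioi (0 : ℝ), ofReal (τ ^ 1) *
      (ofReal (2 * A τ) * ofReal (2 * B τ)) =
      ∫⁻ X in Ioi (0 : ℝ), (fun _ => 2) X * (ofReal (U X) * ofReal (V X))) :
    besselMoment a b 1 = 1 / 2 * ∫ X in Ioi (0 : ℝ), U X * V X := by
  have h' : ∫ τ in Ioi (0 : ℝ), 4 * (besselI0 τ ^ a * besselK0 τ ^ b * τ ^ 1) =
      ∫ X in Ioi (0 : ℝ), 2 * (U X * V X) := by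
    refine setIntegral_eq_of_lintegral_eq ?_ ?_ ?_ ?_ ?_
    · intro τ hτ
      have := besselI0_nonneg τ
      have := besselK0_nonneg τ
      have hτ' : 0 < τ := hτ
      positivity
    · exact fun X hX => mul_nonneg zero_le_two (mul_nonneg (hU X hX) (hV X hX))
    · have := measurable_besselI0
      have := measurable_besselK0
      exact Measurable.aestronglyMeasurable (by fun_prop)
    · exact ((hUc.mul hVc).aestronglyMeasurable measurableSet_Ioi).const_mul 2
    · have e1 : ∀ τ ∈ Ioi (0 : ℝ), ofReal (4 * (besselI0 τ ^ a * besselK0 τ ^ b * τ ^ 1)) =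
          ofReal (τ ^ 1) * (ofReal (2 * A τ) * ofReal (2 * B τ)) := by
        intro τ hτ
        have h1 := hA τ hτ
        have h2 := hB τ hτ
        have hτ' : 0 < τ := hτ
        rw [← ofReal_mul (by positivity), ← ofReal_mul (by positivity), ← hAB]
        congr 1; ring
      have e2 : ∀ X ∈ Ioi (0 : ℝ), ofReal (2 * (U X * V X)) =
          (fun _ => 2) X * (ofReal (U X) * ofReal (V X)) := by
        intro X hX
        rw [ofReal_mul zero_le_two, ofReal_mul (hU X hX), ENNReal.ofReal_ofNat]
      rw [setLIntegral_congr_fun measurableSet_Ioi e1, setLIntegral_congr_fun measurableSet_Ioi e2, h]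
  rw [integral_const_mul, integral_const_mul] at h'
  rw [besselMoment]; linarith

lemma besselMoment_eq_three {a b : ℕ} {U V A B : ℝ → ℝ} (hU : ∀ X > 0, 0 ≤ -U X) (hV : ∀ X > 0, 0 ≤ -V X)
    (hUc : ContinuousOn U (Ioi 0)) (hVc : ContinuousOn V (Ioi 0))
    (hA : ∀ τ > 0, 0 ≤ A τ) (hB : ∀ τ > 0, 0 ≤ B τ)
    (hAB : ∀ τ, A τ * B τ = besselI0 τ ^ a * besselK0 τ ^ b)
    (h : ∫⁻ τ in Ioi (0 : ℝ), ofReal (τ ^ 3) *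
      (ofReal (2 * A τ) * ofReal (2 * B τ)) =
      ∫⁻ X in Ioi (0 : ℝ), ofReal (8 * X) * (ofReal (-U X) * ofReal (-V X))) :
    besselMoment a b 3 = 2 * ∫ X in Ioi (0 : ℝ), X * U X * V X := by
  have h' : ∫ τ in Ioi (0 : ℝ), 4 * (besselI0 τ ^ a * besselK0 τ ^ b * τ ^ 3) =
      ∫ X in Ioi (0 : ℝ), 8 * (X * U X * V X) := by
    refine setIntegral_eq_of_lintegral_eq ?_ ?_ ?_ ?_ ?_
    · intro τ hτ
      have := besselI0_nonneg τ
      have := besselK0_nonneg τ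
      have hτ' : 0 < τ := hτ
      positivity
    · intro X hX
      have := mul_nonneg (le_of_lt (show 0 < X from hX)) (mul_nonneg (hU X hX) (hV X hX))
      linarith
    · have := measurable_besselI0
      have := measurable_besselK0
      exact Measurable.aestronglyMeasurable (by fun_prop)
    · exact (((continuousOn_id.mul hUc).mul hVc).aestronglyMeasurable measurableSet_Ioi).const_mul 8
    · have e1 : ∀ τ ∈ Ioi (0 : ℝ), ofReal (4 * (besselI0 τ ^ a * besselK0 τ ^ b * τ ^ 3)) =
          ofReal (τ ^ 3) * (ofReal (2 * A τ) * ofReal (2 * B τ)) := by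
        intro τ hτ
        have h1 := hA τ hτ
        have h2 := hB τ hτ
        have hτ' : 0 < τ := hτ
        rw [← ofReal_mul (by positivity), ← ofReal_mul (by positivity), ← hAB]
        congr 1; ring
      have e2 : ∀ X ∈ Ioi (0 : ℝ), ofReal (8 * (X * U X * V X)) =
          ofReal (8 * X) * (ofReal (-U X) * ofReal (-V X)) := by
        intro X hX
        have hX' : 0 < X := hX
        rw [← ofReal_mul (hU X hX), ← ofReal_mul (by positivity)]
        congr 1; ring
      rw [setLIntegral_congr_fun measurableSet_Ioi e1, setLIntegral_congr_fun measurableSet_Ioi e2, h]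
  rw [integral_const_mul, integral_const_mul] at h'
  rw [besselMoment]; linarith

lemma contGG : ContinuousOn GG (Ioi 0) := fun X hX =>
  (hasDerivAt_GG (by linarith [mem_Ioi.1 hX])).continuousAt.continuousWithinAt
lemma contGG1 : ContinuousOn GG1 (Ioi 0) := fun X hX =>
  (hasDerivAt_GG1 (by linarith [mem_Ioi.1 hX])).continuousAt.continuousWithinAt

lemma besselMoment_241 : besselMoment 2 4 1 = 1 / 2 * ∫ X in Ioi (0 : ℝ), FF X * FF X :=
  besselMoment_eq_one (A := fun τ => besselI0 τ * besselK0 τ ^ 2) (B := fun τ => besselI0 τ * besselK0 τ ^ 2)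
    (fun X hX => (FF_pos (by linarith)).le) (fun X hX => (FF_pos (by linarith)).le) contFF contFF
    (fun τ _ => mul_nonneg (besselI0_nonneg _) (pow_nonneg (besselK0_nonneg _) _))
    (fun τ _ => mul_nonneg (besselI0_nonneg _) (pow_nonneg (besselK0_nonneg _) _)) (fun τ => by ring)
    (lintegral_mul_of_spectral one_le_mF one_le_mF (fun τ hτ => lintegral_kL_mF hτ)
      (fun τ hτ => lintegral_kL_mF hτ) (fun X hX => lint_FF hX) (fun X hX => lint_FF hX)
      measurable_const (fun μ ν hμ hν => lintegral_one hμ hν))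

lemma besselMoment_151 : besselMoment 1 5 1 = 1 / 2 * ∫ X in Ioi (0 : ℝ), FF X * GG X :=
  besselMoment_eq_one (A := fun τ => besselI0 τ * besselK0 τ ^ 2) (B := fun τ => besselK0 τ ^ 3)
    (fun X hX => (FF_pos (by linarith)).le) (fun X hX => GG_nonneg hX) contFF contGG
    (fun τ _ => mul_nonneg (besselI0_nonneg _) (pow_nonneg (besselK0_nonneg _) _))
    (fun τ _ => pow_nonneg (besselK0_nonneg _) _) (fun τ => by ring)
    (lintegral_mul_of_spectral one_le_mF one_le_mG (fun τ hτ => lintegral_kL_mF hτ)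
      (fun τ hτ => lintegral_kL_mG hτ) (fun X hX => lint_FF hX) (fun X hX => lint_GG hX)
      measurable_const (fun μ ν hμ hν => lintegral_one hμ hν))

lemma besselMoment_243 : besselMoment 2 4 3 = 2 * ∫ X in Ioi (0 : ℝ), X * FF1 X * FF1 X :=
  besselMoment_eq_three (A := fun τ => besselI0 τ * besselK0 τ ^ 2) (B := fun τ => besselI0 τ * besselK0 τ ^ 2)
    (fun X hX => by linarith [FF1_neg (X := X) (by linarith)])
    (fun X hX => by linarith [FF1_neg (X := X) (by linarith)]) contFF1 contFF1
    (fun τ _ => mul_nonneg (besselI0_nonneg _) (pow_nonneg (besselK0_nonneg _) _))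
    (fun τ _ => mul_nonneg (besselI0_nonneg _) (pow_nonneg (besselK0_nonneg _) _)) (fun τ => by ring)
    (lintegral_mul_of_spectral one_le_mF one_le_mF (fun τ hτ => lintegral_kL_mF hτ)
      (fun τ hτ => lintegral_kL_mF hτ) (fun X hX => lint_FF1 hX) (fun X hX => lint_FF1 hX)
      (by fun_prop) (fun μ ν hμ hν => lintegral_pow_three_mul_kL_mul_kL hμ hν))

lemma besselMoment_153 : besselMoment 1 5 3 = 2 * ∫ X in Ioi (0 : ℝ), X * FF1 X * GG1 X :=
  besselMoment_eq_three (A := fun τ => besselI0 τ * besselK0 τ ^ 2) (B := fun τ => besselK0 τ ^ 3)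
    (fun X hX => by linarith [FF1_neg (X := X) (by linarith)])
    (fun X hX => GG1_nonpos) contFF1 contGG1
    (fun τ _ => mul_nonneg (besselI0_nonneg _) (pow_nonneg (besselK0_nonneg _) _))
    (fun τ _ => pow_nonneg (besselK0_nonneg _) _) (fun τ => by ring)
    (lintegral_mul_of_spectral one_le_mF one_le_mG (fun τ hτ => lintegral_kL_mF hτ)
      (fun τ hτ => lintegral_kL_mG hτ) (fun X hX => lint_FF1 hX) (fun X hX => lint_GG1 hX)
      (by fun_prop) (fun μ ν hμ hν => lintegral_pow_three_mul_kL_mul_kL hμ hν))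

lemma dedekindEta_eq (z : ℂ) : dedekindEta z = ModularForm.eta z := by
  unfold dedekindEta ModularForm.eta
  congr 1
  · simp [Function.Periodic.qParam]; ring_nf
  · refine tprod_congr fun n => ?_
    rw [ModularForm.eta_q_eq_cexp]

lemma dedekindEta_ne_zero {z : ℂ} (hz : 0 < z.im) : dedekindEta z ≠ 0 := by
  rw [dedekindEta_eq]; exact ModularForm.eta_ne_zero hz

lemma differentiableAt_dedekindEta {z : ℂ} (hz : 0 < z.im) : DifferentiableAt ℂ dedekindEta z := by
  rw [show dedekindEta = ModularForm.eta from funext dedekindEta_eq]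
  exact ModularForm.differentiableAt_eta_of_mem_upperHalfPlaneSet hz

lemma dedekindEta_add_one (z : ℂ) :
    dedekindEta (z + 1) = Complex.exp (π * I / 12) * dedekindEta z := by
  unfold dedekindEta
  rw [← mul_assoc, ← Complex.exp_add]
  congr 1
  · congr 1; ring
  · refine tprod_congr fun n => ?_
    congr 1
    rw [Complex.exp_eq_exp_iff_exists_int]
    exact ⟨n + 1, by push_cast; ring⟩

lemma sqrt_I_inv_mul_sqrt {z : ℂ} (hz : 0 < z.im) :
    (Complex.sqrt I)⁻¹ * Complex.sqrt z = (-I * z) ^ (1 / 2 : ℂ) := by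
  have hz0 : z ≠ 0 := by rintro rfl; simp at hz
  have hI := Complex.I_ne_zero
  have h1 : -I * z ≠ 0 := mul_ne_zero (neg_ne_zero.2 hI) hz0
  have hlog : Complex.log (-I * z) = Complex.log (-I) + Complex.log z := by
    rw [Complex.log_mul_eq_add_log_iff (neg_ne_zero.2 hI) hz0, Complex.arg_neg_I]
    have a1 := (Complex.arg_mem_Ioc z).2
    have a2 : 0 ≤ Complex.arg z := Complex.arg_nonneg_iff.2 hz.le
    constructor <;> linarith [pi_pos]
  rw [sqrt_eq_exp hI, sqrt_eq_exp hz0, ← Complex.exp_neg, ← Complex.exp_add,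
    Complex.cpow_def_of_ne_zero h1, hlog, Complex.log_neg_I, Complex.log_I]
  congr 1; ring

lemma dedekindEta_neg_inv {z : ℂ} (hz : 0 < z.im) :
    dedekindEta (-1 / z) = (-I * z) ^ (1 / 2 : ℂ) * dedekindEta z := by
  have := ModularForm.eta_comp_eq_csqrt_I_inv (x := z) hz
  simp only [Function.comp_apply, Pi.smul_apply, Pi.mul_apply, smul_eq_mul] at this
  rw [dedekindEta_eq, this, ← sqrt_I_inv_mul_sqrt hz, dedekindEta_eq]; ring

lemma cpow_half_sq {w : ℂ} : (w ^ (1 / 2 : ℂ)) ^ 2 = w := by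
  rw [← Complex.cpow_nat_mul]; norm_num

lemma dedekindEta_neg_inv_sq {z : ℂ} (hz : 0 < z.im) :
    dedekindEta (-1 / z) ^ 2 = -I * z * dedekindEta z ^ 2 := by
  rw [dedekindEta_neg_inv hz, mul_pow, cpow_half_sq]

/-- The Euler product `∏ (1 - q ^ n)`. -/
noncomputable def eu (q : ℂ) : ℂ := ∏' n : ℕ, (1 - q ^ (n + 1))

lemma one_sub_pow_ne_zero {q : ℂ} (hq : ‖q‖ < 1) (n : ℕ) : 1 - q ^ (n + 1) ≠ 0 := by
  intro h
  have h1 : ‖q ^ (n + 1)‖ = 1 := by rw [← sub_eq_zero.1 h]; simp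
  rw [norm_pow] at h1
  exact absurd h1 (pow_lt_one₀ (norm_nonneg _) hq (by simp)).ne

lemma eu_ne_zero {q : ℂ} (hq : ‖q‖ < 1) : eu q ≠ 0 := by
  have : eu q = ∏' n : ℕ, (1 + -q ^ (n + 1)) := by simp [eu, sub_eq_add_neg]
  rw [this]
  refine tprod_one_add_ne_zero_of_summable ?_ ?_
  · intro i; simpa [sub_eq_add_neg] using one_sub_pow_ne_zero hq i
  · simpa using (summable_nat_add_iff 1).mpr (summable_geometric_of_lt_one (norm_nonneg _) hq)

lemma eu_zero : eu 0 = 1 := by simp [eu]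

lemma differentiableOn_eu : DifferentiableOn ℂ eu (Metric.ball (0 : ℂ) 1) :=
  ModularForm.differentiableOn_tprod_one_sub_pow

lemma dedekindEta_eq_eu (z : ℂ) :
    dedekindEta z = Complex.exp (π * I * z / 12) * eu (Complex.exp (2 * π * I * z)) := by
  unfold dedekindEta eu
  congr 1
  refine tprod_congr fun n => ?_
  rw [← Complex.exp_nat_mul]; congr 2; push_cast; ring

/-- Partial products of Gauss's product for triangular numbers. -/
noncomputable def gP (q : ℂ) (n : ℕ) : ℂ := ∏ k ∈ Finset.range n, ((1 - q ^ (2 * k + 2)) / (1 - q ^ (2 * k + 1)))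

lemma gP_ne_zero {q : ℂ} (hq : ‖q‖ < 1) (n : ℕ) : gP q n ≠ 0 :=
  Finset.prod_ne_zero_iff.2 fun k _ =>
    div_ne_zero (one_sub_pow_ne_zero hq (2 * k + 1)) (one_sub_pow_ne_zero hq (2 * k))

lemma gP_succ (q : ℂ) (n : ℕ) :
    gP q (n + 1) = gP q n * ((1 - q ^ (2 * n + 2)) / (1 - q ^ (2 * n + 1))) :=
  Finset.prod_range_succ _ _

lemma sum_triangular {q : ℂ} (hq : ‖q‖ < 1) (n : ℕ) :
    ∑ s ∈ Finset.range (2 * n), q ^ (s * (s + 1) / 2) =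
      ∑ s ∈ Finset.range n, gP q n / gP q s * q ^ (s * (2 * n + 1)) := by
  induction n with
  | zero => simp
  | succ n ih =>
    have hQ : 1 - q ^ (2 * n + 1) ≠ 0 := one_sub_pow_ne_zero hq (2 * n)
    have e1 : (2 * n) * (2 * n + 1) / 2 = n * (2 * n + 1) := by
      rw [mul_assoc]; exact Nat.mul_div_cancel_left _ (by norm_num)
    have e2 : (2 * n + 1) * (2 * n + 1 + 1) / 2 = n * (2 * n + 1) + (2 * n + 1) := by
      rw [show (2 * n + 1) * (2 * n + 1 + 1) = 2 * (n * (2 * n + 1) + (2 * n + 1)) by ring]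
      exact Nat.mul_div_cancel_left _ (by norm_num)
    rw [show 2 * (n + 1) = 2 * n + 1 + 1 by ring, Finset.sum_range_succ, Finset.sum_range_succ, ih, e1, e2,
      Finset.sum_range_succ]
    set b : ℕ → ℂ := fun s => (1 - q ^ (2 * s)) * (gP q n / gP q s * q ^ (s * (2 * n + 1))) /
      (1 - q ^ (2 * n + 1)) with hb
    have hdiff : ∀ s, gP q (n + 1) / gP q s * q ^ (s * (2 * n + 1 + 1 + 1)) -
        gP q n / gP q s * q ^ (s * (2 * n + 1)) = b (s + 1) - b s := by
      intro s
      have h1 := gP_ne_zero hq s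
      have h2 : 1 - q ^ (2 * s + 1) ≠ 0 := one_sub_pow_ne_zero hq (2 * s)
      have h3 : 1 - q ^ (2 * s + 2) ≠ 0 := one_sub_pow_ne_zero hq (2 * s + 1)
      simp only [hb, gP_succ]
      rw [show 2 * (s + 1) = 2 * s + 2 by ring]
      rw [show s * (2 * n + 1 + 1 + 1) = s * (2 * n + 1) + 2 * s by ring,
        show (s + 1) * (2 * n + 1) = s * (2 * n + 1) + (2 * n + 1) by ring]
      field_simp
      ring
    have hsum : ∑ s ∈ Finset.range n, gP q (n + 1) / gP q s * q ^ (s * (2 * n + 1 + 1 + 1)) =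
        ∑ s ∈ Finset.range n, gP q n / gP q s * q ^ (s * (2 * n + 1)) + b n := by
      have h := Finset.sum_range_sub b n
      rw [← Finset.sum_congr rfl (fun s _ => hdiff s), Finset.sum_sub_distrib] at h
      have hb0 : b 0 = 0 := by simp [hb]
      rw [hb0] at h
      linear_combination h
    rw [hsum, add_assoc, add_assoc]
    congr 1
    have h1 := gP_ne_zero hq n
    simp only [hb, gP_succ]
    rw [show n * (2 * n + 1 + 1 + 1) = n * (2 * n + 1) + 2 * n by ring, div_self h1]
    field_simp
    ring

lemma tendsto_gP {q : ℂ} (hq : ‖q‖ < 1) :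
    Tendsto (gP q) atTop (𝓝 (eu (q ^ 2) ^ 2 / eu q)) := by
  have hq2 : ‖q ^ 2‖ < 1 := by rw [norm_pow]; exact pow_lt_one₀ (norm_nonneg _) hq (by norm_num)
  have t1 := (ModularForm.multipliable_one_sub_pow hq).hasProd.tendsto_prod_nat
  have t2 := (ModularForm.multipliable_one_sub_pow hq2).hasProd.tendsto_prod_nat
  have t3 := t1.comp (tendsto_id.const_mul_atTop' (show 0 < 2 by norm_num) : Tendsto (fun n : ℕ => 2 * n) atTop atTop)
  have key := (t2.pow 2).div t3 (eu_ne_zero hq)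
  refine key.congr fun n => ?_
  simp only [Pi.div_apply, Function.comp_apply]
  induction n with
  | zero => simp [gP]
  | succ n ih =>
    have h2 : 1 - q ^ (2 * n + 1) ≠ 0 := one_sub_pow_ne_zero hq (2 * n)
    have h3 : 1 - q ^ (2 * n + 2) ≠ 0 := one_sub_pow_ne_zero hq (2 * n + 1)
    have h4 : ∏ i ∈ Finset.range (2 * n), (1 - q ^ (i + 1)) ≠ 0 :=
      Finset.prod_ne_zero_iff.2 fun k _ => one_sub_pow_ne_zero hq k
    rw [gP_succ, ← ih, show 2 * (n + 1) = 2 * n + 1 + 1 by ring, Finset.prod_range_succ,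
      Finset.prod_range_succ, Finset.prod_range_succ, ← pow_mul, show 2 * (n + 1) = 2 * n + 2 by ring]
    field_simp

lemma tendsto_sum_triangular {q : ℂ} (hq : ‖q‖ < 1) :
    Tendsto (fun n => ∑ s ∈ Finset.range n, gP q n / gP q s * q ^ (s * (2 * n + 1))) atTop
      (𝓝 (eu (q ^ 2) ^ 2 / eu q)) := by
  have hq2 : ‖q ^ 2‖ < 1 := by rw [norm_pow]; exact pow_lt_one₀ (norm_nonneg _) hq (by norm_num)
  have hL : eu (q ^ 2) ^ 2 / eu q ≠ 0 := div_ne_zero (pow_ne_zero _ (eu_ne_zero hq2)) (eu_ne_zero hq)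
  have t := tendsto_gP hq
  have ti := t.inv₀ hL
  obtain ⟨A, hA⟩ := (t.norm.bddAbove_range)
  obtain ⟨B, hB⟩ := (ti.norm.bddAbove_range)
  have hA' : ∀ n, ‖gP q n‖ ≤ A := fun n => hA ⟨n, rfl⟩
  have hB' : ∀ n, ‖(gP q n)⁻¹‖ ≤ B := fun n => hB ⟨n, rfl⟩
  have hA0 : 0 ≤ A := (norm_nonneg _).trans (hA' 0)
  have hB0 : 0 ≤ B := (norm_nonneg _).trans (hB' 0)
  have hr := tsum_geometric_of_lt_one (norm_nonneg q) hq
  have hrs := summable_geometric_of_lt_one (norm_nonneg q) hq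
  have hbound : ∀ n, ‖(∑ s ∈ Finset.range (n + 1), gP q (n + 1) / gP q s * q ^ (s * (2 * (n + 1) + 1))) -
      gP q (n + 1)‖ ≤ A * B * (1 - ‖q‖)⁻¹ * ‖q‖ ^ n := by
    intro n
    rw [Finset.sum_range_succ']
    have h0 : gP q 0 = 1 := by simp [gP]
    simp only [h0, zero_mul, pow_zero, div_one, mul_one, add_sub_cancel_right]
    refine (norm_sum_le _ _).trans ?_
    have hterm : ∀ s ∈ Finset.range n, ‖gP q (n + 1) / gP q (s + 1) * q ^ ((s + 1) * (2 * (n + 1) + 1))‖ ≤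
        A * B * ‖q‖ ^ n * ‖q‖ ^ s := by
      intro s _
      rw [norm_mul, div_eq_mul_inv, norm_mul, norm_pow, mul_assoc (A * B), ← pow_add]
      refine mul_le_mul (mul_le_mul (hA' _) (hB' _) (norm_nonneg _) hA0) ?_ (by positivity) (by positivity)
      refine pow_le_pow_of_le_one (norm_nonneg _) hq.le ?_
      nlinarith
    refine (Finset.sum_le_sum hterm).trans ?_
    rw [← Finset.mul_sum]
    have := hrs.sum_le_tsum (Finset.range n) (fun i _ => by positivity)
    rw [hr] at this
    calc A * B * ‖q‖ ^ n * ∑ i ∈ Finset.range n, ‖q‖ ^ i ≤ A * B * ‖q‖ ^ n * (1 - ‖q‖)⁻¹ := by gcongr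
      _ = _ := by ring
  have hz : Tendsto (fun n => A * B * (1 - ‖q‖)⁻¹ * ‖q‖ ^ n) atTop (𝓝 0) := by
    simpa using (tendsto_pow_atTop_nhds_zero_of_lt_one (norm_nonneg q) hq).const_mul (A * B * (1 - ‖q‖)⁻¹)
  have hz' := squeeze_zero_norm hbound hz
  have := hz'.add ((tendsto_add_atTop_iff_nat 1).2 t)
  rw [← tendsto_add_atTop_iff_nat 1]
  simpa using this

/-- Gauss's product for the generating function of triangular numbers. -/
lemma hasSum_triangular {q : ℂ} (hq : ‖q‖ < 1) :
    HasSum (fun s : ℕ => q ^ (s * (s + 1) / 2)) (eu (q ^ 2) ^ 2 / eu q) := by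
  have hs : Summable (fun s : ℕ => q ^ (s * (s + 1) / 2)) := by
    refine Summable.of_norm_bounded (g := fun s => ‖q‖ ^ s) (summable_geometric_of_lt_one (norm_nonneg _) hq) ?_
    intro s
    rw [norm_pow]
    refine pow_le_pow_of_le_one (norm_nonneg _) hq.le ?_
    rw [Nat.le_div_iff_mul_le (by norm_num)]
    rcases s with _ | s
    · simp
    · nlinarith
  have t1 := hs.hasSum.tendsto_sum_nat.comp
    (tendsto_id.const_mul_atTop' (show 0 < 2 by norm_num) : Tendsto (fun n : ℕ => 2 * n) atTop atTop)
  have t2 := tendsto_sum_triangular hq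
  have e : ((fun n => ∑ i ∈ Finset.range n, q ^ (i * (i + 1) / 2)) ∘ fun n => 2 * n) =
      fun n => ∑ s ∈ Finset.range n, gP q n / gP q s * q ^ (s * (2 * n + 1)) :=
    funext fun n => sum_triangular hq n
  rw [e] at t1
  rw [← tendsto_nhds_unique t1 t2]
  exact hs.hasSum

noncomputable def th3 (τ : ℂ) : ℂ := jacobiTheta₂ 0 τ
noncomputable def th4 (τ : ℂ) : ℂ := jacobiTheta₂ (1 / 2) τ
noncomputable def th2 (τ : ℂ) : ℂ := Complex.exp (π * I * τ / 4) * jacobiTheta₂ (τ / 2) τ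

lemma hasSum_th3 {τ : ℂ} (hτ : 0 < τ.im) :
    HasSum (fun n : ℤ => Complex.exp (π * I * τ * (n : ℂ) ^ 2)) (th3 τ) := by
  refine (hasSum_jacobiTheta₂_term 0 hτ).congr_fun fun n => ?_
  unfold jacobiTheta₂_term; congr 1; ring

lemma hasSum_th4 {τ : ℂ} (hτ : 0 < τ.im) :
    HasSum (fun n : ℤ => (-1 : ℂ) ^ n * Complex.exp (π * I * τ * (n : ℂ) ^ 2)) (th4 τ) := by
  refine (hasSum_jacobiTheta₂_term (1 / 2) hτ).congr_fun fun n => ?_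
  unfold jacobiTheta₂_term
  rw [← Complex.exp_pi_mul_I, ← Complex.exp_int_mul, ← Complex.exp_add]; congr 1; ring

lemma hasSum_th2 {τ : ℂ} (hτ : 0 < τ.im) :
    HasSum (fun n : ℤ => Complex.exp (π * I * τ * ((n : ℂ) + 1 / 2) ^ 2)) (th2 τ) := by
  refine ((hasSum_jacobiTheta₂_term (τ / 2) hτ).mul_left (Complex.exp (π * I * τ / 4))).congr_fun
    fun n => ?_
  unfold jacobiTheta₂_term
  rw [← Complex.exp_add]; congr 1; ring

lemma norm_exp_two_pi_lt_one {z : ℂ} (hz : 0 < z.im) : ‖Complex.exp (2 * π * I * z)‖ < 1 :=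
  UpperHalfPlane.norm_exp_two_pi_I_lt_one ⟨z, hz⟩

lemma two_mul_im_pos {z : ℂ} (hz : 0 < z.im) : 0 < (2 * z).im := by simpa using hz
lemma three_mul_im_pos {z : ℂ} (hz : 0 < z.im) : 0 < (3 * z).im := by simpa using hz
lemma half_im_pos {z : ℂ} (hz : 0 < z.im) : 0 < (z / 2).im := by simpa using hz
lemma neg_inv_im_pos {z : ℂ} (hz : 0 < z.im) : 0 < (-1 / z).im := by
  have : z ≠ 0 := by rintro rfl; simp at hz
  rw [neg_div, Complex.neg_im, one_div, Complex.inv_im, neg_div, neg_neg]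
  exact div_pos hz (Complex.normSq_pos.2 this)

lemma th2_eq {τ : ℂ} (hτ : 0 < τ.im) : th2 τ = 2 * dedekindEta (2 * τ) ^ 2 / dedekindEta τ := by
  have hq := norm_exp_two_pi_lt_one hτ
  set q := Complex.exp (2 * π * I * τ) with hqd
  have h1 := (hasSum_triangular hq).mul_left (Complex.exp (π * I * τ / 4))
  have e1 : ∀ n : ℕ, Complex.exp (π * I * τ / 4) * q ^ (n * (n + 1) / 2) =
      Complex.exp (π * I * τ * ((n : ℂ) + 1 / 2) ^ 2) := by
    intro n
    rw [hqd, ← Complex.exp_nat_mul, ← Complex.exp_add]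
    congr 1
    have : ((n * (n + 1) / 2 : ℕ) : ℂ) = (n : ℂ) * (n + 1) / 2 := by
      rw [Nat.cast_div (Nat.even_mul_succ_self n).two_dvd (by norm_num)]; push_cast; ring
    rw [this]; ring
  simp only [e1] at h1
  have h2 : HasSum (fun n : ℤ => Complex.exp (π * I * τ * ((n : ℂ) + 1 / 2) ^ 2)) _ :=
    HasSum.of_nat_of_neg_add_one (f := fun n : ℤ => Complex.exp (π * I * τ * ((n : ℂ) + 1 / 2) ^ 2))
    (by simpa using h1)
    (by
      refine h1.congr_fun fun n => ?_
      congr 1; push_cast; ring)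
  rw [(hasSum_th2 hτ).unique h2, dedekindEta_eq_eu, dedekindEta_eq_eu,
    show 2 * π * I * (2 * τ) = ((2 : ℕ) : ℂ) * (2 * π * I * τ) by push_cast; ring,
    Complex.exp_nat_mul, ← hqd]
  have e2 : Complex.exp (π * I * (2 * τ) / 12) ^ 2 =
      Complex.exp (π * I * τ / 4) * Complex.exp (π * I * τ / 12) := by
    rw [← Complex.exp_nat_mul, ← Complex.exp_add]; congr 1; push_cast; ring
  rw [mul_pow, e2]
  have := eu_ne_zero hq
  have := Complex.exp_ne_zero (π * I * τ / 12)
  field_simp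
  ring

lemma th4_neg_inv {τ : ℂ} (hτ : 0 < τ.im) :
    th4 τ = 1 / (-I * τ) ^ (1 / 2 : ℂ) * th2 (-1 / τ) := by
  have hτ0 : τ ≠ 0 := by rintro rfl; simp at hτ
  unfold th4 th2
  rw [jacobiTheta₂_functional_equation, mul_assoc,
    show (-1 / τ / 2 : ℂ) = -(1 / 2 / τ) by ring, jacobiTheta₂_neg_left]
  congr 3
  field_simp
  ring

lemma th4_eq {τ : ℂ} (hτ : 0 < τ.im) : th4 τ = dedekindEta (τ / 2) ^ 2 / dedekindEta τ := by
  have hτ0 : τ ≠ 0 := by rintro rfl; simp at hτ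
  rw [th4_neg_inv hτ, th2_eq (neg_inv_im_pos hτ), dedekindEta_neg_inv hτ,
    show 2 * (-1 / τ) = -1 / (τ / 2) by field_simp, dedekindEta_neg_inv_sq (half_im_pos hτ)]
  have h2 : ((-I * τ) ^ (1 / 2 : ℂ)) ^ 2 = -I * τ := cpow_half_sq
  have h3 : (-I * τ) ^ (1 / 2 : ℂ) ≠ 0 := by
    intro h; rw [h] at h2; simp [hτ0] at h2
  have h4 := dedekindEta_ne_zero hτ
  rw [div_mul_div_comm, div_eq_div_iff (mul_ne_zero h3 (mul_ne_zero h3 h4)) h4]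
  linear_combination (-dedekindEta (τ / 2) ^ 2 * dedekindEta τ) * h2

lemma th4_add_one (τ : ℂ) : th4 (τ + 1) = th3 τ := by
  unfold th4 th3 jacobiTheta₂
  refine tsum_congr fun n => ?_
  unfold jacobiTheta₂_term
  rw [Complex.exp_eq_exp_iff_exists_int]
  obtain ⟨k, hk⟩ := (Int.even_mul_succ_self n)
  refine ⟨k, ?_⟩
  have : (n : ℂ) * (n + 1) = k + k := by exact_mod_cast congrArg (Int.cast (R := ℂ)) hk
  linear_combination (π * I) * this

lemma th3_add_one (τ : ℂ) : th3 (τ + 1) = th4 τ := by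
  rw [← th4_add_one, add_assoc]
  unfold th4
  norm_num [jacobiTheta₂_add_right]

lemma th2_add_one {τ : ℂ} (hτ : 0 < τ.im) :
    th2 (τ + 1) = Complex.exp (π * I / 4) * th2 τ := by
  have h' : 0 < (τ + 1).im := by simpa using hτ
  refine (hasSum_th2 h').unique (((hasSum_th2 hτ).mul_left _).congr_fun fun n => ?_)
  rw [← Complex.exp_add, Complex.exp_eq_exp_iff_exists_int]
  obtain ⟨k, hk⟩ := (Int.even_mul_succ_self n)
  refine ⟨k, ?_⟩
  have : (n : ℂ) * (n + 1) = k + k := by exact_mod_cast congrArg (Int.cast (R := ℂ)) hk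
  linear_combination (π * I) * this

lemma th3_eq {τ : ℂ} (hτ : 0 < τ.im) : th3 τ = dedekindEta ((τ + 1) / 2) ^ 2 /
    (Complex.exp (π * I / 12) * dedekindEta τ) := by
  rw [← th4_add_one, th4_eq (by simpa using hτ), dedekindEta_add_one]

lemma HasSum.int_mul {f g : ℤ → ℂ} {a b : ℂ} (hf : HasSum f a) (hg : HasSum g b) :
    HasSum (fun p : ℤ × ℤ => f p.1 * g p.2) (a * b) :=
  hf.mul hg (summable_mul_of_summable_norm hf.summable.norm hg.summable.norm)

/-- Splitting a sum over `ℤ × ℤ` by the parity of the sum of coordinates. -/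
lemma hasSum_parity {f : ℤ × ℤ → ℂ} {s : ℂ} (hf : HasSum f s) :
    ∃ a b : ℂ, HasSum (fun p : ℤ × ℤ => f (p.1 + p.2, p.1 - p.2)) a ∧
      HasSum (fun p : ℤ × ℤ => f (p.1 + p.2 + 1, p.1 - p.2)) b ∧ s = a + b := by
  set e₁ : ℤ × ℤ → ℤ × ℤ := fun p => (p.1 + p.2, p.1 - p.2)
  set e₂ : ℤ × ℤ → ℤ × ℤ := fun p => (p.1 + p.2 + 1, p.1 - p.2)
  have i1 : Function.Injective e₁ := by
    rintro ⟨a, b⟩ ⟨c, d⟩ h; simp only [e₁, Prod.mk.injEq] at h ⊢; omega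
  have i2 : Function.Injective e₂ := by
    rintro ⟨a, b⟩ ⟨c, d⟩ h; simp only [e₂, Prod.mk.injEq] at h ⊢; omega
  have s1 := (hf.summable.comp_injective i1).hasSum
  have s2 := (hf.summable.comp_injective i2).hasSum
  refine ⟨_, _, s1, s2, ?_⟩
  have hc : IsCompl (range e₁) (range e₂) := by
    constructor
    · rw [Set.disjoint_iff]
      rintro _ ⟨⟨⟨a, b⟩, rfl⟩, ⟨⟨c, d⟩, h⟩⟩
      simp only [e₁, e₂, Prod.mk.injEq] at h; omega
    · rw [codisjoint_iff_le_sup]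
      rintro ⟨x, y⟩ -
      rcases Int.even_or_odd' (x + y) with ⟨k, hk | hk⟩
      · exact Or.inl ⟨(k, x - k), by simp only [e₁, Prod.mk.injEq]; omega⟩
      · exact Or.inr ⟨(k, x - k - 1), by simp only [e₂, Prod.mk.injEq]; omega⟩
  have := HasSum.add_isCompl hc (i1.hasSum_range_iff.2 s1) (i2.hasSum_range_iff.2 s2)
  exact hf.unique this

lemma th3_sq {τ : ℂ} (hτ : 0 < τ.im) : th3 τ ^ 2 = th3 (2 * τ) ^ 2 + th2 (2 * τ) ^ 2 := by
  have h2 := two_mul_im_pos hτ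
  obtain ⟨a, b, ha, hb, h⟩ := hasSum_parity (HasSum.int_mul (hasSum_th3 hτ) (hasSum_th3 hτ))
  rw [sq, h]
  congr 1
  · rw [sq]
    refine ha.unique ((HasSum.int_mul (hasSum_th3 h2) (hasSum_th3 h2)).congr_fun fun p => ?_)
    rw [← Complex.exp_add, ← Complex.exp_add]; congr 1; push_cast; ring
  · rw [sq]
    refine hb.unique ((HasSum.int_mul (hasSum_th2 h2) (hasSum_th2 h2)).congr_fun fun p => ?_)
    rw [← Complex.exp_add, ← Complex.exp_add]; congr 1; push_cast; ring

lemma th2_sq {τ : ℂ} (hτ : 0 < τ.im) : th2 τ ^ 2 = 2 * th2 (2 * τ) * th3 (2 * τ) := by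
  have h2 := two_mul_im_pos hτ
  obtain ⟨a, b, ha, hb, h⟩ := hasSum_parity (HasSum.int_mul (hasSum_th2 hτ) (hasSum_th2 hτ))
  have e1 : a = th2 (2 * τ) * th3 (2 * τ) := by
    refine ha.unique ((HasSum.int_mul (hasSum_th2 h2) (hasSum_th3 h2)).congr_fun fun p => ?_)
    rw [← Complex.exp_add, ← Complex.exp_add]; congr 1; push_cast; ring
  have e2 : b = th3 (2 * τ) * th2 (2 * τ) := by
    refine hb.unique (((((Equiv.addRight (1 : ℤ)).prodCongr (Equiv.refl ℤ)).hasSum_iff).2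
      (HasSum.int_mul (hasSum_th3 h2) (hasSum_th2 h2))).congr_fun fun p => ?_)
    simp only [Function.comp_apply, Equiv.prodCongr_apply, Prod.map_fst, Prod.map_snd, Equiv.coe_addRight,
      Equiv.refl_apply]
    rw [← Complex.exp_add, ← Complex.exp_add]; congr 1; push_cast; ring
  rw [sq, h, e1, e2]; ring

lemma th4_sq {τ : ℂ} (hτ : 0 < τ.im) : th4 τ ^ 2 = th3 (2 * τ) ^ 2 - th2 (2 * τ) ^ 2 := by
  have h2 := two_mul_im_pos hτ
  have h3 : 0 < (2 * τ + 1).im := by simpa using hτ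
  rw [← th3_add_one, th3_sq (by simpa using hτ), show 2 * (τ + 1) = 2 * τ + 1 + 1 by ring, th2_add_one h3,
    th2_add_one h2, th3_add_one, th4_add_one, mul_pow, mul_pow, ← Complex.exp_nat_mul,
    show ((2 : ℕ) : ℂ) * (π * I / 4) = π / 2 * I by push_cast; ring,
    Complex.exp_pi_div_two_mul_I]
  linear_combination (th2 (2 * τ) ^ 2) * Complex.I_sq

lemma th_jacobi {τ : ℂ} (hτ : 0 < τ.im) : th3 τ ^ 4 = th2 τ ^ 4 + th4 τ ^ 4 := by
  have h1 := th3_sq hτ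
  have h2 := th2_sq hτ
  have h3 := th4_sq hτ
  calc th3 τ ^ 4 = (th3 τ ^ 2) ^ 2 := by ring
    _ = (th2 τ ^ 2) ^ 2 + (th4 τ ^ 2) ^ 2 := by rw [h1, h2, h3]; ring
    _ = _ := by ring

/-- The cubic theta relation. -/
lemma th_cubic {τ : ℂ} (hτ : 0 < τ.im) :
    th3 τ * th3 (3 * τ) = th2 τ * th2 (3 * τ) + th4 τ * th4 (3 * τ) := by
  have h3 := three_mul_im_pos hτ
  have hd := (HasSum.int_mul (hasSum_th3 hτ) (hasSum_th3 h3)).sub (HasSum.int_mul (hasSum_th4 hτ) (hasSum_th4 h3))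
  obtain ⟨a, b, ha, hb, h⟩ := hasSum_parity hd
  obtain ⟨a', b', ha', hb', h'⟩ := hasSum_parity (HasSum.int_mul (hasSum_th2 hτ) (hasSum_th2 h3))
  have ea : a = 0 := by
    refine ha.unique (hasSum_zero.congr_fun fun p => ?_)
    have : (-1 : ℂ) ^ (p.1 + p.2) * (-1 : ℂ) ^ (p.1 - p.2) = 1 := by
      rw [← zpow_add₀ (by norm_num)]
      exact Even.neg_one_zpow ⟨p.1, by ring⟩
    linear_combination (-Complex.exp (π * I * τ * ((p.1 + p.2 : ℤ) : ℂ) ^ 2) *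
      Complex.exp (π * I * (3 * τ) * ((p.1 - p.2 : ℤ) : ℂ) ^ 2)) * this
  set u : ℤ × ℤ → ℂ := fun p => Complex.exp (π * I * τ *
    ((p.1 + p.2 + 1 : ℂ) ^ 2 + 3 * (p.1 - p.2 : ℂ) ^ 2)) with hu
  have hb2 : HasSum u (b / 2) := by
    refine (hb.div_const 2).congr_fun fun p => ?_
    have : (-1 : ℂ) ^ (p.1 + p.2 + 1) * (-1 : ℂ) ^ (p.1 - p.2) = -1 := by
      rw [← zpow_add₀ (by norm_num)]
      exact Odd.neg_one_zpow ⟨p.1, by ring⟩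
    have e : u p = Complex.exp (π * I * τ * ((p.1 + p.2 + 1 : ℤ) : ℂ) ^ 2) *
      Complex.exp (π * I * (3 * τ) * ((p.1 - p.2 : ℤ) : ℂ) ^ 2) := by
      rw [← Complex.exp_add, hu]; simp only; congr 1; push_cast; ring
    rw [e]
    linear_combination (1 / 2 * Complex.exp (π * I * τ * ((p.1 + p.2 + 1 : ℤ) : ℂ) ^ 2) *
      Complex.exp (π * I * (3 * τ) * ((p.1 - p.2 : ℤ) : ℂ) ^ 2)) * this
  have ea' : a' = b / 2 := by
    let e : ℤ × ℤ ≃ ℤ × ℤ :=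
      { toFun := fun p => (p.1, p.1 - p.2)
        invFun := fun p => (p.1, p.1 - p.2)
        left_inv := fun p => by simp
        right_inv := fun p => by simp }
    refine ha'.unique ((e.hasSum_iff.2 hb2).congr_fun fun p => ?_)
    simp only [Function.comp_apply, hu, e, Equiv.coe_fn_mk]
    rw [← Complex.exp_add]; congr 1; push_cast; ring
  have eb' : b' = b / 2 := by
    let e : ℤ × ℤ ≃ ℤ × ℤ :=
      { toFun := fun p => (p.2, p.2 - p.1 - 1)
        invFun := fun p => (p.1 - p.2 - 1, p.1)
        left_inv := fun p => by ext <;> simp <;> ring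
        right_inv := fun p => by ext <;> simp <;> ring }
    refine hb'.unique ((e.hasSum_iff.2 hb2).congr_fun fun p => ?_)
    simp only [Function.comp_apply, hu, e, Equiv.coe_fn_mk]
    rw [← Complex.exp_add]; congr 1; push_cast; ring
  rw [ea] at h
  rw [ea', eb'] at h'
  linear_combination -h' + h

/-- Elliptic-type integrals over a quarter period. -/
noncomputable def Kg (j : ℕ) (r a : ℝ) : ℝ :=
  ∫ θ in (0 : ℝ)..(π / 2), sin θ ^ (2 * j) * (1 - a * sin θ ^ 2) ^ r

lemma delta_pos {a : ℝ} (ha : a < 1) (θ : ℝ) : 0 < 1 - a * sin θ ^ 2 := by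
  have h1 := sin_sq_le_one θ
  have h0 := sq_nonneg (sin θ)
  rcases le_total a 0 with h | h <;> nlinarith

lemma continuous_delta {a : ℝ} (ha : a < 1) (j : ℕ) (r : ℝ) :
    Continuous fun θ : ℝ => sin θ ^ (2 * j) * (1 - a * sin θ ^ 2) ^ r := by
  refine Continuous.mul (by fun_prop) (Continuous.rpow_const (by fun_prop) fun θ => Or.inl (delta_pos ha θ).ne')

lemma hasDerivAt_Kg (j : ℕ) {r a : ℝ} (hr : r ≤ 0) (ha : a < 1) (ha' : -1 < a) :
    HasDerivAt (Kg j r) (-r * Kg (j + 1) (r - 1) a) a := by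
  set δ := (1 - a) / 2 with hδ
  have hδ0 : 0 < δ := by rw [hδ]; linarith
  have hb : ∀ x ∈ Metric.ball a δ, ∀ θ : ℝ, δ ≤ 1 - x * sin θ ^ 2 := by
    intro x hx θ
    rw [Metric.mem_ball, dist_eq, abs_lt] at hx
    have h1 := sin_sq_le_one θ
    have h0 := sq_nonneg (sin θ)
    rcases le_total x 0 with h | h <;> nlinarith
  have key := (intervalIntegral.hasDerivAt_integral_of_dominated_loc_of_deriv_le (μ := volume) (a := 0) (b := π / 2)
    (F := fun x θ => sin θ ^ (2 * j) * (1 - x * sin θ ^ 2) ^ r)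
    (F' := fun x θ => sin θ ^ (2 * j) * ((-sin θ ^ 2) * r * (1 - x * sin θ ^ 2) ^ (r - 1)))
    (x₀ := a) (s := Metric.ball a δ) (bound := fun _ => |r| * δ ^ (r - 1)) (Metric.ball_mem_nhds a hδ0)
    ?_ ?_ ?_ ?_ ?_ ?_).2
  · refine HasDerivAt.congr_deriv (f := Kg j r) key ?_
    unfold Kg
    rw [← intervalIntegral.integral_const_mul]
    refine intervalIntegral.integral_congr fun θ _ => ?_
    ring
  · filter_upwards [Iio_mem_nhds ha] with x hx
    exact (continuous_delta hx j r).aestronglyMeasurable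
  · exact (continuous_delta ha j r).intervalIntegrable _ _
  · have : (fun θ => sin θ ^ (2 * j) * ((-sin θ ^ 2) * r * (1 - a * sin θ ^ 2) ^ (r - 1))) =
      fun θ => (-sin θ ^ 2 * r) * (sin θ ^ (2 * j) * (1 - a * sin θ ^ 2) ^ (r - 1)) := by
      funext θ; ring
    rw [this]
    exact (Continuous.mul (by fun_prop) (continuous_delta ha j (r - 1))).aestronglyMeasurable
  · refine Eventually.of_forall fun θ _ x hx => ?_
    have h1 := hb x hx θ
    have hs := abs_sin_le_one θ
    rw [norm_eq_abs, abs_mul, abs_mul, abs_mul, abs_pow, abs_neg, abs_pow,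
      abs_of_nonneg (rpow_nonneg (hδ0.le.trans h1) _)]
    have e1 := pow_le_one₀ (n := 2 * j) (abs_nonneg _) hs
    have e2 := pow_le_one₀ (n := 2) (abs_nonneg _) hs
    have e3 := rpow_le_rpow_of_nonpos hδ0 h1 (show r - 1 ≤ 0 by linarith)
    have e4 : 0 ≤ (1 - x * sin θ ^ 2) ^ (r - 1) := rpow_nonneg (hδ0.le.trans h1) _
    calc |sin θ| ^ (2 * j) * (|sin θ| ^ 2 * |r| * (1 - x * sin θ ^ 2) ^ (r - 1))
        ≤ 1 * (1 * |r| * δ ^ (r - 1)) := by gcongr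
      _ = _ := by ring
  · exact intervalIntegrable_const
  · refine Eventually.of_forall fun θ _ x hx => ?_
    have h1 : HasDerivAt (fun x : ℝ => 1 - x * sin θ ^ 2) (-sin θ ^ 2) x := by
      simpa using ((hasDerivAt_id x).mul_const (sin θ ^ 2)).const_sub 1
    exact (h1.rpow_const (Or.inl (hδ0.trans_le (hb x hx θ)).ne')).const_mul _

noncomputable def Kf (a : ℝ) : ℝ := Kg 0 (-(1 / 2)) a
noncomputable def Kf1 (a : ℝ) : ℝ := 1 / 2 * Kg 1 (-(3 / 2)) a
noncomputable def Kf2 (a : ℝ) : ℝ := 3 / 4 * Kg 2 (-(5 / 2)) a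

lemma hasDerivAt_Kf {a : ℝ} (ha : a < 1) (ha' : -1 < a) : HasDerivAt Kf (Kf1 a) a := by
  refine HasDerivAt.congr_deriv (f := Kf) (hasDerivAt_Kg 0 (r := -(1 / 2)) (by norm_num) ha ha') ?_
  unfold Kf1
  norm_num

lemma hasDerivAt_Kf1 {a : ℝ} (ha : a < 1) (ha' : -1 < a) : HasDerivAt Kf1 (Kf2 a) a := by
  refine HasDerivAt.congr_deriv (f := Kf1)
    ((hasDerivAt_Kg 1 (r := -(3 / 2)) (by norm_num) ha ha').const_mul (1 / 2)) ?_
  unfold Kf2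
  rw [show (-(3 / 2) - 1 : ℝ) = -(5 / 2) by norm_num]
  ring

lemma Kf_zero : Kf 0 = π / 2 := by simp [Kf, Kg]

lemma ode_Kf {a : ℝ} (ha : a < 1) : a * (1 - a) * Kf2 a + (1 - 2 * a) * Kf1 a = Kf a / 4 := by
  have hd : ∀ θ ∈ uIcc 0 (π / 2), HasDerivAt
      (fun θ => -(1 / 4) * (sin θ * cos θ * (1 - a * sin θ ^ 2) ^ (-(3 / 2) : ℝ)))
      (a * (1 - a) * (3 / 4 * (sin θ ^ (2 * 2) * (1 - a * sin θ ^ 2) ^ (-(5 / 2) : ℝ))) +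
        (1 - 2 * a) * (1 / 2 * (sin θ ^ (2 * 1) * (1 - a * sin θ ^ 2) ^ (-(3 / 2) : ℝ))) -
        1 / 4 * (sin θ ^ (2 * 0) * (1 - a * sin θ ^ 2) ^ (-(1 / 2) : ℝ))) θ := by
    intro θ _
    have hp := delta_pos ha θ
    have h1 : HasDerivAt (fun θ => 1 - a * sin θ ^ 2) (-(a * (2 * sin θ * cos θ))) θ := by
      simpa using (((hasDerivAt_sin θ).fun_pow 2).const_mul a).const_sub 1
    have h2 := (((hasDerivAt_sin θ).mul (hasDerivAt_cos θ)).mul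
      (h1.rpow_const (p := -(3 / 2)) (Or.inl hp.ne'))).const_mul (-(1 / 4))
    refine h2.congr_deriv ?_
    have r1 : (1 - a * sin θ ^ 2) ^ (-(3 / 2) : ℝ) =
        (1 - a * sin θ ^ 2) * (1 - a * sin θ ^ 2) ^ (-(5 / 2) : ℝ) := by
      rw [← rpow_one_add' hp.le (by norm_num)]; norm_num
    have r2 : (1 - a * sin θ ^ 2) ^ (-(1 / 2) : ℝ) =
        (1 - a * sin θ ^ 2) * (1 - a * sin θ ^ 2) ^ (-(3 / 2) : ℝ) := by
      rw [← rpow_one_add' hp.le (by norm_num)]; norm_num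
    have r3 : (-(3 / 2) - 1 : ℝ) = -(5 / 2) := by norm_num
    simp only [Pi.mul_apply]
    rw [r3, r2, r1]
    have hc : cos θ ^ 2 = 1 - sin θ ^ 2 := cos_sq' θ
    generalize (1 - a * sin θ ^ 2) ^ (-(5 / 2) : ℝ) = u
    linear_combination (-(1 / 4) * (1 - a * sin θ ^ 2) * u - 3 / 4 * a * sin θ ^ 2 * u) * hc
  have i1 := ((continuous_delta ha 2 (-(5 / 2))).intervalIntegrable (μ := volume) 0 (π / 2))
  have i2 := ((continuous_delta ha 1 (-(3 / 2))).intervalIntegrable (μ := volume) 0 (π / 2))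
  have i3 := ((continuous_delta ha 0 (-(1 / 2))).intervalIntegrable (μ := volume) 0 (π / 2))
  have j1 := (i1.const_mul (3 / 4)).const_mul (a * (1 - a))
  have j2 := (i2.const_mul (1 / 2)).const_mul (1 - 2 * a)
  have j3 := i3.const_mul (1 / 4)
  have key := intervalIntegral.integral_eq_sub_of_hasDerivAt hd ((j1.add j2).sub j3)
  rw [intervalIntegral.integral_sub (j1.add j2) j3, intervalIntegral.integral_add j1 j2,
    intervalIntegral.integral_const_mul, intervalIntegral.integral_const_mul,
    intervalIntegral.integral_const_mul, intervalIntegral.integral_const_mul,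
    intervalIntegral.integral_const_mul] at key
  simp only [sin_zero, cos_pi_div_two, mul_zero, zero_mul, sub_zero] at key
  unfold Kf Kf1 Kf2 Kg
  linarith

/-- Landen's transformation of the complete elliptic integral. -/
lemma Kf_landen {k : ℝ} (hk : 0 < k) (hk1 : k ≤ 1) :
    (1 + k) * Kf (1 - k ^ 2) = 2 * Kf (((1 - k) / (1 + k)) ^ 2) := by
  set b : ℝ := ((1 - k) / (1 + k)) ^ 2 with hb
  have ha1 : 1 - k ^ 2 < 1 := by nlinarith
  have hb1 : b < 1 := by
    rw [hb, div_pow, div_lt_one (by positivity)]; nlinarith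
  set e : ℝ → ℝ → ℝ := fun a θ => (1 - a * sin θ ^ 2) ^ (-(1 / 2) : ℝ) with he
  have hec : ∀ {a : ℝ}, a < 1 → Continuous (e a) := fun {a} ha => by
    simpa [he] using continuous_delta ha 0 (-(1 / 2))
  have hE : ∀ {a : ℝ}, a < 1 → ∀ x, HasDerivAt (fun x => ∫ θ in (0 : ℝ)..x, e a θ) (e a x) x :=
    fun {a} ha x => intervalIntegral.integral_hasDerivAt_right ((hec ha).intervalIntegrable _ _)
      (hec ha).aestronglyMeasurable.stronglyMeasurableAtFilter (hec ha).continuousAt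
  have hKf : ∀ a, Kf a = ∫ θ in (0 : ℝ)..(π / 2), e a θ := fun a => by simp [Kf, Kg, he]
  set G : ℝ → ℝ := fun φ => φ + arctan (k * tan φ) with hG
  set H : ℝ → ℝ := fun φ => (∫ θ in (0 : ℝ)..(G φ), e b θ) -
    (1 + k) * ∫ θ in (0 : ℝ)..φ, e (1 - k ^ 2) θ with hH
  have hd : ∀ φ ∈ Ioo (-(π / 2)) (π / 2), HasDerivAt H 0 φ := by
    intro φ hφ
    have hc : 0 < cos φ := cos_pos_of_mem_Ioo hφ
    have hsc := sin_sq_add_cos_sq φ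
    have hΔ : 0 < cos φ ^ 2 + k ^ 2 * sin φ ^ 2 := by positivity
    set Δ := √(cos φ ^ 2 + k ^ 2 * sin φ ^ 2) with hΔd
    have hΔ0 : 0 < Δ := sqrt_pos.2 hΔ
    have hΔ2 : Δ ^ 2 = cos φ ^ 2 + k ^ 2 * sin φ ^ 2 := sq_sqrt hΔ.le
    have hu : 1 + (k * tan φ) ^ 2 = (Δ / cos φ) ^ 2 := by
      rw [tan_eq_sin_div_cos, div_pow, hΔ2]; field_simp
    have hG' : HasDerivAt G ((Δ ^ 2 + k) / Δ ^ 2) φ := by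
      refine ((hasDerivAt_id φ).add (((hasDerivAt_tan hc.ne').const_mul k).arctan)).congr_deriv ?_
      rw [hu]; field_simp
    have hsG : sin (G φ) = (1 + k) * (sin φ * cos φ) / Δ := by
      simp only [hG]
      rw [sin_add, cos_arctan, sin_arctan, hu, sqrt_sq (by positivity),
        tan_eq_sin_div_cos]
      field_simp
    have e1 : e b (G φ) = (1 + k) * Δ / (Δ ^ 2 + k) := by
      have : 1 - b * sin (G φ) ^ 2 = ((Δ ^ 2 + k) / ((1 + k) * Δ)) ^ 2 := by
        rw [hsG, hb]
        have hs2 : sin φ ^ 2 = 1 - cos φ ^ 2 := by linarith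
        have h4 : (Δ ^ 2 + k) ^ 2 = (1 + k) ^ 2 * (Δ ^ 2 - (1 - k) ^ 2 * (sin φ * cos φ) ^ 2) := by
          rw [hΔ2, mul_pow, hs2]; ring
        rw [div_pow (Δ ^ 2 + k), h4]
        field_simp
      simp only [he]
      rw [this, rpow_neg (sq_nonneg _), ← sqrt_eq_rpow, sqrt_sq (by positivity), inv_div]
    have e2 : e (1 - k ^ 2) φ = 1 / Δ := by
      have : 1 - (1 - k ^ 2) * sin φ ^ 2 = Δ ^ 2 := by
        rw [hΔ2]; linear_combination -hsc
      simp only [he]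
      rw [this, rpow_neg (sq_nonneg _), ← sqrt_eq_rpow, sqrt_sq hΔ0.le, one_div]
    refine (((hE hb1 (G φ)).comp φ hG').sub ((hE ha1 φ).const_mul (1 + k))).congr_deriv ?_
    rw [e1, e2]
    have : 0 < Δ ^ 2 + k := by positivity
    field_simp
    ring
  have h0 : (0 : ℝ) ∈ Ioo (-(π / 2)) (π / 2) := by constructor <;> linarith [pi_pos]
  have hconst : ∀ φ ∈ Ioo (-(π / 2)) (π / 2), H φ = 0 := by
    intro φ hφ
    have := isOpen_Ioo.is_const_of_deriv_eq_zero (convex_Ioo _ _).isPreconnected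
      (fun x hx => (hd x hx).differentiableAt.differentiableWithinAt) (fun x hx => (hd x hx).deriv) hφ h0
    rw [this]
    simp [hH, hG]
  have hGt : Tendsto G (𝓝[<] (π / 2)) (𝓝 π) := by
    have h1 : Tendsto (fun φ : ℝ => arctan (k * tan φ)) (𝓝[<] (π / 2)) (𝓝 (π / 2)) :=
      (tendsto_arctan_atTop.mono_right nhdsWithin_le_nhds).comp
        (tendsto_tan_pi_div_two.const_mul_atTop hk)
    have h2 : Tendsto (fun φ : ℝ => φ) (𝓝[<] (π / 2)) (𝓝 (π / 2)) := nhdsWithin_le_nhds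
    simpa using h2.add h1
  have hHt : Tendsto H (𝓝[<] (π / 2)) (𝓝 ((∫ θ in (0 : ℝ)..π, e b θ) -
      (1 + k) * ∫ θ in (0 : ℝ)..(π / 2), e (1 - k ^ 2) θ)) :=
    ((hE hb1 π).continuousAt.tendsto.comp hGt).sub
      (((hE ha1 (π / 2)).continuousAt.tendsto.mono_left nhdsWithin_le_nhds).const_mul _)
  have hH0 : Tendsto H (𝓝[<] (π / 2)) (𝓝 0) := by
    refine tendsto_const_nhds.congr' ?_
    filter_upwards [Ioo_mem_nhdsLT (show -(π / 2) < π / 2 by linarith [pi_pos])] with φ hφ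
    exact (hconst φ hφ).symm
  have hlim := tendsto_nhds_unique hHt hH0
  have hsym : (∫ θ in (0 : ℝ)..π, e b θ) = 2 * ∫ θ in (0 : ℝ)..(π / 2), e b θ := by
    have h1 := intervalIntegral.integral_comp_sub_left (a := 0) (b := π / 2) (e b) π
    have h2 : ∀ x, e b (π - x) = e b x := fun x => by simp [he, sin_pi_sub]
    simp only [h2] at h1
    have h3 := intervalIntegral.integral_add_adjacent_intervals
      ((hec hb1).intervalIntegrable (μ := volume) 0 (π / 2)) ((hec hb1).intervalIntegrable (π / 2) π)
    rw [← h3]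
    have : π - π / 2 = π / 2 := by ring
    rw [this, sub_zero] at h1
    rw [h1]; ring
  rw [hsym] at hlim
  rw [hKf, hKf]
  linarith

/-- Theta constants on the imaginary axis. -/
noncomputable def t2 (y : ℝ) : ℝ := (th2 (I * y)).re
noncomputable def t3 (y : ℝ) : ℝ := (th3 (I * y)).re
noncomputable def t4 (y : ℝ) : ℝ := (th4 (I * y)).re

lemma I_mul_im_pos {y : ℝ} (hy : 0 < y) : 0 < (I * (y : ℂ)).im := by simpa using hy

lemma HasSum.of_ofReal {ι : Type*} {f : ι → ℂ} {g : ι → ℝ} {a : ℂ} (h : HasSum f a) (hg : ∀ i, f i = g i) :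
    HasSum g a.re ∧ (a.re : ℂ) = a := by
  have h1 : HasSum (fun i => (g i : ℂ)) a := h.congr_fun fun i => (hg i).symm
  have h2 := Complex.hasSum_re h1
  have h3 := Complex.hasSum_im h1
  simp only [Complex.ofReal_re, Complex.ofReal_im] at h2 h3
  exact ⟨h2, Complex.ext (by simp) (by simpa using hasSum_zero.unique h3)⟩

lemma hasSum_t3 {y : ℝ} (hy : 0 < y) :
    HasSum (fun n : ℤ => exp (-π * y * (n : ℝ) ^ 2)) (t3 y) ∧ (t3 y : ℂ) = th3 (I * y) := by
  refine HasSum.of_ofReal (hasSum_th3 (I_mul_im_pos hy)) fun n => ?_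
  push_cast
  congr 1
  linear_combination (π * y * (n : ℂ) ^ 2) * Complex.I_sq

lemma hasSum_t2 {y : ℝ} (hy : 0 < y) :
    HasSum (fun n : ℤ => exp (-π * y * ((n : ℝ) + 1 / 2) ^ 2)) (t2 y) ∧
      (t2 y : ℂ) = th2 (I * y) := by
  refine HasSum.of_ofReal (hasSum_th2 (I_mul_im_pos hy)) fun n => ?_
  push_cast
  congr 1
  linear_combination (π * y * ((n : ℂ) + 1 / 2) ^ 2) * Complex.I_sq

lemma ofReal_t4 {y : ℝ} (hy : 0 < y) : (t4 y : ℂ) = th4 (I * y) := by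
  refine (HasSum.of_ofReal (g := fun n : ℤ => (-1) ^ n * exp (-π * y * (n : ℝ) ^ 2))
    (hasSum_th4 (I_mul_im_pos hy)) fun n => ?_).2
  push_cast
  congr 2
  linear_combination (π * y * (n : ℂ) ^ 2) * Complex.I_sq

lemma ofReal_t3 {y : ℝ} (hy : 0 < y) : (t3 y : ℂ) = th3 (I * y) := (hasSum_t3 hy).2
lemma ofReal_t2 {y : ℝ} (hy : 0 < y) : (t2 y : ℂ) = th2 (I * y) := (hasSum_t2 hy).2

lemma t3_pos {y : ℝ} (hy : 0 < y) : 0 < t3 y := by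
  rw [← (hasSum_t3 hy).1.tsum_eq]
  exact (hasSum_t3 hy).1.summable.tsum_pos (fun n => (exp_pos _).le) 0 (exp_pos _)

lemma t2_pos {y : ℝ} (hy : 0 < y) : 0 < t2 y := by
  rw [← (hasSum_t2 hy).1.tsum_eq]
  exact (hasSum_t2 hy).1.summable.tsum_pos (fun n => (exp_pos _).le) 0 (exp_pos _)

lemma neg_I_mul_cpow_half {y : ℝ} (hy : 0 < y) :
    (-I * (I * y)) ^ (1 / 2 : ℂ) = ((√y : ℝ) : ℂ) := by
  have : -I * (I * (y : ℂ)) = (y : ℂ) := by linear_combination -(y : ℂ) * Complex.I_sq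
  rw [this, sqrt_eq_rpow, Complex.ofReal_cpow hy.le]
  norm_num

lemma neg_one_div_I_mul {y : ℝ} (hy : 0 < y) : -1 / (I * (y : ℂ)) = I * ((1 / y : ℝ) : ℂ) := by
  have : (y : ℂ) ≠ 0 := by exact_mod_cast hy.ne'
  push_cast
  field_simp
  simp

lemma sqrt_mul_t4 {y : ℝ} (hy : 0 < y) : √y * t4 y = t2 (1 / y) := by
  have h := th4_neg_inv (I_mul_im_pos hy)
  rw [neg_I_mul_cpow_half hy, neg_one_div_I_mul hy, ← ofReal_t4 hy, ← ofReal_t2 (by positivity)] at h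
  have h' : t4 y = 1 / √y * t2 (1 / y) := by exact_mod_cast h
  have := sqrt_pos.2 hy
  rw [h']; field_simp

lemma sqrt_mul_t3 {y : ℝ} (hy : 0 < y) : √y * t3 y = t3 (1 / y) := by
  have h : th3 (I * y) = 1 / (-I * (I * y)) ^ (1 / 2 : ℂ) * th3 (-1 / (I * y)) := by
    unfold th3
    rw [jacobiTheta₂_functional_equation]
    simp
  rw [neg_I_mul_cpow_half hy, neg_one_div_I_mul hy, ← ofReal_t3 hy, ← ofReal_t3 (by positivity)] at h
  have h' : t3 y = 1 / √y * t3 (1 / y) := by exact_mod_cast h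
  have := sqrt_pos.2 hy
  rw [h']; field_simp

lemma t4_pos {y : ℝ} (hy : 0 < y) : 0 < t4 y := by
  have h := sqrt_mul_t4 hy
  have h2 : 0 < t2 (1 / y) := t2_pos (by positivity)
  rw [← h] at h2
  exact pos_of_mul_pos_right h2 (sqrt_nonneg _)

lemma two_mul_I_mul (y : ℝ) : 2 * (I * (y : ℂ)) = I * ((2 * y : ℝ) : ℂ) := by
  push_cast; ring
lemma three_mul_I_mul (y : ℝ) : 3 * (I * (y : ℂ)) = I * ((3 * y : ℝ) : ℂ) := by
  push_cast; ring

lemma t3_sq {y : ℝ} (hy : 0 < y) : t3 y ^ 2 = t3 (2 * y) ^ 2 + t2 (2 * y) ^ 2 := by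
  have h := th3_sq (I_mul_im_pos hy)
  rw [two_mul_I_mul, ← ofReal_t3 hy, ← ofReal_t3 (by positivity), ← ofReal_t2 (by positivity)] at h
  exact_mod_cast h

lemma t4_sq {y : ℝ} (hy : 0 < y) : t4 y ^ 2 = t3 (2 * y) ^ 2 - t2 (2 * y) ^ 2 := by
  have h := th4_sq (I_mul_im_pos hy)
  rw [two_mul_I_mul, ← ofReal_t4 hy, ← ofReal_t3 (by positivity), ← ofReal_t2 (by positivity)] at h
  exact_mod_cast h

lemma t_jacobi {y : ℝ} (hy : 0 < y) : t3 y ^ 4 = t2 y ^ 4 + t4 y ^ 4 := by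
  have h := th_jacobi (I_mul_im_pos hy)
  rw [← ofReal_t4 hy, ← ofReal_t3 hy, ← ofReal_t2 hy] at h
  exact_mod_cast h

lemma t_cubic {y : ℝ} (hy : 0 < y) :
    t3 y * t3 (3 * y) = t2 y * t2 (3 * y) + t4 y * t4 (3 * y) := by
  have h := th_cubic (I_mul_im_pos hy)
  have h3 : 0 < 3 * y := by positivity
  rw [three_mul_I_mul, ← ofReal_t4 hy, ← ofReal_t3 hy, ← ofReal_t2 hy, ← ofReal_t4 h3, ← ofReal_t3 h3,
    ← ofReal_t2 h3] at h
  exact_mod_cast h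

lemma tendsto_th3_of_im {τ : ℝ → ℂ} (hτ : ∀ y, (τ y).im = y) : Tendsto (fun y => th3 (τ y)) atTop (𝓝 1) := by
  have hE : Tendsto (fun y : ℝ => exp (-π * y)) atTop (𝓝 0) :=
    tendsto_exp_atBot.comp (tendsto_id.const_mul_atTop_of_neg (by linarith [pi_pos]))
  have hb : Tendsto (fun y : ℝ => 2 / (1 - exp (-π * y)) * exp (-π * y)) atTop (𝓝 0) := by
    have := ((tendsto_const_nhds (x := (2 : ℝ))).div (tendsto_const_nhds.sub hE) (by norm_num : (1 : ℝ) - 0 ≠ 0)).mul hE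
    simpa using this
  rw [tendsto_iff_norm_sub_tendsto_zero]
  refine squeeze_zero' (Eventually.of_forall fun _ => norm_nonneg _) ?_ hb
  filter_upwards [eventually_gt_atTop 0] with y hy
  have := norm_jacobiTheta_sub_one_le (τ := τ y) (by rw [hτ]; exact hy)
  rwa [jacobiTheta_eq_jacobiTheta₂, hτ] at this

lemma tendsto_t3 : Tendsto t3 atTop (𝓝 1) := by
  have := (Complex.continuous_re.tendsto 1).comp (tendsto_th3_of_im (τ := fun y => I * y) (by simp))
  rwa [Complex.one_re] at this

lemma tendsto_t4 : Tendsto t4 atTop (𝓝 1) := by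
  have := (Complex.continuous_re.tendsto 1).comp (tendsto_th3_of_im (τ := fun y => I * y + 1) (by simp))
  simp only [th3_add_one] at this
  rwa [Complex.one_re] at this

/-- A function invariant under doubling equals its limit at infinity. -/
lemma eq_of_doubling {Φ : ℝ → ℝ} {L : ℝ} (h : ∀ y, 0 < y → Φ (2 * y) = Φ y) (hL : Tendsto Φ atTop (𝓝 L))
    {y : ℝ} (hy : 0 < y) : Φ y = L := by
  have h1 : ∀ n : ℕ, Φ (2 ^ n * y) = Φ y := by
    intro n
    induction n with
    | zero => simp
    | succ n ih => rw [pow_succ', mul_assoc, h _ (by positivity), ih]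
  have h2 : Tendsto (fun n : ℕ => (2 : ℝ) ^ n * y) atTop atTop :=
    (tendsto_pow_atTop_atTop_of_one_lt (by norm_num)).atTop_mul_const hy
  have h3 := hL.comp h2
  simp only [Function.comp_def, h1] at h3
  exact tendsto_nhds_unique tendsto_const_nhds h3

lemma one_sub_ratio_lt_one {y : ℝ} (hy : 0 < y) : 1 - (t4 y ^ 2 / t3 y ^ 2) ^ 2 < 1 := by
  have := t4_pos hy
  have := t3_pos hy
  have : 0 < (t4 y ^ 2 / t3 y ^ 2) ^ 2 := by positivity
  linarith

lemma ratio_lt_one {y : ℝ} (hy : 0 < y) : t4 y ^ 2 / t3 y ^ 2 < 1 := by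
  have h3 := t3_pos hy
  have h2 := t2_pos (show 0 < 2 * y by positivity)
  rw [div_lt_one (by positivity), t3_sq hy, t4_sq hy]
  nlinarith

lemma ratio_doubling {y : ℝ} (hy : 0 < y) :
    1 + t4 y ^ 2 / t3 y ^ 2 = 2 * t3 (2 * y) ^ 2 / t3 y ^ 2 := by
  have h3 := t3_pos hy
  field_simp
  rw [t3_sq hy, t4_sq hy]; ring

lemma Kf_eq_t3_sq {y : ℝ} (hy : 0 < y) : Kf (1 - (t4 y ^ 2 / t3 y ^ 2) ^ 2) = π / 2 * t3 y ^ 2 := by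
  have key := eq_of_doubling (Φ := fun y => Kf (1 - (t4 y ^ 2 / t3 y ^ 2) ^ 2) / t3 y ^ 2) (L := π / 2)
    ?_ ?_ hy
  · have := t3_pos hy
    rw [← key]; field_simp
  · intro y hy
    have h3 := t3_pos hy
    have h4 := t4_pos hy
    have h6 := t3_pos (show 0 < 2 * y by positivity)
    have hl := Kf_landen (k := t4 y ^ 2 / t3 y ^ 2) (by positivity) (ratio_lt_one hy).le
    have e1 : ((1 - t4 y ^ 2 / t3 y ^ 2) / (1 + t4 y ^ 2 / t3 y ^ 2)) ^ 2 =
        1 - (t4 (2 * y) ^ 2 / t3 (2 * y) ^ 2) ^ 2 := by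
      have j := t_jacobi (show 0 < 2 * y by positivity)
      have : 1 - (t4 (2 * y) ^ 2 / t3 (2 * y) ^ 2) ^ 2 = (t2 (2 * y) ^ 2 / t3 (2 * y) ^ 2) ^ 2 := by
        field_simp
        linear_combination j
      rw [this, ratio_doubling hy]
      congr 1
      field_simp
      rw [t3_sq hy, t4_sq hy]; ring
    rw [e1, ratio_doubling hy] at hl
    field_simp
    field_simp at hl
    linarith
  · have h1 : Tendsto (fun y => 1 - (t4 y ^ 2 / t3 y ^ 2) ^ 2) atTop (𝓝 0) := by
      have := ((((tendsto_t4.pow 2).div (tendsto_t3.pow 2) (by norm_num)).pow 2).const_sub 1)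
      simpa using this
    have h2 := ((hasDerivAt_Kf (a := 0) (by norm_num) (by norm_num)).continuousAt.tendsto.comp h1).div
      (tendsto_t3.pow 2) (by norm_num)
    rw [Kf_zero, one_pow, div_one] at h2
    exact h2

lemma t2_sq {y : ℝ} (hy : 0 < y) : t2 y ^ 2 = 2 * t2 (2 * y) * t3 (2 * y) := by
  have h := th2_sq (I_mul_im_pos hy)
  rw [two_mul_I_mul, ← ofReal_t2 hy, ← ofReal_t3 (by positivity), ← ofReal_t2 (by positivity)] at h
  exact_mod_cast h

lemma t3_strictAntiOn : StrictAntiOn t3 (Ioi 0) := by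
  intro x hx y hy hxy
  rw [← (hasSum_t3 hx).1.tsum_eq, ← (hasSum_t3 hy).1.tsum_eq]
  refine Summable.tsum_lt_tsum (i := 1) (fun n => ?_) ?_ (hasSum_t3 hy).1.summable (hasSum_t3 hx).1.summable
  · have : π * x * (n : ℝ) ^ 2 ≤ π * y * (n : ℝ) ^ 2 := by gcongr
    exact exp_le_exp.2 (by linarith)
  · have : π * x < π * y := by gcongr
    exact exp_lt_exp.2 (by push_cast; linarith)

lemma Kf_mono {a b : ℝ} (hab : a ≤ b) (hb : b < 1) : Kf a ≤ Kf b := by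
  have ha : a < 1 := hab.trans_lt hb
  refine intervalIntegral.integral_mono_on (by positivity) ((continuous_delta ha 0 _).intervalIntegrable _ _)
    ((continuous_delta hb 0 _).intervalIntegrable _ _) fun θ _ => ?_
  have h := delta_pos hb θ
  have : b * sin θ ^ 2 ≥ a * sin θ ^ 2 := by gcongr
  exact mul_le_mul_of_nonneg_left (rpow_le_rpow_of_nonpos h (by linarith) (by norm_num)) (by simp)

lemma ratio_lt_ratio {y : ℝ} (hy : 0 < y) :
    t4 y ^ 2 / t3 y ^ 2 < t4 (3 * y) ^ 2 / t3 (3 * y) ^ 2 := by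
  by_contra! h
  have h3 : 0 < 3 * y := by positivity
  have hp : 0 < t4 (3 * y) ^ 2 / t3 (3 * y) ^ 2 := by
    have := t4_pos h3; have := t3_pos h3; positivity
  have h1 := Kf_mono (a := 1 - (t4 y ^ 2 / t3 y ^ 2) ^ 2) (b := 1 - (t4 (3 * y) ^ 2 / t3 (3 * y) ^ 2) ^ 2)
    (by gcongr) (one_sub_ratio_lt_one h3)
  rw [Kf_eq_t3_sq hy, Kf_eq_t3_sq h3] at h1
  have h2 : t3 (3 * y) < t3 y := t3_strictAntiOn hy h3 (by linarith)
  have h4 := t3_pos h3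
  have : t3 y ^ 2 ≤ t3 (3 * y) ^ 2 := le_of_mul_le_mul_left h1 (by positivity)
  nlinarith

/-- The cubic modular parameter as a function of `B = θ₄(q)θ₄(q³)/(θ₃(q)θ₃(q³))`. -/
noncomputable def mB (B : ℝ) : ℝ := (1 - 2 * B) + √((1 - 2 * B) ^ 2 + 3)

lemma mB_pos (B : ℝ) : 0 < mB B := by
  have : |1 - 2 * B| < √((1 - 2 * B) ^ 2 + 3) := by
    rw [← sqrt_sq_eq_abs]; exact sqrt_lt_sqrt (sq_nonneg _) (by linarith)
  have h2 := neg_abs_le (1 - 2 * B)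
  unfold mB; linarith

lemma mB_eq (B : ℝ) : (3 - mB B) * (mB B + 1) = 4 * mB B * B := by
  have : √((1 - 2 * B) ^ 2 + 3) ^ 2 = (1 - 2 * B) ^ 2 + 3 := sq_sqrt (by positivity)
  unfold mB; linear_combination -this

lemma eq_mB {B m : ℝ} (hm : 0 < m) (h : (3 - m) * (m + 1) = 4 * m * B) : m = mB B := by
  have h1 := mB_eq B
  have h2 := mB_pos B
  have h3 : (m - mB B) * (m * mB B + 3) = 0 := by linear_combination (-mB B) * h + m * h1
  rcases mul_eq_zero.1 h3 with h4 | h4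
  · linarith
  · have : 0 < m * mB B := by positivity
    linarith

lemma mB_mem {B : ℝ} (h0 : 0 < B) (h1 : B < 1) : 1 < mB B ∧ mB B < 3 := by
  have h := mB_eq B
  have hp := mB_pos B
  constructor
  · by_contra! h2
    nlinarith
  · by_contra! h2
    have : 0 < 4 * mB B * B := by positivity
    nlinarith

lemma mB_zero_one : mB 1 = 1 := (eq_mB one_pos (by norm_num)).symm

lemma continuous_mB : Continuous mB := by unfold mB; fun_prop

/-- Solving the cubic modular equation for the two moduli. -/
lemma cubic_moduli {k l B : ℝ} (hk : 0 < k) (hkl : k < l) (hB : 0 < B)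
    (hB1 : B < 1) (h1 : B ^ 2 = k * l) (h2 : (1 - B) ^ 4 = (1 - k ^ 2) * (1 - l ^ 2)) :
    k = (3 - mB B) * √(mB B * (3 - mB B) * (mB B + 1)) / (4 * mB B ^ 2) ∧
      l = (mB B + 1) * √(mB B * (3 - mB B) * (mB B + 1)) / (4 * mB B) := by
  have hm := mB_eq B
  obtain ⟨hm1, hm3⟩ := mB_mem hB hB1
  set m := mB B with hmd
  have hm0 : 0 < m := by linarith
  have h3m : 0 < 3 - m := by linarith
  have hrp : 0 < m * (3 - m) * (m + 1) := by positivity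
  set r := √(m * (3 - m) * (m + 1)) with hr
  have hr0 : 0 < r := sqrt_pos.2 hrp
  have hr2 : r ^ 2 = m * (3 - m) * (m + 1) := sq_sqrt hrp.le
  set k₀ := (3 - m) * r / (4 * m ^ 2) with hk0
  set l₀ := (m + 1) * r / (4 * m) with hl0
  have hk0p : 0 < k₀ := by positivity
  have hl0p : 0 < l₀ := by positivity
  have hl : 0 < l := hk.trans hkl
  have hBm : B = (3 - m) * (m + 1) / (4 * m) := by field_simp; linarith
  have k2 : k₀ ^ 2 = (3 - m) ^ 3 * (m + 1) / (16 * m ^ 3) := by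
    rw [hk0, div_pow, mul_pow, hr2]; field_simp; ring
  have l2 : l₀ ^ 2 = (m + 1) ^ 3 * (3 - m) / (16 * m) := by
    rw [hl0, div_pow, mul_pow, hr2]; field_simp; ring
  have hlt : k₀ < l₀ := by
    rw [hk0, hl0, div_lt_div_iff₀ (by positivity) (by positivity)]
    have : (3 - m) < (m + 1) * m := by nlinarith
    have h5 : 0 < r * m := by positivity
    nlinarith
  have hs : k ^ 2 + l ^ 2 = k₀ ^ 2 + l₀ ^ 2 := by
    have : k ^ 2 + l ^ 2 = 1 + B ^ 4 - (1 - B) ^ 4 := by linear_combination h2 - (B ^ 2 + k * l) * h1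
    rw [this, k2, l2, hBm]; field_simp; ring
  have hp : k ^ 2 * l ^ 2 = k₀ ^ 2 * l₀ ^ 2 := by
    have : k ^ 2 * l ^ 2 = B ^ 4 := by linear_combination (-(B ^ 2 + k * l)) * h1
    rw [this, k2, l2, hBm]; field_simp; norm_num
  have hprod : (k ^ 2 - k₀ ^ 2) * (k ^ 2 - l₀ ^ 2) = 0 := by linear_combination k ^ 2 * hs - hp
  have key : k = k₀ := by
    rcases mul_eq_zero.1 hprod with h | h
    · exact (pow_left_inj₀ hk.le hk0p.le two_ne_zero).1 (by linarith)
    · have h5 : k = l₀ := (pow_left_inj₀ hk.le hl0p.le two_ne_zero).1 (by linarith)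
      have h6 : l = k₀ := (pow_left_inj₀ hl.le hk0p.le two_ne_zero).1 (by rw [h5] at hs; linarith)
      linarith
  refine ⟨key, (pow_left_inj₀ hl.le hl0p.le two_ne_zero).1 ?_⟩
  rw [key] at hs; linarith

noncomputable def tB (y : ℝ) : ℝ := t4 y * t4 (3 * y) / (t3 y * t3 (3 * y))
/-- The cubic multiplier. -/
noncomputable def mm (y : ℝ) : ℝ := t3 y ^ 2 / t3 (3 * y) ^ 2

lemma tB_eq {y : ℝ} (hy : 0 < y) : 1 - tB y = t2 y * t2 (3 * y) / (t3 y * t3 (3 * y)) := by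
  have h3 : 0 < 3 * y := by positivity
  have := t3_pos hy
  have := t3_pos h3
  unfold tB
  field_simp
  linear_combination t_cubic hy

lemma tB_pos {y : ℝ} (hy : 0 < y) : 0 < tB y := by
  have h3 : 0 < 3 * y := by positivity
  have := t3_pos hy; have := t3_pos h3; have := t4_pos hy; have := t4_pos h3
  unfold tB; positivity

lemma tB_lt_one {y : ℝ} (hy : 0 < y) : tB y < 1 := by
  have h3 : 0 < 3 * y := by positivity
  have := t3_pos hy; have := t3_pos h3; have := t2_pos hy; have := t2_pos h3
  have h : 0 < t2 y * t2 (3 * y) / (t3 y * t3 (3 * y)) := by positivity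
  rw [← tB_eq hy] at h; linarith

lemma t_moduli {y : ℝ} (hy : 0 < y) : t4 y ^ 2 / t3 y ^ 2 =
      (3 - mB (tB y)) * √(mB (tB y) * (3 - mB (tB y)) * (mB (tB y) + 1)) / (4 * mB (tB y) ^ 2) ∧
    t4 (3 * y) ^ 2 / t3 (3 * y) ^ 2 =
      (mB (tB y) + 1) * √(mB (tB y) * (3 - mB (tB y)) * (mB (tB y) + 1)) / (4 * mB (tB y)) := by
  have h3 : 0 < 3 * y := by positivity
  have p1 := t3_pos hy
  have p2 := t3_pos h3
  have p3 := t4_pos hy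
  refine cubic_moduli (by positivity) (ratio_lt_ratio hy) (tB_pos hy) (tB_lt_one hy) ?_ ?_
  · unfold tB; field_simp
  · rw [tB_eq hy]
    field_simp
    rw [show t2 y ^ 4 = t3 y ^ 4 - t4 y ^ 4 by linarith [t_jacobi hy],
      show t2 (3 * y) ^ 4 = t3 (3 * y) ^ 4 - t4 (3 * y) ^ 4 by linarith [t_jacobi h3]]

lemma mB_doubling {y : ℝ} (hy : 0 < y) : mB (tB (2 * y)) =
    mB (tB y) * (1 + t4 y ^ 2 / t3 y ^ 2) / (1 + t4 (3 * y) ^ 2 / t3 (3 * y) ^ 2) := by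
  have h3 : 0 < 3 * y := by positivity
  have h2 : 0 < 2 * y := by positivity
  have h6 : 0 < 2 * (3 * y) := by positivity
  have p1 := t3_pos hy
  have p2 := t3_pos h3
  have p3 := t3_pos h2
  have p4 := t3_pos h6
  have q1 := t4_pos hy
  have q2 := t4_pos h3
  have hA : 1 - tB (2 * y) = (1 - tB y) ^ 2 /
      ((1 + t4 y ^ 2 / t3 y ^ 2) * (1 + t4 (3 * y) ^ 2 / t3 (3 * y) ^ 2)) := by
    rw [tB_eq hy, tB_eq h2, ratio_doubling hy, ratio_doubling h3, show 3 * (2 * y) = 2 * (3 * y) by ring,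
      div_pow, mul_pow, t2_sq hy, t2_sq h3]
    generalize t3 (2 * (3 * y)) = u at p4 ⊢
    generalize t3 (3 * y) = v at p2 ⊢
    field_simp
  obtain ⟨hk, hl⟩ := t_moduli hy
  obtain ⟨hm1, hm3⟩ := mB_mem (tB_pos hy) (tB_lt_one hy)
  have hm := mB_eq (tB y)
  set m := mB (tB y)
  have hm0 : 0 < m := by linarith
  have h3m : 0 < 3 - m := by linarith
  have hrp : 0 < m * (3 - m) * (m + 1) := by positivity
  set r := √(m * (3 - m) * (m + 1)) with hr
  have hr2 : r ^ 2 = m * (3 - m) * (m + 1) := sq_sqrt hrp.le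
  set k := t4 y ^ 2 / t3 y ^ 2
  set l := t4 (3 * y) ^ 2 / t3 (3 * y) ^ 2
  have hk0 : 0 < k := by positivity
  have hl0 : 0 < l := by positivity
  refine (eq_mB (by positivity) ?_).symm
  have e1 : m * (1 + k) - (1 + l) = (m - 1) * (1 - r / (2 * m)) := by
    rw [hk, hl]; field_simp; ring
  have e2 : m * (1 + k) + 3 * (1 + l) = (m + 3) * (1 + r / (2 * m)) := by
    rw [hk, hl]; field_simp; ring
  have e3 : (m * (1 + k) - (1 + l)) * (m * (1 + k) + 3 * (1 + l)) = 4 * m * (1 - tB y) ^ 2 := by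
    have : 1 - tB y = (m - 1) * (m + 3) / (4 * m) := by
      have : tB y = (3 - m) * (m + 1) / (4 * m) := by field_simp; linarith
      rw [this]; field_simp; ring
    rw [e1, e2, this]
    field_simp
    linear_combination (-4 * (m - 1)) * hr2
  have hB : tB (2 * y) = 1 - (1 - tB y) ^ 2 / ((1 + k) * (1 + l)) := by linarith
  rw [hB]
  field_simp
  linear_combination (-1) * e3

lemma mm_eq {y : ℝ} (hy : 0 < y) : mm y = mB (tB y) := by
  have key := eq_of_doubling (Φ := fun y => mm y / mB (tB y)) (L := 1) ?_ ?_ hy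
  · have := mB_pos (tB y)
    field_simp at key
    exact key
  · intro y hy
    have h3 : 0 < 3 * y := by positivity
    have h2 : 0 < 2 * y := by positivity
    have h6 : 0 < 2 * (3 * y) := by positivity
    have p1 := t3_pos hy
    have p2 := t3_pos h3
    have p3 := t3_pos h2
    have p4 := t3_pos h6
    have p5 := mB_pos (tB y)
    rw [mB_doubling hy, ratio_doubling hy, ratio_doubling h3]
    unfold mm
    rw [show 3 * (2 * y) = 2 * (3 * y) by ring]
    generalize t3 (2 * (3 * y)) = u at p4 ⊢
    generalize t3 (3 * y) = v at p2 ⊢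
    field_simp
  · have h3 : Tendsto (fun y : ℝ => 3 * y) atTop atTop := tendsto_id.const_mul_atTop (by norm_num)
    have a1 := tendsto_t3.comp h3
    have a2 := tendsto_t4.comp h3
    have b1 := (tendsto_t4.mul a2).div (tendsto_t3.mul a1) (by norm_num)
    have b2 := (continuous_mB.tendsto _).comp b1
    have b3 := (tendsto_t3.pow 2).div (a1.pow 2) (by norm_num)
    have b4 := b3.div b2 (mB_pos _).ne'
    rw [one_mul, one_pow, div_one, mB_zero_one, div_one] at b4
    exact b4

lemma one_lt_mm {y : ℝ} (hy : 0 < y) : 1 < mm y := by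
  rw [mm_eq hy]; exact (mB_mem (tB_pos hy) (tB_lt_one hy)).1

lemma mm_lt_three {y : ℝ} (hy : 0 < y) : mm y < 3 := by
  rw [mm_eq hy]; exact (mB_mem (tB_pos hy) (tB_lt_one hy)).2

lemma t4_mul_t4 {y : ℝ} (hy : 0 < y) : t4 y * t4 (3 * y) / (t3 y * t3 (3 * y)) = (3 - mm y) * (mm y + 1) / (4 * mm y) := by
  have h := mB_eq (tB y)
  have h0 := mB_pos (tB y)
  rw [← mm_eq hy] at h h0
  change tB y = _
  field_simp; linarith

lemma t2_mul_t2 {y : ℝ} (hy : 0 < y) : t2 y * t2 (3 * y) / (t3 y * t3 (3 * y)) = (mm y - 1) * (mm y + 3) / (4 * mm y) := by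
  have h0 := mB_pos (tB y)
  rw [← mm_eq hy] at h0
  rw [← tB_eq hy, tB, t4_mul_t4 hy]; field_simp; ring

lemma modulus_eq {y : ℝ} (hy : 0 < y) : 1 - (t4 y ^ 2 / t3 y ^ 2) ^ 2 = (mm y - 1) * (mm y + 3) ^ 3 / (16 * mm y ^ 3) := by
  rw [(t_moduli hy).1, ← mm_eq hy]
  have h1 := one_lt_mm hy
  have h3 := mm_lt_three hy
  have hp : 0 ≤ mm y * (3 - mm y) * (mm y + 1) :=
    mul_nonneg (mul_nonneg (by linarith) (by linarith)) (by linarith)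
  rw [div_pow, mul_pow, sq_sqrt hp]
  field_simp
  ring

lemma FF_zero : FF 0 = π / (3 * √3) := by
  have hQ : ∀ s, QQ 0 s = 1 + 2 * cosh s := fun s => by
    unfold QQ PP
    rw [show 4 * cosh s ^ 2 + 4 * (0 + 1) * cosh s + 0 ^ 2 + 6 * 0 + 1 = (1 + 2 * cosh s) ^ 2 by ring]
    exact sqrt_sq (by linarith [cosh_pos s])
  rw [FF_eq le_rfl]
  simp only [hQ]
  have h3 : 0 < √3 := by positivity
  have hs3 : √3 ^ 2 = 3 := sq_sqrt (by norm_num)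
  have hd : ∀ s ∈ Ici (0 : ℝ), HasDerivAt (fun s => 2 / √3 * arctan ((2 * exp s + 1) / √3))
      (1 / (1 + 2 * cosh s)) s := by
    intro s _
    refine (((((Real.hasDerivAt_exp s).const_mul 2).add_const 1).div_const √3).arctan.const_mul (2 / √3)).congr_deriv ?_
    have he := exp_pos s
    rw [cosh_eq, exp_neg, div_pow, hs3]
    field_simp
    rw [hs3]
    ring
  have ht : Tendsto (fun s : ℝ => 2 / √3 * arctan ((2 * exp s + 1) / √3)) atTop (𝓝 (2 / √3 * (π / 2))) := by
    refine Tendsto.const_mul _ ((tendsto_arctan_atTop.mono_right nhdsWithin_le_nhds).comp ?_)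
    exact (tendsto_atTop_add_const_right _ _ (tendsto_exp_atTop.const_mul_atTop two_pos)).atTop_div_const h3
  rw [integral_Ioi_of_hasDerivAt_of_nonneg' hd (fun s _ => by have := cosh_pos s; positivity) ht]
  have e1 : (2 * exp 0 + 1) / √3 = tan (π / 3) := by
    rw [tan_pi_div_three, exp_zero]; field_simp; linarith
  rw [e1, arctan_tan (by linarith [pi_pos]) (by linarith [pi_pos])]
  field_simp
  ring

noncomputable def Xs (s : ℝ) : ℝ := 9 * (s ^ 4 - 1) / (9 - s ^ 4)
noncomputable def As (s : ℝ) : ℝ := (s ^ 2 - 1) * (s ^ 2 + 3) ^ 3 / (16 * s ^ 6)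

section
variable {s : ℝ}

lemma hasDerivAt_Xs (h3 : 0 < 9 - s ^ 4) : HasDerivAt Xs (288 * s ^ 3 / (9 - s ^ 4) ^ 2) s := by
  have h := (hasDerivAt_pow 4 s)
  refine (((h.sub_const 1).const_mul 9).div (h.const_sub 9) h3.ne').congr_deriv ?_
  have : (9 - s ^ 4) ≠ 0 := h3.ne'
  field_simp
  push_cast
  ring

lemma hasDerivAt_As (h1 : 0 < s) : HasDerivAt As ((9 - s ^ 4) ^ 2 / (8 * s ^ 7)) s := by
  have h := (hasDerivAt_pow 2 s)
  refine (((h.sub_const 1).mul ((h.add_const 3).fun_pow 3)).div ((hasDerivAt_pow 6 s).const_mul 16)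
    (by positivity)).congr_deriv ?_
  simp only [Pi.mul_apply]
  field_simp
  push_cast
  ring

lemma As_lt_one (h1 : 0 < s) (h3 : 0 < 3 - s ^ 2) : As s < 1 := by
  have : 1 - As s = (3 - s ^ 2) ^ 3 * (s ^ 2 + 1) / (16 * s ^ 6) := by
    unfold As; field_simp; ring
  have : 0 < (3 - s ^ 2) ^ 3 * (s ^ 2 + 1) / (16 * s ^ 6) := by positivity
  linarith

lemma As_nonneg (h1 : 1 ≤ s) : 0 ≤ As s := by
  have : 0 ≤ s ^ 2 - 1 := by nlinarith
  unfold As; positivity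

lemma Xs_nonneg (h1 : 1 ≤ s) (h3 : 0 < 9 - s ^ 4) : 0 ≤ Xs s := by
  have : 0 ≤ s ^ 4 - 1 := by nlinarith [one_le_pow₀ h1 (n := 4)]
  unfold Xs; positivity

/-- The elliptic-integral solution in the uniformizing parameter. -/
noncomputable def Hs (s : ℝ) : ℝ := (9 - s ^ 4) / s ^ 3 * Kf (As s)
noncomputable def Hs1 (s : ℝ) : ℝ :=
  -(s ^ 4 + 27) / s ^ 4 * Kf (As s) + (9 - s ^ 4) ^ 3 / (8 * s ^ 10) * Kf1 (As s)

lemma hasDerivAt_Hs (h1 : 1 ≤ s) (h3 : s ^ 2 < 3) : HasDerivAt Hs (Hs1 s) s := by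
  have hs : 0 < s := by linarith
  have hK := (hasDerivAt_Kf (As_lt_one hs (by linarith)) (by linarith [As_nonneg h1])).comp s (hasDerivAt_As hs)
  refine ((((hasDerivAt_pow 4 s).const_sub 9).div (hasDerivAt_pow 3 s) (by positivity)).mul hK).congr_deriv ?_
  unfold Hs1
  simp only [Pi.div_apply, Function.comp_apply]
  field_simp
  push_cast
  ring

lemma hasDerivAt_Hs1 (h1 : 1 ≤ s) (h3 : s ^ 2 < 3) :
    HasDerivAt (fun s => 18 * s * (s ^ 4 - 1) / (9 - s ^ 4) * Hs1 s)
      (-(1728 * s ^ 3 * (s ^ 4 + 3) / (9 - s ^ 4) ^ 3) * Hs s) s := by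
  have hs : 0 < s := by linarith
  have h9 : 0 < 9 - s ^ 4 := by nlinarith [sq_nonneg s]
  have hA1 := As_lt_one hs (by linarith)
  have hA0 : -1 < As s := by linarith [As_nonneg h1]
  have hK := (hasDerivAt_Kf hA1 hA0).comp s (hasDerivAt_As hs)
  have hK1 := (hasDerivAt_Kf1 hA1 hA0).comp s (hasDerivAt_As hs)
  have p4 := hasDerivAt_pow 4 s
  have hH := (((((p4.add_const 27).neg).div p4 (by positivity)).mul hK)).add
    (((((p4.const_sub 9).fun_pow 3)).div ((hasDerivAt_pow 10 s).const_mul 8) (by positivity)).mul hK1)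
  have hP := (((hasDerivAt_id s).const_mul 18).mul (p4.sub_const 1)).div (p4.const_sub 9) h9.ne'
  refine (hP.mul hH).congr_deriv ?_
  have ode := ode_Kf hA1
  unfold Hs
  simp only [Pi.div_apply, Pi.mul_apply, Pi.add_apply, Pi.neg_apply, Function.comp_apply, id]
  have hA : As s = (s ^ 2 - 1) * (s ^ 2 + 3) ^ 3 / (16 * s ^ 6) := rfl
  generalize Kf (As s) = K at ode ⊢
  generalize Kf1 (As s) = K1 at ode ⊢
  generalize Kf2 (As s) = K2 at ode ⊢
  rw [hA] at ode
  have ode' : (s ^ 4 - 1) * (9 - s ^ 4) ^ 3 * K2 =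
      (K / 4 - (1 - 2 * ((s ^ 2 - 1) * (s ^ 2 + 3) ^ 3 / (16 * s ^ 6))) * K1) * (256 * s ^ 12) := by
    rw [← ode]; field_simp; ring
  linear_combination (norm := skip) (18 * (9 - s ^ 4) / (64 * s ^ 16)) * ode'
  field_simp
  push_cast
  ring

lemma Hs_eq (h1 : 1 ≤ s) (h3 : s ^ 2 < 3) : Hs s = 12 * √3 * FF (Xs s) := by
  have h9 : ∀ {t : ℝ}, t ∈ Icc 1 s → t ^ 2 < 3 ∧ 0 < 9 - t ^ 4 := fun {t} ht => by
    have : t ^ 2 ≤ s ^ 2 := by have := ht.1; have := ht.2; gcongr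
    exact ⟨by linarith, by nlinarith [sq_nonneg t]⟩
  have hX : ∀ {t : ℝ}, t ∈ Icc 1 s → -1 < Xs t := fun {t} ht => by
    linarith [Xs_nonneg ht.1 (h9 ht).2]
  have hF : ∀ {t : ℝ}, t ∈ Icc 1 s → HasDerivAt (fun t => FF (Xs t))
      (FF1 (Xs t) * (288 * t ^ 3 / (9 - t ^ 4) ^ 2)) t := fun {t} ht =>
    (hasDerivAt_FF (hX ht)).comp t (hasDerivAt_Xs (h9 ht).2)
  have hpp : ∀ {t : ℝ}, t ∈ Icc 1 s → pp (Xs t) * (288 * t ^ 3 / (9 - t ^ 4) ^ 2)⁻¹ =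
      18 * t * (t ^ 4 - 1) / (9 - t ^ 4) := fun {t} ht => by
    have := (h9 ht).2
    have : 0 < t := by linarith [ht.1]
    unfold pp Xs
    field_simp
    ring
  have hw : ∀ t ∈ Icc 1 s, HasDerivAt (fun t => FF (Xs t) * (18 * t * (t ^ 4 - 1) / (9 - t ^ 4) * Hs1 t) -
      pp (Xs t) * FF1 (Xs t) * Hs t) 0 t := by
    intro t ht
    have h9' := (h9 ht).2
    have ht0 : 0 < t := by linarith [ht.1]
    have g1 := ((hasDerivAt_pp (Xs t)).mul (hasDerivAt_FF1 (hX ht))).comp t (hasDerivAt_Xs h9')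
    refine (((hF ht).mul (hasDerivAt_Hs1 ht.1 (h9 ht).1)).sub (g1.mul (hasDerivAt_Hs ht.1 (h9 ht).1))).congr_deriv ?_
    have ode := ode_FF (hX ht)
    simp only [Pi.mul_apply, Function.comp_apply]
    have e1 := hpp ht
    have e2 : (Xs t + 3) * (288 * t ^ 3 / (9 - t ^ 4) ^ 2) = 1728 * t ^ 3 * (t ^ 4 + 3) / (9 - t ^ 4) ^ 3 := by
      unfold Xs; field_simp; ring
    rw [← e1, ← e2]
    have hd : 288 * t ^ 3 / (9 - t ^ 4) ^ 2 ≠ 0 := by positivity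
    generalize 288 * t ^ 3 / (9 - t ^ 4) ^ 2 = d at hd ⊢
    linear_combination (norm := skip) (-(d * Hs t)) * ode
    field_simp
    ring
  have hw0 : ∀ t ∈ Icc 1 s, FF (Xs t) * (18 * t * (t ^ 4 - 1) / (9 - t ^ 4) * Hs1 t) -
      pp (Xs t) * FF1 (Xs t) * Hs t = 0 := by
    intro t ht
    have := constant_of_has_deriv_right_zero (fun x hx => (hw x hx).continuousAt.continuousWithinAt)
      (fun x hx => (hw x ⟨hx.1, hx.2.le⟩).hasDerivWithinAt) t ht
    rw [this]
    norm_num [Xs, pp]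
  have hq : ∀ t ∈ Icc 1 s, HasDerivAt (fun t => Hs t / FF (Xs t)) ((Hs1 t * FF (Xs t) -
      Hs t * (FF1 (Xs t) * (288 * t ^ 3 / (9 - t ^ 4) ^ 2))) / FF (Xs t) ^ 2) t := fun t ht =>
    (hasDerivAt_Hs ht.1 (h9 ht).1).div (hF ht) (FF_pos (hX ht)).ne'
  have hq0 : ∀ t ∈ Ioo 1 s, HasDerivAt (fun t => Hs t / FF (Xs t)) 0 t := by
    intro t ht
    have ht' : t ∈ Icc 1 s := ⟨ht.1.le, ht.2.le⟩
    refine (hq t ht').congr_deriv ?_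
    have h9' := (h9 ht').2
    have ht0 : 0 < t := by linarith [ht.1]
    have h1' : 0 < t ^ 4 - 1 := by linarith [one_lt_pow₀ ht.1 (n := 4) (by norm_num)]
    have e := hw0 t ht'
    have e1 := hpp ht'
    have hd : 288 * t ^ 3 / (9 - t ^ 4) ^ 2 ≠ 0 := by positivity
    have e3 : 18 * t * (t ^ 4 - 1) / (9 - t ^ 4) ≠ 0 := by positivity
    generalize 288 * t ^ 3 / (9 - t ^ 4) ^ 2 = d at hd e1 ⊢
    generalize 18 * t * (t ^ 4 - 1) / (9 - t ^ 4) = P at e e1 e3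
    have e4 : pp (Xs t) = P * d := by rw [← e1]; field_simp
    rw [e4] at e
    have : P * (Hs1 t * FF (Xs t) - Hs t * (FF1 (Xs t) * d)) = 0 := by linear_combination e
    rw [(mul_eq_zero.1 this).resolve_left e3, zero_div]
  have hc : Hs s / FF (Xs s) = Hs 1 / FF (Xs 1) := by
    rcases h1.eq_or_lt with h | h
    · rw [← h]
    · obtain ⟨c, -, hc⟩ := exists_hasDerivAt_eq_slope (fun t => Hs t / FF (Xs t)) (fun _ => 0) h
        (fun x hx => (hq x hx).continuousAt.continuousWithinAt) hq0
      have : s - 1 ≠ 0 := by linarith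
      rw [eq_div_iff this] at hc
      linarith
  have hX1 : Xs 1 = 0 := by norm_num [Xs]
  have hH1 : Hs 1 = 4 * π := by
    have : As 1 = 0 := by norm_num [As]
    rw [Hs, this, Kf_zero]; ring
  have hp := FF_pos (hX ⟨h1, le_rfl⟩)
  rw [hX1, hH1, FF_zero] at hc
  have h33 : 0 < √3 := by positivity
  field_simp at hc
  linarith

end

/-- The Hauptmodul on the ray, as a function of the height. -/
noncomputable def XX (y : ℝ) : ℝ := 9 * (mm y ^ 2 - 1) / (9 - mm y ^ 2)

lemma mm_bounds {y : ℝ} (hy : 0 < y) : 0 < mm y ∧ 0 < mm y ^ 2 - 1 ∧ 0 < 9 - mm y ^ 2 := by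
  have h1 := one_lt_mm hy
  have h3 := mm_lt_three hy
  exact ⟨by linarith, by nlinarith, by nlinarith⟩

lemma XX_pos {y : ℝ} (hy : 0 < y) : 0 < XX y := by
  obtain ⟨h1, h2, h3⟩ := mm_bounds hy
  unfold XX; positivity

lemma FF_XX {y : ℝ} (hy : 0 < y) :
    FF (XX y) = π / (24 * √3) * ((9 - mm y ^ 2) / mm y) * (t3 y * t3 (3 * y)) := by
  obtain ⟨h1, h2, h3⟩ := mm_bounds hy
  have p1 := t3_pos hy
  have p2 := t3_pos (show 0 < 3 * y by positivity)
  have hs : t3 y / t3 (3 * y) = √(mm y) := by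
    rw [mm, ← div_pow, sqrt_sq (by positivity)]
  have hs2 : √(mm y) ^ 2 = mm y := sq_sqrt h1.le
  have hs0 : 0 < √(mm y) := sqrt_pos.2 h1
  have key := Hs_eq (s := √(mm y)) (one_le_sqrt.2 (one_lt_mm hy).le) (by rw [hs2]; exact mm_lt_three hy)
  have eX : Xs √(mm y) = XX y := by
    unfold Xs XX; rw [show √(mm y) ^ 4 = (√(mm y) ^ 2) ^ 2 by ring, hs2]
  have eA : As √(mm y) = 1 - (t4 y ^ 2 / t3 y ^ 2) ^ 2 := by
    rw [modulus_eq hy]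
    unfold As; rw [show √(mm y) ^ 6 = (√(mm y) ^ 2) ^ 3 by ring, hs2]
  have e2 : t3 y = √(mm y) * t3 (3 * y) := by rw [← hs]; field_simp
  rw [eX, Hs, eA, Kf_eq_t3_sq hy, show √(mm y) ^ 4 = (√(mm y) ^ 2) ^ 2 by ring, hs2,
    show √(mm y) ^ 3 = √(mm y) ^ 2 * √(mm y) by ring, hs2] at key
  have h33 : 0 < √3 := by positivity
  have e3 : t3 y ^ 2 = √(mm y) * (t3 y * t3 (3 * y)) := by nth_rw 1 [sq, e2]; ring
  rw [e3] at key
  have : FF (XX y) = ((9 - mm y ^ 2) / (mm y * √(mm y)) * (π / 2 * (√(mm y) * (t3 y * t3 (3 * y))))) / (12 * √3) := by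
    rw [key]; field_simp
  rw [this]; field_simp; norm_num

lemma t3_inv_three {y : ℝ} (hy : 0 < y) : t3 (1 / (3 * y)) = √3 * √y * t3 (3 * y) ∧
    t3 (3 * (1 / (3 * y))) = √y * t3 y := by
  have h3 : 0 < 3 * y := by positivity
  refine ⟨by rw [← sqrt_mul_t3 h3, sqrt_mul (by norm_num)], ?_⟩
  rw [sqrt_mul_t3 hy]; congr 1; field_simp

lemma mm_inv_three {y : ℝ} (hy : 0 < y) : mm (1 / (3 * y)) = 3 / mm y := by
  have p1 := t3_pos hy
  have p2 := t3_pos (show 0 < 3 * y by positivity)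
  have hy' := sqrt_pos.2 hy
  have hs3 : √3 ^ 2 = 3 := sq_sqrt (by norm_num)
  unfold mm
  rw [(t3_inv_three hy).1, (t3_inv_three hy).2, mul_pow, mul_pow, hs3]
  generalize t3 (3 * y) = u at *
  field_simp

lemma XX_inv_three {y : ℝ} (hy : 0 < y) : XX (1 / (3 * y)) = 9 / XX y := by
  obtain ⟨h1, h2, h3⟩ := mm_bounds hy
  unfold XX
  rw [mm_inv_three hy]
  have : 9 - (3 / mm y) ^ 2 = 9 * (mm y ^ 2 - 1) / mm y ^ 2 := by field_simp; ring
  rw [this]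
  field_simp
  ring

lemma ss_XX {y : ℝ} (hy : 0 < y) : ss (XX y) = √3 * y * FF (XX y) := by
  obtain ⟨h1, h2, h3⟩ := mm_bounds hy
  have p1 := t3_pos hy
  have p2 := t3_pos (show 0 < 3 * y by positivity)
  have hsq : √y ^ 2 = y := sq_sqrt hy.le
  have h33 : 0 < √3 := by positivity
  unfold ss
  rw [← XX_inv_three hy, FF_XX hy, FF_XX (by positivity), mm_inv_three hy, (t3_inv_three hy).1,
    (t3_inv_three hy).2, XX]
  have : 9 - (3 / mm y) ^ 2 = 9 * (mm y ^ 2 - 1) / mm y ^ 2 := by field_simp; ring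
  rw [this]
  generalize t3 (3 * y) = u at *
  generalize t3 y = v at *
  field_simp
  rw [hsq]

/-- The height as a function of the Hauptmodul. -/
noncomputable def YY (X : ℝ) : ℝ := ss X / (√3 * FF X)

lemma YY_XX {y : ℝ} (hy : 0 < y) : YY (XX y) = y := by
  have := FF_pos (show -1 < XX y by linarith [XX_pos hy])
  have h33 : 0 < √3 := by positivity
  rw [YY, ss_XX hy]; field_simp

lemma YY_pos {X : ℝ} (hX : 0 < X) : 0 < YY X := by
  have := FF_pos (show -1 < X by linarith)
  have := ss_pos hX
  unfold YY; positivity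

lemma hasDerivAt_YY {X : ℝ} (hX : 0 < X) : HasDerivAt YY (-(π / (3 * (pp X * FF X ^ 2)))) X := by
  have hF := FF_pos (show -1 < X by linarith)
  have h33 : 0 < √3 := by positivity
  have hs3 : √3 ^ 2 = 3 := sq_sqrt (by norm_num)
  have hp := pp_pos hX
  refine ((isSol_ss X hX).1.div ((isSol_FF X hX).1.const_mul √3) (by positivity)).congr_deriv ?_
  have hw := wronskian_ss_FF hX
  rw [FF_zero] at hw
  field_simp at hw ⊢
  linear_combination (-√3) * hw + pp X * (ss X * FF1 X - ss1 X * FF X) * hs3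

lemma YY_strictAntiOn : StrictAntiOn YY (Ioi 0) := by
  refine strictAntiOn_of_deriv_neg (convex_Ioi 0)
    (fun X hX => (hasDerivAt_YY hX).continuousAt.continuousWithinAt) fun X hX => ?_
  rw [interior_Ioi] at hX
  have hF := FF_pos (show -1 < X by linarith [mem_Ioi.1 hX])
  have hp := pp_pos hX
  rw [(hasDerivAt_YY hX).deriv, neg_lt_zero]
  positivity

lemma XX_YY {X : ℝ} (hX : 0 < X) : XX (YY X) = X :=
  YY_strictAntiOn.injOn (XX_pos (YY_pos hX)) hX (YY_XX (YY_pos hX))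

lemma YY_three : YY 3 = 1 / √3 := by
  have hF := FF_pos (show (-1 : ℝ) < 3 by norm_num)
  unfold YY ss
  norm_num
  field_simp

lemma image_YY : YY '' Ioo 0 3 = Ioi (1 / √3) := by
  rw [← YY_three]
  ext y
  constructor
  · rintro ⟨X, hX, rfl⟩
    exact YY_strictAntiOn hX.1 (by norm_num : (3 : ℝ) ∈ Ioi 0) hX.2
  · intro hy
    have hy0 : 0 < y := (YY_pos (by norm_num)).trans hy
    refine ⟨XX y, ⟨XX_pos hy0, ?_⟩, YY_XX hy0⟩
    rw [← YY_strictAntiOn.lt_iff_gt (by norm_num : (3 : ℝ) ∈ Ioi 0) (XX_pos hy0), YY_XX hy0]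
    exact hy

lemma eta_triple {τ : ℂ} (hτ : 0 < τ.im) :
    dedekindEta (τ / 2) ^ 2 * dedekindEta (2 * τ) ^ 2 * dedekindEta ((τ + 1) / 2) ^ 2 =
      Complex.exp (π * I / 12) * dedekindEta τ ^ 6 := by
  have h := th2_sq (half_im_pos hτ)
  rw [th2_eq (half_im_pos hτ), show 2 * (τ / 2) = τ by ring, th2_eq hτ, th3_eq hτ] at h
  have h1 := dedekindEta_ne_zero hτ
  have h2 := dedekindEta_ne_zero (half_im_pos hτ)
  have h3 := Complex.exp_ne_zero (π * I / 12)
  field_simp at h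
  linear_combination -h

lemma th_product {τ : ℂ} (hτ : 0 < τ.im) : th2 τ * th3 τ * th4 τ = 2 * dedekindEta τ ^ 3 := by
  have h := eta_triple hτ
  have h1 := dedekindEta_ne_zero hτ
  have h3 := Complex.exp_ne_zero (π * I / 12)
  rw [th2_eq hτ, th3_eq hτ, th4_eq hτ]
  field_simp
  linear_combination h

lemma exp_pi_div_twelve_pow : Complex.exp (π * I / 12) ^ 12 = -1 := by
  rw [← Complex.exp_nat_mul, ← Complex.exp_pi_mul_I]; congr 1; push_cast; ring

/-- Eta values at the points of the ray. -/
lemma eta_ray {τ : ℂ} (hτ : 0 < τ.im) :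
    dedekindEta ((1 + τ) / 2) ^ 2 = Complex.exp (π * I / 12) * dedekindEta τ * th3 τ ∧
    dedekindEta (2 * ((1 + τ) / 2)) = Complex.exp (π * I / 12) * dedekindEta τ ∧
    dedekindEta (3 * ((1 + τ) / 2)) ^ 2 =
      Complex.exp (π * I / 12) ^ 3 * dedekindEta (3 * τ) * th3 (3 * τ) ∧
    dedekindEta (6 * ((1 + τ) / 2)) = Complex.exp (π * I / 12) ^ 3 * dedekindEta (3 * τ) := by
  have h3 := three_mul_im_pos hτ
  have e1 := dedekindEta_ne_zero hτ
  have e2 := dedekindEta_ne_zero h3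
  have c := Complex.exp_ne_zero (π * I / 12)
  refine ⟨?_, ?_, ?_, ?_⟩
  · rw [th3_eq hτ, add_comm]; field_simp
  · rw [show 2 * ((1 + τ) / 2) = τ + 1 by ring, dedekindEta_add_one]
  · rw [show 3 * ((1 + τ) / 2) = (3 * τ + 1) / 2 + 1 by ring, dedekindEta_add_one, th3_eq h3]; field_simp
  · rw [show 6 * ((1 + τ) / 2) = 3 * τ + 1 + 1 + 1 by ring, dedekindEta_add_one, dedekindEta_add_one,
      dedekindEta_add_one]; ring

lemma f46_ray {τ : ℂ} (hτ : 0 < τ.im) : f46 ((1 + τ) / 2) =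
    -(1 / 4) * (th2 τ * th2 (3 * τ)) * (th4 τ * th4 (3 * τ)) * (th3 τ * th3 (3 * τ)) ^ 2 := by
  obtain ⟨h1, h2, h3, h4⟩ := eta_ray hτ
  have p1 := th_product hτ
  have p2 := th_product (three_mul_im_pos hτ)
  have hc := exp_pi_div_twelve_pow
  unfold f46
  rw [mul_pow, mul_pow, mul_pow, h1, h2, h3, h4]
  calc _ = Complex.exp (π * I / 12) ^ 12 * (2 * dedekindEta τ ^ 3) * (2 * dedekindEta (3 * τ) ^ 3) *
        (th3 τ * th3 (3 * τ)) / 4 := by ring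
    _ = _ := by rw [hc, ← p1, ← p2]; ring

lemma w46_ray {τ : ℂ} (hτ : 0 < τ.im) (h0 : th3 τ ≠ 0) : w46 ((1 + τ) / 2) = 3 * th3 (3 * τ) ^ 2 / th3 τ ^ 2 := by
  obtain ⟨h1, h2, h3, h4⟩ := eta_ray hτ
  have e1 := dedekindEta_ne_zero hτ
  have e2 := dedekindEta_ne_zero (three_mul_im_pos hτ)
  have c := Complex.exp_ne_zero (π * I / 12)
  unfold w46
  rw [show dedekindEta (3 * ((1 + τ) / 2)) ^ 4 = (dedekindEta (3 * ((1 + τ) / 2)) ^ 2) ^ 2 by ring,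
    show dedekindEta ((1 + τ) / 2) ^ 4 = (dedekindEta ((1 + τ) / 2) ^ 2) ^ 2 by ring, h1, h2, h3, h4]
  field_simp

lemma f46_XX {y : ℝ} (hy : 0 < y) : f46 ((1 + I * y) / 2) =
    ((-(9 / π ^ 4) * (pp (XX y) * FF (XX y) ^ 4) : ℝ) : ℂ) := by
  have h3 : 0 < 3 * y := by positivity
  rw [f46_ray (I_mul_im_pos hy), three_mul_I_mul, ← ofReal_t2 hy, ← ofReal_t2 h3, ← ofReal_t3 hy,
    ← ofReal_t3 h3, ← ofReal_t4 hy, ← ofReal_t4 h3]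
  have key : -(1 / 4) * (t2 y * t2 (3 * y)) * (t4 y * t4 (3 * y)) * (t3 y * t3 (3 * y)) ^ 2 =
      -(9 / π ^ 4) * (pp (XX y) * FF (XX y) ^ 4) := by
    obtain ⟨m0, m1, m9⟩ := mm_bounds hy
    have p1 := t3_pos hy
    have p2 := t3_pos h3
    have hA := t2_mul_t2 hy
    have hB := t4_mul_t4 hy
    rw [div_eq_iff (by positivity)] at hA hB
    have hs3 : √3 ^ 4 = 9 := by
      rw [show √3 ^ 4 = (√3 ^ 2) ^ 2 by ring, sq_sqrt (by norm_num)]; norm_num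
    rw [hA, hB, FF_XX hy, pp, XX]
    generalize t3 y * t3 (3 * y) = u
    have := pi_pos
    field_simp
    rw [hs3]
    ring
  rw [← key]
  push_cast
  ring

lemma w46_XX {y : ℝ} (hy : 0 < y) : w46 ((1 + I * y) / 2) = ((3 / mm y : ℝ) : ℂ) := by
  have h3 : 0 < 3 * y := by positivity
  have p1 := t3_pos hy
  have p2 := t3_pos h3
  rw [w46_ray (I_mul_im_pos hy), three_mul_I_mul, ← ofReal_t3 hy, ← ofReal_t3 h3]
  · norm_cast
    unfold mm
    generalize t3 (3 * y) = u at *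
    field_simp
  · rw [← ofReal_t3 hy]; exact_mod_cast p1.ne'

lemma g46_XX {y : ℝ} (hy : 0 < y) : g46 ((1 + I * y) / 2) =
    ((-(9 / π ^ 4) * (gX (XX y) * (pp (XX y) * FF (XX y) ^ 4)) : ℝ) : ℂ) := by
  obtain ⟨m0, m1, m9⟩ := mm_bounds hy
  unfold g46
  rw [w46_XX hy, f46_XX hy]
  norm_cast
  have : ((3 / mm y) ^ 2 - 3) ^ 2 * ((3 / mm y) ^ 4 + 9) / (8 * (3 / mm y) ^ 4) = gX (XX y) := by
    unfold gX XX
    have e1 : 9 * (mm y ^ 2 - 1) / (9 - mm y ^ 2) + 1 = 8 * mm y ^ 2 / (9 - mm y ^ 2) := by field_simp; ring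
    have e2 : 9 * (mm y ^ 2 - 1) / (9 - mm y ^ 2) + 9 = 72 / (9 - mm y ^ 2) := by field_simp; ring
    rw [e1, e2]
    field_simp
    ring
  rw [← this]
  ring

/-- The Eichler-type integrals transported to the Hauptmodul. -/
noncomputable def RI (v : ℝ → ℝ) (n : ℕ) : ℝ := ∫ X in Ioo (0 : ℝ) 3, v X * FF X ^ 2 * YY X ^ n

lemma ray_integral {φ : ℂ → ℂ} {v : ℝ → ℝ} (hφ : ∀ y : ℝ, 0 < y → φ ((1 + I * y) / 2) =
    ((-(9 / π ^ 4) * (v (XX y) * (pp (XX y) * FF (XX y) ^ 4)) : ℝ) : ℂ)) (n : ℕ) :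
    -∫ y in Ioi (1 / √3), φ ((1 + I * (y : ℂ)) / 2) * (y : ℂ) ^ n = ((3 / π ^ 3 * RI v n : ℝ) : ℂ) := by
  have h0 : (0 : ℝ) < 1 / √3 := by positivity
  have e1 : ∫ y in Ioi (1 / √3), φ ((1 + I * (y : ℂ)) / 2) * (y : ℂ) ^ n =
      ((∫ y in Ioi (1 / √3), -(9 / π ^ 4) * (v (XX y) * (pp (XX y) * FF (XX y) ^ 4)) * y ^ n : ℝ) : ℂ) := by
    rw [← integral_complex_ofReal]
    refine setIntegral_congr_fun measurableSet_Ioi fun y hy => ?_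
    rw [hφ y (h0.trans hy)]
    push_cast; ring
  rw [e1, ← image_YY, integral_image_eq_integral_abs_deriv_smul measurableSet_Ioo
    (fun X hX => (hasDerivAt_YY hX.1).hasDerivWithinAt) (YY_strictAntiOn.injOn.mono Ioo_subset_Ioi_self)]
  rw [← Complex.ofReal_neg]
  congr 1
  unfold RI
  rw [← integral_neg, ← integral_const_mul]
  refine setIntegral_congr_fun measurableSet_Ioo fun X hX => ?_
  have hF := FF_pos (show -1 < X by linarith [hX.1])
  have hp := pp_pos hX.1
  have := pi_pos
  simp only [smul_eq_mul]
  rw [XX_YY hX.1, abs_neg, abs_of_pos (by positivity)]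
  field_simp
  ring

lemma D_eq (s : ℕ) : D s = ((3 / π ^ 3 * RI (fun _ => 1) (s - 1) : ℝ) : ℂ) :=
  ray_integral (v := fun _ => 1) (fun _ hy => by rw [f46_XX hy]; simp) (s - 1)

lemma E_eq (s : ℕ) : E s = ((3 / π ^ 3 * RI gX (s - 1) : ℝ) : ℂ) :=
  ray_integral (fun _ hy => g46_XX hy) (s - 1)

lemma integral_fold {G : ℝ → ℝ} (hG : IntegrableOn G (Ioi 0)) :
    ∫ X in Ioi (0 : ℝ), G X = (∫ X in Ioo (0 : ℝ) 3, G X) + ∫ X in Ioo (0 : ℝ) 3, 9 / X ^ 2 * G (9 / X) := by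
  have himg : (fun X : ℝ => 9 / X) '' Ioo 0 3 = Ioi 3 := by
    ext x
    constructor
    · rintro ⟨X, hX, rfl⟩
      have := hX.1
      rw [mem_Ioi, lt_div_iff₀ hX.1]; linarith [hX.2]
    · intro hx
      have hx' : (3 : ℝ) < x := hx
      refine ⟨9 / x, ⟨by positivity, ?_⟩, by simp⟩
      rw [div_lt_iff₀ (by linarith)]; linarith
  have h := integral_image_eq_integral_abs_deriv_smul (s := Ioo (0 : ℝ) 3) (f := fun Y => 9 / Y)
    (f' := fun Y => -9 / Y ^ 2) measurableSet_Ioo (fun Y hY => by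
      have h := hasDerivAt_const_div_pow 9 hY.1 1
      simp only [pow_one, Nat.cast_one, one_mul] at h
      exact h.hasDerivWithinAt) (injOn_const_div (by norm_num) _) G
  rw [himg] at h
  have e : ∫ X in Ioo (0 : ℝ) 3, 9 / X ^ 2 * G (9 / X) = ∫ X in Ioi 3, G X := by
    rw [h]
    refine setIntegral_congr_fun measurableSet_Ioo fun X hX => ?_
    have := hX.1
    simp only [smul_eq_mul]
    rw [neg_div, abs_neg, abs_of_pos (by positivity)]
  rw [e, ← integral_Ioc_eq_integral_Ioo, ← setIntegral_union (by simp) measurableSet_Ioi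
    (hG.mono_set Ioc_subset_Ioi_self) (hG.mono_set (Ioi_subset_Ioi (by norm_num))), Ioc_union_Ioi_eq_Ioi (by norm_num)]

lemma ss_eq_YY {X : ℝ} (hX : 0 < X) : ss X = √3 * YY X * FF X := by
  have hF := FF_pos (show -1 < X by linarith)
  have h33 : 0 < √3 := by positivity
  unfold YY; field_simp

lemma integral_FF_FF_eq {v : ℝ → ℝ} (hv : ∀ X, 0 < X → v (9 / X) = v X)
    (hi : IntegrableOn (fun X => v X * (FF X * FF X)) (Ioi 0)) :
    ∫ X in Ioi (0 : ℝ), v X * (FF X * FF X) = RI v 0 + 3 * RI v 2 := by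
  rw [integral_fold hi]
  unfold RI
  rw [← integral_const_mul]
  congr 1
  · refine setIntegral_congr_fun measurableSet_Ioo fun X hX => ?_
    ring
  · refine setIntegral_congr_fun measurableSet_Ioo fun X hX => ?_
    have h := hX.1
    have e := ss_eq_YY h
    have h3 : √3 ^ 2 = 3 := sq_sqrt (by norm_num)
    rw [hv X h]
    calc _ = v X * ss X ^ 2 := by unfold ss; field_simp; ring
      _ = v X * (√3 ^ 2 * YY X ^ 2 * FF X ^ 2) := by rw [e]; ring
      _ = _ := by rw [h3]; ring

lemma integral_FF_ss_eq {v : ℝ → ℝ} (hv : ∀ X, 0 < X → v (9 / X) = v X)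
    (hi : IntegrableOn (fun X => v X * (FF X * ss X)) (Ioi 0)) :
    ∫ X in Ioi (0 : ℝ), v X * (FF X * ss X) = 2 * √3 * RI v 1 := by
  have key : ∫ X in Ioo (0 : ℝ) 3, v X * (FF X * ss X) = √3 * RI v 1 := by
    unfold RI
    rw [← integral_const_mul]
    refine setIntegral_congr_fun measurableSet_Ioo fun X hX => ?_
    rw [ss_eq_YY hX.1]; ring
  have key2 : ∫ X in Ioo (0 : ℝ) 3, 9 / X ^ 2 * (v (9 / X) * (FF (9 / X) * ss (9 / X))) =
      ∫ X in Ioo (0 : ℝ) 3, v X * (FF X * ss X) := by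
    refine setIntegral_congr_fun measurableSet_Ioo fun X hX => ?_
    have h := hX.1
    rw [hv X h]
    unfold ss
    rw [show 9 / (9 / X) = X by field_simp]
    field_simp
  rw [integral_fold hi, key2, key]; ring

lemma gX_inv {X : ℝ} (hX : 0 < X) : gX (9 / X) = gX X := by
  unfold gX
  field_simp
  ring

/-- The nome `q = exp(2πiz)`. -/
noncomputable def qq (z : ℂ) : ℂ := Complex.exp (2 * π * I * z)

lemma norm_qq (z : ℂ) : ‖qq z‖ = exp (-(2 * π * z.im)) := by
  rw [qq, Complex.norm_exp]; congr 1; simp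

lemma qq_mem {z : ℂ} (hz : 0 < z.im) : qq z ∈ Metric.ball (0 : ℂ) 1 := by
  rw [mem_ball_zero_iff]; exact norm_exp_two_pi_lt_one hz

lemma qq_ne_zero (z : ℂ) : qq z ≠ 0 := Complex.exp_ne_zero _

lemma qq_add_one (z : ℂ) : qq (z + 1) = qq z := by
  rw [qq, mul_add, mul_one, Complex.exp_add, Complex.exp_two_pi_mul_I, mul_one, qq]

lemma qq_sub_half (z : ℂ) : qq ((z - 1) / 2) = -qq (z / 2) := by
  rw [qq, qq, show 2 * π * I * ((z - 1) / 2) = 2 * π * I * (z / 2) - π * I by ring,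
    Complex.exp_sub, Complex.exp_pi_mul_I]; ring

lemma hasDerivAt_qq (z : ℂ) : HasDerivAt qq (2 * π * I * qq z) z := by
  refine (((hasDerivAt_id z).const_mul (2 * π * I)).cexp).congr_deriv ?_
  simp [qq]; ring

lemma exists_log_primitive {H : ℂ → ℂ} (hH : DifferentiableOn ℂ H (Metric.ball 0 1)) (h0 : H 0 = 0) :
    ∃ G : ℂ → ℂ, DifferentiableOn ℂ G (Metric.ball 0 1) ∧ G 0 = 0 ∧
      ∀ z : ℂ, 0 < z.im → HasDerivAt (fun z => G (qq z)) (2 * π * I * H (qq z)) z := by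
  have hd : DifferentiableOn ℂ (dslope H 0) (Metric.ball 0 1) :=
    (Complex.differentiableOn_dslope (Metric.ball_mem_nhds 0 one_pos)).2 hH
  obtain ⟨G, hG0, hG⟩ := hd.isExactOn_ball.with_val_at 0 0
  refine ⟨G, fun q hq => (hG q hq).differentiableAt.differentiableWithinAt, hG0, fun z hz => ?_⟩
  refine ((hG _ (qq_mem hz)).comp z (hasDerivAt_qq z)).congr_deriv ?_
  rw [dslope_of_ne _ (qq_ne_zero z), slope_def_field, h0]
  have := qq_ne_zero z
  field_simp
  ring

lemma exists_decay {H : ℂ → ℂ} (hH : DifferentiableOn ℂ H (Metric.ball 0 1)) (h0 : H 0 = 0) :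
    ∃ C : ℝ, ∀ z : ℂ, 1 / 4 ≤ z.im → ‖H (qq z)‖ ≤ C * exp (-(2 * π * z.im)) := by
  have hd : DifferentiableOn ℂ (dslope H 0) (Metric.ball 0 1) :=
    (Complex.differentiableOn_dslope (Metric.ball_mem_nhds 0 one_pos)).2 hH
  have hsub : Metric.closedBall (0 : ℂ) (exp (-(π / 2))) ⊆ Metric.ball 0 1 :=
    Metric.closedBall_subset_ball (by rw [exp_lt_one_iff]; linarith [pi_pos])
  obtain ⟨C, hC⟩ := (isCompact_closedBall (0 : ℂ) (exp (-(π / 2)))).exists_bound_of_continuousOn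
    (hd.continuousOn.mono hsub)
  refine ⟨C, fun z hz => ?_⟩
  have hq : qq z ∈ Metric.closedBall (0 : ℂ) (exp (-(π / 2))) := by
    rw [mem_closedBall_zero_iff, norm_qq]
    exact exp_le_exp.2 (by nlinarith [pi_pos])
  have e : H (qq z) = dslope H 0 (qq z) * qq z := by
    rw [dslope_of_ne _ (qq_ne_zero z), slope_def_field, h0]
    have := qq_ne_zero z
    field_simp
    ring
  rw [e, norm_mul, norm_qq]
  gcongr
  exact hC _ hq

/-- The function `g` is the derivative of `f` on the upper half plane. -/
abbrev HasDerivUpper (f g : ℂ → ℂ) : Prop := ∀ z : ℂ, 0 < z.im → HasDerivAt f (g z) z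

/-- A threefold iterated primitive of a cusp expansion. -/
lemma exists_eichler {H : ℂ → ℂ} (hH : DifferentiableOn ℂ H (Metric.ball 0 1)) (h0 : H 0 = 0) :
    ∃ P P₁ P₂ : ℂ → ℂ, (HasDerivUpper P P₁) ∧
      (HasDerivUpper P₁ P₂) ∧
      (∀ z : ℂ, 0 < z.im → HasDerivAt P₂ (H (qq z)) z) ∧ (∀ z, P (z + 1) = P z) ∧
      ∃ C : ℝ, ∀ z : ℂ, 1 / 4 ≤ z.im → ‖P z‖ ≤ C * exp (-(2 * π * z.im)) ∧
        ‖P₁ z‖ ≤ C * exp (-(2 * π * z.im)) ∧ ‖P₂ z‖ ≤ C * exp (-(2 * π * z.im)) := by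
  obtain ⟨G₂, hd2, h2, hG2⟩ := exists_log_primitive hH h0
  obtain ⟨G₁, hd1, h1, hG1⟩ := exists_log_primitive hd2 h2
  obtain ⟨G, hd, h, hG⟩ := exists_log_primitive hd1 h1
  have hc : (2 * π * I : ℂ) ≠ 0 := Complex.two_pi_I_ne_zero
  set c : ℂ := 2 * π * I with hcdef
  have s : ∀ {F : ℂ → ℂ} (a : ℂ), DifferentiableOn ℂ F (Metric.ball 0 1) → F 0 = 0 →
      ∃ C : ℝ, ∀ z : ℂ, 1 / 4 ≤ z.im → ‖F (qq z) / a‖ ≤ C * exp (-(2 * π * z.im)) := by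
    intro F a hF hF0
    exact exists_decay (H := fun q => F q / a) (hF.div_const _) (by simp [hF0])
  obtain ⟨C2, hC2⟩ := s c hd2 h2
  obtain ⟨C1, hC1⟩ := s (c ^ 2) hd1 h1
  obtain ⟨C0, hC0⟩ := s (c ^ 3) hd h
  refine ⟨fun z => G (qq z) / c ^ 3, fun z => G₁ (qq z) / c ^ 2, fun z => G₂ (qq z) / c, ?_, ?_, ?_,
    fun z => by simp only [qq_add_one], max C0 (max C1 C2), fun z hz => ⟨(hC0 z hz).trans ?_,
    (hC1 z hz).trans ?_, (hC2 z hz).trans ?_⟩⟩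
  · exact fun z hz => ((hG z hz).div_const _).congr_deriv (by field_simp)
  · exact fun z hz => ((hG1 z hz).div_const _).congr_deriv (by field_simp)
  · exact fun z hz => ((hG2 z hz).div_const _).congr_deriv (by field_simp)
  all_goals
    gcongr
    simp

lemma convex_upper : Convex ℝ {z : ℂ | 0 < z.im} := convex_halfSpace_im_gt 0

lemma isOpen_upper : IsOpen {z : ℂ | 0 < z.im} := isOpen_lt continuous_const Complex.continuous_im

lemma const_of_hasDerivAt_zero {N : ℂ → ℂ} (h : ∀ z : ℂ, 0 < z.im → HasDerivAt N 0 z) :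
    ∃ c, ∀ z : ℂ, 0 < z.im → N z = c :=
  isOpen_upper.exists_is_const_of_deriv_eq_zero convex_upper.isPreconnected
    (fun z hz => (h z hz).differentiableAt.differentiableWithinAt) (fun z hz => (h z hz).deriv)

lemma quadratic_of_third_deriv {N N₁ N₂ : ℂ → ℂ} (h : HasDerivUpper N N₁)
    (h₁ : HasDerivUpper N₁ N₂) (h₂ : ∀ z : ℂ, 0 < z.im → HasDerivAt N₂ 0 z) :
    ∃ r₀ r₁ r₂ : ℂ, ∀ z : ℂ, 0 < z.im → N z = r₀ + r₁ * z + r₂ * z ^ 2 := by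
  obtain ⟨c₂, hc₂⟩ := const_of_hasDerivAt_zero h₂
  obtain ⟨c₁, hc₁⟩ := const_of_hasDerivAt_zero (N := fun z => N₁ z - c₂ * z) (fun z hz =>
    ((h₁ z hz).sub ((hasDerivAt_id z).const_mul c₂)).congr_deriv (by rw [hc₂ z hz]; ring))
  obtain ⟨c₀, hc₀⟩ := const_of_hasDerivAt_zero (N := fun z => N z - (c₁ * z + c₂ / 2 * z ^ 2)) (fun z hz =>
    ((h z hz).sub (((hasDerivAt_id z).const_mul c₁).add ((hasDerivAt_pow 2 z).const_mul (c₂ / 2)))).congr_deriv (by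
      have := hc₁ z hz
      linear_combination this))
  refine ⟨c₀, c₁, c₂ / 2, fun z hz => ?_⟩
  have := hc₀ z hz
  linear_combination this

lemma ne_zero_of_im_pos {z : ℂ} (hz : 0 < z.im) : z ≠ 0 := by rintro rfl; simp at hz

lemma neg_one_div_im_pos {c : ℝ} (hc : 0 < c) {z : ℂ} (hz : 0 < z.im) : 0 < (-1 / (c * z)).im := by
  have := neg_inv_im_pos (z := c * z) (by simpa using mul_pos hc hz)
  exact this

lemma hasDerivAt_neg_one_div {c z : ℂ} (hc : c ≠ 0) (hz : z ≠ 0) :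
    HasDerivAt (fun z => -1 / (c * z)) (1 / (c * z ^ 2)) z := by
  refine ((hasDerivAt_const z (-1 : ℂ)).div ((hasDerivAt_id z).const_mul c) (by simp [hc, hz])).congr_deriv ?_
  simp only [id]
  field_simp
  ring

lemma eichler_fricke {P P₁ P₂ h hW χ χ₁ χ₂ : ℂ → ℂ}
    (hP : HasDerivUpper P P₁) (hP₁ : HasDerivUpper P₁ P₂)
    (hP₂ : HasDerivUpper P₂ h)
    (hh : ∀ z : ℂ, 0 < z.im → h (-1 / (6 * z)) = 36 * z ^ 4 * hW z)
    (hχ : HasDerivUpper χ χ₁) (hχ₁ : HasDerivUpper χ₁ χ₂)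
    (hχ₂ : ∀ z : ℂ, 0 < z.im → HasDerivAt χ₂ (hW z - h z) z)
    (anti : ∀ z : ℂ, 0 < z.im → 6 * z ^ 2 * χ (-1 / (6 * z)) = -χ z) :
    ∃ a b : ℂ, ∀ z : ℂ, 0 < z.im → 6 * z ^ 2 * P (-1 / (6 * z)) = P z + χ z + (a * (1 - 6 * z ^ 2) + b * z) := by
  have him : ∀ {z : ℂ}, 0 < z.im → 0 < (-1 / (6 * z)).im := fun hz => by
    simpa using neg_one_div_im_pos (c := 6) (by norm_num) hz
  have hw : ∀ {z : ℂ}, 0 < z.im → HasDerivAt (fun z : ℂ => -1 / (6 * z)) (1 / (6 * z ^ 2)) z :=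
    fun hz => hasDerivAt_neg_one_div (by norm_num) (ne_zero_of_im_pos hz)
  have hi : ∀ {z : ℂ}, 0 < z.im → HasDerivAt (fun z : ℂ => 1 / z) (-1 / z ^ 2) z := fun {z} hz => by
    have h0 := ne_zero_of_im_pos hz
    refine ((hasDerivAt_const z (1 : ℂ)).div (hasDerivAt_id z) h0).congr_deriv ?_
    simp
  obtain ⟨r₀, r₁, r₂, hr⟩ := quadratic_of_third_deriv
    (N := fun z => 6 * z ^ 2 * P (-1 / (6 * z)) - P z - χ z)
    (N₁ := fun z => 12 * z * P (-1 / (6 * z)) + P₁ (-1 / (6 * z)) - P₁ z - χ₁ z)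
    (N₂ := fun z => 12 * P (-1 / (6 * z)) + 2 * (1 / z) * P₁ (-1 / (6 * z)) +
      1 / 6 * (1 / z) ^ 2 * P₂ (-1 / (6 * z)) - P₂ z - χ₂ z)
    (fun z hz => by
      have h0 := ne_zero_of_im_pos hz
      refine ((((((hasDerivAt_id z).fun_pow 2).const_mul 6).mul
        ((hP _ (him hz)).comp z (hw hz))).sub (hP z hz)).sub (hχ z hz)).congr_deriv ?_
      simp only [id, Function.comp]
      field_simp
      ring)
    (fun z hz => by
      have h0 := ne_zero_of_im_pos hz
      refine (((((((hasDerivAt_id z).const_mul 12).mul ((hP _ (him hz)).comp z (hw hz))).add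
        ((hP₁ _ (him hz)).comp z (hw hz))).sub (hP₁ z hz)).sub (hχ₁ z hz))).congr_deriv ?_
      simp only [id, Function.comp]
      field_simp
      ring)
    (fun z hz => by
      have h0 := ne_zero_of_im_pos hz
      refine ((((((((hP _ (him hz)).comp z (hw hz)).const_mul 12).add
        (((hi hz).const_mul 2).mul ((hP₁ _ (him hz)).comp z (hw hz)))).add
        ((((hi hz).fun_pow 2).const_mul (1 / 6)).mul ((hP₂ _ (him hz)).comp z (hw hz)))).sub
        (hP₂ z hz)).sub (hχ₂ z hz))).congr_deriv ?_
      simp only [Function.comp, Nat.reduceSub, Nat.cast_ofNat, pow_one]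
      rw [hh z hz]
      generalize P (-1 / (6 * z)) = p, P₁ (-1 / (6 * z)) = p₁, P₂ (-1 / (6 * z)) = p₂
      field_simp
      ring)
  have key : ∀ z : ℂ, 0 < z.im → (r₂ + 6 * r₀) * (1 + 6 * z ^ 2) = 0 := by
    intro z hz
    have h0 := ne_zero_of_im_pos hz
    have e1 := hr z hz
    have e2 := hr _ (him hz)
    have e3 := anti z hz
    rw [show -1 / (6 * (-1 / (6 * z))) = z by field_simp] at e2
    have e4 : 6 * z ^ 2 * (6 * (-1 / (6 * z)) ^ 2 * P z - P (-1 / (6 * z)) - χ (-1 / (6 * z))) =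
        P z - 6 * z ^ 2 * P (-1 / (6 * z)) + χ z := by
      rw [sub_eq_add_neg _ (χ _), mul_add, mul_neg, e3]; field_simp
    rw [e2] at e4
    have e5 : 6 * z ^ 2 * (r₀ + r₁ * (-1 / (6 * z)) + r₂ * (-1 / (6 * z)) ^ 2) =
        6 * r₀ * z ^ 2 - r₁ * z + r₂ / 6 := by field_simp; ring
    rw [e5] at e4
    linear_combination 6 * e4 - 6 * e1
  have hr2 : r₂ = -6 * r₀ := by
    have := key I (by simp)
    rw [Complex.I_sq] at this
    linear_combination (-1 / 5) * this
  refine ⟨r₀, r₁, fun z hz => ?_⟩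
  have := hr z hz
  rw [hr2] at this
  linear_combination this

lemma sub_one_half_im_pos {z : ℂ} (hz : 0 < z.im) : 0 < ((z - 1) / 2).im := by
  have := half_im_pos (z := z - 1) (by simpa using hz)
  exact this

lemma tendsto_I_mul_decay {P : ℂ → ℂ} {C : ℝ}
    (hC : ∀ z : ℂ, 1 / 4 ≤ z.im → ‖P z‖ ≤ C * exp (-(2 * π * z.im))) {m : ℝ → ℂ}
    (hm : Tendsto (fun y => (m y).im) atTop atTop) : Tendsto (fun y : ℝ => P (m y)) atTop (𝓝 0) := by
  have h1 : Tendsto (fun y : ℝ => C * exp (-(2 * π * (m y).im))) atTop (𝓝 0) := by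
    have : Tendsto (fun y : ℝ => 2 * π * (m y).im) atTop atTop := hm.const_mul_atTop (by positivity)
    simpa using (tendsto_exp_neg_atTop_nhds_zero.comp this).const_mul C
  refine squeeze_zero_norm' ?_ h1
  filter_upwards [hm.eventually_ge_atTop (1 / 4)] with y hy using hC _ hy

lemma eichler_trace {P P₁ P₂ h hW χ χ₁ χ₂ H : ℂ → ℂ} {k : ℂ} {C : ℝ}
    (hP : HasDerivUpper P P₁) (hP₁ : HasDerivUpper P₁ P₂)
    (hP₂ : HasDerivUpper P₂ h) (hper : ∀ z, P (z + 1) = P z)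
    (hC : ∀ z : ℂ, 1 / 4 ≤ z.im → ‖P z‖ ≤ C * exp (-(2 * π * z.im)))
    (hχ : HasDerivUpper χ χ₁) (hχ₁ : HasDerivUpper χ₁ χ₂)
    (hχ₂ : ∀ z : ℂ, 0 < z.im → HasDerivAt χ₂ (hW z - h z) z)
    (hH : ∀ z, χ z = H (qq z) / qq z) (hk : HasDerivAt H k 0)
    (tr : ∀ z : ℂ, 0 < z.im → h z + 1 / 4 * hW (z / 2) + 1 / 4 * hW ((z - 1) / 2) = 0) {z : ℂ} (hz : 0 < z.im) :
    P z + 2 * (P (z / 2) + χ (z / 2)) + 2 * (P ((z - 1) / 2) + χ ((z - 1) / 2)) = 4 * k := by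
  have d1 : ∀ z : ℂ, HasDerivAt (fun z : ℂ => z / 2) (1 / 2) z := fun z => (hasDerivAt_id z).div_const 2
  have d2 : ∀ z : ℂ, HasDerivAt (fun z : ℂ => (z - 1) / 2) (1 / 2) z :=
    fun z => ((hasDerivAt_id z).sub_const 1).div_const 2
  have hcomb {F G F' G' : ℂ → ℂ} (hF : HasDerivUpper F F')
      (hG : HasDerivUpper G G') (c : ℂ) (z : ℂ) (hz : 0 < z.im) :
      HasDerivAt (fun z => c * (F (z / 2) + G (z / 2)) + c * (F ((z - 1) / 2) + G ((z - 1) / 2)))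
        (c / 2 * (F' (z / 2) + G' (z / 2)) + c / 2 * (F' ((z - 1) / 2) + G' ((z - 1) / 2))) z := by
    have h1 := half_im_pos hz
    have h2 := sub_one_half_im_pos hz
    refine (((((hF _ h1).comp z (d1 z)).add ((hG _ h1).comp z (d1 z))).const_mul c).add
      ((((hF _ h2).comp z (d2 z)).add ((hG _ h2).comp z (d2 z))).const_mul c)).congr_deriv ?_
    ring
  obtain ⟨s₀, s₁, s₂, hs⟩ := quadratic_of_third_deriv
    (fun z hz => (hP z hz).add (hcomb hP hχ 2 z hz)) (fun z hz => (hP₁ z hz).add (hcomb hP₁ hχ₁ (2 / 2) z hz))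
    (fun z hz => ((hP₂ z hz).add (hcomb hP₂ hχ₂ (2 / 2 / 2) z hz)).congr_deriv (by
      linear_combination tr z hz))
  simp only [Pi.add_apply] at hs
  have hχper : ∀ z, χ (z + 1) = χ z := fun z => by rw [hH, hH, qq_add_one]
  have hper2 : ∀ z : ℂ, 0 < z.im → s₁ + 2 * s₂ * (z + 1) = 0 := by
    intro z hz
    have e1 := hs z hz
    have e2 := hs (z + 2) (by simpa using hz)
    rw [show (z + 2) / 2 = z / 2 + 1 by ring, show (z + 2 - 1) / 2 = (z - 1) / 2 + 1 by ring,
      show z + 2 = z + 1 + 1 by ring] at e2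
    simp only [hper, hχper] at e2
    linear_combination (e1 - e2) / 2
  have hs2 : s₂ = 0 := by
    have e1 := hper2 I (by simp)
    have e2 := hper2 (I + 1) (by simp)
    linear_combination (e2 - e1) / 2
  have hs1 : s₁ = 0 := by
    have e1 := hper2 I (by simp)
    rw [hs2] at e1; linear_combination e1
  have hlim : Tendsto (fun y : ℝ => P (I * y) + 2 * (P (I * y / 2) + χ (I * y / 2)) +
      2 * (P ((I * y - 1) / 2) + χ ((I * y - 1) / 2))) atTop (𝓝 (4 * k)) := by
    have t0 := tendsto_I_mul_decay hC (m := fun y => I * y) (by simp; exact tendsto_id)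
    have t1 := tendsto_I_mul_decay hC (m := fun y => I * y / 2)
      (by simpa using tendsto_id.atTop_div_const (two_pos (α := ℝ)))
    have t2 := tendsto_I_mul_decay hC (m := fun y => (I * y - 1) / 2)
      (by simpa using tendsto_id.atTop_div_const (two_pos (α := ℝ)))
    have tu : Tendsto (fun y : ℝ => qq (I * y / 2)) atTop (𝓝[≠] 0) := by
      refine tendsto_nhdsWithin_iff.2 ⟨?_, Eventually.of_forall fun y => qq_ne_zero _⟩
      refine squeeze_zero_norm (a := fun y : ℝ => exp (-(π * y))) (fun y => le_of_eq ?_) ?_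
      · rw [norm_qq]; congr 1; simp; ring
      · exact tendsto_exp_neg_atTop_nhds_zero.comp (tendsto_id.const_mul_atTop pi_pos)
    have hodd : HasDerivAt (fun u => H u - H (-u)) (2 * k) 0 := by
      have h1 : HasDerivAt (fun u => H (-u)) (-k) 0 := by
        have := HasDerivAt.comp (0 : ℂ) (h := fun u => -u) (h₂ := H) (by simpa using hk) (hasDerivAt_neg 0)
        exact this.congr_deriv (by ring)
      exact (hk.sub h1).congr_deriv (by ring)
    have tl := (hasDerivAt_iff_tendsto_slope.1 hodd).comp tu
    have tt := (t0.add (t1.const_mul 2)).add ((t2.const_mul 2).add (tl.const_mul 2))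
    rw [show (0 : ℂ) + 2 * 0 + (2 * 0 + 2 * (2 * k)) = 4 * k by ring] at tt
    refine tt.congr fun y => ?_
    have hq := qq_ne_zero (I * y / 2)
    simp only [Function.comp, slope_def_field, neg_zero, sub_self, sub_zero]
    rw [hH (I * y / 2), hH ((I * y - 1) / 2), qq_sub_half]
    field_simp
    ring
  have hs0 : s₀ = 4 * k := by
    refine tendsto_nhds_unique (f := fun _ : ℝ => s₀) (l := atTop) tendsto_const_nhds (hlim.congr' ?_)
    filter_upwards [eventually_gt_atTop 0] with y hy
    have := hs (I * y) (by simpa using hy)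
    rw [hs1, hs2] at this
    linear_combination this
  have := hs z hz
  rw [hs1, hs2, hs0] at this
  linear_combination this

lemma deriv_eq_of_eqOn_upper {f g f' g' : ℂ → ℂ} (h : ∀ z : ℂ, 0 < z.im → f z = g z)
    (hf : HasDerivUpper f f') (hg : HasDerivUpper g g')
    (z : ℂ) (hz : 0 < z.im) : f' z = g' z :=
  (hf z hz).unique ((hg z hz).congr_of_eventuallyEq
    (eventually_of_mem (isOpen_upper.mem_nhds hz) fun w hw => h w hw))

/-- The corner of the fundamental domain on the line `Re z = 1/2`. -/
lemma eichler_jet {P P₁ P₂ : ℂ → ℂ} {a b K : ℂ}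
    (hP : HasDerivUpper P P₁) (hP₁ : HasDerivUpper P₁ P₂)
    (hA : ∀ z : ℂ, 0 < z.im → P z + 3 * z ^ 2 * P (1 + -1 / (3 * z)) + 3 * (z - 1) ^ 2 * P (-1 / (3 * (z - 1))) =
      K + 2 * (a * (1 - 6 * (z / 2) ^ 2) + b * (z / 2)) +
        2 * (a * (1 - 6 * ((z - 1) / 2) ^ 2) + b * ((z - 1) / 2)))
    {z : ℂ} (hz : 0 < z.im) (hz0 : z * (z - 1) = -1 / 3) :
    8 * P₂ z - 60 * (2 * z - 1) * P₁ z + 120 * P z = 24 * K := by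
  have h3 : ∀ {z : ℂ}, 0 < z.im → 0 < (-1 / (3 * z)).im := fun hz => by
    simpa using neg_one_div_im_pos (c := 3) (by norm_num) hz
  have iU : ∀ {z : ℂ}, 0 < z.im → 0 < (1 + -1 / (3 * z)).im := fun hz => by
    have := h3 hz
    rwa [Complex.add_im, Complex.one_im, zero_add]
  have i1 : ∀ {z : ℂ}, 0 < z.im → 0 < (z - 1).im := fun hz => by simpa using hz
  have dU : ∀ {z : ℂ}, 0 < z.im → HasDerivAt (fun z : ℂ => 1 + -1 / (3 * z)) (1 / (3 * z ^ 2)) z :=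
    fun hz => (hasDerivAt_neg_one_div (by norm_num) (ne_zero_of_im_pos hz)).const_add 1
  have dR : ∀ {z : ℂ}, 0 < z.im → HasDerivAt (fun z : ℂ => -1 / (3 * (z - 1))) (1 / (3 * (z - 1) ^ 2)) z :=
    fun {z} hz => (hasDerivAt_neg_one_div (c := 3) (by norm_num)
      (ne_zero_of_im_pos (i1 hz))).comp_sub_const z 1
  have q1 := deriv_eq_of_eqOn_upper
    (f' := fun z => P₁ z + (6 * z * P (1 + -1 / (3 * z)) + P₁ (1 + -1 / (3 * z))) +
      (6 * (z - 1) * P (-1 / (3 * (z - 1))) + P₁ (-1 / (3 * (z - 1)))))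
    (g' := fun z => -6 * a * (2 * z - 1) + 2 * b) hA
    (fun z hz => by
      have n0 := ne_zero_of_im_pos hz
      have n1 := ne_zero_of_im_pos (i1 hz)
      refine (((hP z hz).add ((((hasDerivAt_id z).fun_pow 2).const_mul 3).mul ((hP _ (iU hz)).comp z (dU hz)))).add
        (((((hasDerivAt_id z).sub_const 1).fun_pow 2).const_mul 3).mul
          ((hP _ (h3 (i1 hz))).comp z (dR hz)))).congr_deriv ?_
      simp only [id, Function.comp, Nat.reduceSub, Nat.cast_ofNat, pow_one]
      generalize P (1 + -1 / (3 * z)) = p, P₁ (1 + -1 / (3 * z)) = p₁, P (-1 / (3 * (z - 1))) = r,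
        P₁ (-1 / (3 * (z - 1))) = r₁
      field_simp
      ring)
    (fun z hz => by
      have e : (fun z : ℂ => K + 2 * (a * (1 - 6 * (z / 2) ^ 2) + b * (z / 2)) +
        2 * (a * (1 - 6 * ((z - 1) / 2) ^ 2) + b * ((z - 1) / 2))) =
        fun z => (K + a - b) + (6 * a + 2 * b) * z + -6 * a * z ^ 2 := by funext z; ring
      rw [e]
      refine ((((hasDerivAt_id z).const_mul (6 * a + 2 * b)).const_add (K + a - b)).add
        (((hasDerivAt_id z).fun_pow 2).const_mul (-6 * a))).congr_deriv ?_
      simp only [id, Nat.reduceSub, Nat.cast_ofNat, pow_one]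
      ring)
  have q2 := deriv_eq_of_eqOn_upper
    (f' := fun z => P₂ z + (6 * P (1 + -1 / (3 * z)) + 2 / z * P₁ (1 + -1 / (3 * z)) +
        1 / (3 * z ^ 2) * P₂ (1 + -1 / (3 * z))) +
      (6 * P (-1 / (3 * (z - 1))) + 2 / (z - 1) * P₁ (-1 / (3 * (z - 1))) +
        1 / (3 * (z - 1) ^ 2) * P₂ (-1 / (3 * (z - 1)))))
    (g' := fun z => -12 * a) q1
    (fun z hz => by
      have n0 := ne_zero_of_im_pos hz
      have n1 := ne_zero_of_im_pos (i1 hz)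
      refine (((hP₁ z hz).add ((((hasDerivAt_id z).const_mul 6).mul ((hP _ (iU hz)).comp z (dU hz))).add
        ((hP₁ _ (iU hz)).comp z (dU hz)))).add
        (((((hasDerivAt_id z).sub_const 1).const_mul 6).mul ((hP _ (h3 (i1 hz))).comp z (dR hz))).add
          ((hP₁ _ (h3 (i1 hz))).comp z (dR hz)))).congr_deriv ?_
      simp only [id, Function.comp]
      generalize P (1 + -1 / (3 * z)) = p, P₁ (1 + -1 / (3 * z)) = p₁, P (-1 / (3 * (z - 1))) = r,
        P₁ (-1 / (3 * (z - 1))) = r₁, P₂ (1 + -1 / (3 * z)) = p₂, P₂ (-1 / (3 * (z - 1))) = r₂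
      field_simp
      ring)
    (fun z hz => by
      refine (((((hasDerivAt_id z).const_mul 2).sub_const 1).const_mul (-6 * a)).add_const (2 * b)).congr_deriv ?_
      ring)
  have n0 := ne_zero_of_im_pos hz
  have n1 := ne_zero_of_im_pos (i1 hz)
  have f1 : -1 / (3 * (z - 1)) = z := by
    rw [div_eq_iff (by simp [n1])]; linear_combination -3 * hz0
  have f2 : 1 + -1 / (3 * z) = z := by
    have : -1 / (3 * z) = z - 1 := by rw [div_eq_iff (by simp [n0])]; linear_combination -3 * hz0
    rw [this]; ring
  have e0 := hA z hz
  have e1 := q1 z hz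
  have e2 := q2 z hz
  simp only [f1, f2] at e0 e1 e2
  have g1 : 2 / z = -6 * (z - 1) := by rw [div_eq_iff n0]; linear_combination 6 * hz0
  have g2 : 2 / (z - 1) = -6 * z := by rw [div_eq_iff n1]; linear_combination 6 * hz0
  have g3 : 1 / (3 * z ^ 2) = 3 * (z - 1) ^ 2 := by
    rw [div_eq_iff (by simp [n0])]; linear_combination (-9 * (z * (z - 1)) + 3) * hz0
  have g4 : 1 / (3 * (z - 1) ^ 2) = 3 * z ^ 2 := by
    rw [div_eq_iff (by simp [n1])]; linear_combination (-9 * (z * (z - 1)) + 3) * hz0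
  rw [g1, g2, g3, g4] at e2
  have k0 : 2 * P z = K + 3 * a + b * (2 * z - 1) := by
    linear_combination e0 - (6 * P z + 6 * a) * hz0
  have k1 : 3 * P₁ z + 6 * (2 * z - 1) * P z = -6 * a * (2 * z - 1) + 2 * b := by linear_combination e1
  have k2 : 2 * P₂ z - 6 * (2 * z - 1) * P₁ z + 12 * P z = -12 * a := by
    linear_combination e2 - 6 * P₂ z * hz0
  have k3 : (2 * z - 1) ^ 2 = -1 / 3 := by linear_combination 4 * hz0
  linear_combination 4 * k2 - 12 * (2 * z - 1) * k1 + 24 * k0 + (72 * P z + 72 * a) * k3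

lemma eichler_relation {P P₁ P₂ h hW χ χ₁ χ₂ H : ℂ → ℂ} {k : ℂ} {C : ℝ}
    (hP : HasDerivUpper P P₁) (hP₁ : HasDerivUpper P₁ P₂)
    (hP₂ : HasDerivUpper P₂ h) (hper : ∀ z, P (z + 1) = P z)
    (hC : ∀ z : ℂ, 1 / 4 ≤ z.im → ‖P z‖ ≤ C * exp (-(2 * π * z.im)))
    (hh : ∀ z : ℂ, 0 < z.im → h (-1 / (6 * z)) = 36 * z ^ 4 * hW z)
    (hχ : HasDerivUpper χ χ₁) (hχ₁ : HasDerivUpper χ₁ χ₂)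
    (hχ₂ : ∀ z : ℂ, 0 < z.im → HasDerivAt χ₂ (hW z - h z) z)
    (anti : ∀ z : ℂ, 0 < z.im → 6 * z ^ 2 * χ (-1 / (6 * z)) = -χ z)
    (hH : ∀ z, χ z = H (qq z) / qq z) (hk : HasDerivAt H k 0)
    (tr : ∀ z : ℂ, 0 < z.im → h z + 1 / 4 * hW (z / 2) + 1 / 4 * hW ((z - 1) / 2) = 0)
    {z : ℂ} (hz : 0 < z.im) (hz0 : z * (z - 1) = -1 / 3) :
    8 * P₂ z - 60 * (2 * z - 1) * P₁ z + 120 * P z = 96 * k := by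
  obtain ⟨a, b, hab⟩ := eichler_fricke hP hP₁ hP₂ hh hχ hχ₁ hχ₂ anti
  rw [show 96 * k = 24 * (4 * k) by ring]
  refine eichler_jet (a := a) (b := b) hP hP₁ (fun z hz => ?_) hz hz0
  have e1 := hab _ (half_im_pos hz)
  have e2 := hab _ (sub_one_half_im_pos hz)
  have e3 := eichler_trace hP hP₁ hP₂ hper hC hχ hχ₁ hχ₂ hH hk tr hz
  rw [show 6 * (z / 2) = 3 * z by ring] at e1
  rw [show 6 * ((z - 1) / 2) = 3 * (z - 1) by ring] at e2
  rw [add_comm 1, hper]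
  linear_combination 2 * e1 + 2 * e2 + e3

lemma ray_im (y : ℝ) : ((1 + I * (y : ℂ)) / 2).im = y / 2 := by simp

lemma ray_im_ge {y : ℝ} (hy : 1 / √3 ≤ y) : 1 / 4 ≤ ((1 + I * (y : ℂ)) / 2).im := by
  have : (1 : ℝ) / 2 ≤ 1 / √3 := by
    refine one_div_le_one_div_of_le (by positivity) ?_
    rw [sqrt_le_left (by norm_num)]; norm_num
  rw [ray_im]; linarith

lemma hasDerivAt_ray (y : ℝ) :
    HasDerivAt (fun y : ℝ => (1 + I * (y : ℂ)) / 2) (I / 2) y := by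
  refine ((((Complex.ofRealCLM.hasDerivAt (x := y)).const_mul I).const_add 1).div_const 2).congr_deriv ?_
  simp

lemma integrableOn_ray {H : ℂ → ℂ} (hH : DifferentiableOn ℂ H (Metric.ball 0 1)) (h0 : H 0 = 0) (n : ℕ) :
    IntegrableOn (fun y : ℝ => H (qq ((1 + I * (y : ℂ)) / 2)) * (y : ℂ) ^ n) (Ioi (1 / √3)) := by
  obtain ⟨C, hC⟩ := exists_decay hH h0
  have h3 : (0 : ℝ) < 1 / √3 := by positivity
  have hb : IntegrableOn (fun y : ℝ => y ^ (n : ℝ) * exp (-π * y)) (Ioi 0) :=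
    (integrableOn_rpow_mul_exp_neg_mul_rpow (s := n) (p := 1) (by linarith [n.cast_nonneg (α := ℝ)]) one_pos
      pi_pos).congr_fun (fun y _ => by simp) measurableSet_Ioi
  have hg : IntegrableOn (fun y : ℝ => C * (y ^ (n : ℝ) * exp (-π * y))) (Ioi (1 / √3)) :=
    Integrable.const_mul (hb.mono_set (Ioi_subset_Ioi h3.le)) C
  refine Integrable.mono' hg ?_ ?_
  · refine ContinuousOn.aestronglyMeasurable (fun y hy => ContinuousAt.continuousWithinAt ?_) measurableSet_Ioi
    have hq : ((1 + I * (y : ℂ)) / 2).im > 0 := by rw [ray_im]; linarith [mem_Ioi.1 hy]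
    have h1 : ContinuousAt H (qq ((1 + I * (y : ℂ)) / 2)) :=
      (hH.differentiableAt (Metric.isOpen_ball.mem_nhds (qq_mem hq))).continuousAt
    have h2 : ContinuousAt (fun y : ℝ => qq ((1 + I * (y : ℂ)) / 2)) y :=
      ContinuousAt.comp (f := fun y : ℝ => (1 + I * (y : ℂ)) / 2) (hasDerivAt_qq _).continuousAt
        (hasDerivAt_ray y).continuousAt
    exact (ContinuousAt.comp (f := fun y : ℝ => qq ((1 + I * (y : ℂ)) / 2)) h1 h2).mul (by fun_prop)
  · refine (ae_restrict_mem measurableSet_Ioi).mono fun y hy => ?_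
    have hy0 : 0 < y := h3.trans hy
    have := hC _ (ray_im_ge (mem_Ioi.1 hy).le)
    rw [norm_mul, norm_pow, Complex.norm_real, norm_of_nonneg hy0.le, rpow_natCast]
    rw [ray_im] at this
    calc _ ≤ C * exp (-(2 * π * (y / 2))) * y ^ n := by gcongr
      _ = _ := by rw [show -(2 * π * (y / 2)) = -π * y by ring]; ring

lemma tendsto_poly_decay {P : ℂ → ℂ} {C : ℝ}
    (hC : ∀ z : ℂ, 1 / 4 ≤ z.im → ‖P z‖ ≤ C * exp (-(2 * π * z.im))) (n : ℕ) :
    Tendsto (fun y : ℝ => (y : ℂ) ^ n * P ((1 + I * (y : ℂ)) / 2)) atTop (𝓝 0) := by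
  have h1 : Tendsto (fun y : ℝ => C * (y ^ n * exp (-π * y))) atTop (𝓝 0) := by
    have := (tendsto_rpow_mul_exp_neg_mul_atTop_nhds_zero n π pi_pos).const_mul C
    simpa using this
  refine squeeze_zero_norm' ?_ h1
  filter_upwards [eventually_ge_atTop (1 / √3)] with y hy
  have hy0 : 0 ≤ y := le_trans (by positivity) hy
  have := hC _ (ray_im_ge hy)
  rw [ray_im] at this
  rw [norm_mul, norm_pow, Complex.norm_real, norm_of_nonneg hy0]
  calc _ ≤ y ^ n * (C * exp (-(2 * π * (y / 2)))) := by gcongr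
    _ = _ := by rw [show -(2 * π * (y / 2)) = -π * y by ring]; ring

/-- The linear relation between the even moments of a form along the line `Re z = 1/2`. -/
theorem ray_period {F H h hW χ χ₁ χ₂ : ℂ → ℂ} {k : ℂ} (hF : DifferentiableOn ℂ F (Metric.ball 0 1)) (hF0 : F 0 = 0)
    (hhF : ∀ z, h z = F (qq z))
    (hh : ∀ z : ℂ, 0 < z.im → h (-1 / (6 * z)) = 36 * z ^ 4 * hW z)
    (hχ : HasDerivUpper χ χ₁) (hχ₁ : HasDerivUpper χ₁ χ₂)
    (hχ₂ : ∀ z : ℂ, 0 < z.im → HasDerivAt χ₂ (hW z - h z) z)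
    (anti : ∀ z : ℂ, 0 < z.im → 6 * z ^ 2 * χ (-1 / (6 * z)) = -χ z)
    (hH : ∀ z, χ z = H (qq z) / qq z) (hk : HasDerivAt H k 0)
    (tr : ∀ z : ℂ, 0 < z.im → h z + 1 / 4 * hW (z / 2) + 1 / 4 * hW ((z - 1) / 2) = 0) :
    13 * (∫ y in Ioi (1 / √3), h ((1 + I * (y : ℂ)) / 2) * (y : ℂ) ^ 0) -
      15 * (∫ y in Ioi (1 / √3), h ((1 + I * (y : ℂ)) / 2) * (y : ℂ) ^ 2) = 192 * I * k := by
  have i0 := integrableOn_ray hF hF0 0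
  have i2 := integrableOn_ray hF hF0 2
  simp only [← hhF] at i0 i2
  obtain ⟨P, P₁, P₂, hP, hP₁, hP₂, hper, C, hC⟩ := exists_eichler hF hF0
  simp only [← hhF] at hP₂
  have hrel := fun z hz hz0 => eichler_relation (z := z) hP hP₁ hP₂ hper (fun z hz => (hC z hz).1) hh hχ hχ₁ hχ₂ anti hH hk
    tr hz hz0
  have h3 : (0 : ℝ) < 1 / √3 := by positivity
  have hd : ∀ y ∈ Ici (1 / √3), HasDerivAt (fun y : ℝ => (13 - 15 * (y : ℂ) ^ 2) * P₂ ((1 + I * (y : ℂ)) / 2) -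
      60 * I * y * P₁ ((1 + I * (y : ℂ)) / 2) + 120 * P ((1 + I * (y : ℂ)) / 2))
      (I / 2 * (13 * (h ((1 + I * (y : ℂ)) / 2) * (y : ℂ) ^ 0) -
        15 * (h ((1 + I * (y : ℂ)) / 2) * (y : ℂ) ^ 2))) y := by
    intro y hy
    have hz : 0 < ((1 + I * (y : ℂ)) / 2).im := by linarith [ray_im_ge hy]
    have dy : HasDerivAt (fun y : ℝ => (y : ℂ)) 1 y := Complex.ofRealCLM.hasDerivAt
    have c0 := HasDerivAt.comp y (hP _ hz) (hasDerivAt_ray y)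
    have c1 := HasDerivAt.comp y (hP₁ _ hz) (hasDerivAt_ray y)
    have c2 := HasDerivAt.comp y (hP₂ _ hz) (hasDerivAt_ray y)
    refine ((((((dy.fun_pow 2).const_mul 15).const_sub 13).mul c2).sub
      ((dy.const_mul (60 * I)).mul c1)).add (c0.const_mul 120)).congr_deriv ?_
    simp only [Function.comp, Nat.reduceSub, Nat.cast_ofNat, pow_one]
    linear_combination (-30 * y * P₂ ((1 + I * (y : ℂ)) / 2)) * Complex.I_sq
  have hlim : Tendsto (fun y : ℝ => (13 - 15 * (y : ℂ) ^ 2) * P₂ ((1 + I * (y : ℂ)) / 2) -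
      60 * I * y * P₁ ((1 + I * (y : ℂ)) / 2) + 120 * P ((1 + I * (y : ℂ)) / 2)) atTop (𝓝 0) := by
    have t0 := tendsto_poly_decay (fun z hz => (hC z hz).1) 0
    have t1 := tendsto_poly_decay (fun z hz => (hC z hz).2.1) 1
    have t2 := tendsto_poly_decay (fun z hz => (hC z hz).2.2) 0
    have t3 := tendsto_poly_decay (fun z hz => (hC z hz).2.2) 2
    have tt := (((t2.const_mul 13).sub (t3.const_mul 15)).sub (t1.const_mul (60 * I))).add (t0.const_mul 120)
    simp only [mul_zero, sub_zero, add_zero] at tt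
    refine tt.congr fun y => ?_
    ring
  have key := integral_Ioi_of_hasDerivAt_of_tendsto' hd
    (((i0.const_mul 13).sub (i2.const_mul 15)).const_mul (I / 2)) hlim
  rw [integral_const_mul, integral_sub (i0.const_mul 13) (i2.const_mul 15), integral_const_mul,
    integral_const_mul] at key
  have hs3 : ((1 / √3 : ℝ) : ℂ) ^ 2 = 1 / 3 := by
    rw [← Complex.ofReal_pow, div_pow, sq_sqrt (by norm_num)]; simp
  have hz := hrel ((1 + I * ((1 / √3 : ℝ) : ℂ)) / 2) (by rw [ray_im]; positivity) (by
    linear_combination (1 / 4) * ((1 / √3 : ℝ) : ℂ) ^ 2 * Complex.I_sq - 1 / 4 * hs3)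
  rw [hs3] at key
  generalize (∫ y in Ioi (1 / √3), h ((1 + I * (y : ℂ)) / 2) * (y : ℂ) ^ 0) = A at key ⊢
  generalize (∫ y in Ioi (1 / √3), h ((1 + I * (y : ℂ)) / 2) * (y : ℂ) ^ 2) = B at key ⊢
  linear_combination (-2 * I) * key + (2 * I) * hz + (13 * A - 15 * B) * Complex.I_sq

lemma hasDerivAt_eu_zero : HasDerivAt eu (-1) 0 := by
  have hl : ∀ n : ℕ, logDeriv (fun q : ℂ => 1 - q ^ (n + 1)) 0 = if n = 0 then -1 else 0 := by
    intro n
    rw [logDeriv_apply, ((hasDerivAt_pow (n + 1) (0 : ℂ)).const_sub 1).deriv]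
    rcases n with _ | n <;> simp
  have h := logDeriv_tprod_eq_tsum (f := fun n q => 1 - q ^ (n + 1)) Metric.isOpen_ball
    (Metric.mem_ball_self one_pos : (0 : ℂ) ∈ Metric.ball 0 1) (by simp) (fun n => by fun_prop)
    (by simp only [hl]; exact (hasSum_ite_eq 0 (-1 : ℂ)).summable)
    ModularForm.multipliableLocallyUniformlyOn_one_sub_pow (by simp)
  simp only [hl, tsum_ite_eq] at h
  have hd := (differentiableOn_eu.differentiableAt (Metric.ball_mem_nhds 0 one_pos)).hasDerivAt
  have e : deriv eu 0 = -1 := by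
    rw [← h, logDeriv_apply]
    change _ = deriv eu 0 / eu 0
    rw [eu_zero, div_one]
  rwa [e] at hd

/-- The power series part of `ee`. -/
noncomputable def es (q : ℂ) : ℂ := (eu q * eu (q ^ 3)) ^ 2

/-- The eta product `(η(z)η(3z))²`. -/
noncomputable def ee (z : ℂ) : ℂ := (dedekindEta z * dedekindEta (3 * z)) ^ 2

lemma qq_nat_mul (n : ℕ) (z : ℂ) : qq (n * z) = qq z ^ n := by
  rw [qq, qq, ← Complex.exp_nat_mul]; congr 1; ring

lemma dedekindEta_eq_qq (n : ℕ) (z : ℂ) :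
    dedekindEta (n * z) = Complex.exp (π * I * z / 12) ^ n * eu (qq z ^ n) := by
  rw [dedekindEta_eq_eu, ← qq_nat_mul, ← Complex.exp_nat_mul, qq]; congr 2; ring

lemma ee_eq (n : ℕ) (z : ℂ) : ee (n * z) = Complex.exp (π * I * z / 12) ^ (8 * n) * es (qq z ^ n) := by
  have h := dedekindEta_eq_qq (3 * n) z
  push_cast at h
  rw [ee, es, ← mul_assoc, h, dedekindEta_eq_qq]
  ring

lemma exp_pow_eq_qq (z : ℂ) : Complex.exp (π * I * z / 12) ^ 24 = qq z := by
  rw [← Complex.exp_nat_mul, qq]; congr 1; push_cast; ring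

lemma pow_mem_ball {q : ℂ} (hq : q ∈ Metric.ball (0 : ℂ) 1) {n : ℕ} (hn : n ≠ 0) : q ^ n ∈ Metric.ball (0 : ℂ) 1 := by
  rw [mem_ball_zero_iff, norm_pow]
  exact pow_lt_one₀ (norm_nonneg _) (mem_ball_zero_iff.1 hq) hn

lemma differentiableOn_eu_pow {n : ℕ} (hn : n ≠ 0) : DifferentiableOn ℂ (fun q => eu (q ^ n)) (Metric.ball 0 1) :=
  differentiableOn_eu.comp (by fun_prop) fun _ hq => pow_mem_ball hq hn

lemma eu_pow_ne_zero {q : ℂ} (hq : q ∈ Metric.ball (0 : ℂ) 1) {n : ℕ} (hn : n ≠ 0) : eu (q ^ n) ≠ 0 :=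
  eu_ne_zero (mem_ball_zero_iff.1 (pow_mem_ball hq hn))

lemma es_ne_zero {q : ℂ} (hq : q ∈ Metric.ball (0 : ℂ) 1) : es q ≠ 0 :=
  pow_ne_zero _ (mul_ne_zero (eu_ne_zero (mem_ball_zero_iff.1 hq)) (eu_pow_ne_zero hq three_ne_zero))

lemma differentiableOn_es : DifferentiableOn ℂ es (Metric.ball 0 1) :=
  (differentiableOn_eu.mul (differentiableOn_eu_pow three_ne_zero)).pow 2

lemma differentiableOn_es_sq : DifferentiableOn ℂ (fun q => es (q ^ 2)) (Metric.ball 0 1) :=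
  differentiableOn_es.comp (by fun_prop) fun _ hq => pow_mem_ball hq two_ne_zero

lemma ee_ne_zero {z : ℂ} (hz : 0 < z.im) : ee z ≠ 0 :=
  pow_ne_zero _ (mul_ne_zero (dedekindEta_ne_zero hz) (dedekindEta_ne_zero (three_mul_im_pos hz)))

lemma ee_neg_inv {z : ℂ} (hz : 0 < z.im) : ee (-1 / (3 * z)) = -3 * z ^ 2 * ee z := by
  have h0 := ne_zero_of_im_pos hz
  rw [ee, show 3 * (-1 / (3 * z)) = -1 / z by field_simp, mul_pow, dedekindEta_neg_inv_sq hz,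
    dedekindEta_neg_inv_sq (three_mul_im_pos hz), ee]
  linear_combination (3 * z ^ 2 * dedekindEta z ^ 2 * dedekindEta (3 * z) ^ 2) * Complex.I_sq

lemma ee_fricke {z : ℂ} (hz : 0 < z.im) : ee (-1 / (6 * z)) = -12 * z ^ 2 * ee (2 * z) ∧
    ee (2 * (-1 / (6 * z))) = -3 * z ^ 2 * ee z := by
  have h0 := ne_zero_of_im_pos hz
  refine ⟨?_, ?_⟩
  · rw [show 6 * z = 3 * (2 * z) by ring, ee_neg_inv (two_mul_im_pos hz)]; ring
  · rw [show 2 * (-1 / (6 * z)) = -1 / (3 * z) by field_simp; norm_num, ee_neg_inv hz]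

lemma ee_add_one (z : ℂ) : ee (z + 1) = Complex.exp (π * I / 12) ^ 8 * ee z := by
  rw [ee, show 3 * (z + 1) = 3 * z + 1 + 1 + 1 by ring, dedekindEta_add_one, dedekindEta_add_one,
    dedekindEta_add_one, dedekindEta_add_one, ee]
  ring

/-- The linear and cubic relations between the values of `ee` at the points of the second Hecke correspondence. -/
lemma ee_relations {z : ℂ} (hz : 0 < z.im) :
    4 * ee (2 * z) + ee (z / 2) + Complex.exp (π * I / 12) ^ 16 * ee ((z - 1) / 2) = 0 ∧
    ee (2 * z) * ee (z / 2) * (Complex.exp (π * I / 12) ^ 16 * ee ((z - 1) / 2)) = -ee z ^ 3 := by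
  have h3 := three_mul_im_pos hz
  have e1 := dedekindEta_ne_zero hz
  have e2 := dedekindEta_ne_zero h3
  have c := Complex.exp_ne_zero (π * I / 12)
  have hc := exp_pi_div_twelve_pow
  have hT := th_cubic hz
  have hE1 := eta_triple hz
  have hE2 := eta_triple h3
  rw [th3_eq hz, th3_eq h3, th2_eq hz, th2_eq h3, th4_eq hz, th4_eq h3] at hT
  have s1 : dedekindEta ((z + 1) / 2) = Complex.exp (π * I / 12) * dedekindEta ((z - 1) / 2) := by
    rw [← dedekindEta_add_one]; congr 1; ring
  have s2 : dedekindEta ((3 * z + 1) / 2) =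
      Complex.exp (π * I / 12) ^ 2 * dedekindEta (3 * ((z - 1) / 2)) := by
    rw [pow_two, mul_assoc, ← dedekindEta_add_one, ← dedekindEta_add_one]; congr 1; ring
  simp only [ee]
  rw [show 3 * (2 * z) = 2 * (3 * z) by ring, show 3 * (z / 2) = 3 * z / 2 by ring]
  rw [s1, s2] at hT
  rw [s1] at hE1
  rw [s2] at hE2
  generalize Complex.exp (π * I / 12) = C at *
  clear s1 s2
  generalize dedekindEta (3 * ((z - 1) / 2)) = r₁ at *
  generalize dedekindEta ((z - 1) / 2) = r₂ at *
  generalize dedekindEta (2 * (3 * z)) = r₃ at *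
  generalize dedekindEta (3 * z / 2) = r₄ at *
  generalize dedekindEta (3 * z) = r₅ at *
  field_simp at hT
  refine ⟨?_, ?_⟩
  · linear_combination (-1 : ℂ) * hT + C ^ 4 * r₂ ^ 2 * r₁ ^ 2 * hc
  · refine mul_left_cancel₀ (pow_ne_zero 6 c) ?_
    have := congr_arg₂ (· * ·) hE1 hE2
    linear_combination C ^ 16 * this + C ^ 6 * dedekindEta z ^ 6 * r₅ ^ 6 * hc

/-- The `q`-expansion of a modular form of weight four given by a function `φ` of the Hauptmodul. -/
noncomputable def mf (φ : ℂ → ℂ) (q : ℂ) : ℂ := q * es q * es (q ^ 2) * φ (64 * q * (es (q ^ 2) / es q) ^ 3)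

/-- The image of such a form under the Fricke involution. -/
noncomputable def mw (φ : ℂ → ℂ) (z : ℂ) : ℂ := ee z * ee (2 * z) * φ ((ee z / ee (2 * z)) ^ 3)

lemma ee_eq_one_two (z : ℂ) : ee z = Complex.exp (π * I * z / 12) ^ 8 * es (qq z) ∧
    ee (2 * z) = Complex.exp (π * I * z / 12) ^ 16 * es (qq z ^ 2) := by
  have h1 := ee_eq 1 z
  have h2 := ee_eq 2 z
  simp only [Nat.cast_one, one_mul, pow_one, mul_one, Nat.cast_ofNat] at h1 h2
  exact ⟨h1, h2⟩

lemma mf_eq (φ : ℂ → ℂ) (z : ℂ) : mf φ (qq z) = ee z * ee (2 * z) * φ (64 * (ee (2 * z) / ee z) ^ 3) := by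
  have h3 := exp_pow_eq_qq z
  have h0 := Complex.exp_ne_zero (π * I * z / 12)
  rw [(ee_eq_one_two z).1, (ee_eq_one_two z).2, mf]
  generalize Complex.exp (π * I * z / 12) = C at *
  rw [show C ^ 16 * es (qq z ^ 2) / (C ^ 8 * es (qq z)) = C ^ 8 * (es (qq z ^ 2) / es (qq z)) by field_simp,
    mul_pow, ← pow_mul, h3, ← mul_assoc 64, show C ^ 8 * es (qq z) * (C ^ 16 * es (qq z ^ 2)) =
      C ^ 24 * es (qq z) * es (qq z ^ 2) by ring, h3]

lemma differentiableOn_mf {φ : ℂ → ℂ} (hφ : Differentiable ℂ φ) : DifferentiableOn ℂ (mf φ) (Metric.ball 0 1) :=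
  ((differentiableOn_id.mul differentiableOn_es).mul differentiableOn_es_sq).mul
    (hφ.comp_differentiableOn ((differentiableOn_id.const_mul 64).mul
      ((differentiableOn_es_sq.div differentiableOn_es fun _ hq => es_ne_zero hq).pow 3)))

lemma mf_zero (φ : ℂ → ℂ) : mf φ 0 = 0 := by simp [mf]

lemma mf_fricke (φ : ℂ → ℂ) {z : ℂ} (hz : 0 < z.im) : mf φ (qq (-1 / (6 * z))) = 36 * z ^ 4 * mw φ z := by
  have h0 := ne_zero_of_im_pos hz
  have h2 := ee_ne_zero (two_mul_im_pos hz)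
  rw [mf_eq, (ee_fricke hz).1, (ee_fricke hz).2, mw]
  rw [show 64 * (-3 * z ^ 2 * ee z / (-12 * z ^ 2 * ee (2 * z))) ^ 3 = (ee z / ee (2 * z)) ^ 3 by
    generalize ee (2 * z) = u at *
    field_simp; norm_num [mul_comm]]
  ring

lemma mf_trace {φ : ℂ → ℂ} (hφ : ∀ a b d : ℂ, a + b + d = 0 → a * b * d = -4 →
    a * φ (a ^ 3) + b * φ (b ^ 3) + d * φ (d ^ 3) = 0) {z : ℂ} (hz : 0 < z.im) :
    mf φ (qq z) + 1 / 4 * mw φ (z / 2) + 1 / 4 * mw φ ((z - 1) / 2) = 0 := by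
  have hE := ee_ne_zero hz
  have hc := exp_pi_div_twelve_pow
  have c := Complex.exp_ne_zero (π * I / 12)
  obtain ⟨r1, r2⟩ := ee_relations hz
  have hp := ee_add_one (z - 1)
  rw [sub_add_cancel] at hp
  rw [mf_eq, mw, mw, show 2 * (z / 2) = z by ring, show 2 * ((z - 1) / 2) = z - 1 by ring]
  generalize Complex.exp (π * I / 12) = C at *
  have hp' : ee (z - 1) = C ^ 16 * ee z := by
    rw [hp]; linear_combination (-(C ^ 12 - 1) * ee (z - 1)) * hc
  rw [hp']
  generalize ee (2 * z) = u at *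
  have key := hφ (ee (z / 2) / ee z) (C ^ 16 * ee ((z - 1) / 2) / ee z) (4 * u / ee z)
    (by field_simp; linear_combination r1) (by field_simp; linear_combination r2)
  rw [show 64 * (u / ee z) ^ 3 = (4 * u / ee z) ^ 3 by ring,
    show (ee ((z - 1) / 2) / (C ^ 16 * ee z)) ^ 3 = (C ^ 16 * ee ((z - 1) / 2) / ee z) ^ 3 by
      field_simp; linear_combination (-ee ((z - 1) / 2) ^ 3 * (C ^ 84 - C ^ 72 + C ^ 60 - C ^ 48 + C ^ 36 - C ^ 24 + C ^ 12 - 1)) * hc]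
  generalize φ ((C ^ 16 * ee ((z - 1) / 2) / ee z) ^ 3) = p₁ at *
  generalize φ ((4 * u / ee z) ^ 3) = p₂ at *
  generalize φ ((ee (z / 2) / ee z) ^ 3) = p₃ at *
  field_simp at key ⊢
  linear_combination ee z * key

/-- The period relation for a form together with a primitive of its Fricke defect. -/
theorem mf_period {φ H χ₁ χ₂ : ℂ → ℂ} {k : ℂ} (hφ : Differentiable ℂ φ)
    (htr : ∀ a b d : ℂ, a + b + d = 0 → a * b * d = -4 → a * φ (a ^ 3) + b * φ (b ^ 3) + d * φ (d ^ 3) = 0)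
    (hχ : ∀ z : ℂ, 0 < z.im → HasDerivAt (fun z => H (qq z) / qq z) (χ₁ z) z)
    (hχ₁ : HasDerivUpper χ₁ χ₂)
    (hχ₂ : ∀ z : ℂ, 0 < z.im → HasDerivAt χ₂ (mw φ z - mf φ (qq z)) z)
    (anti : ∀ z : ℂ, 0 < z.im → 6 * z ^ 2 * (H (qq (-1 / (6 * z))) / qq (-1 / (6 * z))) = -(H (qq z) / qq z))
    (hk : HasDerivAt H k 0) {v : ℝ → ℝ} (hv : ∀ y : ℝ, 0 < y → mf φ (qq ((1 + I * y) / 2)) =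
      ((-(9 / π ^ 4) * (v (XX y) * (pp (XX y) * FF (XX y) ^ 4)) : ℝ) : ℂ)) :
    ((13 * RI v 0 - 15 * RI v 2 : ℝ) : ℂ) = -64 * π ^ 3 * I * k := by
  have h := ray_period (h := fun z => mf φ (qq z)) (differentiableOn_mf hφ) (mf_zero φ) (fun z => rfl)
    (fun z hz => mf_fricke φ hz) hχ hχ₁ hχ₂ anti (fun z => rfl) hk (fun z hz => mf_trace htr hz)
  have e0 := ray_integral (φ := fun z => mf φ (qq z)) hv 0
  have e2 := ray_integral (φ := fun z => mf φ (qq z)) hv 2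
  rw [neg_eq_iff_eq_neg] at e0 e2
  rw [e0, e2] at h
  have hpi : (π : ℂ) ≠ 0 := by exact_mod_cast pi_ne_zero
  push_cast at h ⊢
  field_simp at h
  linear_combination (-1 / 3 : ℂ) * h

theorem RI_one_relation : 13 * RI (fun _ => 1) 0 = 15 * RI (fun _ => 1) 2 := by
  have h := mf_period (φ := fun _ => 1) (H := fun _ => 0) (χ₁ := fun _ => 0) (χ₂ := fun _ => 0) (k := 0)
    (v := fun _ => 1) (differentiable_const 1) (fun a b d h _ => by linear_combination h)
    (fun z _ => by simpa using hasDerivAt_const z (0 : ℂ)) (fun z _ => hasDerivAt_const z 0)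
    (fun z _ => by rw [mf_eq, mw, sub_self]; exact hasDerivAt_const z 0) (by simp) (hasDerivAt_const _ _)
    (fun y hy => by
      rw [mf_eq, one_mul, ← f46_XX hy, f46, ee, ee]
      rw [show 3 * (2 * ((1 + I * (y : ℂ)) / 2)) = 6 * ((1 + I * (y : ℂ)) / 2) by ring]
      ring)
  rw [mul_zero] at h
  linarith [Complex.ofReal_eq_zero.1 h]

lemma eq_on_upper_of_ray {f g : ℂ → ℂ} (hf : DifferentiableOn ℂ f {z | 0 < z.im})
    (hg : DifferentiableOn ℂ g {z | 0 < z.im})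
    (h : ∀ X : ℝ, 0 < X → f ((1 + I * YY X) / 2) = g ((1 + I * YY X) / 2)) {z : ℂ} (hz : 0 < z.im) :
    f z = g z := by
  refine (hf.analyticOnNhd isOpen_upper).eqOn_of_preconnected_of_frequently_eq (hg.analyticOnNhd isOpen_upper)
    convex_upper.isPreconnected (z₀ := (1 + I * ((1 : ℝ) : ℂ)) / 2) (by
      change 0 < Complex.im _; rw [ray_im]; norm_num) ?_ hz
  have ht : Tendsto (fun y : ℝ => (1 + I * (y : ℂ)) / 2) (𝓝[≠] 1) (𝓝[≠] ((1 + I * ((1 : ℝ) : ℂ)) / 2)) := by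
    refine tendsto_nhdsWithin_of_tendsto_nhds_of_eventually_within _
      ((hasDerivAt_ray 1).continuousAt.tendsto.mono_left nhdsWithin_le_nhds) ?_
    filter_upwards [self_mem_nhdsWithin] with y hy h
    refine hy ?_
    have := congr_arg Complex.im h
    rw [ray_im, ray_im] at this
    exact mem_singleton_iff.2 (by linarith)
  refine ht.frequently (Eventually.frequently ?_)
  filter_upwards [nhdsWithin_le_nhds (Ioi_mem_nhds (zero_lt_one (α := ℝ)))] with y hy
  have := h (XX y) (XX_pos hy)
  rwa [YY_XX hy] at this

lemma ray_deriv {Φ Φ₁ : ℂ → ℂ} {c : ℂ} {G G₁ : ℝ → ℝ} (hΦ : HasDerivUpper Φ Φ₁)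
    (hG : ∀ X, 0 < X → HasDerivAt G (G₁ X / (pp X * FF X ^ 2)) X)
    (h : ∀ X : ℝ, 0 < X → Φ ((1 + I * YY X) / 2) = c * G X) (X : ℝ) (hX : 0 < X) :
    Φ₁ ((1 + I * YY X) / 2) = c * (6 * I / π) * G₁ X := by
  have hF := FF_pos (show -1 < X by linarith)
  have hp := pp_pos hX
  have h1 := (hΦ _ (by
    change 0 < ((1 + I * (YY X : ℂ)) / 2).im; rw [ray_im]; linarith [YY_pos hX])).comp X ((hasDerivAt_ray (YY X)).scomp X (hasDerivAt_YY hX))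
  have h2 := (((hG X hX).ofReal_comp).const_mul c).congr_of_eventuallyEq
    (f₁ := Φ ∘ (fun y : ℝ => (1 + I * (y : ℂ)) / 2) ∘ YY)
    (eventually_of_mem (Ioi_mem_nhds hX) fun x hx => h x hx)
  have := h1.unique h2
  rw [Complex.real_smul, Function.comp_apply] at this
  push_cast at this
  have hpi : (π : ℂ) ≠ 0 := by exact_mod_cast pi_ne_zero
  have hp' : (pp X : ℂ) ≠ 0 := by exact_mod_cast hp.ne'
  have hF' : (FF X : ℂ) ≠ 0 := by exact_mod_cast hF.ne'
  generalize Φ₁ ((1 + I * YY X) / 2) = w at *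
  field_simp at this ⊢
  linear_combination I * this + π * w * Complex.I_sq

/-- The numerators of the first three derivatives of a quasi-period potential along the ray. -/
noncomputable def g₀ (X : ℝ) : ℝ := (9 - X ^ 2) / (pp X * FF X ^ 2)
noncomputable def g₁ (X : ℝ) : ℝ := (X ^ 4 - 36 * X ^ 2 - 180 * X - 81) / pp X - 2 * (9 - X ^ 2) / pp X * (pp X * FF1 X) / FF X
noncomputable def g₂ (X : ℝ) : ℝ :=
  ((4 * X ^ 3 - 72 * X - 180) * pp X - (X ^ 4 - 36 * X ^ 2 - 180 * X - 81) * pp1 X) / pp X * FF X ^ 2 -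
    2 * (X ^ 4 - 36 * X ^ 2 - 180 * X - 81) / pp X * FF X * (pp X * FF1 X) +
    2 * (X + 3) * (9 - X ^ 2) * FF X ^ 2 + 2 * (9 - X ^ 2) / pp X * (pp X * FF1 X) ^ 2
noncomputable def g₃ (X : ℝ) : ℝ :=
  -pp X * FF X ^ 4 * ((10 - (X + 1) * (X + 9) / X) * (4 - (X + 1) * (X + 9) / X) -
    (10 - 64 * X / ((X + 1) * (X + 9))) * (4 - 64 * X / ((X + 1) * (X + 9))))

lemma hasDerivAt_g {X : ℝ} (hX : 0 < X) : HasDerivAt g₀ (g₁ X / (pp X * FF X ^ 2)) X ∧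
    HasDerivAt g₁ (g₂ X / (pp X * FF X ^ 2)) X ∧ HasDerivAt g₂ (g₃ X / (pp X * FF X ^ 2)) X := by
  have hF := FF_pos (show -1 < X by linarith)
  have hp := pp_pos hX
  obtain ⟨dF, dP⟩ := isSol_FF X hX
  have dp := hasDerivAt_pp X
  have dp1 : HasDerivAt pp1 (6 * X + 20) X := by
    refine ((((hasDerivAt_id X).fun_pow 2).const_mul 3).add ((hasDerivAt_id X).const_mul 20)).add_const 9 |>.congr_deriv ?_
    simp; ring
  have dN : HasDerivAt (fun X : ℝ => 9 - X ^ 2) (-(2 * X)) X := by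
    simpa using ((hasDerivAt_id X).fun_pow 2).const_sub 9
  have dM : HasDerivAt (fun X : ℝ => X ^ 4 - 36 * X ^ 2 - 180 * X - 81) (4 * X ^ 3 - 72 * X - 180) X := by
    refine ((((hasDerivAt_id X).fun_pow 4).sub (((hasDerivAt_id X).fun_pow 2).const_mul 36)).sub
      ((hasDerivAt_id X).const_mul 180)).sub_const 81 |>.congr_deriv ?_
    simp; ring
  have dL : HasDerivAt (fun X : ℝ => 4 * X ^ 3 - 72 * X - 180) (12 * X ^ 2 - 72) X := by
    refine ((((hasDerivAt_id X).fun_pow 3).const_mul 4).sub ((hasDerivAt_id X).const_mul 72)).sub_const 180 |>.congr_deriv ?_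
    simp; ring
  have d3 : HasDerivAt (fun X : ℝ => 2 * (X + 3)) 2 X := by
    simpa using ((hasDerivAt_id X).add_const 3).const_mul 2
  have hQ : FF1 X = (pp X * FF1 X) / pp X := by field_simp
  have hpe : pp X = X * (X + 1) * (X + 9) := rfl
  have hp1e : pp1 X = 3 * X ^ 2 + 20 * X + 9 := rfl
  refine ⟨?_, ?_, ?_⟩
  · refine (dN.div (dp.mul (dF.fun_pow 2)) (by simpa using ⟨hp.ne', hF.ne'⟩)).congr_deriv ?_
    simp only [Pi.mul_apply, Nat.reduceSub, Nat.cast_ofNat, pow_one, g₁]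
    rw [hp1e]
    generalize FF X = f at *
    generalize FF1 X = f1 at *
    field_simp
    rw [hpe]
    ring
  · refine ((dM.div dp hp.ne').sub ((((dN.const_mul 2).div dp hp.ne').mul dP).div dF hF.ne')).congr_deriv ?_
    simp only [Pi.mul_apply, Pi.div_apply, g₂]
    rw [hp1e]
    generalize FF X = f at *
    generalize FF1 X = f1 at *
    field_simp
    rw [hpe]
    ring
  · refine (((((((dL.mul dp).sub (dM.mul dp1)).div dp hp.ne').mul (dF.fun_pow 2)).sub
      ((((dM.const_mul 2).div dp hp.ne').mul dF).mul dP)).add ((d3.mul dN).mul (dF.fun_pow 2))).add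
      (((dN.const_mul 2).div dp hp.ne').mul (dP.fun_pow 2))).congr_deriv ?_
    simp only [Pi.mul_apply, Pi.div_apply, Pi.sub_apply, Nat.reduceSub, Nat.cast_ofNat, pow_one, g₃]
    rw [hp1e]
    generalize FF X = f at *
    generalize FF1 X = f1 at *
    rw [hpe]
    field_simp
    ring

/-- The `q`-expansion of `w46`. -/
noncomputable def wq (q : ℂ) : ℂ := 3 * eu (q ^ 2) ^ 2 * eu (q ^ 3) ^ 4 / (eu q ^ 4 * eu (q ^ 6) ^ 2)

/-- The `q`-expansion of the potential of weight `-2`, multiplied by `q`. -/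
noncomputable def hq (q : ℂ) : ℂ := es q / es (q ^ 2) ^ 2 * (wq q ^ 2 - 9 / wq q ^ 2)

/-- The Fricke transform of `w46`. -/
noncomputable def vv (z : ℂ) : ℂ :=
  dedekindEta (2 * z) ^ 4 * dedekindEta (3 * z) ^ 2 / (dedekindEta z ^ 2 * dedekindEta (6 * z) ^ 4)

lemma six_mul_im_pos {z : ℂ} (hz : 0 < z.im) : 0 < (6 * z).im := by simpa using hz

lemma w46_eq_wq (z : ℂ) : w46 z = wq (qq z) := by
  have h1 := dedekindEta_eq_qq 1 z
  have h2 := dedekindEta_eq_qq 2 z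
  have h3 := dedekindEta_eq_qq 3 z
  have h6 := dedekindEta_eq_qq 6 z
  simp only [Nat.cast_one, one_mul, pow_one, Nat.cast_ofNat] at h1 h2 h3 h6
  have h0 := Complex.exp_ne_zero (π * I * z / 12)
  rw [w46, wq, h1, h2, h3, h6]
  generalize Complex.exp (π * I * z / 12) = C at *
  field_simp

lemma hq_eq (z : ℂ) : hq (qq z) / qq z = ee z / ee (2 * z) ^ 2 * (w46 z ^ 2 - 9 / w46 z ^ 2) := by
  have h0 := Complex.exp_ne_zero (π * I * z / 12)
  rw [hq, w46_eq_wq, (ee_eq_one_two z).1, (ee_eq_one_two z).2]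
  have hC := exp_pow_eq_qq z
  generalize Complex.exp (π * I * z / 12) = C at *
  generalize es (qq z) = a, es (qq z ^ 2) = b, wq (qq z) = w
  rw [← hC]
  field_simp

lemma wq_ne_zero {q : ℂ} (hq : q ∈ Metric.ball (0 : ℂ) 1) : wq q ≠ 0 := by
  have h1 := eu_ne_zero (mem_ball_zero_iff.1 hq)
  have h2 := eu_pow_ne_zero hq two_ne_zero
  have h3 := eu_pow_ne_zero hq three_ne_zero
  have h6 := eu_pow_ne_zero hq (show 6 ≠ 0 by norm_num)
  rw [wq]
  simp [h1, h2, h3, h6]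

lemma differentiableOn_wq : DifferentiableOn ℂ wq (Metric.ball 0 1) :=
  (((differentiableOn_eu_pow two_ne_zero).fun_pow 2).const_mul 3 |>.mul
    ((differentiableOn_eu_pow three_ne_zero).fun_pow 4)).div ((differentiableOn_eu.pow 4).mul
    ((differentiableOn_eu_pow (by norm_num)).fun_pow 2)) fun q h => by
      have h1 := eu_ne_zero (mem_ball_zero_iff.1 h)
      have h6 := eu_pow_ne_zero h (show 6 ≠ 0 by norm_num)
      simp [h1, h6]

lemma differentiableOn_hq : DifferentiableOn ℂ hq (Metric.ball 0 1) :=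
  (differentiableOn_es.div (differentiableOn_es_sq.fun_pow 2) fun _ h =>
    pow_ne_zero 2 (es_ne_zero (pow_mem_ball h two_ne_zero))).mul
    ((differentiableOn_wq.fun_pow 2).sub ((differentiableOn_const 9).div (differentiableOn_wq.fun_pow 2)
      fun _ h => pow_ne_zero 2 (wq_ne_zero h)))

lemma hasDerivAt_eu_pow_zero (n : ℕ) : HasDerivAt (fun q => eu (q ^ (n + 2))) 0 0 := by
  have h := HasDerivAt.comp (0 : ℂ) (h := fun q : ℂ => q ^ (n + 2)) (h₂ := eu) (h₂' := -1)
    (by simpa using hasDerivAt_eu_zero) (hasDerivAt_pow (n + 2) 0)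
  simpa [Function.comp_def] using h

lemma hasDerivAt_hq_zero : HasDerivAt hq 64 0 := by
  have d1 := hasDerivAt_eu_zero
  have d2 := hasDerivAt_eu_pow_zero 0
  have d3 := hasDerivAt_eu_pow_zero 1
  have d6 := hasDerivAt_eu_pow_zero 4
  have ds : HasDerivAt es (-2) 0 := by
    refine ((d1.mul d3).pow 2).congr_deriv ?_
    simp [eu_zero]
  have es0 : es 0 = 1 := by simp [es, eu_zero]
  have ds2 : HasDerivAt (fun q => es (q ^ 2)) 0 0 := by
    have h := HasDerivAt.comp (0 : ℂ) (h := fun q : ℂ => q ^ 2) (h₂ := es) (h₂' := -2)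
      (by simpa using ds) (hasDerivAt_pow 2 0)
    simpa [Function.comp_def] using h
  have dw : HasDerivAt wq 12 0 := by
    refine ((((d2.fun_pow 2).const_mul 3).mul (d3.fun_pow 4)).div ((d1.fun_pow 4).mul (d6.fun_pow 2))
      (by simp [eu_zero])).congr_deriv ?_
    simp [eu_zero]; norm_num
  have w0 : wq 0 = 3 := by simp [wq, eu_zero]
  refine ((ds.div (ds2.fun_pow 2) (by simp [es0])).mul ((dw.fun_pow 2).sub
    ((hasDerivAt_const 0 (9 : ℂ)).div (dw.fun_pow 2) (by simp [w0])))).congr_deriv ?_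
  simp [es0, w0]; norm_num

lemma w46_fricke {z : ℂ} (hz : 0 < z.im) : w46 (-1 / (6 * z)) = vv z := by
  have h0 := ne_zero_of_im_pos hz
  have e1 := dedekindEta_neg_inv_sq hz
  have e2 := dedekindEta_neg_inv_sq (two_mul_im_pos hz)
  have e3 := dedekindEta_neg_inv_sq (three_mul_im_pos hz)
  have e6 := dedekindEta_neg_inv_sq (six_mul_im_pos hz)
  have n1 := dedekindEta_ne_zero hz
  have n6 := dedekindEta_ne_zero (six_mul_im_pos hz)
  rw [w46, vv, show 2 * (-1 / (6 * z)) = -1 / (3 * z) by field_simp; norm_num,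
    show 3 * (-1 / (6 * z)) = -1 / (2 * z) by field_simp; norm_num, show 6 * (-1 / (6 * z)) = -1 / z by field_simp,
    show dedekindEta (-1 / (2 * z)) ^ 4 = (dedekindEta (-1 / (2 * z)) ^ 2) ^ 2 by ring,
    show dedekindEta (-1 / (6 * z)) ^ 4 = (dedekindEta (-1 / (6 * z)) ^ 2) ^ 2 by ring, e1, e2, e3, e6]
  have hI := Complex.I_ne_zero
  generalize dedekindEta (6 * z) = a at *
  generalize dedekindEta (3 * z) = b at *
  generalize dedekindEta (2 * z) = d at *
  field_simp
  ring

lemma ee_ray {τ : ℂ} (hτ : 0 < τ.im) (h0 : th3 τ ≠ 0) (h0' : th3 (3 * τ) ≠ 0) :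
    64 * (ee (2 * ((1 + τ) / 2)) / ee ((1 + τ) / 2)) ^ 3 =
      -(16 * ((th2 τ * th2 (3 * τ)) * (th4 τ * th4 (3 * τ))) / (th3 τ * th3 (3 * τ)) ^ 2) ∧
    ee ((1 + τ) / 2) / ee (2 * ((1 + τ) / 2)) ^ 2 =
      -(4 / ((th2 τ * th2 (3 * τ)) * (th4 τ * th4 (3 * τ)))) ∧
    vv ((1 + τ) / 2) ^ 2 = -((th2 τ * th4 τ) / (th2 (3 * τ) * th4 (3 * τ))) ^ 2 := by
  obtain ⟨h1, h2, h3, h4⟩ := eta_ray hτ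
  have e1 := dedekindEta_ne_zero hτ
  have e2 := dedekindEta_ne_zero (three_mul_im_pos hτ)
  have c := Complex.exp_ne_zero (π * I / 12)
  have hc := exp_pi_div_twelve_pow
  have p1 := th_product hτ
  have p2 := th_product (three_mul_im_pos hτ)
  have q1 : th2 τ * th4 τ = 2 * dedekindEta τ ^ 3 / th3 τ := by rw [← p1]; field_simp
  have q2 : th2 (3 * τ) * th4 (3 * τ) = 2 * dedekindEta (3 * τ) ^ 3 / th3 (3 * τ) := by rw [← p2]; field_simp
  have q3 : (th2 τ * th2 (3 * τ)) * (th4 τ * th4 (3 * τ)) =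
      (2 * dedekindEta τ ^ 3 / th3 τ) * (2 * dedekindEta (3 * τ) ^ 3 / th3 (3 * τ)) := by rw [← q1, ← q2]; ring
  rw [q3, q1, q2, ee, ee, mul_pow, mul_pow, vv, h1, h2, h3, h4,
    show 3 * (2 * ((1 + τ) / 2)) = 6 * ((1 + τ) / 2) by ring, h4]
  generalize Complex.exp (π * I / 12) = C at *
  generalize dedekindEta (3 * τ) = a at *
  generalize th3 (3 * τ) = b at *
  refine ⟨?_, ?_, ?_⟩
  · field_simp
    linear_combination (64 : ℂ) * hc
  · field_simp
    linear_combination (4 : ℂ) * hc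
  · field_simp
    linear_combination hc

lemma t_ratio_sq {y : ℝ} (hy : 0 < y) :
    ((t2 y * t4 y) / (t2 (3 * y) * t4 (3 * y))) ^ 2 = (9 - mm y ^ 2) / (mm y ^ 2 - 1) := by
  obtain ⟨m0, m1, m9⟩ := mm_bounds hy
  have h3 : 0 < 3 * y := by positivity
  have p1 := t3_pos hy
  have p2 := t2_pos hy
  have p4 := t4_pos hy
  have q1 := t3_pos h3
  have q2 := t2_pos h3
  have q4 := t4_pos h3
  have hA := t2_mul_t2 hy
  have hB := t4_mul_t4 hy
  have hM := modulus_eq hy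
  have hJ := t_jacobi hy
  have hm : mm y * t3 (3 * y) ^ 2 = t3 y ^ 2 := by unfold mm; field_simp
  generalize mm y = m at *
  generalize t2 (3 * y) = b2 at *
  generalize t3 (3 * y) = b3 at *
  generalize t4 (3 * y) = b4 at *
  generalize t2 y = a2 at *
  generalize t3 y = a3 at *
  generalize t4 y = a4 at *
  have h4 : a4 ^ 4 = a3 ^ 4 * ((m + 1) * (3 - m) ^ 3 / (16 * m ^ 3)) := by
    have : a4 ^ 4 = a3 ^ 4 * (1 - (m - 1) * (m + 3) ^ 3 / (16 * m ^ 3)) := by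
      rw [← hM]; field_simp; ring
    rw [this]; field_simp; ring
  have h2 : a2 ^ 4 = a3 ^ 4 * ((m - 1) * (m + 3) ^ 3 / (16 * m ^ 3)) := by
    rw [← sub_eq_iff_eq_add] at hJ
    rw [← hJ, h4]; field_simp; ring
  rw [div_eq_iff (by positivity)] at hA hB
  have k : (a2 * a4) ^ 4 * (m ^ 2 - 1) = (9 - m ^ 2) * ((a2 * b2) * (a4 * b4)) ^ 2 := by
    rw [mul_pow a2 a4 4, h2, h4, hA, hB, show a3 ^ 4 = (a3 ^ 2) ^ 2 by ring, show ((m - 1) * (m + 3) / (4 * m) * (a3 * b3) * ((3 - m) * (m + 1) / (4 * m) * (a3 * b3))) ^ 2 =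
      ((m - 1) * (m + 3) / (4 * m) * ((3 - m) * (m + 1) / (4 * m))) ^ 2 * (a3 ^ 2) ^ 2 * (b3 ^ 2) ^ 2 by ring, ← hm]
    field_simp
    ring
  rw [div_pow, div_eq_div_iff (by positivity) m1.ne']
  have : (a2 * a4) ^ 2 ≠ 0 := by positivity
  refine mul_left_cancel₀ this ?_
  linear_combination k

/-- The values of the Hauptmodul, of the weight `-2` prefactor and of the Fricke transform on the ray. -/
lemma ray_values {X : ℝ} (hX : 0 < X) :
    64 * (ee (2 * ((1 + I * YY X) / 2)) / ee ((1 + I * YY X) / 2)) ^ 3 =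
      ((-(64 * X / ((X + 1) * (X + 9))) : ℝ) : ℂ) ∧
    ee ((1 + I * YY X) / 2) / ee (2 * ((1 + I * YY X) / 2)) ^ 2 =
      ((-(π ^ 2 / 3 / (X * FF X ^ 2)) : ℝ) : ℂ) ∧
    vv ((1 + I * YY X) / 2) ^ 2 = ((-(9 / X) : ℝ) : ℂ) ∧
    w46 ((1 + I * YY X) / 2) ^ 2 = (((X + 9) / (X + 1) : ℝ) : ℂ) := by
  have hy := YY_pos hX
  rw [← XX_YY hX, YY_XX hy]
  generalize YY X = y at *
  have h3 : 0 < 3 * y := by positivity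
  have p1 := t3_pos hy
  have p3 := t3_pos h3
  obtain ⟨m0, m1, m9⟩ := mm_bounds hy
  have e1 : XX y + 1 = 8 * mm y ^ 2 / (9 - mm y ^ 2) := by unfold XX; field_simp; ring
  have e2 : XX y + 9 = 72 / (9 - mm y ^ 2) := by unfold XX; field_simp; ring
  obtain ⟨r1, r2, r3⟩ := ee_ray (I_mul_im_pos hy) (by rw [← ofReal_t3 hy]; exact_mod_cast p1.ne')
    (by rw [three_mul_I_mul, ← ofReal_t3 h3]; exact_mod_cast p3.ne')
  rw [three_mul_I_mul, ← ofReal_t2 hy, ← ofReal_t2 h3, ← ofReal_t4 hy, ← ofReal_t4 h3] at r1 r2 r3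
  rw [← ofReal_t3 hy, ← ofReal_t3 h3] at r1
  have hA := t2_mul_t2 hy
  have hB := t4_mul_t4 hy
  have hR := t_ratio_sq hy
  rw [div_eq_iff (by positivity)] at hA hB
  have f1 : mm y + 1 ≠ 0 := by positivity
  have f2 : mm y - 1 ≠ 0 := fun h => by nlinarith
  have f3 : mm y + 3 ≠ 0 := by positivity
  have f4 : 3 - mm y ≠ 0 := fun h => by nlinarith
  rw [r1, r2, r3, w46_XX hy, e1, e2]
  norm_cast
  rw [hR, hA, hB, FF_XX hy, XX]
  have hs : √3 ^ 2 = 3 := sq_sqrt (by norm_num)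
  have hs0 : √3 ≠ 0 := by positivity
  have hpi := pi_ne_zero
  have hu : t3 y * t3 (3 * y) ≠ 0 := by positivity
  generalize t3 y * t3 (3 * y) = u at *
  refine ⟨?_, ?_, ?_, ?_⟩
  · field_simp
    ring
  · rw [mul_pow, mul_pow, div_pow, mul_pow, hs, show (9 : ℝ) - mm y ^ 2 = (3 - mm y) * (mm y + 3) by ring,
      show mm y ^ 2 - 1 = (mm y - 1) * (mm y + 1) by ring]
    field_simp
    norm_num
  · field_simp
  · field_simp
    norm_num

lemma differentiableAt_dedekindEta_mul {c : ℝ} (hc : 0 < c) {z : ℂ} (hz : 0 < z.im) :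
    DifferentiableAt ℂ (fun z => dedekindEta (c * z)) z :=
  (differentiableAt_dedekindEta (z := c * z) (by simpa using mul_pos hc hz)).comp z
    (differentiableAt_id.const_mul (c : ℂ))

lemma differentiableOn_ee_mul {c : ℝ} (hc : 0 < c) : DifferentiableOn ℂ (fun z => ee (c * z)) {z | 0 < z.im} := by
  intro z hz
  have h := ((differentiableAt_dedekindEta_mul hc hz).mul
    (differentiableAt_dedekindEta_mul (show 0 < 3 * c by positivity) hz)).pow 2
  refine (h.congr_of_eventuallyEq (Eventually.of_forall fun w => ?_)).differentiableWithinAt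
  simp [ee, mul_assoc]

lemma differentiableOn_vv : DifferentiableOn ℂ vv {z | 0 < z.im} := by
  intro z hz
  have d := fun c : ℝ => fun hc : 0 < c => differentiableAt_dedekindEta_mul hc hz
  have h := (((d 2 two_pos).pow 4).mul ((d 3 three_pos).pow 2)).div
    (((d 1 one_pos).pow 2).mul ((d 6 (by norm_num)).pow 4)) (by
      have h1 := dedekindEta_ne_zero hz
      have h6 := dedekindEta_ne_zero (six_mul_im_pos hz)
      simp [h1, h6])
  refine (h.congr_of_eventuallyEq (Eventually.of_forall fun w => ?_)).differentiableWithinAt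
  simp [vv]

lemma differentiableOn_comp_qq {f : ℂ → ℂ} (hf : DifferentiableOn ℂ f (Metric.ball 0 1)) :
    DifferentiableOn ℂ (fun z => f (qq z)) {z | 0 < z.im} :=
  hf.comp (fun z _ => (hasDerivAt_qq z).differentiableAt.differentiableWithinAt) fun _ hz => qq_mem hz

lemma vv_ne_zero {z : ℂ} (hz : 0 < z.im) : vv z ≠ 0 := by
  have h1 := dedekindEta_ne_zero hz
  have h2 := dedekindEta_ne_zero (two_mul_im_pos hz)
  have h3 := dedekindEta_ne_zero (three_mul_im_pos hz)
  have h6 := dedekindEta_ne_zero (six_mul_im_pos hz)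
  simp [vv, h1, h2, h3, h6]

lemma w46_vv {z : ℂ} (hz : 0 < z.im) :
    w46 z ^ 2 - 9 / w46 z ^ 2 = 8 * (ee (2 * z) / ee z) ^ 3 * (vv z ^ 2 - 9 / vv z ^ 2) := by
  have d1 : DifferentiableOn ℂ ee {z | 0 < z.im} := by simpa using differentiableOn_ee_mul one_pos
  have d2 : DifferentiableOn ℂ (fun z => ee (2 * z)) {z | 0 < z.im} := by simpa using differentiableOn_ee_mul two_pos
  have dw : DifferentiableOn ℂ w46 {z | 0 < z.im} :=
    (differentiableOn_comp_qq differentiableOn_wq).congr fun z _ => w46_eq_wq z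
  refine eq_on_upper_of_ray (f := fun z => w46 z ^ 2 - 9 / w46 z ^ 2)
    (g := fun z => 8 * (ee (2 * z) / ee z) ^ 3 * (vv z ^ 2 - 9 / vv z ^ 2)) ?_ ?_ ?_ hz
  · refine (dw.pow 2).sub ((differentiableOn_const 9).div (dw.pow 2) fun z hz => pow_ne_zero 2 ?_)
    rw [w46_eq_wq]; exact wq_ne_zero (qq_mem hz)
  · exact (((d2.div d1 fun z hz => ee_ne_zero hz).pow 3).const_mul 8).mul ((differentiableOn_vv.pow 2).sub
      ((differentiableOn_const 9).div (differentiableOn_vv.pow 2) fun z hz => pow_ne_zero 2 (vv_ne_zero hz)))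
  · intro X hX
    obtain ⟨h1, -, h3, h4⟩ := ray_values hX
    rw [h3, h4, show ∀ x : ℂ, 8 * x = 64 * x / 8 from fun x => by ring, h1]
    norm_cast
    field_simp
    ring

lemma hq_fricke {z : ℂ} (hz : 0 < z.im) :
    6 * z ^ 2 * (hq (qq (-1 / (6 * z))) / qq (-1 / (6 * z))) = -(hq (qq z) / qq z) := by
  have h0 := ne_zero_of_im_pos hz
  have n1 := ee_ne_zero hz
  have n2 := ee_ne_zero (two_mul_im_pos hz)
  rw [hq_eq, hq_eq, w46_fricke hz, (ee_fricke hz).1, (ee_fricke hz).2, w46_vv hz]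
  generalize ee (2 * z) = u at *
  generalize vv z ^ 2 - 9 / vv z ^ 2 = v
  field_simp
  ring

lemma hq_ray {X : ℝ} (hX : 0 < X) :
    hq (qq ((1 + I * YY X) / 2)) / qq ((1 + I * YY X) / 2) = -(8 * π ^ 2 / 3) * (g₀ X : ℂ) := by
  obtain ⟨-, h2, -, h4⟩ := ray_values hX
  have hF := FF_pos (show -1 < X by linarith)
  rw [hq_eq, h2, h4]
  norm_cast
  rw [g₀, pp]
  field_simp
  ring

lemma ee_mul_ee_ray {X : ℝ} (hX : 0 < X) :
    ee ((1 + I * YY X) / 2) * ee (2 * ((1 + I * YY X) / 2)) =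
      ((-(9 / π ^ 4) * (pp X * FF X ^ 4) : ℝ) : ℂ) := by
  have h := f46_XX (YY_pos hX)
  rw [XX_YY hX] at h
  rw [← h, f46, ee, ee, show 3 * (2 * ((1 + I * (YY X : ℂ)) / 2)) = 6 * ((1 + I * (YY X : ℂ)) / 2) by ring]
  ring

/-- The polynomial in the Hauptmodul that describes `g46`. -/
noncomputable def qf (x : ℂ) : ℂ := (10 + x) * (4 + x) / 8

lemma mf_qf_ray {X : ℝ} (hX : 0 < X) : mf qf (qq ((1 + I * YY X) / 2)) =
    ((-(9 / π ^ 4) * (gX X * (pp X * FF X ^ 4)) : ℝ) : ℂ) := by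
  rw [mf_eq, ee_mul_ee_ray hX, (ray_values hX).1, qf]
  norm_cast
  generalize pp X * FF X ^ 4 = u
  have := pi_pos
  rw [gX]
  field_simp
  ring

lemma mw_sub_mf_ray {X : ℝ} (hX : 0 < X) :
    mw qf ((1 + I * YY X) / 2) - mf qf (qq ((1 + I * YY X) / 2)) =
      9 / (8 * π ^ 4) * (g₃ X : ℂ) := by
  have h1 := (ray_values hX).1
  have h : (ee ((1 + I * YY X) / 2) / ee (2 * ((1 + I * YY X) / 2))) ^ 3 =
      ((-((X + 1) * (X + 9) / X) : ℝ) : ℂ) := by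
    rw [← inv_div, inv_pow, inv_eq_iff_eq_inv, ← Complex.ofReal_inv]
    refine mul_left_cancel₀ (show (64 : ℂ) ≠ 0 by norm_num) ?_
    rw [h1]
    norm_cast
    field_simp
  rw [mf_qf_ray hX, mw, ee_mul_ee_ray hX, h, qf]
  norm_cast
  have := pi_pos
  rw [gX, g₃]
  generalize FF X = u
  generalize pp X = p
  field_simp
  ring

theorem RI_gX_relation : 13 * RI gX 0 - 15 * RI gX 2 = -8 := by
  have hpi : (π : ℂ) ≠ 0 := by exact_mod_cast pi_ne_zero
  have hd : DifferentiableOn ℂ (fun z => hq (qq z) / qq z) {z | 0 < z.im} :=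
    (differentiableOn_comp_qq differentiableOn_hq).div (differentiableOn_comp_qq differentiableOn_id)
      fun z _ => qq_ne_zero z
  set c : ℂ := 1 / (512 * I * π ^ 3) with hc
  set χ : ℂ → ℂ := fun z => c * hq (qq z) / qq z with hχ
  have d0 : DifferentiableOn ℂ χ {z | 0 < z.im} :=
    (hd.const_mul c).congr fun z _ => by simp [hχ, mul_div_assoc]
  have d1 := d0.deriv isOpen_upper
  have d2 := d1.deriv isOpen_upper
  have D {f : ℂ → ℂ} (hf : DifferentiableOn ℂ f {z | 0 < z.im}) (z : ℂ) (hz : 0 < z.im) :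
      HasDerivAt f (deriv f z) z := ((hf z hz).differentiableAt (isOpen_upper.mem_nhds hz)).hasDerivAt
  have r0 : ∀ X : ℝ, 0 < X → χ ((1 + I * YY X) / 2) = (c * -(8 * π ^ 2 / 3)) * (g₀ X : ℂ) := fun X hX => by
    rw [mul_assoc, ← hq_ray hX, ← mul_div_assoc]
  have r1 := ray_deriv (D d0) (fun X hX => (hasDerivAt_g hX).1) r0
  have r2 := ray_deriv (D d1) (fun X hX => (hasDerivAt_g hX).2.1) r1
  have r3 := ray_deriv (D d2) (fun X hX => (hasDerivAt_g hX).2.2) r2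
  have hφ : Differentiable ℂ qf := by unfold qf; fun_prop
  have dm : DifferentiableOn ℂ (fun z => mw qf z - mf qf (qq z)) {z | 0 < z.im} := by
    have e1 : DifferentiableOn ℂ ee {z | 0 < z.im} := by simpa using differentiableOn_ee_mul one_pos
    have e2 : DifferentiableOn ℂ (fun z => ee (2 * z)) {z | 0 < z.im} := by
      simpa using differentiableOn_ee_mul two_pos
    exact ((e1.mul e2).mul (hφ.comp_differentiableOn ((e1.div e2 fun z hz => ee_ne_zero (two_mul_im_pos hz)).pow 3))).sub
      (differentiableOn_comp_qq (differentiableOn_mf hφ))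
  have h := mf_period (φ := qf) (H := fun q => c * hq q) (v := gX) hφ (fun a b d h1 h2 => ?_) (D d0) (D d1)
    (fun z hz => ?_) (fun z hz => ?_) (hasDerivAt_hq_zero.const_mul c) (fun y hy => ?_)
  · rw [hc] at h
    have e : (-64 * π ^ 3 * I * (1 / (512 * I * π ^ 3) * 64) : ℂ) = ((-8 : ℝ) : ℂ) := by
      have := Complex.I_ne_zero
      push_cast
      field_simp
      norm_num
    exact Complex.ofReal_injective (h.trans e)
  · obtain rfl : d = -a - b := by linear_combination h1
    unfold qf
    linear_combination (7 / 8 * (a * b - (a + b) ^ 2) ^ 2) * h2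
  · rw [← eq_on_upper_of_ray (d2.deriv isOpen_upper) dm (fun X hX => ?_) hz]
    · exact D d2 z hz
    · rw [r3 X hX, mw_sub_mf_ray hX, hc]
      field_simp
      rw [Complex.I_sq]
      ring
  · linear_combination c * hq_fricke hz
  · have := mf_qf_ray (XX_pos hy)
    rwa [YY_XX hy] at this

theorem moments_eq_RI :
    besselMoment 1 5 1 = 3 / 2 * π * RI (fun _ => 1) 1 ∧
    besselMoment 2 4 1 = 9 / 5 * RI (fun _ => 1) 0 ∧
    besselMoment 1 5 1 - 4 * besselMoment 1 5 3 = 5 / 6 * π * RI gX 1 ∧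
    besselMoment 2 4 1 - 4 * besselMoment 2 4 3 = RI gX 0 := by
  have a1 := integral_bform_FF_FF
  have a2 := integral_bform_FF_ss
  have i1 := integral_FF_FF_eq (v := fun _ => 1) (fun _ _ => rfl) (by simpa using integrableOn_FF_FF)
  have i2 := integral_FF_ss_eq (v := fun _ => 1) (fun _ _ => rfl) (by simpa using integrableOn_FF_ss)
  have i3 := integral_FF_FF_eq (v := gX) (fun _ => gX_inv) (integrableOn_gX_mul integrableOn_FF_FF)
  have i4 := integral_FF_ss_eq (v := gX) (fun _ => gX_inv) (integrableOn_gX_mul integrableOn_FF_ss)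
  have hs : √3 ^ 2 = 3 := sq_sqrt (by norm_num)
  have hF : FF 0 * √3 = π / 3 := by rw [FF_zero]; field_simp
  simp only [one_mul] at i1 i2
  rw [besselMoment_151, besselMoment_241, besselMoment_153, besselMoment_243, integral_FF_GG.2, integral_FF1_GG1.2]
  rw [i3] at a1
  rw [i4] at a2
  refine ⟨?_, ?_, ?_, ?_⟩
  · rw [i2]; linear_combination (9 / 2 * RI (fun _ => 1) 1) * hF
  · rw [i1]; linear_combination (-1 / 10 : ℝ) * RI_one_relation
  · linear_combination (9 / 2 * FF 0) * a2 + (5 / 2 * RI gX 1) * hF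
  · linear_combination a1 - (1 / 18 : ℝ) * RI_gX_relation

end BesselPeriods

/-- The 4-loop Bessel moments as periods and quasi-periods:
`M(1,5,1)/π⁴ = D₂/2 = 4M(1,5,3)/π⁴ + 5E₂/18` and
`M(2,4,1)/π³ = 3D₁/5 = 4M(2,4,3)/π³ + E₁/3`. -/
theorem bessel_moments_periods_quasiperiods :
    (besselMoment 1 5 1 : ℂ) / (π : ℂ) ^ 4 =
        4 * (besselMoment 1 5 3 : ℂ) / (π : ℂ) ^ 4 + 5 * E 2 / 18 ∧
      (besselMoment 2 4 1 : ℂ) / (π : ℂ) ^ 3 =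
        4 * (besselMoment 2 4 3 : ℂ) / (π : ℂ) ^ 3 + E 1 / 3 ∧
      (besselMoment 1 5 1 : ℂ) / (π : ℂ) ^ 4 = D 2 / 2 ∧
      (besselMoment 2 4 1 : ℂ) / (π : ℂ) ^ 3 = 3 * D 1 / 5 := by
  obtain ⟨h1, h2, h3, h4⟩ := BesselPeriods.moments_eq_RI
  have hpi : (π : ℂ) ≠ 0 := by exact_mod_cast Real.pi_ne_zero
  rw [sub_eq_iff_eq_add] at h3 h4
  simp only [BesselPeriods.E_eq, BesselPeriods.D_eq]
  refine ⟨?_, ?_, ?_, ?_⟩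
  · rw [h3]; push_cast; field_simp; ring
  · rw [h4]; push_cast; field_simp; ring
  · rw [h1]; push_cast; field_simp
  · rw [h2]; push_cast; field_simp; ring
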